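/- The choice of standard index-m forms in the preceding setting can be made so that, in addition to having optimal growth and being primitive, every Φ⁰_{2,m} satisfies C_{Φ⁰_{2,m}}(0,ℓ) = 0 for all ℓ; its polar coefficients are then necessarily given by C_{Φ⁰_{2,m}}(−1,r) = (1/24)·∑_{d ≥ 1, d² | m} μ(d)·( gcd((r−1)/2, m/d²) + gcd((r+1)/2, m/d²) ) for every r with r² ≡ 1 (mod 4m), and for each m the function Φ⁰_{2,m} with these properties is unique up to the addition of a Jacobi cusp form of weight 2 and index m. -/

import Mathlib

noncomputable section

open Complex Filter Topology MeasureTheory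
open scoped Classical

/-- `ee x = e^{2πix}`. -/
def ee (x : ℂ) : ℂ := Complex.exp (2 * (Real.pi : ℂ) * Complex.I * x)

/-- The index-`m` elliptic transformation law on `ℍ × ℂ`. -/
def EllipticLaw (m : ℕ) (φ : ℂ → ℂ → ℂ) : Prop :=
  ∀ τ : ℂ, 0 < τ.im → ∀ z : ℂ, ∀ lam mu : ℤ,
    φ τ (z + (lam : ℂ) * τ + (mu : ℂ)) =
      ee (-(m : ℂ) * ((lam : ℂ) ^ 2 * τ + 2 * (lam : ℂ) * z)) * φ τ z

/-- The weight-`k` index-`m` modular transformation law on `ℍ × ℂ`. -/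
def ModularLaw (k : ℤ) (m : ℕ) (φ : ℂ → ℂ → ℂ) : Prop :=
  ∀ τ : ℂ, 0 < τ.im → ∀ z : ℂ, ∀ a b c d : ℤ, a * d - b * c = 1 →
    φ (((a : ℂ) * τ + (b : ℂ)) / ((c : ℂ) * τ + (d : ℂ))) (z / ((c : ℂ) * τ + (d : ℂ))) =
      ((c : ℂ) * τ + (d : ℂ)) ^ k *
        ee ((m : ℂ) * (c : ℂ) * z ^ 2 / ((c : ℂ) * τ + (d : ℂ))) * φ τ z

/-- The theta function `θ_{m,ℓ}(τ,z) = ∑_{r ≡ ℓ (mod 2m)} q^{r²/4m} y^r`. -/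
def jTheta (m : ℕ) (l : ℤ) (τ z : ℂ) : ℂ :=
  ∑' n : ℤ, ee (((l : ℂ) + 2 * (m : ℂ) * (n : ℂ)) ^ 2 / (4 * (m : ℂ)) * τ +
      ((l : ℂ) + 2 * (m : ℂ) * (n : ℂ)) * z)

/-- The point `z_s = ατ + β` for `s = (α,β) ∈ ℚ²`. -/
def zpt (s : ℚ × ℚ) (τ : ℂ) : ℂ := (s.1 : ℚ) * τ + (s.2 : ℚ)

/-- A holomorphic function on `ℍ × ℂ` satisfying the index-`m` elliptic transformation law,
together with its Fourier coefficient data `coeff Δ ℓ = C(Δ,ℓ)` (so that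
`c(n,r) = C(4nm - r², r)`, `C(Δ,ℓ)` depends on `ℓ` only modulo `2m`, and `C(Δ,ℓ) = 0` on
pairs with `Δ + ℓ² ≢ 0 (mod 4m)`). -/
structure EllFormData (m : ℕ) where
  toFun : ℂ → ℂ → ℂ
  coeff : ℤ → ℤ → ℂ
  holo : ∀ τ z : ℂ, 0 < τ.im → DifferentiableAt ℂ (fun p : ℂ × ℂ => toFun p.1 p.2) (τ, z)
  elliptic : EllipticLaw m toFun
  expansion : ∀ τ z : ℂ, 0 < τ.im →
    HasSum (fun p : ℤ × ℤ => coeff (4 * (m : ℤ) * p.1 - p.2 ^ 2) p.2 *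
      ee ((p.1 : ℂ) * τ + (p.2 : ℂ) * z)) (toFun τ z)
  periodic : ∀ Δ l : ℤ, coeff Δ (l + 2 * (m : ℤ)) = coeff Δ l
  support : ∀ Δ l : ℤ, ¬ (4 * (m : ℤ)) ∣ (Δ + l ^ 2) → coeff Δ l = 0

/-- An elliptic form is weak if `c(n,r) = 0` for `n < 0`. -/
def IsWeakC (m : ℕ) (C : ℤ → ℤ → ℂ) : Prop :=
  ∀ n r : ℤ, n < 0 → C (4 * (m : ℤ) * n - r ^ 2) r = 0

/-- Even coefficients: `C(Δ,-ℓ) = C(Δ,ℓ)`. -/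
def IsEvenC (C : ℤ → ℤ → ℂ) : Prop := ∀ Δ l : ℤ, C Δ (-l) = C Δ l

/-- Holomorphic (as opposed to weak): `C(Δ,ℓ) = 0` for `Δ < 0`. -/
def IsHolC (C : ℤ → ℤ → ℂ) : Prop := ∀ Δ l : ℤ, Δ < 0 → C Δ l = 0

/-- Cuspidal: `C(Δ,ℓ) = 0` for `Δ ≤ 0`. -/
def IsCuspC (C : ℤ → ℤ → ℂ) : Prop := ∀ Δ l : ℤ, Δ ≤ 0 → C Δ l = 0

/-- Optimal growth: `C(Δ,ℓ) = 0` for `Δ < -1`. -/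
def IsOGC (C : ℤ → ℤ → ℂ) : Prop := ∀ Δ l : ℤ, Δ < -1 → C Δ l = 0

/-- The Appell–Lerch sum `A_{2,m}(τ,z) = ∑_{s∈ℤ} q^{ms²+s}·y^{2ms+1}/(1-q^s y)²`. -/
def A2sum (m : ℕ) (τ z : ℂ) : ℂ :=
  ∑' s : ℤ, ee (((m : ℂ) * (s : ℂ) ^ 2 + (s : ℂ)) * τ + (2 * (m : ℂ) * (s : ℂ) + 1) * z) /
      (1 - ee ((s : ℂ) * τ + z)) ^ 2

/-- A standard index-`m` form: a function on `ℍ × ℂ` satisfying the weight-2 index-`m`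
modular law and the index-`m` elliptic law, holomorphic away from `z ∈ ℤτ + ℤ`, and such
that `z ↦ φ(τ,z) - (2πiz)^{-2}` extends holomorphically across `z = 0`. -/
def IsStandardForm (m : ℕ) (φ : ℂ → ℂ → ℂ) : Prop :=
  ModularLaw 2 m φ ∧ EllipticLaw m φ ∧
  (∀ τ : ℂ, 0 < τ.im → ∀ z : ℂ, (∀ lam mu : ℤ, z ≠ (lam : ℂ) * τ + (mu : ℂ)) →
    DifferentiableAt ℂ (fun p : ℂ × ℂ => φ p.1 p.2) (τ, z)) ∧
  (∀ τ : ℂ, 0 < τ.im → ∃ g : ℂ → ℂ, AnalyticAt ℂ g 0 ∧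
    ∀ᶠ z in 𝓝[≠] (0 : ℂ), φ τ z - 1 / (2 * (Real.pi : ℂ) * Complex.I * z) ^ 2 = g z)

/-- `C` is the Fourier coefficient data of the finite part `Φ = φ - A_{2,m}` of the
standard index-`m` form `φ`. -/
def IsFinitePartCoeffs (m : ℕ) (φ : ℂ → ℂ → ℂ) (C : ℤ → ℤ → ℂ) : Prop :=
  (∀ Δ l : ℤ, C Δ (l + 2 * (m : ℤ)) = C Δ l) ∧
  (∀ Δ l : ℤ, ¬ (4 * (m : ℤ)) ∣ (Δ + l ^ 2) → C Δ l = 0) ∧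
  (∀ τ : ℂ, 0 < τ.im → ∀ z : ℂ, (∀ lam mu : ℤ, z ≠ (lam : ℂ) * τ + (mu : ℂ)) →
    HasSum (fun p : ℤ × ℤ => C (4 * (m : ℤ) * p.1 - p.2 ^ 2) p.2 *
      ee ((p.1 : ℂ) * τ + (p.2 : ℂ) * z)) (φ τ z - A2sum m τ z))

/-- The coefficients of the primitive form `Φ⁰_{2,m} = ∑_{d² ∣ m} μ(d)·(Φ_{2,m/d²}|U_d)`,
at the level of `C(Δ,ℓ)`-coefficients. -/
def primC0 (m : ℕ) (Cfam : ℕ → ℤ → ℤ → ℂ) : ℤ → ℤ → ℂ :=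
  fun Δ l => ∑ d ∈ m.divisors,
    if d ^ 2 ∣ m ∧ (d : ℤ) ∣ l ∧ ((d : ℤ)) ^ 2 ∣ Δ then
      ((ArithmeticFunction.moebius d : ℤ) : ℂ) *
        Cfam (m / d ^ 2) (Δ / (d : ℤ) ^ 2) (l / (d : ℤ))
    else 0

/-- A family of finite-part coefficient data of standard forms of all indices. -/
def IsStandardFamily (φfam : ℕ → ℂ → ℂ → ℂ) (Cfam : ℕ → ℤ → ℤ → ℂ) : Prop :=
  ∀ m : ℕ, 0 < m → IsStandardForm m (φfam m) ∧ IsFinitePartCoeffs m (φfam m) (Cfam m)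

/-- For the given index `m`: `Φ⁰_{2,m}` has optimal growth, is primitive, and all its
`Δ = 0` coefficients vanish. -/
def GoodPrim (m : ℕ) (Cfam : ℕ → ℤ → ℤ → ℂ) : Prop :=
  (∀ Δ l : ℤ, Δ < -1 → primC0 m Cfam Δ l = 0) ∧
  (∀ q : ℕ, q.Prime → q ^ 2 ∣ m → ∀ Δ l : ℤ,
    ∑ j ∈ Finset.range q,
      primC0 m Cfam (Δ * (q : ℤ) ^ 2) ((l + 2 * (m : ℤ) / (q : ℤ) ^ 2 * (j : ℤ)) * (q : ℤ)) = 0) ∧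
  (∀ l : ℤ, primC0 m Cfam 0 l = 0)

open Finset
open scoped Real
open ArithmeticFunction (moebius)
open Function (Periodic)

/-- Arrays of Fourier coefficients. -/
abbrev Arr : Type := ℤ × ℤ → ℂ

variable {m : ℕ} {k : ℤ} {τ z : ℂ} {φ : ℂ → ℂ → ℂ} {c : Arr}

/-- The period `2πi`. -/
notation "ϖ" => 2 * (Real.pi : ℂ) * I

/-! ### The exponential `ee` -/

theorem ee_add (x y : ℂ) : ee (x + y) = ee x * ee y := by unfold ee; rw [← exp_add]; ring_nf

theorem ee_zero : ee 0 = 1 := by simp [ee]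

theorem ee_ne_zero (x : ℂ) : ee x ≠ 0 := exp_ne_zero _

theorem ee_neg (x : ℂ) : ee (-x) = (ee x)⁻¹ := by unfold ee; rw [← exp_neg]; ring_nf

theorem ee_sub (x y : ℂ) : ee (x - y) = ee x / ee y := by
  rw [sub_eq_add_neg, ee_add, ee_neg, div_eq_mul_inv]

theorem ee_int (n : ℤ) : ee n = 1 := by
  unfold ee
  rw [exp_eq_one_iff]
  exact ⟨n, by ring⟩

theorem ee_one : ee 1 = 1 := by exact_mod_cast ee_int 1

theorem ee_add_int (x : ℂ) (n : ℤ) : ee (x + n) = ee x := by rw [ee_add, ee_int, mul_one]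

theorem ee_int_mul (n : ℤ) (x : ℂ) : ee (n * x) = ee x ^ n := by
  unfold ee; rw [← exp_int_mul]; ring_nf

theorem ee_nat_mul (n : ℕ) (x : ℂ) : ee (n * x) = ee x ^ n := by
  unfold ee; rw [← exp_nat_mul]; ring_nf

theorem ee_half : ee (1 / 2) = -1 := by
  unfold ee
  rw [← exp_pi_mul_I]; ring_nf

theorem norm_ee (x : ℂ) : ‖ee x‖ = Real.exp (-(2 * π * x.im)) := by
  unfold ee; rw [norm_exp]; simp [mul_re, mul_im]

theorem ee_eq_one_iff (x : ℂ) : ee x = 1 ↔ ∃ n : ℤ, x = n := by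
  unfold ee
  rw [exp_eq_one_iff]
  have h := two_pi_I_ne_zero
  constructor
  · rintro ⟨n, hn⟩
    refine ⟨n, mul_left_cancel₀ h ?_⟩
    rw [hn]; ring
  · rintro ⟨n, rfl⟩
    exact ⟨n, by ring⟩

theorem hasDerivAt_ee (x : ℂ) : HasDerivAt ee (ϖ * ee x) x := by
  have h : HasDerivAt (fun y : ℂ => exp (ϖ * y))
      (exp (ϖ * x) * (ϖ * 1)) x :=
    ((hasDerivAt_id x).const_mul _).cexp
  have e : ee = fun y : ℂ => exp (ϖ * y) := rfl
  rw [e]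
  convert h using 1
  ring

theorem differentiable_ee : Differentiable ℂ ee := fun x => (hasDerivAt_ee x).differentiableAt

theorem continuous_ee : Continuous ee := differentiable_ee.continuous

/-! ### Two-variable Fourier series -/

/-- The character `p ↦ q^{p.1} y^{p.2}`. -/
def chr (τ z : ℂ) (p : ℤ × ℤ) : ℂ := ee ((p.1 : ℂ) * τ + (p.2 : ℂ) * z)

theorem chr_add (τ z : ℂ) (p q : ℤ × ℤ) : chr τ z (p + q) = chr τ z p * chr τ z q := by
  unfold chr; rw [← ee_add]; push_cast [Prod.fst_add, Prod.snd_add]; ring_nf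

theorem norm_chr (τ z : ℂ) (p : ℤ × ℤ) :
    ‖chr τ z p‖ = Real.exp (-(2 * π * (p.1 * τ.im + p.2 * z.im))) := by
  unfold chr; rw [norm_ee]; simp

/-- The function with Fourier coefficients `c`. -/
def JF (c : Arr) (τ z : ℂ) : ℂ := ∑' p, c p * chr τ z p

/-- Summability of the Fourier series of `c` at `(τ,z)`. -/
def SmAt (c : Arr) (τ z : ℂ) : Prop := Summable fun p => c p * chr τ z p

/-- Summability of the Fourier series of `c` on `ℍ × ℂ`. -/
def Sm (c : Arr) : Prop := ∀ τ z : ℂ, 0 < τ.im → SmAt c τ z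

theorem SmAt.hasSum (h : SmAt c τ z) :
    HasSum (fun p => c p * chr τ z p) (JF c τ z) := Summable.hasSum h

theorem SmAt.congr_im {τ z τ' z' : ℂ} (h : SmAt c τ z) (h1 : τ'.im = τ.im)
    (h2 : z'.im = z.im) : SmAt c τ' z' := by
  have h := Summable.norm h
  apply Summable.of_norm
  refine h.congr fun p => ?_
  simp only [norm_mul, norm_chr, h1, h2]

theorem JF_add {a b : Arr} (ha : SmAt a τ z) (hb : SmAt b τ z) :
    JF (a + b) τ z = JF a τ z + JF b τ z := by
  unfold JF
  rw [← Summable.tsum_add ha hb]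
  congr 1; ext p; simp [add_mul]

theorem SmAt.add {a b : Arr} (ha : SmAt a τ z) (hb : SmAt b τ z) : SmAt (a + b) τ z := by
  refine (Summable.add ha hb).congr fun p => ?_
  simp [add_mul]

theorem SmAt.smul {a : Arr} (s : ℂ) (ha : SmAt a τ z) : SmAt (s • a) τ z := by
  refine (Summable.mul_left s ha).congr fun p => ?_
  simp [mul_assoc]

theorem JF_smul (s : ℂ) (a : Arr) (τ z : ℂ) : JF (s • a) τ z = s * JF a τ z := by
  unfold JF
  rw [← tsum_mul_left]
  congr 1; ext p; simp [mul_assoc]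

theorem Sm.add {a b : Arr} (ha : Sm a) (hb : Sm b) : Sm (a + b) :=
  fun τ z h => (ha τ z h).add (hb τ z h)

theorem Sm.smul {a : Arr} (s : ℂ) (ha : Sm a) : Sm (s • a) := fun τ z h => (ha τ z h).smul s

theorem JF_zero (τ z : ℂ) : JF 0 τ z = 0 := by simp [JF]

theorem Sm.zero : Sm 0 := fun τ z _ => by simp [SmAt, summable_zero]

/-- Convolution of families indexed by an additive group. -/
def conv {G : Type*} [AddCommGroup G] (a b : G → ℂ) (p : G) : ℂ := ∑' x, a x * b (p - x)

theorem hasSum_conv {G : Type*} [AddCommGroup G] {a b χ : G → ℂ}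
    (hχ : ∀ x y, χ (x + y) = χ x * χ y) (ha : Summable fun p => a p * χ p)
    (hb : Summable fun p => b p * χ p) :
    HasSum (fun p => conv a b p * χ p) ((∑' p, a p * χ p) * ∑' p, b p * χ p) := by
  have hs := summable_mul_of_summable_norm ha.norm hb.norm
  have ht := tsum_mul_tsum_of_summable_norm ha.norm hb.norm
  have H := hs.hasSum
  rw [← ht] at H
  let e : G × G ≃ G × G :=
    { toFun := fun x => (x.2, x.1 - x.2)
      invFun := fun x => (x.1 + x.2, x.1)
      left_inv := fun x => by simp
      right_inv := fun x => by simp }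
  rw [← e.hasSum_iff] at H
  have key : ∀ p x : G, a x * χ x * (b (p - x) * χ (p - x)) = a x * b (p - x) * χ p := by
    intro p x
    have : χ p = χ x * χ (p - x) := by rw [← hχ]; simp
    rw [this]; ring
  have H2 : HasSum (fun x : G × G => a x.2 * b (x.1 - x.2) * χ x.1)
      ((∑' p, a p * χ p) * ∑' p, b p * χ p) := by
    have E : (fun x : G × G => a x.2 * b (x.1 - x.2) * χ x.1) =
        (fun x : G × G => a x.1 * χ x.1 * (b x.2 * χ x.2)) ∘ e :=
      funext fun x => (key x.1 x.2).symm
    rwa [E]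
  refine H2.prod_fiberwise fun p => ?_
  have h3 := H2.summable.prod_factor p
  have h4 := h3.hasSum
  have h5 : ∑' x, a x * b (p - x) * χ p = conv a b p * χ p := tsum_mul_right
  rw [← h5]
  exact h4

theorem SmAt.conv {a b : Arr} (ha : SmAt a τ z) (hb : SmAt b τ z) : SmAt (conv a b) τ z :=
  (hasSum_conv (chr_add τ z) ha hb).summable

theorem JF_conv {a b : Arr} (ha : SmAt a τ z) (hb : SmAt b τ z) :
    JF (conv a b) τ z = JF a τ z * JF b τ z :=
  (hasSum_conv (chr_add τ z) ha hb).tsum_eq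

theorem Sm.conv {a b : Arr} (ha : Sm a) (hb : Sm b) : Sm (conv a b) :=
  fun τ z h => (ha τ z h).conv (hb τ z h)

/-! ### Differentiability -/

theorem corner_bound (n r : ℤ) {u v u' v' δ : ℝ} (hδ : 0 < δ) (hu : |u' - u| ≤ δ)
    (hv : |v' - v| ≤ δ) :
    (1 + |(n : ℝ)| + |(r : ℝ)|) * Real.exp (-(2 * π * (n * u' + r * v'))) ≤
      (1 + 1 / δ) * (Real.exp (-(2 * π * (n * (u + 2 * δ) + r * (v + 2 * δ)))) +
        Real.exp (-(2 * π * (n * (u + 2 * δ) + r * (v - 2 * δ)))) +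
        Real.exp (-(2 * π * (n * (u - 2 * δ) + r * (v + 2 * δ)))) +
        Real.exp (-(2 * π * (n * (u - 2 * δ) + r * (v - 2 * δ))))) := by
  set L : ℝ := |(n : ℝ)| + |(r : ℝ)| with hL
  have hL0 : 0 ≤ L := by positivity
  have hpi := Real.pi_gt_three
  have h1 : (1 + L) ≤ (1 + 1 / δ) * Real.exp (2 * π * (δ * L)) := by
    have e1 : δ * L + 1 ≤ Real.exp (2 * π * (δ * L)) := by
      have := Real.add_one_le_exp (2 * π * (δ * L))
      have h3 : 0 ≤ δ * L := by positivity
      nlinarith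
    have e2 : (1 + L) ≤ (1 + 1 / δ) * (δ * L + 1) := by
      have : (1 + 1 / δ) * (δ * L + 1) = 1 + L + δ * L + 1 / δ := by field_simp; ring
      rw [this]
      have : 0 ≤ δ * L + 1 / δ := by positivity
      linarith
    exact e2.trans (mul_le_mul_of_nonneg_left e1 (by positivity))
  have h2 : -(2 * π * (n * u' + r * v')) ≤ -(2 * π * (n * u + r * v)) + 2 * π * (δ * L) := by
    have a1 : -((n : ℝ) * (u' - u)) ≤ |(n : ℝ)| * δ := by
      refine (neg_le_abs _).trans ?_
      rw [abs_mul]; exact mul_le_mul_of_nonneg_left hu (abs_nonneg _)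
    have a2 : -((r : ℝ) * (v' - v)) ≤ |(r : ℝ)| * δ := by
      refine (neg_le_abs _).trans ?_
      rw [abs_mul]; exact mul_le_mul_of_nonneg_left hv (abs_nonneg _)
    have : -((n : ℝ) * (u' - u)) + -((r : ℝ) * (v' - v)) ≤ δ * L := by rw [hL]; linarith
    nlinarith
  have h3 : (1 + L) * Real.exp (-(2 * π * (n * u' + r * v'))) ≤
      (1 + 1 / δ) * Real.exp (-(2 * π * (n * u + r * v)) + 4 * π * (δ * L)) := by
    calc _ ≤ ((1 + 1 / δ) * Real.exp (2 * π * (δ * L))) *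
          Real.exp (-(2 * π * (n * u + r * v)) + 2 * π * (δ * L)) := by gcongr
      _ = _ := by rw [mul_assoc, ← Real.exp_add]; ring_nf
  have h4 : (1 + |(n : ℝ)| + |(r : ℝ)|) = 1 + L := by rw [hL]; ring
  rw [h4]
  refine h3.trans (mul_le_mul_of_nonneg_left ?_ (by positivity))
  have p (a b : ℝ) := (Real.exp_pos (-(2 * π * (n * a + r * b)))).le
  have p1 := p (u + 2 * δ) (v + 2 * δ)
  have p2 := p (u + 2 * δ) (v - 2 * δ)
  have p3 := p (u - 2 * δ) (v + 2 * δ)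
  have p4 := p (u - 2 * δ) (v - 2 * δ)
  rcases abs_cases (n : ℝ) with ⟨hn, -⟩ | ⟨hn, -⟩ <;> rcases abs_cases (r : ℝ) with ⟨hr, -⟩ | ⟨hr, -⟩ <;>
  · rw [hn, hr] at hL
    rw [hL]
    ring_nf at p1 p2 p3 p4 ⊢
    linarith

/-- A summable majorant, uniform near `(τ,z)`, including one linear factor. -/
theorem exists_majorant (h : ∀ᶠ x : ℂ × ℂ in 𝓝 (τ, z), SmAt c x.1 x.2) :
    ∃ δ > 0, ∃ u : ℤ × ℤ → ℝ, Summable u ∧ ∀ p τ' z', |τ'.im - τ.im| ≤ δ → |z'.im - z.im| ≤ δ →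
      (1 + |(p.1 : ℝ)| + |(p.2 : ℝ)|) * ‖c p * chr τ' z' p‖ ≤ u p := by
  rw [Metric.eventually_nhds_iff] at h
  obtain ⟨ε, hε, h⟩ := h
  have key : ∀ s t : ℝ, |s| ≤ ε / 2 → |t| ≤ ε / 2 → Summable fun p : ℤ × ℤ =>
      ‖c p‖ * Real.exp (-(2 * π * (p.1 * (τ.im + s) + p.2 * (z.im + t)))) := by
    intro s t hs ht
    have := h (y := (τ + s * I, z + t * I)) (by
      rw [Prod.dist_eq]
      simp only [dist_eq_norm, add_sub_cancel_left, norm_mul, norm_real, norm_I, mul_one,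
        Real.norm_eq_abs]
      exact max_lt (by linarith) (by linarith))
    refine (Summable.norm this).congr fun p => ?_
    simp [norm_chr]
  set δ := ε / 4 with hδ
  have hδ0 : 0 < δ := by positivity
  have hp : |2 * δ| ≤ ε / 2 := by rw [abs_of_pos (by positivity)]; linarith
  have hm : |-(2 * δ)| ≤ ε / 2 := by rw [abs_neg]; exact hp
  refine ⟨δ, hδ0, _, ((((key _ _ hp hp).add (key _ _ hp hm)).add (key _ _ hm hp)).add
    (key _ _ hm hm)).mul_left (1 + 1 / δ), ?_⟩
  intro p τ' z' h1 h2
  have := mul_le_mul_of_nonneg_left (corner_bound p.1 p.2 hδ0 h1 h2) (norm_nonneg (c p))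
  rw [norm_mul, norm_chr]
  simp only [← sub_eq_add_neg]
  refine le_trans (le_of_eq ?_) (this.trans (le_of_eq ?_)) <;> ring

theorem Sm.eventually (h : Sm c) (hτ : 0 < τ.im) (z : ℂ) :
    ∀ᶠ x : ℂ × ℂ in 𝓝 (τ, z), SmAt c x.1 x.2 := by
  have : ∀ᶠ x : ℂ × ℂ in 𝓝 (τ, z), 0 < x.1.im :=
    (continuous_im.comp continuous_fst).continuousAt.eventually (lt_mem_nhds hτ)
  exact this.mono fun x hx => h _ _ hx

/-- The linear form `(τ,z) ↦ p.1 τ + p.2 z`. -/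
def linForm (p : ℤ × ℤ) : ℂ × ℂ →L[ℂ] ℂ :=
  (p.1 : ℂ) • ContinuousLinearMap.fst ℂ ℂ ℂ + (p.2 : ℂ) • ContinuousLinearMap.snd ℂ ℂ ℂ

theorem linForm_apply (p : ℤ × ℤ) (x : ℂ × ℂ) : linForm p x = p.1 * x.1 + p.2 * x.2 := by
  simp [linForm]

theorem norm_linForm_le (p : ℤ × ℤ) : ‖linForm p‖ ≤ 1 + |(p.1 : ℝ)| + |(p.2 : ℝ)| := by
  refine (norm_add_le _ _).trans ?_
  rw [norm_smul, norm_smul]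
  have e1 := mul_le_mul_of_nonneg_left (ContinuousLinearMap.norm_fst_le ℂ ℂ ℂ)
    (norm_nonneg (p.1 : ℂ))
  have e2 := mul_le_mul_of_nonneg_left (ContinuousLinearMap.norm_snd_le ℂ ℂ ℂ)
    (norm_nonneg (p.2 : ℂ))
  have e3 : ‖(p.1 : ℂ)‖ = |(p.1 : ℝ)| := norm_intCast _
  have e4 : ‖(p.2 : ℂ)‖ = |(p.2 : ℝ)| := norm_intCast _
  linarith

theorem hasFDerivAt_chr (p : ℤ × ℤ) (x : ℂ × ℂ) :
    HasFDerivAt (fun x : ℂ × ℂ => chr x.1 x.2 p) ((ϖ * chr x.1 x.2 p) •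
      linForm p) x := by
  have h1 : HasFDerivAt (fun x : ℂ × ℂ => (p.1 : ℂ) * x.1 + (p.2 : ℂ) * x.2)
      ((p.1 : ℂ) • ContinuousLinearMap.fst ℂ ℂ ℂ + (p.2 : ℂ) • ContinuousLinearMap.snd ℂ ℂ ℂ) x :=
    (hasFDerivAt_fst.const_mul _).add (hasFDerivAt_snd.const_mul _)
  exact (hasDerivAt_ee _).comp_hasFDerivAt x h1

theorem JF_hasFDerivAt (h : ∀ᶠ x : ℂ × ℂ in 𝓝 (τ, z), SmAt c x.1 x.2) :
    HasFDerivAt (fun x : ℂ × ℂ => JF c x.1 x.2) (∑' p : ℤ × ℤ, (c p * (ϖ *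
      chr τ z p)) • linForm p) (τ, z) ∧
    Summable fun p : ℤ × ℤ => (c p * (ϖ * chr τ z p)) • linForm p := by
  obtain ⟨δ, hδ, u, hu, hb⟩ := exists_majorant h
  have him : ∀ x ∈ Metric.ball (τ, z) δ, |x.1.im - τ.im| ≤ δ ∧ |x.2.im - z.im| ≤ δ := by
    intro x hx
    rw [Metric.mem_ball, Prod.dist_eq, max_lt_iff, dist_eq_norm, dist_eq_norm] at hx
    constructor
    · rw [← sub_im]; exact (abs_im_le_norm _).trans hx.1.le
    · rw [← sub_im]; exact (abs_im_le_norm _).trans hx.2.le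
  have hf : ∀ p : ℤ × ℤ, ∀ x ∈ Metric.ball (τ, z) δ,
      HasFDerivAt (fun x : ℂ × ℂ => c p * chr x.1 x.2 p) ((c p * (ϖ *
      chr x.1 x.2 p)) • linForm p) x := by
    intro p x _
    have := (hasFDerivAt_chr p x).const_mul (c p)
    rwa [smul_smul] at this
  have hbd : ∀ p : ℤ × ℤ, ∀ x ∈ Metric.ball (τ, z) δ, ‖(c p * (ϖ *
      chr x.1 x.2 p)) • linForm p‖ ≤ 2 * π * u p := by
    intro p x hx
    rw [norm_smul]
    have h1 := norm_linForm_le p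
    have h2 := hb p x.1 x.2 (him x hx).1 (him x hx).2
    have h3 : ‖c p * (ϖ * chr x.1 x.2 p)‖ = 2 * π * ‖c p * chr x.1 x.2 p‖ := by
      simp only [norm_mul, norm_I, norm_real, Real.norm_eq_abs, abs_of_pos Real.pi_pos]
      simp; ring
    rw [h3]
    calc _ ≤ 2 * π * ‖c p * chr x.1 x.2 p‖ * (1 + |(p.1 : ℝ)| + |(p.2 : ℝ)|) := by gcongr
      _ = 2 * π * ((1 + |(p.1 : ℝ)| + |(p.2 : ℝ)|) * ‖c p * chr x.1 x.2 p‖) := by ring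
      _ ≤ _ := by gcongr
  have h0 : (τ, z) ∈ Metric.ball (τ, z) δ := Metric.mem_ball_self hδ
  constructor
  · have hc : IsPreconnected (Metric.ball (τ, z) δ) := (convex_ball _ _).isPreconnected
    have hd := hasFDerivAt_tsum_of_isPreconnected (𝕜 := ℂ) (x := (τ, z)) (x₀ := (τ, z)) (u := fun p => 2 * π * u p)
      (f := fun (p : ℤ × ℤ) (x : ℂ × ℂ) => c p * chr x.1 x.2 p)
      (f' := fun p x => (c p * (ϖ * chr x.1 x.2 p)) • linForm p)
      (hu.mul_left _) Metric.isOpen_ball hc hf hbd h0 h.self_of_nhds h0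
    have e : (fun x : ℂ × ℂ => JF c x.1 x.2) = fun x => ∑' p, c p * chr x.1 x.2 p := rfl
    rw [e]
    exact hd
  · exact Summable.of_norm_bounded (g := fun p => 2 * π * u p) (hu.mul_left _)
      fun p => hbd p (τ, z) h0

theorem JF_differentiableAt (h : ∀ᶠ x : ℂ × ℂ in 𝓝 (τ, z), SmAt c x.1 x.2) :
    DifferentiableAt ℂ (fun x : ℂ × ℂ => JF c x.1 x.2) (τ, z) :=
  (JF_hasFDerivAt h).1.differentiableAt

theorem Sm.differentiable (h : Sm c) (hτ : 0 < τ.im) (z : ℂ) :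
    DifferentiableAt ℂ (fun x : ℂ × ℂ => JF c x.1 x.2) (τ, z) :=
  JF_differentiableAt (h.eventually hτ z)

theorem Sm.differentiable_right (h : Sm c) (hτ : 0 < τ.im) :
    Differentiable ℂ (fun z => JF c τ z) := fun z =>
  DifferentiableAt.comp z (h.differentiable hτ z)
    (DifferentiableAt.prodMk (differentiableAt_const τ) differentiableAt_id)

theorem Sm.continuous_right (h : Sm c) (hτ : 0 < τ.im) :
    Continuous (fun z => JF c τ z) := (h.differentiable_right hτ).continuous

theorem Sm.differentiableOn_left (h : Sm c) (z : ℂ) :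
    DifferentiableOn ℂ (fun τ => JF c τ z) {τ | 0 < τ.im} := fun τ hτ =>
  (DifferentiableAt.comp (g := fun x : ℂ × ℂ => JF c x.1 x.2) (f := fun t => (t, z)) τ
    (h.differentiable hτ z)
    (DifferentiableAt.prodMk differentiableAt_id (differentiableAt_const z))).differentiableWithinAt

theorem Sm.int_mul (h : Sm c) : Sm (fun p => (p.1 : ℂ) * c p) ∧ Sm (fun p => (p.2 : ℂ) * c p) := by
  constructor <;> intro τ z hτ <;> obtain ⟨δ, hδ, u, hu, hb⟩ := exists_majorant (h.eventually hτ z)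
  · refine Summable.of_norm_bounded hu fun p => le_trans ?_ (hb p τ z (by simp [hδ.le]) (by simp [hδ.le]))
    rw [mul_assoc, norm_mul, norm_intCast]
    gcongr
    have := abs_nonneg (p.2 : ℝ); linarith
  · refine Summable.of_norm_bounded hu fun p => le_trans ?_ (hb p τ z (by simp [hδ.le]) (by simp [hδ.le]))
    rw [mul_assoc, norm_mul, norm_intCast]
    gcongr
    have := abs_nonneg (p.1 : ℝ); linarith

theorem Sm.hasDerivAt (h : Sm c) (hτ : 0 < τ.im) (z : ℂ) :
    HasDerivAt (fun τ => JF c τ z) (ϖ * JF (fun p => (p.1 : ℂ) * c p) τ z) τ ∧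
    HasDerivAt (fun z => JF c τ z) (ϖ * JF (fun p => (p.2 : ℂ) * c p) τ z) z := by
  obtain ⟨h1, h2⟩ := JF_hasFDerivAt (h.eventually hτ z)
  constructor
  · have e : HasDerivAt (fun t : ℂ => (t, z)) (1, 0) τ :=
      (hasDerivAt_id τ).prodMk (hasDerivAt_const τ z)
    have := HasFDerivAt.comp_hasDerivAt τ h1 e
    have e2 := (ContinuousLinearMap.apply ℂ ℂ ((1 : ℂ), (0 : ℂ))).map_tsum h2
    rw [ContinuousLinearMap.apply_apply] at e2
    rw [e2] at this
    rw [JF, ← tsum_mul_left]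
    refine this.congr_deriv (tsum_congr fun p => ?_)
    rw [ContinuousLinearMap.apply_apply, smul_apply, linForm_apply, smul_eq_mul]
    ring
  · have e : HasDerivAt (fun t : ℂ => (τ, t)) (0, 1) z :=
      (hasDerivAt_const z τ).prodMk (hasDerivAt_id z)
    have := HasFDerivAt.comp_hasDerivAt z h1 e
    have e2 := (ContinuousLinearMap.apply ℂ ℂ ((0 : ℂ), (1 : ℂ))).map_tsum h2
    rw [ContinuousLinearMap.apply_apply] at e2
    rw [e2] at this
    rw [JF, ← tsum_mul_left]
    refine this.congr_deriv (tsum_congr fun p => ?_)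
    rw [ContinuousLinearMap.apply_apply, smul_apply, linForm_apply, smul_eq_mul]
    ring

/-! ### Uniqueness of Fourier coefficients -/

theorem integral_ee_int (n : ℤ) : ∫ x in (0 : ℝ)..1, ee (n * x) = if n = 0 then 1 else 0 := by
  split_ifs with h
  · simp [h, ee_zero]
  · have hn : (ϖ * n) ≠ 0 := mul_ne_zero two_pi_I_ne_zero (by exact_mod_cast h)
    have : ∀ x : ℝ, ee (n * x) = exp (ϖ * n * x) := by intro x; unfold ee; ring_nf
    simp only [this]
    rw [integral_exp_mul_complex hn]
    have e1 : exp (ϖ * n * (1 : ℝ)) = 1 := by rw [← this]; simpa using ee_int n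
    rw [e1]; simp

theorem fourier_coeff_eq_zero {a : ℤ → ℂ} (hs : Summable a)
    (h : ∀ x : ℝ, ∑' n, a n * ee (n * x) = 0) (k : ℤ) : a k = 0 := by
  have hcont : ∀ n : ℤ, Continuous fun x : ℝ => a n * ee (n * x) * ee (-(k * x)) := by
    intro n
    have := continuous_ee
    fun_prop
  have hn1 : ∀ (n : ℤ) (x : ℝ), ‖ee (n * x)‖ = 1 := by intro n x; rw [norm_ee]; simp
  have hbound : ∀ (n : ℤ) (x : ℝ), ‖a n * ee (n * x) * ee (-(k * x))‖ = ‖a n‖ := by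
    intro n x
    rw [ee_neg, norm_mul, norm_mul, norm_inv, hn1, hn1]; simp
  have H := intervalIntegral.hasSum_integral_of_dominated_convergence (μ := volume) (a := 0) (b := 1)
    (F := fun (n : ℤ) (x : ℝ) => a n * ee (n * x) * ee (-(k * x))) (f := fun _ => 0)
    (fun n _ => ‖a n‖)
    (fun n => (hcont n).aestronglyMeasurable)
    (fun n => Filter.Eventually.of_forall fun x _ => (hbound n x).le)
    (Filter.Eventually.of_forall fun x _ => hs.norm)
    (by simp)
    (Filter.Eventually.of_forall fun x _ => by
      have h1 : Summable fun n : ℤ => a n * ee (n * x) := by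
        apply Summable.of_norm
        refine hs.norm.congr fun n => ?_
        rw [norm_mul, hn1, mul_one]
      have := h1.hasSum.mul_right (ee (-(k * x)))
      rwa [h x, zero_mul] at this)
  have e : ∀ n : ℤ, ∫ x in (0 : ℝ)..1, a n * ee (n * x) * ee (-(k * x)) = if n = k then a n else 0 := by
    intro n
    have : ∀ x : ℝ, a n * ee (n * x) * ee (-(k * x)) = a n * ee ((n - k : ℤ) * x) := by
      intro x
      rw [mul_assoc, ← ee_add]; push_cast; ring_nf
    simp only [this]
    rw [intervalIntegral.integral_const_mul, integral_ee_int]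
    simp only [sub_eq_zero]
    split_ifs <;> simp
  simp only [e, intervalIntegral.integral_zero] at H
  have H2 := hasSum_ite_eq k (a k)
  have : (fun n => if n = k then a n else 0) = fun n => if n = k then a k else 0 := by
    ext n; split_ifs with hh <;> simp [hh]
  rw [this] at H
  exact H2.unique H

/-- The coefficient of `y^r`, as a function of `τ`. -/
def row (c : Arr) (r : ℤ) (τ : ℂ) : ℂ := ∑' n : ℤ, c (n, r) * ee (n * τ)

theorem SmAt.row_summable (h : SmAt c τ z) (r : ℤ) :
    Summable fun n : ℤ => c (n, r) * ee (n * τ) := by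
  have h1 : Summable fun n : ℤ => c (n, r) * chr τ z (n, r) :=
    Summable.comp_injective h (i := fun n : ℤ => (n, r)) fun a b hab => by simpa using hab
  refine (h1.mul_right (ee (-(r * z)))).congr fun n => ?_
  simp only [chr]
  rw [mul_assoc, ← ee_add]; ring_nf

theorem SmAt.hasSum_row (h : SmAt c τ z) :
    HasSum (fun r : ℤ => row c r τ * ee (r * z)) (JF c τ z) := by
  have h1 := h.hasSum
  rw [← (Equiv.prodComm ℤ ℤ).hasSum_iff] at h1
  refine h1.prod_fiberwise fun r => ?_
  have := (h.row_summable r).hasSum.mul_right (ee (r * z))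
  refine this.congr_fun ?_
  intro n
  simp only [Function.comp, Equiv.prodComm_apply, Prod.swap, chr]
  rw [mul_assoc, ← ee_add]

theorem row_eq_zero_of_JF (hc : SmAt c τ 0)
    (h : ∀ x : ℝ, JF c τ x = 0) (r : ℤ) : row c r τ = 0 := by
  have h0 : ∀ x : ℝ, HasSum (fun r : ℤ => row c r τ * ee (r * x)) 0 := fun x => by
    have := (hc.congr_im (τ' := τ) (z' := x) rfl (by simp)).hasSum_row
    rwa [h x] at this
  refine fourier_coeff_eq_zero ?_ (fun x => (h0 x).tsum_eq) r
  have := (h0 0).summable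
  simpa [ee_zero] using this

theorem eq_zero_of_row (hc : Sm c) {r : ℤ}
    (h : ∀ τ : ℂ, 0 < τ.im → row c r τ = 0) (n : ℤ) : c (n, r) = 0 := by
  have key : ∀ (x : ℝ) (n : ℤ), c (n, r) * ee (n * (x + I)) = c (n, r) * ee (n * I) * ee (n * x) := by
    intro x n
    rw [mul_assoc, ← ee_add]; ring_nf
  have h1 := fourier_coeff_eq_zero (a := fun n => c (n, r) * ee (n * I))
    ((hc I 0 (by simp)).row_summable r) (fun x => by
      have := h (x + I) (by simp)
      simpa only [row, key] using this) n
  exact (mul_eq_zero.mp h1).resolve_right (ee_ne_zero _)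

theorem eq_zero_of_JF (hc : Sm c) (h : ∀ τ z : ℂ, 0 < τ.im → JF c τ z = 0) : c = 0 := by
  ext ⟨n, r⟩
  exact eq_zero_of_row hc (fun τ hτ => row_eq_zero_of_JF (hc τ 0 hτ) (fun x => h τ x hτ) r) n

theorem Sm.neg {a : Arr} (ha : Sm a) : Sm (-a) := by have := ha.smul (-1); simpa using this

theorem Sm.sub {a b : Arr} (ha : Sm a) (hb : Sm b) : Sm (a - b) := by
  rw [sub_eq_add_neg]; exact ha.add hb.neg

theorem JF_sub {a b : Arr} (ha : SmAt a τ z) (hb : SmAt b τ z) :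
    JF (a - b) τ z = JF a τ z - JF b τ z := by
  have h := JF_add ha (hb.smul (-1))
  rw [JF_smul] at h
  have e : a - b = a + (-1 : ℂ) • b := by simp [sub_eq_add_neg]
  rw [e, h]; ring

theorem JF_injective {a b : Arr} (ha : Sm a) (hb : Sm b)
    (h : ∀ τ z : ℂ, 0 < τ.im → JF a τ z = JF b τ z) : a = b := by
  have := eq_zero_of_JF (ha.sub hb) fun τ z hτ => by
    rw [JF_sub (ha τ z hτ) (hb τ z hτ), h τ z hτ, sub_self]
  exact sub_eq_zero.mp this

/-! ### Elliptic arrays -/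

/-- The elliptic law of index `m`, on Fourier coefficients. -/
def Ell (m : ℕ) (c : Arr) : Prop := ∀ n r l : ℤ, c (n + r * l + m * l ^ 2, r + 2 * m * l) = c (n, r)

def Evn (c : Arr) : Prop := ∀ n r : ℤ, c (n, -r) = c (n, r)

def LowAt (N : ℤ) (c : Arr) : Prop := ∀ n r : ℤ, n < N → c (n, r) = 0

/-- The index-`m` translation by `l` on pairs `(n,r)`. -/
def ellEquiv (m : ℕ) (l : ℤ) : ℤ × ℤ ≃ ℤ × ℤ where
  toFun p := (p.1 + p.2 * l + m * l ^ 2, p.2 + 2 * m * l)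
  invFun p := (p.1 - p.2 * l + m * l ^ 2, p.2 - 2 * m * l)
  left_inv p := by ext <;> simp; ring
  right_inv p := by ext <;> simp; ring

theorem chr_ellEquiv (m : ℕ) (l : ℤ) (τ z : ℂ) (p : ℤ × ℤ) :
    chr τ z (ellEquiv m l p) = ee (m * (l ^ 2 * τ + 2 * l * z)) * chr τ (z + l * τ) p := by
  simp only [chr, ellEquiv, Equiv.coe_fn_mk]
  rw [← ee_add]; push_cast; ring_nf

theorem chr_add_int (τ z : ℂ) (l : ℤ) (p : ℤ × ℤ) : chr τ (z + l) p = chr τ z p := by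
  simp only [chr]
  have : (p.1 : ℂ) * τ + p.2 * (z + l) = (p.1 * τ + p.2 * z) + ((p.2 * l : ℤ) : ℂ) := by
    push_cast; ring
  rw [this, ee_add_int]

theorem chr_add_int_left (τ z : ℂ) (l : ℤ) (p : ℤ × ℤ) : chr (τ + l) z p = chr τ z p := by
  simp only [chr]
  have : (p.1 : ℂ) * (τ + l) + p.2 * z = (p.1 * τ + p.2 * z) + ((p.1 * l : ℤ) : ℂ) := by
    push_cast; ring
  rw [this, ee_add_int]

theorem chr_neg (τ z : ℂ) (n r : ℤ) : chr τ (-z) (n, r) = chr τ z (n, -r) := by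
  simp only [chr]; push_cast; ring_nf

theorem JF_add_int (c : Arr) (τ z : ℂ) (l : ℤ) : JF c τ (z + l) = JF c τ z := by
  simp only [JF, chr_add_int]

theorem JF_add_one_left (c : Arr) (τ z : ℂ) : JF c (τ + 1) z = JF c τ z := by
  have := chr_add_int_left τ z 1
  simp only [Int.cast_one] at this
  simp only [JF, this]

theorem JF_shift (h : Ell m c) (τ z : ℂ) (l : ℤ) :
    JF c τ z = ee (m * (l ^ 2 * τ + 2 * l * z)) * JF c τ (z + l * τ) := by
  unfold JF
  rw [← (ellEquiv m l).tsum_eq, ← tsum_mul_left]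
  congr 1; ext p
  rw [chr_ellEquiv]
  have : c (ellEquiv m l p) = c p := h p.1 p.2 l
  rw [this]; ring

theorem JF_elliptic (h : Ell m c) : EllipticLaw m (JF c) := by
  intro τ _ z l k
  rw [JF_add_int, JF_shift h τ z l, ← mul_assoc, ← ee_add]
  have : -(m : ℂ) * ((l : ℂ) ^ 2 * τ + 2 * l * z) + m * ((l : ℂ) ^ 2 * τ + 2 * l * z) = 0 := by ring
  rw [this, ee_zero, one_mul]

theorem ell_of_JF (hc : Sm c) (h : ∀ τ z : ℂ, 0 < τ.im → ∀ l : ℤ, JF c τ (z + l * τ) =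
      ee (-(m : ℂ) * (l ^ 2 * τ + 2 * l * z)) * JF c τ z) : Ell m c := by
  have key : ∀ l : ℤ, (fun p => c (ellEquiv m l p)) = c := by
    intro l
    have e : ∀ τ z : ℂ, 0 < τ.im → HasSum (fun p => c (ellEquiv m l p) * chr τ z p) (JF c τ z) := by
      intro τ z hτ
      have h1 := (hc τ (z - l * τ) hτ).hasSum
      rw [← (ellEquiv m l).hasSum_iff] at h1
      have h2 := h τ (z - l * τ) hτ l
      rw [sub_add_cancel] at h2
      rw [h2]
      refine (h1.mul_left _).congr_fun ?_
      intro p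
      simp only [Function.comp, chr_ellEquiv, sub_add_cancel]
      have : ee (-(m : ℂ) * (l ^ 2 * τ + 2 * l * (z - l * τ))) *
        ee (m * (l ^ 2 * τ + 2 * l * (z - l * τ))) = 1 := by
        rw [← ee_add, ← ee_zero]; ring_nf
      linear_combination (-c (ellEquiv m l p) * chr τ z p) * this
    exact JF_injective (fun τ z hτ => (e τ z hτ).summable) hc fun τ z hτ => (e τ z hτ).tsum_eq
  intro n r l
  exact congrFun (key l) (n, r)

theorem JF_even (h : Evn c) (τ z : ℂ) : JF c τ (-z) = JF c τ z := by
  unfold JF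
  rw [← ((Equiv.refl ℤ).prodCongr (Equiv.neg ℤ)).tsum_eq]
  congr 1; ext ⟨n, r⟩
  have e : ((Equiv.refl ℤ).prodCongr (Equiv.neg ℤ)) (n, r) = (n, -r) := rfl
  rw [e, h, chr_neg, neg_neg]

theorem even_of_JF (hc : Sm c) (h : ∀ τ z : ℂ, 0 < τ.im → JF c τ (-z) = JF c τ z) : Evn c := by
  have e : ∀ τ z : ℂ, 0 < τ.im → HasSum (fun p : ℤ × ℤ => c (p.1, -p.2) * chr τ z p)
        (JF c τ z) := by
    intro τ z hτ
    have h1 := (hc τ (-z) hτ).hasSum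
    rw [← ((Equiv.refl ℤ).prodCongr (Equiv.neg ℤ)).hasSum_iff, h τ z hτ] at h1
    refine h1.congr_fun ?_
    intro p
    have e : ((Equiv.refl ℤ).prodCongr (Equiv.neg ℤ)) p = (p.1, -p.2) := rfl
    simp only [Function.comp, e, chr_neg, neg_neg]
  have := JF_injective (fun τ z hτ => (e τ z hτ).summable) hc fun τ z hτ => (e τ z hτ).tsum_eq
  intro n r
  exact congrFun this (n, r)

/-! ### The modular law from its generators -/

theorem im_moebius_pos (hτ : 0 < τ.im) {a b c d : ℤ} (h : a * d - b * c = 1) :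
    (c : ℂ) * τ + d ≠ 0 ∧ 0 < (((a : ℂ) * τ + b) / (c * τ + d)).im := by
  have hne : (c : ℂ) * τ + d ≠ 0 := by
    intro h0
    have h1 : (c : ℝ) * τ.im = 0 := by simpa using congrArg im h0
    have h2 : (c : ℝ) * τ.re + d = 0 := by simpa using congrArg re h0
    have hc : c = 0 := by
      rcases mul_eq_zero.mp h1 with h | h
      · exact_mod_cast h
      · linarith
    subst hc
    have hd : d = 0 := by simpa using h2
    subst hd
    simp at h
  refine ⟨hne, ?_⟩
  have h' : ((a * d - b * c : ℤ) : ℝ) = 1 := by rw [h]; simp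
  push_cast at h'
  have e : (((a : ℂ) * τ + b) / (c * τ + d)).im = τ.im / normSq (c * τ + d) := by
    rw [div_im, ← sub_div]
    congr 1
    simp only [add_im, mul_im, intCast_re, intCast_im, add_re, mul_re]
    linear_combination τ.im * h'
  rw [e]
  exact div_pos hτ (normSq_pos.mpr hne)

/-- The transformation law under a single matrix. -/
def LawFor (k : ℤ) (m : ℕ) (φ : ℂ → ℂ → ℂ) (a b c d : ℤ) : Prop :=
  ∀ τ z : ℂ, 0 < τ.im → φ (((a : ℂ) * τ + b) / (c * τ + d)) (z / (c * τ + d)) =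
      ((c : ℂ) * τ + d) ^ k * ee ((m : ℂ) * c * z ^ 2 / (c * τ + d)) * φ τ z

theorem LawFor.mul {a b c d a' b' c' d' : ℤ}
    (h1 : LawFor k m φ a b c d) (h2 : LawFor k m φ a' b' c' d')
    (e2 : a' * d' - b' * c' = 1) (e1 : a * d - b * c = 1) :
    LawFor k m φ (a * a' + b * c') (a * b' + b * d') (c * a' + d * c') (c * b' + d * d') := by
  intro τ z hτ
  obtain ⟨hj, hτ'⟩ := im_moebius_pos hτ e2
  obtain ⟨hj1, -⟩ := im_moebius_pos hτ' e1
  have H := h1 _ (z / (c' * τ + d')) hτ'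
  rw [h2 τ z hτ] at H
  have ed : ((a' : ℂ)) * d' - b' * c' = 1 := by exact_mod_cast e2
  obtain ⟨J, hJ⟩ : ∃ J : ℂ, J = c' * τ + d' := ⟨_, rfl⟩
  obtain ⟨t, ht⟩ : ∃ t : ℂ, t = ((a' : ℂ) * τ + b') / (c' * τ + d') := ⟨_, rfl⟩
  obtain ⟨K, hK⟩ : ∃ K : ℂ, K = c * t + d := ⟨_, rfl⟩
  rw [← ht, ← hK, ← hJ] at H
  rw [← ht, ← hK] at hj1
  rw [← hJ] at hj ht
  have htJ : t * J = a' * τ + b' := by rw [ht]; field_simp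
  have hj12 : ((c * a' + d * c' : ℤ) : ℂ) * τ + (c * b' + d * d' : ℤ) = K * J := by
    push_cast; rw [hK]; linear_combination (-c : ℂ) * htJ - (d : ℂ) * hJ
  have hn : ((a * a' + b * c' : ℤ) : ℂ) * τ + (a * b' + b * d' : ℤ) = (a * t + b) * J := by
    push_cast; linear_combination (-a : ℂ) * htJ - (b : ℂ) * hJ
  have A1 : (a * t + b) * J / (K * J) = (a * t + b) / K := mul_div_mul_right _ _ hj
  have A2 : z / (K * J) = z / J / K := by rw [div_div, mul_comm]
  have A3 : ee (m * c * (z / J) ^ 2 / K) * ee (m * c' * z ^ 2 / J) =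
      ee (m * (c * a' + d * c' : ℤ) * z ^ 2 / (K * J)) := by
    rw [← ee_add]
    congr 1
    push_cast
    field_simp
    rw [hK]
    linear_combination (m * z ^ 2 * c : ℂ) * (c' * htJ - ed - a' * hJ)
  rw [hj12, hn, A1, A2, H, mul_zpow, ← A3]
  ring

theorem LawFor.inv {a b c d : ℤ}
    (h1 : LawFor k m φ a b c d) (e1 : a * d - b * c = 1) : LawFor k m φ d (-b) (-c) a := by
  intro τ z hτ
  have e2 : d * a - (-b) * (-c) = 1 := by linarith
  obtain ⟨hj, hτ'⟩ := im_moebius_pos hτ e2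
  have H := h1 _ (z / ((-c : ℤ) * τ + a)) hτ'
  have ed : (a : ℂ) * d - b * c = 1 := by exact_mod_cast e1
  obtain ⟨J, hJ⟩ : ∃ J : ℂ, J = (-c : ℤ) * τ + a := ⟨_, rfl⟩
  obtain ⟨t, ht⟩ : ∃ t : ℂ, t = ((d : ℂ) * τ + (-b : ℤ)) / ((-c : ℤ) * τ + a) := ⟨_, rfl⟩
  rw [← ht, ← hJ] at H
  rw [← hJ] at hj ht
  rw [← hJ, ← ht]
  have htJ : t * J = d * τ - b := by rw [ht]; field_simp; push_cast; ring
  push_cast at hJ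
  have j1 : (c : ℂ) * t + d = 1 / J := by
    field_simp
    linear_combination (c : ℂ) * htJ + d * hJ + ed
  have t1 : ((a : ℂ) * t + b) / (1 / J) = τ := by
    field_simp
    linear_combination (a : ℂ) * htJ + b * hJ + τ * ed
  have z1 : z / J / (1 / J) = z := by field_simp
  rw [j1, t1, z1] at H
  rw [H]
  have h3 : J ^ k * (1 / J) ^ k = 1 := by rw [← mul_zpow]; rw [mul_one_div_cancel hj, one_zpow]
  have E : ee (m * (-c : ℤ) * z ^ 2 / J) * ee (m * c * (z / J) ^ 2 / (1 / J)) = 1 := by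
    have e0 : (m : ℂ) * (-c : ℤ) * z ^ 2 / J + m * c * (z / J) ^ 2 / (1 / J) = 0 := by
      push_cast
      field_simp
      ring
    rw [← ee_add, e0, ee_zero]
  linear_combination (-φ t (z / J)) * (J ^ k * (1 / J) ^ k * E + h3)

theorem modularLaw_of_generators (hT : ∀ τ z : ℂ, 0 < τ.im → φ (τ + 1) z = φ τ z)
    (hS : ∀ τ z : ℂ, 0 < τ.im → φ (-1 / τ) (z / τ) = τ ^ k * ee (m * z ^ 2 / τ) * φ τ z) :
    ModularLaw k m φ := by
  have main : ∀ γ : Matrix.SpecialLinearGroup (Fin 2) ℤ,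
      LawFor k m φ (γ 0 0) (γ 0 1) (γ 1 0) (γ 1 1) := by
    intro γ
    have hγ : γ ∈ Subgroup.closure {ModularGroup.S, ModularGroup.T} := by
      rw [SpecialLinearGroup.SL2Z_generators]; trivial
    induction hγ using Subgroup.closure_induction with
    | mem x hx =>
      rcases hx with rfl | rfl
      · intro τ z hτ
        simpa [ModularGroup.S] using hS τ z hτ
      · intro τ z hτ
        simpa [ModularGroup.T, ee_zero] using hT τ z hτ
    | one => intro τ z hτ; simp [ee_zero]
    | mul x y _ _ hx hy =>
      have dx := x.det_coe
      have dy := y.det_coe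
      rw [Matrix.det_fin_two] at dx dy
      have := hx.mul hy dy dx
      simpa [Matrix.mul_apply, Fin.sum_univ_two] using this
    | inv x _ hx =>
      have dx := x.det_coe
      rw [Matrix.det_fin_two] at dx
      have := hx.inv dx
      rw [Matrix.SpecialLinearGroup.coe_inv, Matrix.adjugate_fin_two]
      simpa using this
  intro τ hτ z a b c d h
  have := main ⟨!![a, b; c, d], by rw [Matrix.det_fin_two]; simpa using h⟩ τ z hτ
  simpa using this

/-! ### Weakly holomorphic Jacobi forms -/

/-- Fourier coefficients of an even weakly holomorphic Jacobi form of weight `k`, index `m`. -/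
structure WJ (k : ℤ) (m : ℕ) (c : Arr) : Prop where
  ell : Ell m c
  even : Evn c
  low : ∃ N, LowAt N c
  sm : Sm c
  slaw : ∀ τ z : ℂ, 0 < τ.im → JF c (-1 / τ) (z / τ) = τ ^ k * ee (m * z ^ 2 / τ) * JF c τ z

theorem WJ.modularLaw (h : WJ k m c) : ModularLaw k m (JF c) :=
  modularLaw_of_generators (fun τ z _ => JF_add_one_left c τ z) h.slaw

theorem im_neg_one_div_pos (hτ : 0 < τ.im) : 0 < (-1 / τ).im := by
  have := (im_moebius_pos (a := 0) (b := -1) (c := 1) (d := 0) hτ (by norm_num)).2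
  simpa using this

theorem ne_zero_of_im_pos (hτ : 0 < τ.im) : τ ≠ 0 := by rintro rfl; simp at hτ

theorem WJ.add {a b : Arr} (ha : WJ k m a) (hb : WJ k m b) : WJ k m (a + b) where
  ell n r l := by simp [ha.ell n r l, hb.ell n r l]
  even n r := by simp [ha.even n r, hb.even n r]
  low := by
    obtain ⟨N, hN⟩ := ha.low
    obtain ⟨M, hM⟩ := hb.low
    exact ⟨min N M, fun n r h => by
      simp [hN n r (lt_of_lt_of_le h (min_le_left _ _)), hM n r (lt_of_lt_of_le h (min_le_right _ _))]⟩
  sm := ha.sm.add hb.sm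
  slaw τ z hτ := by
    have h' := im_neg_one_div_pos hτ
    rw [JF_add (ha.sm _ _ h') (hb.sm _ _ h'), JF_add (ha.sm _ _ hτ) (hb.sm _ _ hτ), ha.slaw τ z hτ,
      hb.slaw τ z hτ]; ring

theorem WJ.smul {a : Arr} (s : ℂ) (ha : WJ k m a) : WJ k m (s • a) where
  ell n r l := by simp [ha.ell n r l]
  even n r := by simp [ha.even n r]
  low := by
    obtain ⟨N, hN⟩ := ha.low
    exact ⟨N, fun n r h => by simp [hN n r h]⟩
  sm := ha.sm.smul s
  slaw τ z hτ := by rw [JF_smul, JF_smul, ha.slaw τ z hτ]; ring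

theorem WJ.zero (k : ℤ) (m : ℕ) : WJ k m 0 where
  ell n r l := rfl
  even n r := rfl
  low := ⟨0, fun n r h => rfl⟩
  sm := Sm.zero
  slaw τ z hτ := by simp [JF_zero]

/-- The space of even weakly holomorphic Jacobi forms of weight `k` and index `m`. -/
def WJSub (k : ℤ) (m : ℕ) : Submodule ℂ Arr where
  carrier := {c | WJ k m c}
  add_mem' := WJ.add
  zero_mem' := WJ.zero k m
  smul_mem' s _ h := h.smul s

theorem mem_WJSub : c ∈ WJSub k m ↔ WJ k m c := Iff.rfl

theorem conv_low {a b : Arr} {N M : ℤ} (ha : LowAt N a) (hb : LowAt M b) :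
    LowAt (N + M) (conv a b) := by
  intro n r h
  unfold conv
  rw [← tsum_zero (α := ℂ) (β := ℤ × ℤ)]
  congr 1; ext x
  by_cases hx : x.1 < N
  · rw [show x = (x.1, x.2) from rfl, ha _ _ hx, zero_mul]
  · have : b ((n, r) - x) = 0 := hb _ _ (by simp; omega)
    rw [this, mul_zero]

theorem WJ.conv {k k' : ℤ} {m m' : ℕ} {a b : Arr} (ha : WJ k m a) (hb : WJ k' m' b) :
    WJ (k + k') (m + m') (conv a b) where
  ell := by
    refine ell_of_JF (ha.sm.conv hb.sm) fun τ z hτ l => ?_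
    have h1 := JF_elliptic ha.ell τ hτ z l 0
    have h2 := JF_elliptic hb.ell τ hτ z l 0
    simp only [Int.cast_zero, add_zero] at h1 h2
    rw [JF_conv (ha.sm _ _ hτ) (hb.sm _ _ hτ), JF_conv (ha.sm _ _ hτ) (hb.sm _ _ hτ), h1, h2]
    have : -((m + m' : ℕ) : ℂ) * ((l : ℂ) ^ 2 * τ + 2 * l * z) =
      -(m : ℂ) * ((l : ℂ) ^ 2 * τ + 2 * l * z) + -(m' : ℂ) * ((l : ℂ) ^ 2 * τ + 2 * l * z) := by
      push_cast; ring
    rw [this, ee_add]; ring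
  even := by
    refine even_of_JF (ha.sm.conv hb.sm) fun τ z hτ => ?_
    rw [JF_conv (ha.sm _ _ hτ) (hb.sm _ _ hτ), JF_conv (ha.sm _ _ hτ) (hb.sm _ _ hτ),
      JF_even ha.even, JF_even hb.even]
  low := by
    obtain ⟨N, hN⟩ := ha.low
    obtain ⟨M, hM⟩ := hb.low
    exact ⟨_, conv_low hN hM⟩
  sm := ha.sm.conv hb.sm
  slaw τ z hτ := by
    have h' := im_neg_one_div_pos hτ
    have h0 := ne_zero_of_im_pos hτ
    rw [JF_conv (ha.sm _ _ h') (hb.sm _ _ h'), JF_conv (ha.sm _ _ hτ) (hb.sm _ _ hτ),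
      ha.slaw τ z hτ, hb.slaw τ z hτ, zpow_add₀ h0]
    have : ((m + m' : ℕ) : ℂ) * z ^ 2 / τ = m * z ^ 2 / τ + m' * z ^ 2 / τ := by push_cast; ring
    rw [this, ee_add]; ring

/-- The array of the constant function `1`. -/
def oneArr : Arr := Pi.single 0 1

theorem hasSum_oneArr (τ z : ℂ) : HasSum (fun p => oneArr p * chr τ z p) 1 := by
  have : (fun p => oneArr p * chr τ z p) = Pi.single 0 1 := by
    ext p
    by_cases h : p = 0
    · subst h; simp [oneArr, chr, ee_zero]
    · simp [oneArr, h]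
  rw [this]
  exact hasSum_pi_single 0 1

theorem JF_oneArr (τ z : ℂ) : JF oneArr τ z = 1 := (hasSum_oneArr τ z).tsum_eq

theorem WJ.one : WJ 0 0 oneArr where
  ell := ell_of_JF (fun τ z _ => (hasSum_oneArr τ z).summable) fun τ z _ l => by
    simp [JF_oneArr, ee_zero]
  even := even_of_JF (fun τ z _ => (hasSum_oneArr τ z).summable) fun τ z _ => by simp [JF_oneArr]
  low := ⟨0, fun n r h => by
    have : ((n, r) : ℤ × ℤ) ≠ 0 := by intro h0; simp at h0; omega
    simp [oneArr, this]⟩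
  sm := fun τ z _ => (hasSum_oneArr τ z).summable
  slaw τ z hτ := by simp [JF_oneArr, ee_zero]

def convPow (c : Arr) : ℕ → Arr
  | 0 => oneArr
  | n + 1 => conv c (convPow c n)

theorem Sm.convPow (h : Sm c) (n : ℕ) : Sm (convPow c n) := by
  induction n with
  | zero => exact WJ.one.sm
  | succ n ih => exact h.conv ih

theorem JF_convPow (h : Sm c) (n : ℕ) (hτ : 0 < τ.im) (z : ℂ) :
    JF (convPow c n) τ z = JF c τ z ^ n := by
  induction n with
  | zero => simp [convPow, JF_oneArr]
  | succ n ih => rw [convPow, JF_conv (h _ _ hτ) (h.convPow n _ _ hτ), ih, pow_succ']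

theorem WJ.convPow (h : WJ k m c) (n : ℕ) : WJ (n * k) (n * m) (convPow c n) := by
  induction n with
  | zero => simpa [_root_.convPow] using WJ.one
  | succ n ih =>
    have := h.conv ih
    have e1 : k + n * k = ((n + 1 : ℕ) : ℤ) * k := by push_cast; ring
    have e2 : m + n * m = (n + 1) * m := by ring
    rwa [e1, e2] at this

/-! ### Integral arrays and leading terms -/

def IntArr (c : Arr) : Prop := ∀ p, ∃ k : ℤ, c p = k

theorem exists_int_tsum {ι : Type*} {f : ι → ℂ} (hf : ∀ i, ∃ k : ℤ, f i = k) :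
    ∃ k : ℤ, ∑' i, f i = k := by
  by_cases hs : Summable f
  · have h0 := hs.tendsto_cofinite_zero
    have h1 : ∀ᶠ i in cofinite, ‖f i‖ < 1 := by
      have := h0.norm
      rw [norm_zero] at this
      exact this.eventually (gt_mem_nhds one_pos)
    have h2 : {i | f i ≠ 0}.Finite := by
      refine Set.Finite.subset h1 fun i hi => ?_
      simp only [Set.mem_compl_iff, Set.mem_ofPred_eq, not_lt]
      obtain ⟨k, hk⟩ := hf i
      have hk0 : k ≠ 0 := by rintro rfl; exact hi (by simpa using hk)
      rw [hk, norm_intCast]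
      exact_mod_cast Int.one_le_abs hk0
    rw [tsum_eq_sum (s := h2.toFinset) fun i hi => by simpa using hi]
    choose g hg using hf
    exact ⟨∑ i ∈ h2.toFinset, g i, by push_cast; exact sum_congr rfl fun i _ => hg i⟩
  · exact ⟨0, by rw [tsum_eq_zero_of_not_summable hs]; simp⟩

theorem IntArr.conv {a b : Arr} (ha : IntArr a) (hb : IntArr b) : IntArr (conv a b) := by
  intro p
  refine exists_int_tsum fun x => ?_
  obtain ⟨k, hk⟩ := ha x
  obtain ⟨l, hl⟩ := hb (p - x)
  exact ⟨k * l, by rw [hk, hl]; push_cast; rfl⟩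

theorem IntArr.one : IntArr oneArr := by
  intro p
  by_cases h : p = 0
  · exact ⟨1, by simp [oneArr, h]⟩
  · exact ⟨0, by simp [oneArr, h]⟩

theorem IntArr.convPow (h : IntArr c) (n : ℕ) : IntArr (convPow c n) := by
  induction n with
  | zero => exact IntArr.one
  | succ n ih => exact h.conv ih

theorem IntArr.add {a b : Arr} (ha : IntArr a) (hb : IntArr b) : IntArr (a + b) := by
  intro p
  obtain ⟨k, hk⟩ := ha p
  obtain ⟨l, hl⟩ := hb p
  exact ⟨k + l, by simp [hk, hl]⟩

/-- The leading term of `c` is `q^n (y^i + ⋯ + y^{-i})`. -/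
structure LeadTerm (c : Arr) (n : ℤ) (i : ℕ) : Prop where
  low : LowAt n c
  out : ∀ r : ℤ, (i : ℤ) < |r| → c (n, r) = 0
  pos : c (n, i) = 1
  neg : c (n, -i) = 1

theorem LeadTerm.conv {a b : Arr} {n n' : ℤ} {i i' : ℕ} (ha : LeadTerm a n i) (hb : LeadTerm b n' i') :
    LeadTerm (conv a b) (n + n') (i + i') := by
  have key : ∀ r : ℤ, ∀ x : ℤ × ℤ, a x * b ((n + n', r) - x) ≠ 0 →
      x.1 = n ∧ |x.2| ≤ i ∧ |r - x.2| ≤ i' := by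
    intro r x hx
    have h1 : a x ≠ 0 := left_ne_zero_of_mul hx
    have h2 : b (n + n' - x.1, r - x.2) ≠ 0 := right_ne_zero_of_mul hx
    have l1 : n ≤ x.1 := by by_contra h; exact h1 (ha.low x.1 x.2 (by omega))
    have l2 : n' ≤ n + n' - x.1 := by by_contra h; exact h2 (hb.low _ _ (by omega))
    have e : x.1 = n := by omega
    refine ⟨e, ?_, ?_⟩
    · by_contra h
      apply h1
      rw [show x = (x.1, x.2) from rfl, e]
      exact ha.out _ (by omega)
    · by_contra h
      apply h2
      rw [show n + n' - x.1 = n' by omega]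
      exact hb.out _ (by omega)
  refine ⟨conv_low ha.low hb.low, fun r hr => ?_, ?_, ?_⟩
  · unfold _root_.conv
    rw [← tsum_zero (α := ℂ) (β := ℤ × ℤ)]
    congr 1; ext x
    by_contra h
    obtain ⟨-, h1, h2⟩ := key r x h
    push_cast at hr
    have := abs_add_le x.2 (r - x.2)
    rw [add_sub_cancel] at this
    omega
  · unfold _root_.conv
    rw [tsum_eq_single (n, (i : ℤ))]
    · have : ((n + n', ((i + i' : ℕ) : ℤ)) - (n, (i : ℤ)) : ℤ × ℤ) = (n', (i' : ℤ)) := by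
        ext <;> simp
      rw [this, ha.pos, hb.pos, mul_one]
    · intro x hx
      by_contra h
      obtain ⟨h0, h1, h2⟩ := key _ x h
      push_cast at h2
      rw [abs_le] at h1 h2
      exact hx (by ext <;> simp <;> omega)
  · unfold _root_.conv
    rw [tsum_eq_single (n, -(i : ℤ))]
    · have : ((n + n', -((i + i' : ℕ) : ℤ)) - (n, -(i : ℤ)) : ℤ × ℤ) = (n', -(i' : ℤ)) := by
        ext <;> simp
      rw [this, ha.neg, hb.neg, mul_one]
    · intro x hx
      by_contra h
      obtain ⟨h0, h1, h2⟩ := key _ x h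
      push_cast at h2
      rw [abs_le] at h1 h2
      exact hx (by ext <;> simp <;> omega)

theorem LeadTerm.one : LeadTerm oneArr 0 0 := by
  refine ⟨fun n r h => ?_, fun r h => ?_, Pi.single_eq_same _ _, Pi.single_eq_same _ _⟩
  · have : ((n, r) : ℤ × ℤ) ≠ 0 := by intro h0; simp at h0; omega
    simp [oneArr, this]
  · have : ((0, r) : ℤ × ℤ) ≠ 0 := by intro h0; simp at h0; simp [h0] at h
    simp [oneArr, this]

theorem LeadTerm.convPow {n : ℤ} {i : ℕ} (h : LeadTerm c n i) (s : ℕ) :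
    LeadTerm (convPow c s) (s * n) (s * i) := by
  induction s with
  | zero => simpa [_root_.convPow] using LeadTerm.one
  | succ s ih =>
    have := h.conv ih
    have e1 : n + s * n = ((s + 1 : ℕ) : ℤ) * n := by push_cast; ring
    have e2 : i + s * i = (s + 1) * i := by ring
    rwa [e1, e2] at this

/-! ### Power series in `q` -/

theorem exists_ee_eq {w : ℂ} (h0 : w ≠ 0) (h1 : ‖w‖ < 1) : ∃ τ : ℂ, 0 < τ.im ∧ ee τ = w := by
  refine ⟨log w / (ϖ), ?_, ?_⟩
  · have hl : Real.log ‖w‖ < 0 := Real.log_neg (norm_pos_iff.mpr h0) h1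
    have e : log w / (ϖ) = ((1 / (2 * π) : ℝ) : ℂ) * (-I * log w) := by
      have : (π : ℂ) ≠ 0 := by exact_mod_cast Real.pi_ne_zero
      push_cast
      field_simp
      rw [I_sq]; ring
    rw [e, im_ofReal_mul]
    have : (-I * log w).im = -Real.log ‖w‖ := by simp [log_re]
    rw [this]
    have := Real.pi_pos
    exact mul_pos (by positivity) (by linarith)
  · unfold ee
    rw [mul_div_cancel₀ _ two_pi_I_ne_zero, exp_log h0]

theorem norm_ee_lt_one (hτ : 0 < τ.im) : ‖ee τ‖ < 1 := by
  rw [norm_ee, Real.exp_lt_one_iff]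
  have := mul_pos Real.two_pi_pos hτ
  linarith

/-- The array of the power series `∑ a n q^n`. -/
def qArr (a : ℕ → ℂ) (p : ℤ × ℤ) : ℂ := if p.2 = 0 ∧ 0 ≤ p.1 then a p.1.toNat else 0

theorem qArr_nat (a : ℕ → ℂ) (n : ℕ) : qArr a ((n : ℤ), 0) = a n := by simp [qArr]

theorem hasSum_qArr_iff {a : ℕ → ℂ} {τ z s : ℂ} :
    HasSum (fun p => qArr a p * chr τ z p) s ↔ HasSum (fun n : ℕ => a n * ee τ ^ n) s := by
  have hi : Function.Injective (fun n : ℕ => ((n : ℤ), (0 : ℤ))) := fun x y h => by simpa using h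
  rw [← hi.hasSum_iff]
  · have : ((fun p => qArr a p * chr τ z p) ∘ fun n : ℕ => ((n : ℤ), (0 : ℤ))) =
        fun n : ℕ => a n * ee τ ^ n := by
      ext n
      simp [qArr_nat, chr, ee_nat_mul]
    rw [this]
  · rintro ⟨n, r⟩ h
    have : ¬ (r = 0 ∧ 0 ≤ n) := by
      rintro ⟨rfl, hn⟩
      exact h ⟨n.toNat, by simp [hn]⟩
    simp [qArr, this]

theorem qArr_low (a : ℕ → ℂ) : LowAt 0 (qArr a) := by
  intro n r h
  simp [qArr]; omega

/-- Convergence of `∑ a n w^n` in the unit disc. -/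
def DiscSummable (a : ℕ → ℂ) : Prop := ∀ w : ℂ, ‖w‖ < 1 → Summable fun n => a n * w ^ n

theorem DiscSummable.sm {a : ℕ → ℂ} (h : DiscSummable a) : Sm (qArr a) := fun _ _ hτ =>
  (hasSum_qArr_iff.mpr (h _ (norm_ee_lt_one hτ)).hasSum).summable

theorem DiscSummable.JF_qArr {a : ℕ → ℂ} (h : DiscSummable a) (hτ : 0 < τ.im) (z : ℂ) :
    JF (qArr a) τ z = ∑' n, a n * ee τ ^ n :=
  (hasSum_qArr_iff.mpr (h _ (norm_ee_lt_one hτ)).hasSum).tsum_eq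

theorem discSummable_of_upper {a : ℕ → ℂ}
    (h : ∀ τ : ℂ, 0 < τ.im → Summable fun n => a n * ee τ ^ n) : DiscSummable a := by
  intro w hw
  by_cases h0 : w = 0
  · subst h0
    refine summable_of_ne_finset_zero (s := {0}) fun n hn => ?_
    simp at hn
    simp [hn]
  · obtain ⟨τ, hτ, rfl⟩ := exists_ee_eq h0 hw
    exact h τ hτ

theorem DiscSummable.differentiableOn {a : ℕ → ℂ} (h : DiscSummable a) :
    DifferentiableOn ℂ (fun w => ∑' n, a n * w ^ n) (Metric.ball 0 1) := by
  intro w hw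
  rw [mem_ball_zero_iff] at hw
  obtain ⟨ρ, h1, h2⟩ := exists_between hw
  have hρ0 : 0 ≤ ρ := (norm_nonneg w).trans h1.le
  have hs := (h (ρ : ℂ) (by simpa [abs_of_nonneg hρ0] using h2)).norm
  have := differentiableOn_tsum_of_summable_norm (F := fun (n : ℕ) (w : ℂ) => a n * w ^ n)
    (U := Metric.ball (0 : ℂ) ρ) hs (fun n => by fun_prop) Metric.isOpen_ball
    (fun n w hw => by
      rw [mem_ball_zero_iff] at hw
      simp only [norm_mul, norm_pow, norm_real, Real.norm_eq_abs, abs_of_nonneg hρ0]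
      gcongr)
  exact (this.differentiableAt (Metric.isOpen_ball.mem_nhds (by simpa using h1))).differentiableWithinAt

theorem exists_discSummable {G : ℂ → ℂ} (hG : DifferentiableOn ℂ G (Metric.ball 0 1)) :
    ∃ a : ℕ → ℂ, DiscSummable a ∧ (∀ w, ‖w‖ < 1 → ∑' n, a n * w ^ n = G w) ∧ a 0 = G 0 := by
  have key : ∀ w : ℂ, ‖w‖ < 1 →
      HasSum (fun n : ℕ => ((n.factorial : ℂ)⁻¹ * iteratedDeriv n G 0) * w ^ n) (G w) := by
    intro w hw
    have := hasSum_taylorSeries_on_ball hG (z := w) (by simpa using hw)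
    refine this.congr_fun fun n => ?_
    simp only [smul_eq_mul, sub_zero]; ring
  exact ⟨_, fun w hw => (key w hw).summable, fun w hw => (key w hw).tsum_eq, by simp⟩

theorem discSummable_unique {a b : ℕ → ℂ} (ha : DiscSummable a) (hb : DiscSummable b)
    (h : ∀ w, ‖w‖ < 1 → ∑' n, a n * w ^ n = ∑' n, b n * w ^ n) : a = b := by
  have := JF_injective ha.sm hb.sm fun τ z hτ => by
    rw [ha.JF_qArr hτ, hb.JF_qArr hτ, h _ (norm_ee_lt_one hτ)]
  ext n
  rw [← qArr_nat a, this, qArr_nat]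

/-- The reciprocal of a non-vanishing integral power series is integral. -/
theorem exists_reciprocal {a : ℕ → ℂ} (ha : DiscSummable a) (h0 : a 0 = 1)
    (hz : ∀ n, ∃ k : ℤ, a n = k) (hne : ∀ w, ‖w‖ < 1 → ∑' n, a n * w ^ n ≠ 0) :
    ∃ b : ℕ → ℂ, DiscSummable b ∧ b 0 = 1 ∧ (∀ n, ∃ k : ℤ, b n = k) ∧
      ∀ w, ‖w‖ < 1 → (∑' n, a n * w ^ n) * ∑' n, b n * w ^ n = 1 := by
  obtain ⟨b, hb, hb1, hb0⟩ := exists_discSummable (G := fun w => (∑' n, a n * w ^ n)⁻¹)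
    (ha.differentiableOn.inv fun w hw => hne w (by simpa using hw))
  have hmul : ∀ w, ‖w‖ < 1 → (∑' n, a n * w ^ n) * ∑' n, b n * w ^ n = 1 := fun w hw => by
    rw [hb1 w hw, mul_inv_cancel₀ (hne w hw)]
  have hb00 : b 0 = 1 := by
    rw [hb0, tsum_eq_single 0 (fun n hn => by simp [hn])]
    simp [h0]
  have hd : ∀ w, ‖w‖ < 1 → HasSum (fun n => (∑ kl ∈ Finset.HasAntidiagonal.antidiagonal n, a kl.1 * b kl.2) * w ^ n)
      1 := by
    intro w hw
    have e : ∀ n, (∑ kl ∈ Finset.HasAntidiagonal.antidiagonal n, a kl.1 * b kl.2) * w ^ n =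
        ∑ kl ∈ Finset.HasAntidiagonal.antidiagonal n, (a kl.1 * w ^ kl.1) * (b kl.2 * w ^ kl.2) := by
      intro n
      rw [sum_mul]
      refine sum_congr rfl fun kl hkl => ?_
      rw [← Finset.HasAntidiagonal.mem_antidiagonal.mp hkl, pow_add]; ring
    simp only [e]
    have hs := summable_norm_sum_mul_antidiagonal_of_summable_norm (ha w hw).norm (hb w hw).norm
    have := hs.of_norm.hasSum
    rwa [← tsum_mul_tsum_eq_tsum_sum_antidiagonal_of_summable_norm (ha w hw).norm (hb w hw).norm,
      hmul w hw] at this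
  have h1 : ∀ w : ℂ, HasSum (fun n : ℕ => (if n = 0 then (1 : ℂ) else 0) * w ^ n) 1 := by
    intro w
    convert hasSum_ite_eq (0 : ℕ) (1 : ℂ) using 2 with n
    split_ifs with h <;> simp [h]
  have hrec := discSummable_unique (fun w hw => (hd w hw).summable) (fun w _ => (h1 w).summable)
    fun w hw => by rw [(hd w hw).tsum_eq, (h1 w).tsum_eq]
  refine ⟨b, hb, hb00, ?_, hmul⟩
  intro n
  induction n using Nat.strong_induction_on with
  | _ n ih =>
    rcases n with _ | n
    · exact ⟨1, by simp [hb00]⟩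
    · have e := congrFun hrec (n + 1)
      simp only [Finset.Nat.sum_antidiagonal_succ, h0, one_mul, Nat.add_eq_zero_iff, one_ne_zero,
        and_false, if_false] at e
      have : ∃ k : ℤ, ∑ p ∈ Finset.HasAntidiagonal.antidiagonal n, a (p.1 + 1) * b p.2 = k := by
        choose! f hf using ih
        choose g hg using hz
        refine ⟨∑ p ∈ Finset.HasAntidiagonal.antidiagonal n, g (p.1 + 1) * f p.2, ?_⟩
        push_cast
        refine sum_congr rfl fun p hp => ?_
        have := Finset.HasAntidiagonal.mem_antidiagonal.mp hp
        rw [hg, hf p.2 (by omega)]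
      obtain ⟨k, hk⟩ := this
      exact ⟨-k, by push_cast; rw [← hk]; linear_combination e⟩

/-- Setting `z = 0`: the coefficients of the resulting power series. -/
def coll (c : Arr) (n : ℕ) : ℂ := ∑' s : ℤ, c (n, s)

theorem hasSum_coll (hc : ∀ τ : ℂ, 0 < τ.im → SmAt c τ 0) (hl : LowAt 0 c) (hτ : 0 < τ.im) :
    HasSum (fun n : ℕ => coll c n * ee τ ^ n) (JF c τ 0) := by
  have h := (hc τ hτ).hasSum
  have h1 := h.prod_fiberwise (g := fun n : ℤ => (∑' s : ℤ, c (n, s)) * ee (n * τ)) fun n => by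
    have h2 := (h.summable.prod_factor n).hasSum
    have e : ∀ s : ℤ, c (n, s) * chr τ 0 (n, s) = c (n, s) * ee (n * τ) := fun s => by simp [chr]
    simp only [e] at h2
    rw [tsum_mul_right] at h2
    exact h2.congr_fun fun s => e s
  have hi : Function.Injective (fun n : ℕ => (n : ℤ)) := Nat.cast_injective
  rw [← hi.hasSum_iff] at h1
  · refine h1.congr_fun fun n => ?_
    simp [coll, ee_nat_mul]
  · intro n hn
    have : n < 0 := by
      by_contra h0
      exact hn ⟨n.toNat, by simp; omega⟩
    simp [hl n _ this]

theorem discSummable_coll (hc : ∀ τ : ℂ, 0 < τ.im → SmAt c τ 0)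
    (hl : LowAt 0 c) : DiscSummable (coll c) :=
  discSummable_of_upper fun _ hτ => (hasSum_coll hc hl hτ).summable

/-! ### The odd theta function -/

/-- The array of `∑ (-1)^r q^{r(r+1)/2} y^r`. -/
def gArr (p : ℤ × ℤ) : ℂ := if 2 * p.1 = p.2 * (p.2 + 1) then ee (p.2 / 2) else 0

theorem ee_half_int (r : ℤ) : ee ((r : ℂ) / 2) = (-1) ^ r := by
  rw [← ee_half, ← ee_int_mul]; ring_nf

theorem hasSum_gArr (hτ : 0 < τ.im) (z : ℂ) :
    HasSum (fun p => gArr p * chr τ z p) (jacobiTheta₂ (z + τ / 2 + 1 / 2) τ) := by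
  have hd : ∀ r : ℤ, 2 * (r * (r + 1) / 2) = r * (r + 1) := fun r =>
    Int.mul_ediv_cancel' (Int.even_mul_succ_self r).two_dvd
  have hi : Function.Injective (fun r : ℤ => (r * (r + 1) / 2, r)) := fun x y h => by
    simpa using congrArg Prod.snd h
  rw [← hi.hasSum_iff]
  · refine (hasSum_jacobiTheta₂_term (z + τ / 2 + 1 / 2) hτ).congr_fun fun r => ?_
    have hc : (2 : ℂ) * ((r * (r + 1) / 2 : ℤ) : ℂ) = r * (r + 1) := by exact_mod_cast hd r
    simp only [Function.comp, gArr, hd, if_true, chr, jacobiTheta₂_term]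
    rw [← ee_add, ee]
    congr 1
    linear_combination (π : ℂ) * I * τ * hc
  · rintro ⟨n, r⟩ h
    have : ¬ 2 * n = r * (r + 1) := fun e => h ⟨r, by ext <;> simp; rw [← e]; simp⟩
    simp [gArr, this]

theorem gArr_sm : Sm gArr := fun _ z hτ => (hasSum_gArr hτ z).summable

theorem JF_gArr (hτ : 0 < τ.im) (z : ℂ) :
    JF gArr τ z = jacobiTheta₂ (z + τ / 2 + 1 / 2) τ := (hasSum_gArr hτ z).tsum_eq

theorem gArr_low : LowAt 0 gArr := by
  intro n r h
  have : ¬ 2 * n = r * (r + 1) := by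
    rcases le_or_gt 0 r with h1 | h1
    · nlinarith
    · nlinarith [mul_nonneg (by omega : 0 ≤ -r) (by omega : 0 ≤ -(r + 1))]
  simp [gArr, this]

theorem gArr_int : IntArr gArr := by
  intro p
  unfold gArr
  split_ifs
  · rw [ee_half_int]
    rcases Int.even_or_odd p.2 with h | h
    · exact ⟨1, by simp [h.neg_one_zpow]⟩
    · exact ⟨-1, by simp [h.neg_one_zpow]⟩
  · exact ⟨0, by simp⟩

theorem gArr_refl (n r : ℤ) : gArr (n, -1 - r) = -gArr (n, r) := by
  unfold gArr
  have : (2 * n = (-1 - r) * (-1 - r + 1)) ↔ 2 * n = r * (r + 1) := by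
    constructor <;> intro h <;> rw [h] <;> ring
  simp only [this]
  split_ifs
  · rw [ee_half_int, ee_half_int, zpow_sub₀ (by norm_num)]
    rcases Int.even_or_odd r with h | h <;> simp [h.neg_one_zpow]
  · simp

theorem JF_gArr_neg (z : ℂ) : JF gArr τ (-z) = -(ee z * JF gArr τ z) := by
  let e : ℤ × ℤ ≃ ℤ × ℤ := (Equiv.refl ℤ).prodCongr (Equiv.subLeft (-1))
  unfold JF
  rw [← e.tsum_eq, ← tsum_mul_left, ← tsum_neg]
  congr 1; ext ⟨n, r⟩
  have e1 : e (n, r) = (n, -1 - r) := rfl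
  rw [e1, gArr_refl]
  simp only [chr]
  have : (n : ℂ) * τ + ((-1 - r : ℤ) : ℂ) * -z = z + (n * τ + r * z) := by push_cast; ring
  rw [this, ee_add]; ring

theorem JF_gArr_zero (τ : ℂ) : JF gArr τ 0 = 0 := by
  have := JF_gArr_neg (τ := τ) 0
  rw [neg_zero, ee_zero, one_mul] at this
  exact self_eq_neg.mp this

/-- The odd Jacobi theta function. -/
def theta1 (τ z : ℂ) : ℂ := ee (τ / 8 + z / 2) * JF gArr τ z

/-- The automorphy factor of `theta1`. -/
def thetaFactor (τ : ℂ) : ℂ := ee (-1 / 4) * (-I * τ) ^ (1 / 2 : ℂ)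

theorem thetaFactor_sq (τ : ℂ) : thetaFactor τ ^ 2 = I * τ := by
  unfold thetaFactor
  rw [mul_pow, ← cpow_nat_mul]
  have h1 : ee (-1 / 4) ^ 2 = -1 := by
    rw [← ee_nat_mul, show ((2 : ℕ) : ℂ) * (-1 / 4) = -(1 / 2) by norm_num, ee_neg, ee_half]
    norm_num
  rw [h1]
  norm_num

theorem theta1_S (hτ : 0 < τ.im) (z : ℂ) :
    theta1 (-1 / τ) (z / τ) = thetaFactor τ * ee (z ^ 2 / (2 * τ)) * theta1 τ z := by
  have h0 := ne_zero_of_im_pos hτ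
  have hs : (-I * τ) ^ (1 / 2 : ℂ) ≠ 0 := by
    rw [Ne, cpow_eq_zero_iff]
    simp [h0]
  unfold theta1
  rw [JF_gArr (im_neg_one_div_pos hτ), JF_gArr hτ]
  have hf := jacobiTheta₂_functional_equation (z + τ / 2 - 1 / 2) τ
  have e1 : jacobiTheta₂ (z + τ / 2 + 1 / 2) τ = jacobiTheta₂ (z + τ / 2 - 1 / 2) τ := by
    rw [← jacobiTheta₂_add_left (z + τ / 2 - 1 / 2)]; ring_nf
  have e2 : (z + τ / 2 - 1 / 2) / τ = z / τ + -1 / τ / 2 + 1 / 2 := by field_simp; ring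
  rw [e2] at hf
  rw [e1, hf]
  have e3 : cexp (-(π : ℂ) * I * (z + τ / 2 - 1 / 2) ^ 2 / τ) =
      ee (-(z + τ / 2 - 1 / 2) ^ 2 / (2 * τ)) := by
    unfold ee; congr 1; field_simp
  rw [e3]
  have e4 : ee (-1 / τ / 8 + z / τ / 2) = ee (-1 / 4) * ee (z ^ 2 / (2 * τ)) * ee (τ / 8 + z / 2) *
      ee (-(z + τ / 2 - 1 / 2) ^ 2 / (2 * τ)) := by
    rw [← ee_add, ← ee_add, ← ee_add]
    congr 1; field_simp; ring
  rw [e4, thetaFactor]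
  field_simp

/-- `∑_{k≥0} (-1)^k (2k+1) q^{k(k+1)/2}`. -/
def eta3 (τ : ℂ) : ℂ := JF (fun p => (p.2 : ℂ) * gArr p) τ 0

theorem theta1_hasDerivAt_zero (hτ : 0 < τ.im) :
    HasDerivAt (theta1 τ) (ϖ * (ee (τ / 8) * eta3 τ)) 0 := by
  have h1 := (gArr_sm.hasDerivAt hτ 0).2
  have h2 : HasDerivAt (fun z : ℂ => ee (τ / 8 + z / 2))
      (ϖ * ee (τ / 8 + 0 / 2) * (1 / 2)) 0 := by
    have h3 : HasDerivAt (fun z : ℂ => τ / 8 + z / 2) (1 / 2) 0 :=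
      ((hasDerivAt_id (0 : ℂ)).div_const 2).const_add _
    exact HasDerivAt.comp (h₂ := ee) 0 (hasDerivAt_ee (τ / 8 + 0 / 2)) h3
  have := h2.mul h1
  rw [JF_gArr_zero] at this
  refine this.congr_deriv ?_
  simp [eta3]; ring

theorem eta3_S (hτ : 0 < τ.im) :
    ee (-1 / τ / 8) * eta3 (-1 / τ) = τ * thetaFactor τ * (ee (τ / 8) * eta3 τ) := by
  have h0 := ne_zero_of_im_pos hτ
  have ht0 : theta1 τ 0 = 0 := by simp [theta1, JF_gArr_zero]
  have h1 : HasDerivAt (fun z => theta1 (-1 / τ) (z / τ))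
      (ϖ * (ee (-1 / τ / 8) * eta3 (-1 / τ)) * (1 / τ)) 0 := by
    have a := theta1_hasDerivAt_zero (im_neg_one_div_pos hτ)
    have b : HasDerivAt (fun z : ℂ => z / τ) (1 / τ) 0 := (hasDerivAt_id (0 : ℂ)).div_const τ
    rw [show (0 : ℂ) = 0 / τ by simp] at a
    exact a.comp 0 b
  have h2 : HasDerivAt (fun z => thetaFactor τ * ee (z ^ 2 / (2 * τ)) * theta1 τ z)
      (thetaFactor τ * (ϖ * (ee (τ / 8) * eta3 τ))) 0 := by
    have a : DifferentiableAt ℂ (fun z : ℂ => thetaFactor τ * ee (z ^ 2 / (2 * τ))) 0 := by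
      have := differentiable_ee
      fun_prop
    have := a.hasDerivAt.mul (theta1_hasDerivAt_zero hτ)
    refine this.congr_deriv ?_
    simp [ht0, ee_zero]
  have h3 : (fun z => theta1 (-1 / τ) (z / τ)) =
      fun z => thetaFactor τ * ee (z ^ 2 / (2 * τ)) * theta1 τ z := funext fun z => theta1_S hτ z
  rw [h3] at h1
  have := h1.unique h2
  have hpi := two_pi_I_ne_zero
  have e : (ϖ) * (ee (-1 / τ / 8) * eta3 (-1 / τ)) =
      (ϖ) * (τ * thetaFactor τ * (ee (τ / 8) * eta3 τ)) := by
    field_simp at this ⊢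
    linear_combination this
  exact mul_left_cancel₀ hpi e

theorem eta3_add_one (τ : ℂ) : eta3 (τ + 1) = eta3 τ := JF_add_one_left _ _ _

def eta3Coeff : ℕ → ℂ := coll fun p => (p.2 : ℂ) * gArr p

theorem eta3_low : LowAt 0 (fun p : ℤ × ℤ => (p.2 : ℂ) * gArr p) := fun n r h => by
  simp [gArr_low n r h]

theorem hasSum_eta3 (hτ : 0 < τ.im) : HasSum (fun n => eta3Coeff n * ee τ ^ n) (eta3 τ) :=
  hasSum_coll (fun τ => gArr_sm.int_mul.2 τ 0) eta3_low hτ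

theorem eta3_discSummable : DiscSummable eta3Coeff :=
  discSummable_coll (fun τ => gArr_sm.int_mul.2 τ 0) eta3_low

theorem eta3Coeff_zero : eta3Coeff 0 = 1 := by
  unfold eta3Coeff coll
  rw [tsum_eq_single (-1)]
  · simp [gArr]
    rw [neg_div, ee_neg, ee_half]; norm_num
  · intro s hs
    by_cases h : s = 0
    · simp [h]
    · have : ¬ (2 * ((0 : ℕ) : ℤ) = s * (s + 1)) := by
        intro h0
        have : s * (s + 1) = 0 := by rw [← h0]; simp
        rcases mul_eq_zero.mp this with h1 | h1 <;> omega
      simp only [gArr, this, if_false, mul_zero]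

theorem eta3Coeff_int (n : ℕ) : ∃ k : ℤ, eta3Coeff n = k := by
  refine exists_int_tsum fun s => ?_
  obtain ⟨k, hk⟩ := gArr_int (n, s)
  exact ⟨s * k, by simp [hk]⟩

/-! ### Non-vanishing of `eta3` -/

open UpperHalfPlane ModularForm in
theorem tendsto_ee_atImInfty : Tendsto (fun z : ℍ => ee (z : ℂ)) atImInfty (𝓝 0) := by
  have := UpperHalfPlane.qParam_tendsto_atImInfty (h := 1) zero_lt_one
  refine this.congr fun z => ?_
  simp [Function.Periodic.qParam, ee]

theorem eta3_pow_S (hτ : 0 < τ.im) :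
    ee (-1 / τ) * eta3 (-1 / τ) ^ 8 = τ ^ 12 * (ee τ * eta3 τ ^ 8) := by
  have h := congrArg (· ^ 8) (eta3_S hτ)
  simp only [mul_pow] at h
  have e : ∀ x : ℂ, ee (x / 8) ^ 8 = ee x := fun x => by rw [← ee_nat_mul]; congr 1; push_cast; ring
  rw [e, e] at h
  have e2 : thetaFactor τ ^ 8 = τ ^ 4 := by
    rw [show thetaFactor τ ^ 8 = (thetaFactor τ ^ 2) ^ 4 by ring, thetaFactor_sq, mul_pow, I_pow_four,
      one_mul]
  rw [h, e2]; ring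

open UpperHalfPlane ModularForm SlashInvariantForm MatrixGroups in
theorem eta3_ne_zero (hτ : 0 < τ.im) : eta3 τ ≠ 0 := by
  let F : ℍ → ℂ := fun z => ee z * eta3 z ^ 8
  have hT : F ∣[(12 : ℤ)] ModularGroup.T = F := by
    ext z
    rw [SL_slash_apply, ModularGroup.denom_apply, modular_T_smul]
    have h1 : ee (1 + (z : ℂ)) = ee z := by rw [ee_add, ee_one, one_mul]
    have h2 : eta3 (1 + (z : ℂ)) = eta3 z := by rw [add_comm, eta3_add_one]
    simp [F, h1, h2, ModularGroup.T]
  have hS : F ∣[(12 : ℤ)] ModularGroup.S = F := by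
    ext z
    have h := eta3_pow_S z.2
    have h0 : (z : ℂ) ≠ 0 := z.ne_zero
    rw [SL_slash_apply, UpperHalfPlane.modular_S_smul, ModularGroup.denom_S]
    have e : (-(z : ℂ))⁻¹ = -1 / (z : ℂ) := by field_simp
    have h3 : ee (-1 / (z : ℂ)) * eta3 (-1 / (z : ℂ)) ^ 8 * ((z : ℂ) ^ 12)⁻¹ = ee z * eta3 z ^ 8 := by
      rw [h]; field_simp
    change ee ((-(z : ℂ))⁻¹) * eta3 ((-(z : ℂ))⁻¹) ^ 8 * (z : ℂ) ^ (-12 : ℤ) = ee z * eta3 z ^ 8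
    rw [e, ← h3]
    congr 1
  have hsl := slash_action_generators_SL2Z hS hT
  have hdiff : DifferentiableOn ℂ (fun τ => ee τ * eta3 τ ^ 8) {τ : ℂ | 0 < τ.im} :=
    differentiable_ee.differentiableOn.mul ((gArr_sm.int_mul.2.differentiableOn_left 0).pow 8)
  have hlim : Tendsto (fun z : ℍ => eta3 z) atImInfty (𝓝 1) := by
    have hG : ContinuousAt (fun w : ℂ => ∑' n, eta3Coeff n * w ^ n) 0 :=
      (eta3_discSummable.differentiableOn.differentiableAt
        (Metric.ball_mem_nhds 0 one_pos)).continuousAt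
    have h1 := hG.tendsto.comp tendsto_ee_atImInfty
    rw [tsum_eq_single 0 fun n hn => by simp [hn], eta3Coeff_zero, pow_zero, mul_one] at h1
    exact h1.congr fun z => (hasSum_eta3 z.2).tsum_eq
  have hz : IsZeroAtImInfty F := by
    have h3 := tendsto_ee_atImInfty.mul (hlim.pow 8)
    rw [zero_mul] at h3
    exact h3
  let Fc : CuspForm 𝒮ℒ 12 :=
    { toFun := F
      slash_action_eq' := fun A hA => by
        obtain ⟨A, rfl⟩ := hA
        exact hsl A
      holo' := by
        rw [UpperHalfPlane.mdifferentiable_iff]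
        refine hdiff.congr fun z hz => ?_
        simp [F, ofComplex_apply_of_im_pos hz]
      zero_at_cusps' := fun hc => by
        rw [Subgroup.IsArithmetic.isCusp_iff_isCusp_SL2Z] at hc
        rw [OnePoint.isZeroAt_iff_forall_SL2Z hc]
        intro γ _
        rw [hsl]
        exact hz }
  obtain ⟨c, hc⟩ := CuspForm.exists_smul_discriminant_of_weight_eq_twelve Fc
  have hcz : ∀ z : ℍ, c * ModularForm.discriminant z = ee z * eta3 z ^ 8 := fun z =>
    congrArg (fun f : CuspForm 𝒮ℒ 12 => f z) hc
  have hc0 : c ≠ 0 := by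
    rintro rfl
    refine one_ne_zero (tendsto_nhds_unique hlim (tendsto_const_nhds.congr fun z => ?_))
    have h := hcz z
    rw [zero_mul] at h
    simpa using (pow_eq_zero_iff (by simp)).mp ((mul_eq_zero.mp h.symm).resolve_left (ee_ne_zero _)) |>.symm
  intro h0
  have := hcz ⟨τ, hτ⟩
  have h2 : eta3 ((⟨τ, hτ⟩ : ℍ) : ℂ) = 0 := h0
  rw [h2] at this
  simp only [ne_eq, OfNat.ofNat_ne_zero, not_false_eq_true, zero_pow, mul_zero, mul_eq_zero] at this
  exact this.elim hc0 (ModularForm.discriminant_ne_zero _)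

theorem exists_eta3_reciprocal : ∃ b : ℕ → ℂ, DiscSummable b ∧ b 0 = 1 ∧ (∀ n, ∃ k : ℤ, b n = k) ∧
    ∀ τ : ℂ, 0 < τ.im → eta3 τ * ∑' n, b n * ee τ ^ n = 1 := by
  obtain ⟨b, h1, h2, h3, h4⟩ := exists_reciprocal eta3_discSummable eta3Coeff_zero eta3Coeff_int
    (fun w hw => by
      by_cases h0 : w = 0
      · subst h0
        rw [tsum_eq_single 0 (fun n hn => by simp [hn])]
        simp [eta3Coeff_zero]
      · obtain ⟨τ, hτ, rfl⟩ := exists_ee_eq h0 hw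
        rw [(hasSum_eta3 hτ).tsum_eq]
        exact eta3_ne_zero hτ)
  refine ⟨b, h1, h2, h3, fun τ hτ => ?_⟩
  rw [← (hasSum_eta3 hτ).tsum_eq]
  exact h4 _ (norm_ee_lt_one hτ)

def eta3Inv : ℕ → ℂ := exists_eta3_reciprocal.choose

theorem eta3Inv_disc : DiscSummable eta3Inv := exists_eta3_reciprocal.choose_spec.1

theorem eta3Inv_zero : eta3Inv 0 = 1 := exists_eta3_reciprocal.choose_spec.2.1

theorem eta3Inv_int (n : ℕ) : ∃ k : ℤ, eta3Inv n = k := exists_eta3_reciprocal.choose_spec.2.2.1 n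

theorem JF_eta3Inv (hτ : 0 < τ.im) (z : ℂ) : JF (qArr eta3Inv) τ z = (eta3 τ)⁻¹ := by
  rw [eta3Inv_disc.JF_qArr hτ]
  exact eq_inv_of_mul_eq_one_right (exists_eta3_reciprocal.choose_spec.2.2.2 τ hτ)

theorem JF_eta3Coeff (hτ : 0 < τ.im) (z : ℂ) : JF (qArr eta3Coeff) τ z = eta3 τ := by
  rw [eta3_discSummable.JF_qArr hτ, (hasSum_eta3 hτ).tsum_eq]

theorem qArr_int {a : ℕ → ℂ} (h : ∀ n, ∃ k : ℤ, a n = k) : IntArr (qArr a) := by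
  intro p
  unfold qArr
  split_ifs
  · exact h _
  · exact ⟨0, by simp⟩

theorem qArr_leadTerm {a : ℕ → ℂ} (h : a 0 = 1) : LeadTerm (qArr a) 0 0 := by
  refine ⟨qArr_low a, fun r hr => ?_, by simp [qArr, h], by simp [qArr, h]⟩
  have : r ≠ 0 := by rintro rfl; simp at hr
  simp [qArr, this]

/-- Level-one weakly holomorphic forms as index-zero arrays. -/
theorem WJ.of_qArr {a : ℕ → ℂ} (h : DiscSummable a)
    (hS : ∀ τ : ℂ, 0 < τ.im → ∑' n, a n * ee (-1 / τ) ^ n = τ ^ k * ∑' n, a n * ee τ ^ n) :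
    WJ k 0 (qArr a) where
  ell n r l := by
    simp only [qArr]
    by_cases hr : r = 0
    · subst hr; simp
    · simp [hr]
  even n r := by simp [qArr]
  low := ⟨0, qArr_low a⟩
  sm := h.sm
  slaw τ z hτ := by
    rw [h.JF_qArr hτ, h.JF_qArr (im_neg_one_div_pos hτ), hS τ hτ]
    simp [ee_zero]

/-- Multiplication by `q^s y^t`. -/
def shiftArr (s t : ℤ) (c : Arr) (p : ℤ × ℤ) : ℂ := c (p.1 - s, p.2 - t)

theorem hasSum_shiftArr {s t : ℤ} (h : SmAt c τ z) :
    HasSum (fun p => shiftArr s t c p * chr τ z p) (ee (s * τ + t * z) * JF c τ z) := by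
  let e : ℤ × ℤ ≃ ℤ × ℤ := Equiv.addRight (s, t)
  rw [← e.hasSum_iff]
  refine (h.hasSum.mul_left (ee (s * τ + t * z))).congr_fun fun p => ?_
  have e1 : e p = p + (s, t) := rfl
  have e2 : shiftArr s t c (p + (s, t)) = c p := by simp [shiftArr]
  simp only [Function.comp, e1, e2, chr_add]
  simp only [chr]; ring

theorem JF_shiftArr {s t : ℤ} (h : SmAt c τ z) :
    JF (shiftArr s t c) τ z = ee (s * τ + t * z) * JF c τ z := (hasSum_shiftArr h).tsum_eq

theorem Sm.shiftArr {s t : ℤ} (h : Sm c) : Sm (shiftArr s t c) :=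
  fun τ z hτ => (hasSum_shiftArr (h τ z hτ)).summable

theorem IntArr.shiftArr {s t : ℤ} (h : IntArr c) : IntArr (shiftArr s t c) := fun _ => h _

/-- The discriminant `Δ = q eta3^8`. -/
def dltArr : Arr := shiftArr 1 0 (convPow (qArr eta3Coeff) 8)

/-- The reciprocal of the discriminant. -/
def dltInv : Arr := shiftArr (-1) 0 (convPow (qArr eta3Inv) 8)

theorem JF_dltArr (hτ : 0 < τ.im) (z : ℂ) : JF dltArr τ z = ee τ * eta3 τ ^ 8 := by
  rw [dltArr, JF_shiftArr (eta3_discSummable.sm.convPow 8 _ _ hτ), JF_convPow eta3_discSummable.sm 8 hτ,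
    JF_eta3Coeff hτ]
  simp

theorem JF_dltInv (hτ : 0 < τ.im) (z : ℂ) : JF dltInv τ z = (ee τ * eta3 τ ^ 8)⁻¹ := by
  rw [dltInv, JF_shiftArr (eta3Inv_disc.sm.convPow 8 _ _ hτ), JF_convPow eta3Inv_disc.sm 8 hτ,
    JF_eta3Inv hτ]
  simp [ee_neg, mul_comm]

theorem LeadTerm.shift {n s : ℤ} {i : ℕ} (h : LeadTerm c n i) :
    LeadTerm (shiftArr s 0 c) (n + s) i where
  low n' r h' := h.low _ _ (by simp; omega)
  out r hr := by simpa [shiftArr] using h.out r hr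
  pos := by simpa [shiftArr] using h.pos
  neg := by simpa [shiftArr] using h.neg

theorem dltArr_lead : LeadTerm dltArr 1 0 := by
  simpa [dltArr] using ((qArr_leadTerm eta3Coeff_zero).convPow 8).shift (s := 1)

theorem dltInv_lead : LeadTerm dltInv (-1) 0 := by
  simpa [dltInv] using ((qArr_leadTerm eta3Inv_zero).convPow 8).shift (s := -1)

theorem dltInv_int : IntArr dltInv := ((qArr_int eta3Inv_int).convPow 8).shiftArr

theorem dltArr_sm : Sm dltArr := (eta3_discSummable.sm.convPow 8).shiftArr

theorem dltInv_sm : Sm dltInv := (eta3Inv_disc.sm.convPow 8).shiftArr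

theorem WJ.of_index_zero (hsm : Sm c) (hl : ∃ N, LowAt N c)
    (f : ℂ → ℂ) (hf : ∀ τ z : ℂ, 0 < τ.im → JF c τ z = f τ)
    (hS : ∀ τ : ℂ, 0 < τ.im → f (-1 / τ) = τ ^ k * f τ) : WJ k 0 c where
  ell := ell_of_JF hsm fun τ z hτ l => by simp [hf _ _ hτ, ee_zero]
  even := even_of_JF hsm fun τ z hτ => by simp [hf _ _ hτ]
  low := hl
  sm := hsm
  slaw τ z hτ := by rw [hf _ _ hτ, hf _ _ (im_neg_one_div_pos hτ), hS τ hτ]; simp [ee_zero]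

theorem dltArr_wj : WJ 12 0 dltArr :=
  WJ.of_index_zero dltArr_sm ⟨_, dltArr_lead.low⟩ _ (fun _ z hτ => JF_dltArr hτ z) fun τ hτ => by
    rw [eta3_pow_S hτ]; norm_cast

theorem dltInv_wj : WJ (-12) 0 dltInv :=
  WJ.of_index_zero dltInv_sm ⟨_, dltInv_lead.low⟩ _ (fun _ z hτ => JF_dltInv hτ z) fun τ hτ => by
    rw [eta3_pow_S hτ, mul_inv, zpow_neg]; norm_cast

/-! ### Eisenstein series -/

open ArithmeticFunction in
/-- The coefficients `1 + A ∑ σ_k(n) q^n`. -/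
def eisCoeff (A : ℂ) (k n : ℕ) : ℂ := if n = 0 then 1 else A * (sigma k n : ℕ)

open UpperHalfPlane ModularForm EisensteinSeries SlashInvariantForm MatrixGroups in
theorem hasSum_eis {k : ℕ} (hk : 3 ≤ k) (hk2 : Even k) {A : ℂ}
    (hA : A = -(2 * k / bernoulli k : ℂ)) (z : ℍ) :
    HasSum (fun n => eisCoeff A (k - 1) n * ee z ^ n) (E hk z) := by
  have := ModularForm.hasSum_qExpansion (f := E hk) (h := 1) one_pos one_mem_strictPeriods_SL z
  refine this.congr_fun fun n => ?_
  rw [E_qExpansion_coeff hk hk2, eisCoeff, hA]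
  congr 1
  simp [Function.Periodic.qParam, ee]

open UpperHalfPlane ModularForm EisensteinSeries SlashInvariantForm MatrixGroups in
theorem eis_S {k : ℕ} (hk : 3 ≤ k) {z z' : ℍ} (h : (z' : ℂ) = -1 / z) :
    E hk z' = (z : ℂ) ^ (k : ℤ) * E hk z := by
  have h0 : (E hk : ℍ → ℂ) ∣[(k : ℤ)] ModularGroup.S = E hk := (E hk).slash_action_eq' _ ⟨ModularGroup.S, rfl⟩
  have h1 := congrFun h0 z
  rw [SL_slash_apply] at h1
  have e : ModularGroup.S • z = z' := by
    ext
    rw [UpperHalfPlane.modular_S_smul, h]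
    simp [neg_div, one_div]
  rw [e, ModularGroup.denom_S] at h1
  have hz : (z : ℂ) ≠ 0 := z.ne_zero
  have hz2 : (z : ℂ) ^ (k : ℤ) ≠ 0 := zpow_ne_zero _ hz
  rw [← h1, zpow_neg]
  field_simp

open UpperHalfPlane in
theorem eis_wj {k : ℕ} (hk : 3 ≤ k) (hk2 : Even k) {A : ℂ} (hA : A = -(2 * k / bernoulli k : ℂ)) :
    DiscSummable (eisCoeff A (k - 1)) ∧ WJ k 0 (qArr (eisCoeff A (k - 1))) := by
  have hd : DiscSummable (eisCoeff A (k - 1)) := discSummable_of_upper fun τ hτ =>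
    (hasSum_eis hk hk2 hA ⟨τ, hτ⟩).summable
  refine ⟨hd, WJ.of_qArr hd fun τ hτ => ?_⟩
  have h1 := (hasSum_eis hk hk2 hA ⟨τ, hτ⟩).tsum_eq
  have h2 := (hasSum_eis hk hk2 hA ⟨-1 / τ, im_neg_one_div_pos hτ⟩).tsum_eq
  have h3 := eis_S hk (z := ⟨τ, hτ⟩) (z' := ⟨-1 / τ, im_neg_one_div_pos hτ⟩) rfl
  calc _ = _ := h2
    _ = _ := h3
    _ = _ := by rw [← h1]

def e4Arr : Arr := qArr (eisCoeff 240 3)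

def e6Arr : Arr := qArr (eisCoeff (-504) 5)

theorem e4Arr_wj : WJ 4 0 e4Arr :=
  (eis_wj (k := 4) (by norm_num) ⟨2, rfl⟩
    (by norm_num [show bernoulli 4 = -1 / 30 by decide +kernel])).2

theorem e6Arr_wj : WJ 6 0 e6Arr :=
  (eis_wj (k := 6) (by norm_num) ⟨3, rfl⟩
    (by norm_num [show bernoulli 6 = 1 / 42 by decide +kernel])).2

theorem e4Arr_lead : LeadTerm e4Arr 0 0 := qArr_leadTerm (by simp [eisCoeff])

theorem e6Arr_lead : LeadTerm e6Arr 0 0 := qArr_leadTerm (by simp [eisCoeff])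

theorem eisCoeff_int (A : ℤ) (k n : ℕ) : ∃ j : ℤ, eisCoeff A k n = j := by
  unfold eisCoeff
  split_ifs
  · exact ⟨1, by simp⟩
  · exact ⟨A * (ArithmeticFunction.sigma k n : ℕ), by push_cast; rfl⟩

theorem e4Arr_int : IntArr e4Arr := qArr_int fun n => by simpa using eisCoeff_int 240 3 n

theorem e6Arr_int : IntArr e6Arr := qArr_int fun n => by simpa using eisCoeff_int (-504) 5 n

/-! ### The form of weight `-2` and index `1` -/

/-- `A = θ₁² / η⁶`. -/
def aArr : Arr := conv (shiftArr 0 1 (conv gArr gArr)) (convPow (qArr eta3Inv) 2)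

theorem aArr_sm : Sm aArr := (gArr_sm.conv gArr_sm).shiftArr.conv (eta3Inv_disc.sm.convPow 2)

theorem JF_aArr (hτ : 0 < τ.im) (z : ℂ) :
    JF aArr τ z = (theta1 τ z / (ee (τ / 8) * eta3 τ)) ^ 2 := by
  have h1 := gArr_sm τ z hτ
  rw [aArr, JF_conv ((gArr_sm.conv gArr_sm).shiftArr _ _ hτ) (eta3Inv_disc.sm.convPow 2 _ _ hτ),
    JF_shiftArr (h1.conv h1), JF_conv h1 h1, JF_convPow eta3Inv_disc.sm 2 hτ, JF_eta3Inv hτ, theta1]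
  have h2 : ee (τ / 8 + z / 2) = ee (τ / 8) * ee (z / 2) := ee_add _ _
  have h3 : ee ((0 : ℤ) * τ + (1 : ℤ) * z) = ee (z / 2) ^ 2 := by
    rw [← ee_nat_mul]; congr 1; push_cast; ring
  rw [h2, h3]
  have h4 := ee_ne_zero (τ / 8)
  have h5 := eta3_ne_zero hτ
  field_simp

theorem theta1_neg (τ z : ℂ) : theta1 τ (-z) = -theta1 τ z := by
  unfold theta1
  rw [JF_gArr_neg, show τ / 8 + -z / 2 = τ / 8 + z / 2 - z by ring, ee_sub]
  have := ee_ne_zero z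
  field_simp

theorem theta1_shift (hτ : 0 < τ.im) (z : ℂ) :
    theta1 τ (z + τ) = -(ee (-(τ / 2 + z)) * theta1 τ z) := by
  unfold theta1
  rw [JF_gArr hτ, JF_gArr hτ, show z + τ + τ / 2 + 1 / 2 = (z + τ / 2 + 1 / 2) + τ by ring,
    jacobiTheta₂_add_left']
  have e : cexp (-(π : ℂ) * I * (τ + 2 * (z + τ / 2 + 1 / 2))) = ee (-(τ + z + 1 / 2)) := by
    unfold ee; congr 1; ring
  rw [e, ← mul_assoc, ← ee_add, ← mul_assoc, ← ee_add, ← neg_mul]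
  congr 1
  have : τ / 8 + (z + τ) / 2 + -(τ + z + 1 / 2) = (-(τ / 2 + z) + (τ / 8 + z / 2)) - 1 / 2 := by ring
  rw [this, ee_sub, ee_half]; ring

theorem aArr_ell : Ell 1 aArr := by
  have step : ∀ τ : ℂ, 0 < τ.im → ∀ z : ℂ, JF aArr τ (z + τ) = ee (-(τ + 2 * z)) * JF aArr τ z := by
    intro τ hτ z
    rw [JF_aArr hτ, JF_aArr hτ, theta1_shift hτ]
    have : ee (-(τ + 2 * z)) = ee (-(τ / 2 + z)) ^ 2 := by
      rw [← ee_nat_mul]; congr 1; push_cast; ring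
    rw [this]; ring
  refine ell_of_JF aArr_sm fun τ z hτ l => ?_
  have key (l : ℤ) : ee (((l + 1 : ℤ) : ℂ) ^ 2 * τ + 2 * (l + 1 : ℤ) * z) * JF aArr τ (z + (l + 1 : ℤ) * τ) =
      ee (l ^ 2 * τ + 2 * l * z) * JF aArr τ (z + l * τ) := by
    rw [show z + ((l + 1 : ℤ) : ℂ) * τ = z + l * τ + τ by push_cast; ring, step τ hτ, ← mul_assoc,
      ← ee_add]
    congr 2; push_cast; ring
  have h : ee (l ^ 2 * τ + 2 * l * z) * JF aArr τ (z + l * τ) = JF aArr τ z := by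
    induction l using Int.induction_on with
    | zero => simp [ee_zero]
    | succ i ih => exact (key _).trans ih
    | pred i ih => rw [← ih, ← key, sub_add_cancel]
  rw [← h, Nat.cast_one, neg_one_mul, ee_neg, inv_mul_cancel_left₀ (ee_ne_zero _)]

theorem shiftArr_gArr_low : LowAt 0 (shiftArr 0 1 (conv gArr gArr)) := fun n r h => by
  simpa [shiftArr] using (conv_low gArr_low gArr_low) n (r - 1) (by simpa using h)

theorem aArr_low : LowAt 0 aArr :=
  conv_low shiftArr_gArr_low (by simpa using ((qArr_leadTerm eta3Inv_zero).convPow 2).low)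

theorem aArr_int : IntArr aArr :=
  (gArr_int.conv gArr_int).shiftArr.conv ((qArr_int eta3Inv_int).convPow 2)

theorem aArr_wj : WJ (-2) 1 aArr where
  ell := aArr_ell
  even := even_of_JF aArr_sm fun τ z hτ => by rw [JF_aArr hτ, JF_aArr hτ, theta1_neg]; ring
  low := ⟨0, aArr_low⟩
  sm := aArr_sm
  slaw τ z hτ := by
    have h0 := ne_zero_of_im_pos hτ
    rw [JF_aArr hτ, JF_aArr (im_neg_one_div_pos hτ), theta1_S hτ, eta3_S hτ]
    have h1 : ee (((1 : ℕ) : ℂ) * z ^ 2 / τ) = ee (z ^ 2 / (2 * τ)) ^ 2 := by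
      rw [← ee_nat_mul]; congr 1; push_cast; field_simp
    have h2 : thetaFactor τ ≠ 0 := by
      intro h
      have := thetaFactor_sq τ
      rw [h] at this
      simp [h0] at this
    have h4 := ee_ne_zero (τ / 8)
    have h5 := eta3_ne_zero hτ
    rw [h1, show (-2 : ℤ) = -((2 : ℕ) : ℤ) by norm_num, zpow_neg, zpow_natCast]
    field_simp

theorem conv_eq_of_leadTerm_zero {c u : Arr} (hc : LowAt 0 c) (hu : LeadTerm u 0 0) (r : ℤ) :
    conv c u (0, r) = c (0, r) := by
  unfold conv
  rw [tsum_eq_single (0, r)]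
  · have := hu.pos
    simp only [sub_self]
    rw [show ((0 : ℤ × ℤ)) = (0, ((0 : ℕ) : ℤ)) from rfl, this, mul_one]
  · rintro ⟨n, s⟩ h
    rcases lt_trichotomy n 0 with hn | hn | hn
    · rw [hc _ _ hn, zero_mul]
    · subst hn
      have hs : s ≠ r := fun e => h (by rw [e])
      have : u ((0, r) - (0, s)) = 0 := hu.out _ (by simpa [sub_eq_zero] using fun e : r = s => hs e.symm)
      rw [this, mul_zero]
    · have : u ((0, r) - (n, s)) = 0 := hu.low _ _ (by simpa using hn)
      rw [this, mul_zero]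

theorem gArr_zero_row (r : ℤ) : gArr (0, r) = if r = 0 then 1 else if r = -1 then -1 else 0 := by
  unfold gArr
  by_cases h0 : r = 0
  · simp [h0, ee_zero]
  · by_cases h1 : r = -1
    · subst h1
      simp
      rw [neg_div, ee_neg, ee_half]; norm_num
    · have : ¬ (2 * (0 : ℤ) = r * (r + 1)) := by
        intro h
        have : r * (r + 1) = 0 := by rw [← h]; simp
        rcases mul_eq_zero.mp this with h2 | h2
        · exact h0 h2
        · exact h1 (by omega)
      simp only [this, h0, h1, if_false]

theorem aArr_zero_row (r : ℤ) : aArr (0, r) = gArr (0, r - 1) - gArr (0, r) := by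
  rw [aArr, conv_eq_of_leadTerm_zero shiftArr_gArr_low (by simpa using (qArr_leadTerm eta3Inv_zero).convPow 2)]
  simp only [shiftArr, sub_zero, conv]
  rw [tsum_eq_sum (s := {((0 : ℤ), (0 : ℤ)), ((0 : ℤ), (-1 : ℤ))})]
  · rw [sum_pair (by simp)]
    have e1 : gArr (0, 0) = 1 := by rw [gArr_zero_row]; simp
    have e2 : gArr (0, -1) = -1 := by rw [gArr_zero_row]; simp
    have e3 : ((0, r - 1) - (0, 0) : ℤ × ℤ) = (0, r - 1) := by simp
    have e4 : ((0, r - 1) - (0, -1) : ℤ × ℤ) = (0, r) := by simp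
    rw [e1, e2, e3, e4]; ring
  · rintro ⟨n, s⟩ hx
    rcases lt_trichotomy n 0 with hn | hn | hn
    · rw [gArr_low _ _ hn, zero_mul]
    · subst hn
      simp at hx
      simp [gArr_zero_row s, hx]
    · have : gArr ((0, r - 1) - (n, s)) = 0 := gArr_low _ _ (by simpa using hn)
      rw [this, mul_zero]

theorem aArr_lead : LeadTerm aArr 0 1 where
  low := aArr_low
  out r hr := by
    rw [aArr_zero_row, gArr_zero_row, gArr_zero_row]
    rcases lt_abs.mp hr with h | h <;> split_ifs <;> first | (exfalso; omega) | simp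
  pos := by rw [aArr_zero_row, gArr_zero_row, gArr_zero_row]; simp
  neg := by rw [aArr_zero_row, gArr_zero_row, gArr_zero_row]; norm_num

/-- `A(τ,z) = (2πiz)² (1 + o(1))` at `z = 0`. -/
theorem aArr_tendsto (hτ : 0 < τ.im) :
    Tendsto (fun z => JF aArr τ z / (ϖ * z) ^ 2) (𝓝[≠] 0) (𝓝 1) := by
  have h := (theta1_hasDerivAt_zero hτ).tendsto_slope_zero
  have h4 := ee_ne_zero (τ / 8)
  have h5 := eta3_ne_zero hτ
  have hpi := two_pi_I_ne_zero
  have h2 := (h.div_const (ϖ * (ee (τ / 8) * eta3 τ))).pow 2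
  rw [div_self (by simp [h4, h5]), one_pow] at h2
  refine h2.congr' ?_
  filter_upwards [self_mem_nhdsWithin] with z hz
  have hz : z ≠ 0 := hz
  have ht0 : theta1 τ 0 = 0 := by simp [theta1, JF_gArr_zero]
  rw [JF_aArr hτ, zero_add, ht0, sub_zero, smul_eq_mul]
  field_simp

/-! ### Lambert series -/

theorem summable_lambert_nat {Q Y : ℝ} (hQ0 : 0 < Q) (hQ1 : Q < 1) (hY : 0 < Y) :
    Summable fun n : ℕ => Q ^ n * Y / (1 - Q ^ n * Y) ^ 2 := by
  have ht : Tendsto (fun n : ℕ => Q ^ n * Y) atTop (𝓝 0) := by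
    simpa using (tendsto_pow_atTop_nhds_zero_of_lt_one hQ0.le hQ1).mul_const Y
  refine Summable.of_norm_bounded_eventually_nat (g := fun n => 4 * (Q ^ n * Y))
    (((summable_geometric_of_lt_one hQ0.le hQ1).mul_right Y).mul_left 4) ?_
  filter_upwards [ht.eventually (gt_mem_nhds (by norm_num : (0 : ℝ) < 1 / 2))] with n hn
  have h0 : 0 < Q ^ n * Y := by positivity
  rw [Real.norm_of_nonneg (by positivity), div_le_iff₀ (by nlinarith)]
  have : 1 / 4 ≤ (1 - Q ^ n * Y) ^ 2 := by nlinarith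
  nlinarith

theorem lambert_inv (W : ℝ) : W⁻¹ / (1 - W⁻¹) ^ 2 = W / (1 - W) ^ 2 := by
  by_cases h : W = 0
  · simp [h]
  by_cases h1 : W = 1
  · simp [h1]
  have : (1 : ℝ) - W ≠ 0 := fun e => h1 (by linarith)
  have h2 : (W : ℝ) - 1 ≠ 0 := fun e => h1 (by linarith)
  have h3 : (1 - W⁻¹) = (W - 1) / W := by field_simp
  rw [h3]
  field_simp
  ring

theorem summable_lambert {Q Y : ℝ} (hQ0 : 0 < Q) (hQ1 : Q < 1) (hY : 0 < Y) :
    Summable fun s : ℤ => Q ^ s * Y / (1 - Q ^ s * Y) ^ 2 := by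
  refine Summable.of_nat_of_neg (by simpa using summable_lambert_nat hQ0 hQ1 hY) ?_
  refine (summable_lambert_nat hQ0 hQ1 (inv_pos.mpr hY)).congr fun n => ?_
  rw [← lambert_inv (Q ^ n * Y⁻¹), mul_inv, inv_inv]
  simp

/-- The summand `w/(1-w)²` at `w = ee x`. -/
def lam (x : ℂ) : ℂ := ee x / (1 - ee x) ^ 2

theorem norm_lam_le {x : ℂ} (h : ‖ee x‖ ≠ 1) : ‖lam x‖ ≤ ‖ee x‖ / (1 - ‖ee x‖) ^ 2 := by
  unfold lam
  rw [norm_div, norm_pow]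
  have h1 : |1 - ‖ee x‖| ≤ ‖1 - ee x‖ := by
    have := abs_norm_sub_norm_le (1 : ℂ) (ee x); simpa using this
  have h2 : (1 - ‖ee x‖) ^ 2 ≤ ‖1 - ee x‖ ^ 2 := by rw [← sq_abs]; gcongr
  have h3 : 0 < (1 - ‖ee x‖) ^ 2 := by
    have : 1 - ‖ee x‖ ≠ 0 := fun e => h (by linarith)
    positivity
  gcongr

theorem lam_neg (x : ℂ) : lam (-x) = lam x := by
  unfold lam
  rw [ee_neg]
  by_cases h1 : ee x = 1
  · simp [h1]
  have h := ee_ne_zero x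
  have : (1 : ℂ) - ee x ≠ 0 := fun e => h1 (by linear_combination -e)
  have h2 : (ee x : ℂ) - 1 ≠ 0 := fun e => h1 (by linear_combination e)
  have h3 : (1 - (ee x)⁻¹) = (ee x - 1) / ee x := by field_simp
  rw [h3]
  field_simp
  ring

theorem norm_ee_shift (τ z : ℂ) (s : ℤ) : ‖ee (s * τ + z)‖ = ‖ee τ‖ ^ s * ‖ee z‖ := by
  rw [ee_add, ee_int_mul, norm_mul, norm_zpow]

/-- Only finitely many `s` have `|q^s y| = 1`. -/
theorem eventually_norm_ee_ne_one (hτ : 0 < τ.im) (z : ℂ) :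
    ∀ᶠ s : ℤ in cofinite, ‖ee (s * τ + z)‖ ≠ 1 := by
  have : {s : ℤ | ‖ee (s * τ + z)‖ = 1}.Subsingleton := by
    intro s hs t ht
    simp only [Set.mem_ofPred_eq, norm_ee, Real.exp_eq_one_iff] at hs ht
    have hpi := Real.pi_pos
    have e1 : ((s : ℂ) * τ + z).im = 0 := by
      by_contra h; exact (mul_ne_zero (by positivity : 2 * π ≠ 0) h) (by linarith)
    have e2 : ((t : ℂ) * τ + z).im = 0 := by
      by_contra h; exact (mul_ne_zero (by positivity : 2 * π ≠ 0) h) (by linarith)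
    simp at e1 e2
    have : ((s : ℝ) - t) * τ.im = 0 := by linarith
    rcases mul_eq_zero.mp this with h | h
    · have : (s : ℝ) = t := by linarith
      exact_mod_cast this
    · linarith
  rw [Filter.eventually_cofinite]
  simpa using this.finite

theorem summable_lambert_ee (hτ : 0 < τ.im) (z : ℂ) :
    Summable fun s : ℤ => ‖ee (s * τ + z)‖ / (1 - ‖ee (s * τ + z)‖) ^ 2 := by
  simp only [norm_ee_shift]
  exact summable_lambert (norm_pos_iff.mpr (ee_ne_zero _)) (norm_ee_lt_one hτ)
    (norm_pos_iff.mpr (ee_ne_zero _))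

/-- `P(τ,z) = ∑ q^s y / (1 - q^s y)²`. -/
def wpSum (τ z : ℂ) : ℂ := ∑' s : ℤ, lam (s * τ + z)

theorem summable_wpSum (hτ : 0 < τ.im) (z : ℂ) : Summable fun s : ℤ => lam (s * τ + z) := by
  refine Summable.of_norm_bounded_eventually (summable_lambert_ee hτ z) ?_
  filter_upwards [eventually_norm_ee_ne_one hτ z] with s hs using norm_lam_le hs

theorem wpSum_neg (τ z : ℂ) : wpSum τ (-z) = wpSum τ z := by
  unfold wpSum
  rw [← (Equiv.neg ℤ).tsum_eq]
  congr 1; ext s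
  rw [← lam_neg]
  congr 1
  simp only [Equiv.neg_apply]
  push_cast
  ring

theorem wpSum_shift (τ z : ℂ) (l k : ℤ) : wpSum τ (z + l * τ + k) = wpSum τ z := by
  unfold wpSum
  rw [← (Equiv.addRight l).tsum_eq (fun s : ℤ => lam (s * τ + z))]
  congr 1; ext s
  unfold lam
  have : ee (s * τ + (z + l * τ + k)) = ee (((Equiv.addRight l) s : ℤ) * τ + z) := by
    have e : (s : ℂ) * τ + (z + l * τ + k) = ((s + l : ℤ) * τ + z) + k := by push_cast; ring
    rw [e, ee_add_int]
    rfl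
  rw [this]

theorem wpSum_add_one_left (τ z : ℂ) : wpSum (τ + 1) z = wpSum τ z := by
  unfold wpSum lam
  congr 1; ext s
  have : ee (s * (τ + 1) + z) = ee (s * τ + z) := by rw [← ee_add_int (s * τ + z) s]; ring_nf
  rw [this]

/-- The array of `∑_{s ≥ 1} q^s y / (1 - q^s y)²`. -/
def ppArr (p : ℤ × ℤ) : ℂ := if 1 ≤ p.1 ∧ 1 ≤ p.2 ∧ p.2 ∣ p.1 then p.2 else 0

theorem hasSum_ppArr (hτ : 0 < τ.im) (hz : -τ.im < z.im) :
    HasSum (fun p => ppArr p * chr τ z p) (∑' s : ℕ, lam ((s + 1 : ℕ) * τ + z)) := by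
  have hW : ∀ s : ℕ, ‖ee ((s + 1 : ℕ) * τ + z)‖ < 1 := by
    intro s
    apply norm_ee_lt_one
    have : (0 : ℝ) ≤ s * τ.im := by positivity
    simp; nlinarith
  let F : ℕ × ℕ → ℂ := fun x => ((x.2 + 1 : ℕ) : ℂ) * ee ((x.1 + 1 : ℕ) * τ + z) ^ (x.2 + 1)
  have hinner : ∀ s : ℕ, HasSum (fun k => F (s, k)) (lam ((s + 1 : ℕ) * τ + z)) := by
    intro s
    have h := hasSum_coe_mul_geometric_of_norm_lt_one (hW s)
    rw [← hasSum_nat_add_iff' 1] at h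
    simpa [F, lam] using h
  have hinner' : ∀ s : ℕ, HasSum (fun k => ‖F (s, k)‖)
      (‖ee ((s + 1 : ℕ) * τ + z)‖ / (1 - ‖ee ((s + 1 : ℕ) * τ + z)‖) ^ 2) := by
    intro s
    have h := hasSum_coe_mul_geometric_of_norm_lt_one (r := ‖ee ((s + 1 : ℕ) * τ + z)‖)
      (by simpa using hW s)
    rw [← hasSum_nat_add_iff' 1] at h
    have e : ∀ k : ℕ, ‖F (s, k)‖ = ((k + 1 : ℕ) : ℝ) * ‖ee ((s + 1 : ℕ) * τ + z)‖ ^ (k + 1) := by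
      intro k
      simp only [F]
      rw [norm_mul, norm_pow, norm_natCast]
    simp only [e]
    simpa using h
  have hsum : Summable F := by
    apply Summable.of_norm
    rw [summable_prod_of_nonneg fun _ => norm_nonneg _]
    refine ⟨fun s => (hinner' s).summable, ?_⟩
    simp only [fun s => (hinner' s).tsum_eq]
    have := (summable_lambert_ee hτ z).comp_injective
      (i := fun s : ℕ => ((s + 1 : ℕ) : ℤ)) (fun a b h => by simpa using h)
    refine this.congr fun s => ?_
    simp
  have hF := hsum.hasSum.prod_fiberwise hinner
  have hF' : HasSum F (∑' s : ℕ, lam ((s + 1 : ℕ) * τ + z)) := by rw [hF.tsum_eq]; exact hsum.hasSum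
  have hi : Function.Injective (fun x : ℕ × ℕ => (((x.1 + 1) * (x.2 + 1) : ℤ), (x.2 + 1 : ℤ))) := by
    rintro ⟨a, b⟩ ⟨c, d⟩ h
    simp only [Prod.mk.injEq] at h
    obtain ⟨h1, h2⟩ := h
    have hbd : b = d := by omega
    subst hbd
    have : (a + 1 : ℤ) = c + 1 := mul_right_cancel₀ (by positivity) h1
    ext <;> simp; omega
  rw [← hi.hasSum_iff]
  · refine hF'.congr_fun fun x => ?_
    have hc : (1 : ℤ) ≤ (x.1 + 1) * (x.2 + 1) ∧ (1 : ℤ) ≤ x.2 + 1 ∧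
        (x.2 + 1 : ℤ) ∣ (x.1 + 1) * (x.2 + 1) :=
      ⟨by nlinarith [Int.natCast_nonneg x.1, Int.natCast_nonneg x.2], by omega, dvd_mul_left _ _⟩
    simp only [Function.comp, ppArr, hc, chr, F]
    rw [← ee_nat_mul]
    push_cast
    simp
    left; ring_nf
  · rintro ⟨n, r⟩ h
    have : ¬ (1 ≤ n ∧ 1 ≤ r ∧ r ∣ n) := by
      rintro ⟨h1, h2, k, rfl⟩
      have hk : 0 < k := by by_contra hk; nlinarith
      refine h ⟨((k - 1).toNat, (r - 1).toNat), ?_⟩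
      ext
      · simp only
        rw [Int.toNat_of_nonneg (by omega), Int.toNat_of_nonneg (by omega)]; ring
      · simp only
        rw [Int.toNat_of_nonneg (by omega)]; ring
    simp [ppArr, this]

theorem ppArr_smAt (hτ : 0 < τ.im) (hz : -τ.im < z.im) : SmAt ppArr τ z :=
  (hasSum_ppArr hτ hz).summable

theorem wpSum_eq (hτ : 0 < τ.im) (hz : |z.im| < τ.im) :
    wpSum τ z = lam z + JF ppArr τ z + JF ppArr τ (-z) := by
  rw [abs_lt] at hz
  have h1 := (hasSum_ppArr hτ hz.1).tsum_eq
  have h2 := (hasSum_ppArr (z := -z) hτ (by simp; linarith)).tsum_eq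
  have hs := summable_wpSum hτ z
  have hsn : Summable fun s : ℕ => lam ((s + 1 : ℕ) * τ + z) := by
    refine (hs.comp_injective (i := fun s : ℕ => ((s + 1 : ℕ) : ℤ))
      (fun a b h => by simpa using h)).congr fun s => ?_
    simp
  have e : ∀ s : ℕ, lam ((-(s + 1 : ℕ) : ℤ) * τ + z) = lam ((s + 1 : ℕ) * τ + -z) := by
    intro s
    rw [← lam_neg]; congr 1; push_cast; ring
  have hsm : Summable fun s : ℕ => lam ((s + 1 : ℕ) * τ + -z) := by
    have := hs.comp_injective (i := fun s : ℕ => (-(s + 1 : ℕ) : ℤ)) (fun a b h => by simpa using h)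
    refine this.congr fun s => ?_
    simp only [Function.comp]
    exact e s
  have := HasSum.of_nat_of_neg_add_one (f := fun s : ℤ => lam (s * τ + z))
    (m := lam z + ∑' s : ℕ, lam ((s + 1 : ℕ) * τ + z)) (m' := ∑' s : ℕ, lam ((s + 1 : ℕ) * τ + -z))
    (by
      rw [add_comm, ← hasSum_nat_add_iff' 1]
      simpa using hsn.hasSum)
    (by
      refine hsm.hasSum.congr_fun fun s => ?_
      have := e s
      push_cast at this ⊢
      exact this)
  rw [wpSum, this.tsum_eq, JF, JF, h1, h2]

/-! ### The expansion at `z = 0` -/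

theorem exp_third_order : ∃ E : ℂ → ℂ, AnalyticAt ℂ E 0 ∧ E 0 = 1 / 6 ∧
    ∀ u : ℂ, ‖u‖ < 1 → exp u = 1 + u + u ^ 2 / 2 + u ^ 3 * E u := by
  have key : ∀ u : ℂ, HasSum (fun n : ℕ => u ^ 3 * (((n + 3).factorial : ℂ)⁻¹ * u ^ n))
      (exp u - (1 + u + u ^ 2 / 2)) := by
    intro u
    have h := NormedSpace.expSeries_div_hasSum_exp (𝔸 := ℂ) u
    rw [← exp_eq_exp_ℂ, ← hasSum_nat_add_iff' 3] at h
    simp only [Finset.sum_range_succ, Finset.sum_range_zero] at h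
    have e : exp u - (1 + u + u ^ 2 / 2) = exp u - (0 + u ^ 0 / (Nat.factorial 0 : ℂ) +
        u ^ 1 / (Nat.factorial 1 : ℂ) + u ^ 2 / (Nat.factorial 2 : ℂ)) := by
      norm_num [Nat.factorial]
    rw [e]
    refine h.congr_fun fun n => ?_
    rw [pow_add]; ring
  have hd : DiscSummable fun n : ℕ => ((n + 3).factorial : ℂ)⁻¹ := by
    intro w hw
    by_cases h0 : w = 0
    · subst h0
      exact summable_of_ne_finset_zero (s := {0}) fun n hn => by simp at hn; simp [hn]
    · have := (key w).summable
      exact (summable_mul_left_iff (pow_ne_zero 3 h0)).mp this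
  refine ⟨fun u => ∑' n : ℕ, ((n + 3).factorial : ℂ)⁻¹ * u ^ n, ?_, ?_, ?_⟩
  · exact hd.differentiableOn.analyticAt (Metric.ball_mem_nhds 0 one_pos)
  · change ∑' n : ℕ, ((n + 3).factorial : ℂ)⁻¹ * 0 ^ n = 1 / 6
    rw [tsum_eq_single 0 (fun n hn => by simp [hn])]
    norm_num [Nat.factorial]
  · intro u _
    have := (key u).tsum_eq
    rw [tsum_mul_left] at this
    rw [this]; ring

/-- `y/(1-y)² - (2πiz)⁻²` extends analytically to `z = 0` with value `-1/12`. -/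
theorem lam_expansion : ∃ g : ℂ → ℂ, AnalyticAt ℂ g 0 ∧ g 0 = -1 / 12 ∧
    ∀ᶠ z in 𝓝[≠] (0 : ℂ), lam z - 1 / (ϖ * z) ^ 2 = g z := by
  obtain ⟨E, hE, hE0, hexp⟩ := exp_third_order
  let u : ℂ → ℂ := fun z => ϖ * z
  have hu : AnalyticAt ℂ u 0 := by fun_prop
  have hu0 : u 0 = 0 := by simp [u]
  have hEu : AnalyticAt ℂ (fun z => E (u z)) 0 := AnalyticAt.fun_comp (by rwa [hu0]) hu
  let den : ℂ → ℂ := fun z => 1 + u z / 2 + u z ^ 2 * E (u z)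
  have hden : AnalyticAt ℂ den 0 := (analyticAt_const.add (hu.div_const)).add ((hu.pow 2).mul hEu)
  have hden0 : den 0 = 1 := by simp [den, hu0]
  refine ⟨fun z => (1 / 4 - 2 * E (u z) - u z ^ 2 * E (u z) ^ 2) / den z ^ 2, ?_, ?_, ?_⟩
  · exact AnalyticAt.div ((analyticAt_const.sub (analyticAt_const.mul hEu)).sub
      ((hu.pow 2).mul (hEu.pow 2))) (hden.pow 2) (by simp [hden0])
  · simp [hden0, hu0, hE0]; norm_num
  · have h1 : ∀ᶠ z in 𝓝[≠] (0 : ℂ), ‖u z‖ < 1 := nhdsWithin_le_nhds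
      (hu.continuousAt.norm.eventually (gt_mem_nhds (by simp [hu0])))
    have h2 : ∀ᶠ z in 𝓝[≠] (0 : ℂ), den z ≠ 0 := nhdsWithin_le_nhds
      (hden.continuousAt.eventually (isOpen_ne.mem_nhds (by simp [hden0])))
    filter_upwards [h1, h2, self_mem_nhdsWithin] with z hz1 hz2 hz3
    have huz : u z ≠ 0 := mul_ne_zero two_pi_I_ne_zero hz3
    have e := hexp (u z) hz1
    have e1 : ee z = exp (u z) := rfl
    have e2 : 1 - ee z = -(u z * den z) := by rw [e1, e]; simp only [den]; ring
    change lam z - 1 / (u z) ^ 2 = _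
    unfold lam
    rw [e2, e1, e]
    obtain ⟨D, hD⟩ : ∃ D, D = den z := ⟨_, rfl⟩
    rw [← hD] at hz2 ⊢
    field_simp
    rw [hD]
    simp only [den]
    ring

/-- The constant term of `wpSum` at `z = 0`. -/
def wp0 (τ : ℂ) : ℂ := -1 / 12 + 2 * JF ppArr τ 0

/-- The normalized Weierstrass function `(2πi)⁻² ℘`. -/
def wpN (τ z : ℂ) : ℂ := wpSum τ z - wp0 τ

theorem eventually_ppArr (hτ : 0 < τ.im) (hz : -τ.im < z.im) :
    ∀ᶠ x : ℂ × ℂ in 𝓝 (τ, z), SmAt ppArr x.1 x.2 := by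
  have h1 : ∀ᶠ x : ℂ × ℂ in 𝓝 (τ, z), 0 < x.1.im :=
    (continuous_im.comp continuous_fst).continuousAt.eventually (lt_mem_nhds hτ)
  have h2 : ∀ᶠ x : ℂ × ℂ in 𝓝 (τ, z), 0 < x.1.im + x.2.im :=
    ((continuous_im.comp continuous_fst).add
      (continuous_im.comp continuous_snd)).continuousAt.eventually
      (lt_mem_nhds (by simp; linarith))
  filter_upwards [h1, h2] with x hx1 hx2
  exact ppArr_smAt hx1 (by linarith)

theorem ppArr_differentiableAt (hτ : 0 < τ.im) (hz : |z.im| < τ.im) :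
    DifferentiableAt ℂ (fun x : ℂ × ℂ => JF ppArr x.1 x.2 + JF ppArr x.1 (-x.2)) (τ, z) := by
  rw [abs_lt] at hz
  refine DifferentiableAt.add (JF_differentiableAt (eventually_ppArr hτ hz.1)) ?_
  exact DifferentiableAt.comp (τ, z) (g := fun x : ℂ × ℂ => JF ppArr x.1 x.2)
    (f := fun x : ℂ × ℂ => (x.1, -x.2))
    (JF_differentiableAt (eventually_ppArr hτ (by simp; linarith))) (by fun_prop)

theorem ppArr_analyticAt (hτ : 0 < τ.im) :
    AnalyticAt ℂ (fun z : ℂ => JF ppArr τ z + JF ppArr τ (-z)) 0 := by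
  rw [analyticAt_iff_eventually_differentiableAt]
  have : ∀ᶠ z : ℂ in 𝓝 0, |z.im| < τ.im :=
    (continuous_im.abs).continuousAt.eventually (gt_mem_nhds (by simpa using hτ))
  filter_upwards [this] with z hz
  exact DifferentiableAt.comp z (g := fun x : ℂ × ℂ => JF ppArr x.1 x.2 + JF ppArr x.1 (-x.2))
    (f := fun z => (τ, z)) (ppArr_differentiableAt hτ hz) (by fun_prop)

theorem wpN_expansion (hτ : 0 < τ.im) : ∃ g : ℂ → ℂ, AnalyticAt ℂ g 0 ∧ g 0 = 0 ∧
    ∀ᶠ z in 𝓝[≠] (0 : ℂ), wpN τ z - 1 / (ϖ * z) ^ 2 = g z := by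
  obtain ⟨g, hg, hg0, hgz⟩ := lam_expansion
  refine ⟨fun z => g z + (JF ppArr τ z + JF ppArr τ (-z)) - wp0 τ,
    (hg.add (ppArr_analyticAt hτ)).sub analyticAt_const, ?_, ?_⟩
  · simp only [hg0, neg_zero, wp0]; ring
  · have : ∀ᶠ z : ℂ in 𝓝[≠] 0, |z.im| < τ.im := nhdsWithin_le_nhds
      ((continuous_im.abs).continuousAt.eventually (gt_mem_nhds (by simpa using hτ)))
    filter_upwards [hgz, this] with z h1 h2
    rw [wpN, wpSum_eq hτ h2, ← h1]; ring

/-! ### Points off the lattice -/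

/-- `z ∉ ℤτ + ℤ`. -/
def OffL (τ z : ℂ) : Prop := ∀ l k : ℤ, z ≠ (l : ℂ) * τ + k

theorem offL_shift (l k : ℤ) : OffL τ (z + l * τ + k) ↔ OffL τ z := by
  constructor
  · intro h a b e
    exact h (a + l) (b + k) (by rw [e]; push_cast; ring)
  · intro h a b e
    exact h (a - l) (b - k) (by push_cast; linear_combination e)

theorem offL_neg : OffL τ (-z) ↔ OffL τ z := by
  constructor
  · intro h a b e
    exact h (-a) (-b) (by rw [e]; push_cast; ring)
  · intro h a b e
    exact h (-a) (-b) (by push_cast; linear_combination -e)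

theorem offL_iff_strip (h : |z.im| < τ.im) : OffL τ z ↔ ee z ≠ 1 := by
  rw [Ne, ee_eq_one_iff]
  constructor
  · rintro h1 ⟨n, rfl⟩
    exact h1 0 n (by simp)
  · intro h1 l k e
    have him : z.im = l * τ.im := by rw [e]; simp
    have hl : l = 0 := by
      by_contra hl
      have : (1 : ℝ) ≤ |(l : ℝ)| := by exact_mod_cast Int.one_le_abs hl
      have hτ : 0 < τ.im := (abs_nonneg _).trans_lt h
      rw [him, abs_mul, abs_of_pos hτ] at h
      nlinarith
    exact h1 ⟨k, by rw [e, hl]; simp⟩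

theorem OffL.ee_ne_one (h : OffL τ z) (s : ℤ) : ee (s * τ + z) ≠ 1 := by
  rw [Ne, ee_eq_one_iff]
  rintro ⟨n, hn⟩
  exact h (-s) n (by push_cast; linear_combination hn)

theorem exists_shift_strip (hτ : 0 < τ.im) (z : ℂ) : ∃ l : ℤ, |(z + l * τ).im| < τ.im := by
  refine ⟨-⌊z.im / τ.im⌋, ?_⟩
  have h1 := Int.floor_le (z.im / τ.im)
  have h2 := Int.lt_floor_add_one (z.im / τ.im)
  rw [le_div_iff₀ hτ] at h1
  rw [div_lt_iff₀ hτ] at h2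
  have : (z + ((-⌊z.im / τ.im⌋ : ℤ) : ℂ) * τ).im = z.im - ⌊z.im / τ.im⌋ * τ.im := by simp; ring
  rw [this, abs_lt]
  constructor <;> linarith

theorem eventually_strip (h : |z.im| < τ.im) : ∀ᶠ x : ℂ × ℂ in 𝓝 (τ, z), |x.2.im| < x.1.im := by
  have h1 : ContinuousAt (fun x : ℂ × ℂ => x.1.im - |x.2.im|) (τ, z) := by fun_prop
  have := h1.eventually (lt_mem_nhds (show (0 : ℝ) < τ.im - |z.im| by linarith))
  filter_upwards [this] with x hx
  linarith

theorem OffL.eventually (hτ : 0 < τ.im) (h : OffL τ z) :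
    ∀ᶠ x : ℂ × ℂ in 𝓝 (τ, z), OffL x.1 x.2 := by
  obtain ⟨l, hl⟩ := exists_shift_strip hτ z
  have hs : ∀ τ z : ℂ, OffL τ (z + l * τ) ↔ OffL τ z := fun τ z => by
    simpa using offL_shift (τ := τ) (z := z) l 0
  have hc : ContinuousAt (fun x : ℂ × ℂ => (x.1, x.2 + l * x.1)) (τ, z) := by fun_prop
  have h1 := hc.eventually (eventually_strip hl)
  have h2 : ∀ᶠ x : ℂ × ℂ in 𝓝 (τ, z), ee (x.2 + l * x.1) ≠ 1 := by
    have : ContinuousAt (fun x : ℂ × ℂ => ee (x.2 + l * x.1)) (τ, z) := by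
      have := continuous_ee
      fun_prop
    exact this.eventually (isOpen_ne.mem_nhds ((offL_iff_strip hl).mp ((hs τ z).mpr h)))
  filter_upwards [h1, h2] with x hx1 hx2
  exact (hs _ _).mp ((offL_iff_strip hx1).mpr hx2)

theorem OffL.eventually_right (hτ : 0 < τ.im) (h : OffL τ z) : ∀ᶠ w in 𝓝 z, OffL τ w :=
  ((Continuous.prodMk_right τ).continuousAt (x := z)).eventually (h.eventually hτ)

theorem eventually_offL_zero (hτ : 0 < τ.im) : ∀ᶠ w in 𝓝[≠] (0 : ℂ), OffL τ w := by
  have h1 : ∀ᶠ w in 𝓝[≠] (0 : ℂ), |w.im| < τ.im := nhdsWithin_le_nhds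
    ((continuous_im.abs).continuousAt.eventually (gt_mem_nhds (by simpa using hτ)))
  have h2 : ∀ᶠ w in 𝓝[≠] (0 : ℂ), ‖w‖ < 1 := nhdsWithin_le_nhds
    (continuous_norm.continuousAt.eventually (gt_mem_nhds (by simp)))
  filter_upwards [h1, h2, self_mem_nhdsWithin] with w h1 h2 h3
  rw [offL_iff_strip h1, Ne, ee_eq_one_iff]
  rintro ⟨n, rfl⟩
  rw [norm_intCast] at h2
  have : |n| < 1 := by exact_mod_cast h2
  have : n = 0 := by by_contra hn; exact absurd (Int.one_le_abs hn) (by omega)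
  exact h3 (by simp [this])

theorem eventually_offL (hτ : 0 < τ.im) (z : ℂ) : ∀ᶠ w in 𝓝[≠] z, OffL τ w := by
  by_cases h : OffL τ z
  · exact nhdsWithin_le_nhds (h.eventually_right hτ)
  · simp only [OffL, not_forall, not_not] at h
    obtain ⟨l, k, rfl⟩ := h
    have h0 := eventually_offL_zero hτ
    have ht : Tendsto (fun w : ℂ => w - (l * τ + k)) (𝓝[≠] (l * τ + k)) (𝓝[≠] 0) := by
      apply tendsto_nhdsWithin_of_tendsto_nhds_of_eventually_within
      · have : ContinuousAt (fun w : ℂ => w - (l * τ + k)) (l * τ + k) := by fun_prop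
        have := this.tendsto
        rw [sub_self] at this
        exact this.mono_left nhdsWithin_le_nhds
      · filter_upwards [self_mem_nhdsWithin] with w hw
        exact sub_ne_zero.mpr hw
    filter_upwards [ht.eventually h0] with w hw
    have := (offL_shift (τ := τ) (z := w - (l * τ + k)) l k).mpr hw
    simpa [sub_add_eq_sub_sub, sub_add, add_assoc] using this

/-- Continuous functions agreeing off the lattice agree. -/
theorem eq_of_eq_offL (hτ : 0 < τ.im) {f g : ℂ → ℂ} (hf : Continuous f) (hg : Continuous g)
    (h : ∀ z, OffL τ z → f z = g z) (z : ℂ) : f z = g z := by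
  have h1 : Tendsto f (𝓝[≠] z) (𝓝 (f z)) := hf.continuousAt.tendsto.mono_left nhdsWithin_le_nhds
  have h2 : Tendsto g (𝓝[≠] z) (𝓝 (g z)) := hg.continuousAt.tendsto.mono_left nhdsWithin_le_nhds
  exact tendsto_nhds_unique h1 (h2.congr' ((eventually_offL hτ z).mono fun w hw => (h w hw).symm))

/-! ### Regularity and modularity of `wpN` -/

theorem wpSum_differentiableAt (hτ : 0 < τ.im) (h : OffL τ z) :
    DifferentiableAt ℂ (fun x : ℂ × ℂ => wpSum x.1 x.2) (τ, z) := by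
  obtain ⟨l, hl⟩ := exists_shift_strip hτ z
  have hs : ∀ τ z : ℂ, wpSum τ (z + l * τ) = wpSum τ z := fun τ z => by
    simpa using wpSum_shift τ z l 0
  have hne : ee (z + l * τ) ≠ 1 := (offL_iff_strip hl).mp
    (by simpa using (offL_shift (τ := τ) (z := z) l 0).mpr h)
  have hloc : DifferentiableAt ℂ (fun x : ℂ × ℂ => lam x.2 +
      (JF ppArr x.1 x.2 + JF ppArr x.1 (-x.2))) (τ, z + l * τ) := by
    refine DifferentiableAt.add ?_ (ppArr_differentiableAt hτ hl)
    unfold lam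
    have h0 := differentiable_ee
    have h1 : DifferentiableAt ℂ (fun x : ℂ × ℂ => ee x.2) (τ, z + l * τ) :=
      (h0 _).comp _ differentiableAt_snd
    have h2 : DifferentiableAt ℂ (fun x : ℂ × ℂ => (1 - ee x.2) ^ 2) (τ, z + l * τ) :=
      (h1.const_sub 1).pow 2
    have h3 : (1 - ee (z + l * τ)) ^ 2 ≠ 0 := pow_ne_zero 2 (sub_ne_zero.mpr hne.symm)
    simp only [div_eq_mul_inv]
    exact h1.mul (h2.inv h3)
  have hcomp : DifferentiableAt ℂ (fun x : ℂ × ℂ => (x.1, x.2 + l * x.1)) (τ, z) := by fun_prop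
  have h1 := DifferentiableAt.comp (τ, z) (g := fun x : ℂ × ℂ => lam x.2 +
      (JF ppArr x.1 x.2 + JF ppArr x.1 (-x.2))) (f := fun x : ℂ × ℂ => (x.1, x.2 + l * x.1)) hloc hcomp
  refine h1.congr_of_eventuallyEq ?_
  have hpos : ∀ᶠ x : ℂ × ℂ in 𝓝 (τ, z), 0 < x.1.im :=
    (continuous_im.comp continuous_fst).continuousAt.eventually (lt_mem_nhds hτ)
  filter_upwards [hcomp.continuousAt.eventually (eventually_strip hl), hpos] with x hx hx0
  simp only [Function.comp]
  rw [← hs, wpSum_eq hx0 hx]; ring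

theorem wp0_differentiableAt (hτ : 0 < τ.im) : DifferentiableAt ℂ wp0 τ := by
  unfold wp0
  have := DifferentiableAt.comp τ (g := fun x : ℂ × ℂ => JF ppArr x.1 x.2)
    (f := fun τ => (τ, (0 : ℂ))) (JF_differentiableAt (eventually_ppArr hτ (by simpa using hτ)))
    (by fun_prop)
  exact (differentiableAt_const _).add (this.const_mul 2)

theorem wpN_differentiableAt (hτ : 0 < τ.im) (h : OffL τ z) :
    DifferentiableAt ℂ (fun x : ℂ × ℂ => wpN x.1 x.2) (τ, z) := by
  unfold wpN
  exact (wpSum_differentiableAt hτ h).sub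
    (DifferentiableAt.comp (τ, z) (g := wp0) (f := Prod.fst) (wp0_differentiableAt hτ)
      differentiableAt_fst)

theorem wpN_differentiableAt_right (hτ : 0 < τ.im) (h : OffL τ z) : DifferentiableAt ℂ (wpN τ) z :=
  DifferentiableAt.comp z (g := fun x : ℂ × ℂ => wpN x.1 x.2) (f := fun w => (τ, w))
    (wpN_differentiableAt hτ h) (by fun_prop)

theorem wpN_shift (τ z : ℂ) (l k : ℤ) : wpN τ (z + l * τ + k) = wpN τ z := by
  rw [wpN, wpSum_shift, wpN]

theorem wpN_neg (τ z : ℂ) : wpN τ (-z) = wpN τ z := by rw [wpN, wpSum_neg, wpN]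

theorem wpN_add_one_left (τ z : ℂ) : wpN (τ + 1) z = wpN τ z := by
  rw [wpN, wpSum_add_one_left, wpN, wp0, wp0, JF_add_one_left]

theorem exists_lattice_rep (hτ : 0 < τ.im) (z : ℂ) : ∃ l k : ℤ, ∃ a b : ℝ,
    a ∈ Set.Icc (0 : ℝ) 1 ∧ b ∈ Set.Icc (0 : ℝ) 1 ∧ z + l * τ + k = a * τ + b := by
  set a := z.im / τ.im with ha
  set b := z.re - a * τ.re with hb
  refine ⟨-⌊a⌋, -⌊b⌋, Int.fract a, Int.fract b, ⟨Int.fract_nonneg a, (Int.fract_lt_one a).le⟩,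
    ⟨Int.fract_nonneg b, (Int.fract_lt_one b).le⟩, ?_⟩
  have hz : z = a * τ + b := by
    apply Complex.ext
    · simp [hb]
    · simp [ha]; field_simp
  have hf : ∀ x : ℝ, ((Int.fract x : ℝ) : ℂ) = (x : ℂ) - (⌊x⌋ : ℤ) := fun x => by
    rw [← Int.self_sub_floor]; push_cast; rfl
  rw [hf, hf]
  conv_lhs => rw [hz]
  push_cast; ring

/-- A doubly periodic function with removable singularities, vanishing at `0`, vanishes. -/
theorem eq_zero_of_doubly_periodic (hτ : 0 < τ.im) {D G : ℂ → ℂ}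
    (hper : ∀ z : ℂ, ∀ l k : ℤ, D (z + l * τ + k) = D z)
    (hdiff : ∀ z, OffL τ z → DifferentiableAt ℂ D z) (hG : AnalyticAt ℂ G 0) (hG0 : G 0 = 0)
    (hDG : ∀ᶠ z in 𝓝[≠] (0 : ℂ), D z = G z) (hz : OffL τ z) : D z = 0 := by
  let F : ℂ → ℂ := fun z => if OffL τ z then D z else 0
  have hFper : ∀ z : ℂ, ∀ l k : ℤ, F (z + l * τ + k) = F z := by
    intro z l k
    simp only [F, offL_shift, hper]
  have hF0 : F =ᶠ[𝓝 0] G := by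
    have h1 : ∀ᶠ z in 𝓝[≠] (0 : ℂ), F z = G z := by
      filter_upwards [hDG, eventually_offL_zero hτ] with z h1 h2
      simp [F, h2, h1]
    rw [eventually_nhdsWithin_iff] at h1
    filter_upwards [h1] with z hz
    by_cases h0 : z = 0
    · subst h0
      have : ¬ OffL τ 0 := fun h => h 0 0 (by simp)
      simp [F, this, hG0]
    · exact hz h0
  have hFdiff : Differentiable ℂ F := by
    intro z
    by_cases h : OffL τ z
    · refine (hdiff z h).congr_of_eventuallyEq ?_
      filter_upwards [h.eventually_right hτ] with w hw
      simp [F, hw]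
    · simp only [OffL, not_forall, not_not] at h
      obtain ⟨l, k, rfl⟩ := h
      have h1 : DifferentiableAt ℂ F 0 := hG.differentiableAt.congr_of_eventuallyEq hF0
      have h2 : F = fun w => F (w - (l * τ + k)) := by
        ext w
        have := hFper (w - (l * τ + k)) l k
        rw [← this]; congr 1; ring
      rw [h2]
      refine DifferentiableAt.comp (l * τ + k : ℂ) (g := F) (f := fun w => w - (l * τ + k)) ?_
        (by fun_prop)
      simpa using h1
  have hK : IsCompact ((fun x : ℝ × ℝ => (x.1 : ℂ) * τ + x.2) ''
      (Set.Icc (0 : ℝ) 1 ×ˢ Set.Icc (0 : ℝ) 1)) :=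
    (isCompact_Icc.prod isCompact_Icc).image (by fun_prop)
  have hb : Bornology.IsBounded (Set.range F) := by
    refine (hK.image hFdiff.continuous).isBounded.subset ?_
    rintro _ ⟨w, rfl⟩
    obtain ⟨l, k, a, b, ha, hb, e⟩ := exists_lattice_rep hτ w
    exact ⟨a * τ + b, ⟨(a, b), ⟨ha, hb⟩, rfl⟩, by rw [← e, hFper]⟩
  have := hFdiff.apply_eq_apply_of_bounded hb z 0
  rw [hF0.self_of_nhds, hG0] at this
  simpa [F, hz] using this

theorem offL_S (h0 : τ ≠ 0) : OffL (-1 / τ) (z / τ) ↔ OffL τ z := by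
  constructor
  · intro h l k e
    exact h (-k) l (by rw [e]; push_cast; field_simp; ring)
  · intro h l k e
    refine h k (-l) ?_
    have : z / τ * τ = (l * (-1 / τ) + k) * τ := by rw [e]
    rw [div_mul_cancel₀ _ h0] at this
    rw [this]; push_cast; field_simp; ring

theorem wpN_S (hτ : 0 < τ.im) (hz : OffL τ z) : wpN (-1 / τ) (z / τ) = τ ^ 2 * wpN τ z := by
  have h0 := ne_zero_of_im_pos hτ
  have hτ' := im_neg_one_div_pos hτ
  obtain ⟨g, hg, hg0, hgz⟩ := wpN_expansion hτ
  obtain ⟨g', hg', hg0', hgz'⟩ := wpN_expansion hτ'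
  have hlin : AnalyticAt ℂ (fun z : ℂ => z / τ) 0 := by fun_prop (disch := assumption)
  have hcomp : AnalyticAt ℂ (fun z => g' (z / τ)) 0 :=
    AnalyticAt.fun_comp (f := fun z : ℂ => z / τ) (by simpa using hg') hlin
  have ht : Tendsto (fun z : ℂ => z / τ) (𝓝[≠] 0) (𝓝[≠] 0) := by
    apply tendsto_nhdsWithin_of_tendsto_nhds_of_eventually_within
    · have := hlin.continuousAt.tendsto
      rw [zero_div] at this
      exact this.mono_left nhdsWithin_le_nhds
    · filter_upwards [self_mem_nhdsWithin] with w hw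
      exact div_ne_zero hw h0
  have key := eq_zero_of_doubly_periodic hτ (D := fun z => wpN (-1 / τ) (z / τ) - τ ^ 2 * wpN τ z)
    (G := fun z => g' (z / τ) - τ ^ 2 * g z) ?_ ?_ (hcomp.sub (analyticAt_const.mul hg))
    (by simp [hg0, hg0']) ?_ hz
  · exact sub_eq_zero.mp key
  · intro z l k
    have e : (z + l * τ + k) / τ = z / τ + (-k : ℤ) * (-1 / τ) + l := by push_cast; field_simp; ring
    simp only [e, wpN_shift]
  · intro z hz
    have h1 := wpN_differentiableAt_right hτ' ((offL_S h0).mpr hz)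
    have h2 := wpN_differentiableAt_right hτ hz
    exact (DifferentiableAt.comp z (g := wpN (-1 / τ)) (f := fun z => z / τ) h1 (by fun_prop)).sub
      (h2.const_mul _)
  · filter_upwards [hgz, ht.eventually hgz', self_mem_nhdsWithin] with z h1 h2 h3
    have hz0 : z ≠ 0 := h3
    have hpi := two_pi_I_ne_zero
    rw [← h1, ← h2]
    field_simp
    ring

/-! ### Multiplying an even elliptic form by `wpSum` -/

def cnt (r j : ℤ) : ℤ := max (r - |j|) 0

theorem cnt_nonneg (r j : ℤ) : 0 ≤ cnt r j := le_max_right _ _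

theorem cnt_of_nonpos {r : ℤ} (h : r ≤ 0) (j : ℤ) : cnt r j = 0 :=
  max_eq_right (by have := abs_nonneg j; omega)

theorem abs_lt_of_cnt_ne_zero {r j : ℤ} (h : cnt r j ≠ 0) : |j| < r := by
  by_contra h1
  exact h (max_eq_right (by omega))

theorem hasSum_zpow_abs_le {K : Type*} [NormedField K] {w : K} (h0 : w ≠ 0) (h1 : w ≠ 1) (r : ℕ) :
    HasSum (fun j : ℤ => if |j| ≤ r then w ^ j else 0)
      ((w ^ (r + 1 : ℤ) - w ^ (-r : ℤ)) / (w - 1)) := by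
  have hw : w - 1 ≠ 0 := sub_ne_zero.mpr h1
  induction r with
  | zero =>
    have : (fun j : ℤ => if |j| ≤ ((0 : ℕ) : ℤ) then w ^ j else 0) =
        fun j => if j = 0 then 1 else 0 := by
      ext j
      by_cases h : j = 0
      · simp [h]
      · rw [if_neg h, if_neg]
        rw [Nat.cast_zero, abs_nonpos_iff]; exact h
    rw [this]
    convert hasSum_ite_eq (0 : ℤ) (1 : K) using 1
    simp [hw]
  | succ r ih =>
    have e : (fun j : ℤ => if |j| ≤ ((r + 1 : ℕ) : ℤ) then w ^ j else 0) = fun j : ℤ =>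
        (if |j| ≤ (r : ℤ) then w ^ j else 0) + (if j = (r + 1 : ℤ) then w ^ (r + 1 : ℤ) else 0) +
          (if j = -(r + 1 : ℤ) then w ^ (-(r + 1 : ℤ)) else 0) := by
      ext j
      push_cast
      by_cases h1 : j = r + 1
      · subst h1
        rw [if_pos (by rw [abs_of_nonneg (by positivity)]),
          if_neg (by rw [abs_of_nonneg (by positivity)]; omega), if_pos rfl, if_neg (by omega)]
        simp
      · by_cases h2 : j = -(r + 1 : ℤ)
        · subst h2
          rw [if_pos (by rw [abs_neg, abs_of_nonneg (by positivity)]),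
            if_neg (by rw [abs_neg, abs_of_nonneg (by positivity)]; omega), if_neg h1, if_pos rfl]
          simp
        · rw [if_neg h1, if_neg h2, add_zero, add_zero]
          have : |j| ≤ (r : ℤ) + 1 ↔ |j| ≤ (r : ℤ) := by rw [abs_le, abs_le]; omega
          simp only [this]
    rw [e]
    have := (ih.add (hasSum_ite_eq (r + 1 : ℤ) (w ^ (r + 1 : ℤ)))).add
      (hasSum_ite_eq (-(r + 1 : ℤ)) (w ^ (-(r + 1 : ℤ))))
    convert this using 1
    push_cast
    rw [show (-(r : ℤ)) = -((r : ℤ) + 1) + 1 by ring, zpow_add₀ h0 (r + 1 : ℤ) 1,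
      zpow_add₀ h0 (-((r : ℤ) + 1)) 1, zpow_one]
    field_simp
    ring

theorem hasSum_cnt {K : Type*} [NormedField K] {w : K} (h0 : w ≠ 0) (h1 : w ≠ 1) (r : ℤ) :
    HasSum (fun j : ℤ => (cnt r j : K) * w ^ j)
      (if 0 < r then (w ^ r - 2 + w ^ (-r)) * (w / (1 - w) ^ 2) else 0) := by
  have hw : w - 1 ≠ 0 := sub_ne_zero.mpr h1
  have hw' : 1 - w ≠ 0 := sub_ne_zero.mpr h1.symm
  rcases lt_or_ge 0 r with hr | hr
  swap
  · simp [cnt_of_nonpos hr, if_neg (not_lt.mpr hr)]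
  rw [if_pos hr]
  lift r to ℕ using hr.le
  clear hr
  induction r with
  | zero => simp [cnt_of_nonpos, hasSum_zero, show (1 : K) - 2 + 1 = 0 by ring]
  | succ r ih =>
    have e : (fun j : ℤ => (cnt ((r + 1 : ℕ) : ℤ) j : K) * w ^ j) = fun j : ℤ =>
        (cnt (r : ℤ) j : K) * w ^ j + if |j| ≤ r then w ^ j else 0 := by
      ext j
      by_cases h : |j| ≤ r
      · rw [if_pos h, show cnt ((r + 1 : ℕ) : ℤ) j = cnt r j + 1 by unfold cnt; push_cast; omega]
        push_cast; ring
      · rw [if_neg h, show cnt ((r + 1 : ℕ) : ℤ) j = cnt r j by unfold cnt; push_cast; omega]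
        ring
    rw [e]
    convert ih.add (hasSum_zpow_abs_le h0 h1 r) using 1
    push_cast
    rw [show (-(r : ℤ)) = -((r : ℤ) + 1) + 1 by ring, zpow_add₀ h0 (r : ℤ) 1,
      zpow_add₀ h0 (-((r : ℤ) + 1)) 1, zpow_one]
    field_simp
    ring

/-- The array of `φ·wpSum - φ(τ,0)·A2sum` for an even elliptic form `φ` with array `ψ`. -/
def lpArr (m : ℕ) (ψ : Arr) (p : ℤ × ℤ) : ℂ :=
  ∑' x : ℤ × ℤ, ψ (((ellEquiv m x.1).symm p).1, x.2) * cnt x.2 ((ellEquiv m x.1).symm p).2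

theorem norm_chr_eq (τ x : ℂ) (n j : ℤ) : ‖chr τ x (n, j)‖ = ‖ee (n * τ)‖ * ‖ee x‖ ^ j := by
  rw [chr, ee_add, norm_mul, ee_int_mul j x, norm_zpow]

theorem hasSum_lp_norm {ψ : Arr} {τ x : ℂ} (h1 : ‖ee x‖ ≠ 1) (a : ℤ × ℤ) :
    HasSum (fun j : ℤ => ‖ψ a * cnt a.2 j * chr τ x (a.1, j)‖)
      (‖ψ a‖ * ‖ee (a.1 * τ)‖ * (if 0 < a.2 then (‖ee x‖ ^ a.2 - 2 + ‖ee x‖ ^ (-a.2)) *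
        (‖ee x‖ / (1 - ‖ee x‖) ^ 2) else 0)) := by
  have := (hasSum_cnt (norm_ne_zero_iff.mpr (ee_ne_zero x)) h1 a.2).mul_left
    (‖ψ a‖ * ‖ee (a.1 * τ)‖)
  refine this.congr_fun fun j => ?_
  rw [norm_mul, norm_mul, norm_chr_eq, norm_intCast, abs_of_nonneg
    (by exact_mod_cast cnt_nonneg _ _)]
  ring

theorem lp_norm_bound {ψ : Arr} (hψ : Sm ψ) (hev : Evn ψ) {τ x : ℂ} (hτ : 0 < τ.im)
    (h1 : ‖ee x‖ ≠ 1) :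
    Summable (fun y : (ℤ × ℤ) × ℤ => ψ y.1 * cnt y.1.2 y.2 * chr τ x (y.1.1, y.2)) ∧
    ∑' y : (ℤ × ℤ) × ℤ, ‖ψ y.1 * cnt y.1.2 y.2 * chr τ x (y.1.1, y.2)‖ ≤
      2 * (∑' p, ‖ψ p * chr τ x p‖) * (‖ee x‖ / (1 - ‖ee x‖) ^ 2) := by
  set W := ‖ee x‖ with hW
  have hW0 : 0 < W := norm_pos_iff.mpr (ee_ne_zero x)
  have hL : 0 ≤ W / (1 - W) ^ 2 := by positivity
  have hs : Summable fun p => ‖ψ p * chr τ x p‖ := (hψ τ x hτ).norm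
  have hs' : Summable fun p => ‖ψ p * chr τ (-x) p‖ := (hψ τ (-x) hτ).norm
  have hsum' : ∑' p, ‖ψ p * chr τ (-x) p‖ = ∑' p, ‖ψ p * chr τ x p‖ := by
    rw [← (Equiv.prodCongr (Equiv.refl ℤ) (Equiv.neg ℤ)).tsum_eq]
    refine tsum_congr fun p => ?_
    rcases p with ⟨n, r⟩
    simp [hev n r, chr_neg]
  have hle : ∀ a : ℤ × ℤ, ‖ψ a‖ * ‖ee (a.1 * τ)‖ * (if 0 < a.2 then (W ^ a.2 - 2 + W ^ (-a.2)) *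
        (W / (1 - W) ^ 2) else 0) ≤
        (‖ψ a * chr τ x a‖ + ‖ψ a * chr τ (-x) a‖) * (W / (1 - W) ^ 2) := by
    intro a
    have e1 : ‖ψ a * chr τ x a‖ = ‖ψ a‖ * ‖ee (a.1 * τ)‖ * W ^ a.2 := by
      rw [norm_mul, show a = (a.1, a.2) from rfl, norm_chr_eq, mul_assoc]
    have e2 : ‖ψ a * chr τ (-x) a‖ = ‖ψ a‖ * ‖ee (a.1 * τ)‖ * W ^ (-a.2) := by
      rw [norm_mul, show a = (a.1, a.2) from rfl, chr_neg, norm_chr_eq, mul_assoc]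
    rw [e1, e2, ← mul_add, mul_assoc (‖ψ a‖ * ‖ee (a.1 * τ)‖)]
    refine mul_le_mul_of_nonneg_left ?_ (by positivity)
    have p1 : 0 < W ^ a.2 := by positivity
    have p2 : 0 < W ^ (-a.2) := by positivity
    split_ifs
    · exact mul_le_mul_of_nonneg_right (by linarith) hL
    · positivity
  have hR := (hs.add hs').mul_right (W / (1 - W) ^ 2)
  have hN : Summable fun y : (ℤ × ℤ) × ℤ => ‖ψ y.1 * cnt y.1.2 y.2 * chr τ x (y.1.1, y.2)‖ := by
    rw [summable_prod_of_nonneg (fun _ => norm_nonneg _)]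
    refine ⟨fun a => (hasSum_lp_norm h1 a).summable, ?_⟩
    refine Summable.of_nonneg_of_le (fun a => tsum_nonneg fun _ => norm_nonneg _) (fun a => ?_) hR
    rw [(hasSum_lp_norm h1 a).tsum_eq]
    exact hle a
  refine ⟨hN.of_norm, ?_⟩
  rw [hN.tsum_prod]
  calc _ ≤ ∑' a : ℤ × ℤ, (‖ψ a * chr τ x a‖ + ‖ψ a * chr τ (-x) a‖) * (W / (1 - W) ^ 2) := by
        refine Summable.tsum_le_tsum (fun a => ?_) hN.prod hR
        rw [(hasSum_lp_norm h1 a).tsum_eq]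
        exact hle a
    _ = _ := by rw [tsum_mul_right, hs.tsum_add hs', hsum']; ring

theorem lp_inner_summable {ψ : Arr} (hψ : Sm ψ) (hev : Evn ψ) (hτ : 0 < τ.im)
    (x : ℂ) : Summable (fun y : (ℤ × ℤ) × ℤ => ψ y.1 * cnt y.1.2 y.2 * chr τ x (y.1.1, y.2)) := by
  by_cases h1 : ‖ee x‖ ≠ 1
  · exact (lp_norm_bound hψ hev hτ h1).1
  push Not at h1
  have hx : x.im = 0 := by
    rw [norm_ee, Real.exp_eq_one_iff] at h1
    have := Real.pi_pos
    nlinarith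
  have hne : ∀ t : ℝ, t ≠ 0 → ‖ee (t * I)‖ ≠ 1 := by
    intro t ht h
    rw [norm_ee, Real.exp_eq_one_iff] at h
    apply ht
    have := Real.pi_pos
    simp at h
    tauto
  have a1 := (lp_norm_bound hψ hev hτ (x := I) (by simpa using hne 1 one_ne_zero)).1.norm
  have a2 := (lp_norm_bound hψ hev hτ (x := -I) (by simpa using hne (-1) (by norm_num))).1.norm
  refine Summable.of_norm_bounded (a1.add a2) fun y => ?_
  simp only [norm_mul, ← mul_add]
  refine mul_le_mul_of_nonneg_left ?_ (by positivity)
  simp only [norm_chr, hx, I_im, neg_im]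
  rcases le_total (0 : ℝ) y.2 with h | h
  · refine le_add_of_nonneg_of_le (by positivity) (Real.exp_le_exp.mpr ?_)
    have := Real.pi_pos
    nlinarith
  · refine le_add_of_le_of_nonneg (Real.exp_le_exp.mpr ?_) (by positivity)
    have := Real.pi_pos
    nlinarith

theorem lp_inner_tsum {ψ : Arr} (hψ : Sm ψ) (hev : Evn ψ) (hτ : 0 < τ.im) {x : ℂ} (hx : ee x ≠ 1) :
    ∑' y : (ℤ × ℤ) × ℤ, ψ y.1 * cnt y.1.2 y.2 * chr τ x (y.1.1, y.2) =
      (JF ψ τ x - JF ψ τ 0) * lam x := by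
  have hS := lp_inner_summable hψ hev hτ x
  have hin : ∀ a : ℤ × ℤ, ∑' j : ℤ, ψ a * cnt a.2 j * chr τ x (a.1, j) =
      ψ a * ee (a.1 * τ) * (if 0 < a.2 then (ee x ^ a.2 - 2 + ee x ^ (-a.2)) * lam x else 0) := by
    intro a
    have := (hasSum_cnt (ee_ne_zero x) hx a.2).mul_left (ψ a * ee (a.1 * τ))
    refine HasSum.tsum_eq (this.congr_fun fun j => ?_)
    rw [chr, ee_add, ee_int_mul j x]; ring
  have hout : HasSum (fun a : ℤ × ℤ => ψ a * ee (a.1 * τ) *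
      (if 0 < a.2 then (ee x ^ a.2 - 2 + ee x ^ (-a.2)) * lam x else 0))
      (∑' y : (ℤ × ℤ) × ℤ, ψ y.1 * cnt y.1.2 y.2 * chr τ x (y.1.1, y.2)) := by
    have := hS.hasSum.prod_fiberwise fun a => (hS.prod_factor a).hasSum
    exact this.congr_fun fun a => (hin a).symm
  have hout' := ((Equiv.prodCongr (Equiv.refl ℤ) (Equiv.neg ℤ)).hasSum_iff).mpr hout
  have h2 := hout.add hout'
  have h3 := ((((hψ τ x hτ).hasSum).add ((hψ τ (-x) hτ).hasSum)).sub
    (((hψ τ 0 hτ).hasSum).mul_left 2)).mul_right (lam x)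
  have h4 := h2.unique (h3.congr_fun fun a => ?_)
  · rw [JF_even hev] at h4
    linear_combination h4 / 2
  · rcases a with ⟨n, r⟩
    simp only [Function.comp, Equiv.prodCongr_apply, Equiv.coe_refl, Prod.map, id, Equiv.neg_apply,
      hev n r, chr, ee_add, ee_int_mul, neg_neg, mul_neg, mul_zero, ee_zero, ee_neg, zpow_neg]
    rcases lt_trichotomy r 0 with h | h | h
    · rw [if_neg (by omega), if_pos (by omega)]; ring
    · subst h; simp only [lt_irrefl, if_false, neg_zero, zpow_zero]; ring
    · rw [if_pos h, if_neg (by omega)]; ring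

def lpEquiv (m : ℕ) : (ℤ × ℤ) × (ℤ × ℤ) ≃ ℤ × ((ℤ × ℤ) × ℤ) where
  toFun y := (y.2.1, ((((ellEquiv m y.2.1).symm y.1).1, y.2.2), ((ellEquiv m y.2.1).symm y.1).2))
  invFun y := (ellEquiv m y.1 (y.2.1.1, y.2.2), (y.1, y.2.1.2))
  left_inv y := by simp
  right_inv y := by simp

theorem lp_summable {ψ : Arr} (hψ : Sm ψ) (hell : Ell m ψ) (hev : Evn ψ) (hτ : 0 < τ.im) (z : ℂ) :
    Summable fun y : ℤ × ((ℤ × ℤ) × ℤ) =>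
      ψ y.2.1 * cnt y.2.1.2 y.2.2 * chr τ z (ellEquiv m y.1 (y.2.1.1, y.2.2)) := by
  have hS : ∀ s : ℤ, ‖ee (m * (s ^ 2 * τ + 2 * s * z))‖ * ∑' p, ‖ψ p * chr τ (z + s * τ) p‖ =
      ∑' p, ‖ψ p * chr τ z p‖ := by
    intro s
    rw [← (ellEquiv m s).tsum_eq (fun p => ‖ψ p * chr τ z p‖), ← tsum_mul_left]
    refine tsum_congr fun p => ?_
    rw [chr_ellEquiv, ← norm_mul]
    have : ψ (ellEquiv m s p) = ψ p := hell _ _ _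
    rw [this]; congr 1; ring
  have he : ∀ s : ℤ, ∀ y : (ℤ × ℤ) × ℤ,
      ψ y.1 * cnt y.1.2 y.2 * chr τ z (ellEquiv m s (y.1.1, y.2)) =
      ee (m * (s ^ 2 * τ + 2 * s * z)) *
        (ψ y.1 * cnt y.1.2 y.2 * chr τ (z + s * τ) (y.1.1, y.2)) := by
    intro s y
    rw [chr_ellEquiv]; ring
  refine Summable.of_norm ?_
  rw [summable_prod_of_nonneg (fun _ => norm_nonneg _)]
  constructor
  · intro s
    simp only [he]
    exact ((lp_inner_summable hψ hev hτ (z + s * τ)).mul_left _).norm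
  · refine Summable.of_norm_bounded_eventually
      ((summable_lambert_ee hτ z).mul_left (2 * ∑' p, ‖ψ p * chr τ z p‖)) ?_
    filter_upwards [eventually_norm_ee_ne_one hτ z] with s hs
    rw [add_comm] at hs
    rw [Real.norm_of_nonneg (tsum_nonneg fun _ => norm_nonneg _)]
    simp only [he]
    simp only [norm_mul (ee _) (_ * _)]
    rw [tsum_mul_left, ← hS s, add_comm (s * τ) z]
    have := (lp_norm_bound hψ hev hτ hs).2
    calc _ ≤ _ := mul_le_mul_of_nonneg_left this (norm_nonneg _)
      _ = _ := by ring

theorem hasSum_lpArr {ψ : Arr} (hψ : Sm ψ) (hell : Ell m ψ) (hev : Evn ψ) (hτ : 0 < τ.im) (z : ℂ) :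
    HasSum (fun p => lpArr m ψ p * chr τ z p) (∑' y : ℤ × ((ℤ × ℤ) × ℤ),
      ψ y.2.1 * cnt y.2.1.2 y.2.2 * chr τ z (ellEquiv m y.1 (y.2.1.1, y.2.2))) := by
  have h := (lpEquiv m).hasSum_iff.mpr (lp_summable hψ hell hev hτ z).hasSum
  have := h.prod_fiberwise fun p => (h.summable.prod_factor p).hasSum
  refine this.congr_fun fun p => ?_
  rw [lpArr, ← tsum_mul_right]
  refine tsum_congr fun x => ?_
  simp [lpEquiv]

theorem lpArr_sm {ψ : Arr} (hψ : Sm ψ) (hell : Ell m ψ) (hev : Evn ψ) :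
    Sm (lpArr m ψ) := fun _ z hτ => (hasSum_lpArr hψ hell hev hτ z).summable

theorem A2sum_eq (m : ℕ) (τ z : ℂ) :
    A2sum m τ z = ∑' s : ℤ, ee (m * (s ^ 2 * τ + 2 * s * z)) * lam (s * τ + z) := by
  unfold A2sum lam
  refine tsum_congr fun s => ?_
  rw [← mul_div_assoc, ← ee_add]; congr 2; ring

theorem JF_lpArr {ψ : Arr} (hψ : Sm ψ) (hell : Ell m ψ) (hev : Evn ψ)
    (hτ : 0 < τ.im) (hz : OffL τ z) :
    JF (lpArr m ψ) τ z = JF ψ τ z * wpSum τ z - JF ψ τ 0 * A2sum m τ z := by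
  have hS := lp_summable hψ hell hev hτ z
  have h1 := hS.hasSum.prod_fiberwise fun a => (hS.prod_factor a).hasSum
  have h2 : ∀ s : ℤ, ∑' y : (ℤ × ℤ) × ℤ, ψ y.1 * cnt y.1.2 y.2 * chr τ z (ellEquiv m s (y.1.1, y.2)) =
      JF ψ τ z * lam (s * τ + z) -
        JF ψ τ 0 * (ee (m * (s ^ 2 * τ + 2 * s * z)) * lam (s * τ + z)) := by
    intro s
    have := lp_inner_tsum hψ hev hτ (x := z + s * τ) (by rw [add_comm]; exact hz.ee_ne_one s)
    rw [JF_shift hell τ z s, add_comm (s * τ) z]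
    calc _ = ee (m * (s ^ 2 * τ + 2 * s * z)) * ∑' y : (ℤ × ℤ) × ℤ,
          ψ y.1 * cnt y.1.2 y.2 * chr τ (z + s * τ) (y.1.1, y.2) := by
          rw [← tsum_mul_left]
          refine tsum_congr fun y => ?_
          rw [chr_ellEquiv]; ring
      _ = _ := by rw [this]; ring
  have h3 := (summable_wpSum hτ z).hasSum.mul_left (JF ψ τ z)
  have h4 := (h1.congr_fun fun s => (h2 s).symm)
  have h5 := (h3.sub h4).tsum_eq
  simp only [sub_sub_cancel] at h5
  rw [tsum_mul_left, ← A2sum_eq] at h5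
  rw [JF, (hasSum_lpArr hψ hell hev hτ z).tsum_eq]
  change _ = JF ψ τ z * wpSum τ z - _ at h5
  linear_combination h5

/-! ### Support of elliptic arrays -/

theorem ell_low_bound (hm : 0 < m) (hc : Ell m c) {N : ℤ} (hl : LowAt N c)
    {n r : ℤ} (h : c (n, r) ≠ 0) : 4 * m * N - m ^ 2 ≤ 4 * m * n - r ^ 2 := by
  have hm' : (0 : ℤ) < m := by exact_mod_cast hm
  obtain ⟨l, hl1, hl2⟩ : ∃ l : ℤ, -m ≤ r + 2 * m * l ∧ r + 2 * m * l ≤ m := by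
    refine ⟨-((r + m) / (2 * m)), ?_⟩
    have h1 := Int.emod_nonneg (r + m) (show (2 * m : ℤ) ≠ 0 by omega)
    have h2 := Int.emod_lt_of_pos (r + m) (show (0 : ℤ) < 2 * m by omega)
    have h3 := Int.mul_ediv_add_emod (r + m) (2 * m)
    constructor <;> linarith
  have h1 := hc n r l
  have h2 : N ≤ n + r * l + m * l ^ 2 := by
    by_contra h3
    exact h (h1 ▸ hl _ _ (not_le.mp h3))
  have h3 : (r + 2 * m * l) ^ 2 ≤ (m : ℤ) ^ 2 := sq_le_sq' hl1 hl2
  nlinarith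

theorem lpArr_support {ψ : Arr} {n r : ℤ} (h : lpArr m ψ (n, r) ≠ 0) :
    ∃ n' r' s j : ℤ, ψ (n', r') ≠ 0 ∧ |j| < r' ∧ j = r - 2 * m * s ∧ n' = n - r * s + m * s ^ 2 := by
  by_contra hcon
  push Not at hcon
  apply h
  rw [lpArr, show (0 : ℂ) = ∑' _ : ℤ × ℤ, (0 : ℂ) by simp]
  refine tsum_congr fun x => ?_
  by_contra h0
  have h1 := left_ne_zero_of_mul h0
  have h2 : cnt x.2 ((ellEquiv m x.1).symm (n, r)).2 ≠ 0 := by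
    exact_mod_cast right_ne_zero_of_mul h0
  exact hcon _ _ x.1 _ h1 (abs_lt_of_cnt_ne_zero h2) rfl rfl

theorem lpArr_bound (hm : 0 < m) {ψ : Arr} (hψ : Ell m ψ) (hl : LowAt 0 ψ)
    {n r : ℤ} (h : lpArr m ψ (n, r) ≠ 0) : 1 - (m : ℤ) ^ 2 ≤ 4 * m * n - r ^ 2 := by
  obtain ⟨n', r', s, j, h1, h2, h3, h4⟩ := lpArr_support h
  have h5 := ell_low_bound hm hψ hl h1
  have h6 : j ^ 2 + 1 ≤ r' ^ 2 := by
    have := sq_abs j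
    have := abs_nonneg j
    nlinarith
  subst h3 h4
  nlinarith

theorem lpArr_low (hm : 0 < m) {ψ : Arr} (hψ : Ell m ψ) (hl : LowAt 0 ψ) :
    LowAt (-m) (lpArr m ψ) := by
  intro n r h
  by_contra h0
  have := lpArr_bound hm hψ hl h0
  have hm' : (0 : ℤ) < m := by exact_mod_cast hm
  nlinarith

/-! ### The basic forms of index one and weights `0` and `4` -/

/-- The constant term `wp0`, as an array. -/
def p0Arr : Arr := (-1 / 12 : ℂ) • oneArr + (2 : ℂ) • qArr (coll ppArr)

theorem ppArr_low : LowAt 1 ppArr := fun n r h => if_neg (by simp; omega)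

theorem ppArr_smAt_zero (τ : ℂ) (hτ : 0 < τ.im) : SmAt ppArr τ 0 :=
  ppArr_smAt hτ (by simpa using hτ)

theorem coll_ppArr_disc : DiscSummable (coll ppArr) :=
  discSummable_coll ppArr_smAt_zero fun n r h => ppArr_low n r (by omega)

theorem JF_coll_ppArr (hτ : 0 < τ.im) (z : ℂ) : JF (qArr (coll ppArr)) τ z = JF ppArr τ 0 := by
  rw [coll_ppArr_disc.JF_qArr hτ]
  exact (hasSum_coll ppArr_smAt_zero (fun n r h => ppArr_low n r (by omega)) hτ).tsum_eq

theorem oneArr_sm : Sm oneArr := WJ.one.sm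

theorem p0Arr_sm : Sm p0Arr := (oneArr_sm.smul _).add (coll_ppArr_disc.sm.smul _)

theorem JF_p0Arr (hτ : 0 < τ.im) (z : ℂ) : JF p0Arr τ z = wp0 τ := by
  rw [p0Arr, JF_add (oneArr_sm.smul _ τ z hτ) (coll_ppArr_disc.sm.smul _ τ z hτ), JF_smul, JF_smul,
    JF_oneArr, JF_coll_ppArr hτ, wp0, mul_one]

theorem p0Arr_low : LowAt 0 p0Arr := fun n r h => by
  have h1 : oneArr (n, r) = 0 := LeadTerm.one.low n r h
  simp [p0Arr, h1, qArr_low _ n r h]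

/-- `A·wpSum`, an entire function with integral Fourier coefficients. -/
def rArr : Arr := lpArr 1 aArr

theorem rArr_sm : Sm rArr := lpArr_sm aArr_sm aArr_ell aArr_wj.even

theorem rArr_bound {n r : ℤ} (h : rArr (n, r) ≠ 0) : 0 ≤ 4 * n - r ^ 2 := by
  have := lpArr_bound one_pos aArr_ell aArr_low h
  push_cast at this
  linarith

theorem rArr_low : LowAt 0 rArr := fun n r h => by
  by_contra h0
  have := rArr_bound h0
  nlinarith [sq_nonneg r]

theorem rArr_int : IntArr rArr := fun p => exists_int_tsum fun x => by
  obtain ⟨k, hk⟩ := aArr_int (((ellEquiv 1 x.1).symm p).1, x.2)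
  exact ⟨k * cnt x.2 ((ellEquiv 1 x.1).symm p).2, by rw [hk]; push_cast; ring⟩

theorem rArr_lead : LeadTerm rArr 0 0 := by
  have h00 : rArr (0, 0) = 1 := by
    rw [rArr, lpArr, tsum_eq_single ((0, 1) : ℤ × ℤ)]
    · simp [ellEquiv, cnt]
      exact_mod_cast aArr_lead.pos
    · intro x hx
      by_contra h0
      have h1 := left_ne_zero_of_mul h0
      have h2 : cnt x.2 ((ellEquiv 1 x.1).symm (0, 0)).2 ≠ 0 := by
        exact_mod_cast right_ne_zero_of_mul h0
      have h3 := abs_lt_of_cnt_ne_zero h2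
      have h4 := ell_low_bound one_pos aArr_ell aArr_low h1
      simp only [ellEquiv, Equiv.coe_fn_symm_mk] at h3 h4
      push_cast at h3 h4
      have h5 := sq_abs ((0 : ℤ) - 2 * 1 * x.1)
      have h6 := abs_nonneg ((0 : ℤ) - 2 * 1 * x.1)
      rw [mul_one] at h5 h6
      have h7 : |(0 : ℤ) - 2 * x.1| = 0 := by nlinarith
      have h8 : x.1 = 0 := by rw [abs_eq_zero] at h7; omega
      rw [h7] at h3
      rw [h8] at h4
      have h9 : x.2 = 1 := by nlinarith
      exact hx (Prod.ext h8 h9)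
  refine ⟨rArr_low, fun r hr => ?_, by simpa using h00, by simpa using h00⟩
  by_contra h0
  have := rArr_bound h0
  have : r = 0 := by nlinarith
  simp [this] at hr

/-- `φ₀₁ / 12`, i.e. `A·wpN`. -/
def bArr : Arr := rArr - conv p0Arr aArr

theorem bArr_sm : Sm bArr := rArr_sm.sub (p0Arr_sm.conv aArr_sm)

theorem JF_aArr_zero (hτ : 0 < τ.im) : JF aArr τ 0 = 0 := by
  have h : theta1 τ 0 = 0 := by
    have := theta1_neg τ 0
    rw [neg_zero] at this
    linear_combination this / 2
  rw [JF_aArr hτ, h]; simp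

theorem JF_rArr (hτ : 0 < τ.im) (hz : OffL τ z) : JF rArr τ z = JF aArr τ z * wpSum τ z := by
  rw [rArr, JF_lpArr aArr_sm aArr_ell aArr_wj.even hτ hz, JF_aArr_zero hτ]; ring

theorem JF_bArr (hτ : 0 < τ.im) (z : ℂ) : JF bArr τ z = JF rArr τ z - wp0 τ * JF aArr τ z := by
  rw [bArr, JF_sub (rArr_sm τ z hτ) (p0Arr_sm.conv aArr_sm τ z hτ),
    JF_conv (p0Arr_sm τ z hτ) (aArr_sm τ z hτ), JF_p0Arr hτ]

theorem JF_bArr_offL (hτ : 0 < τ.im) (hz : OffL τ z) : JF bArr τ z = JF aArr τ z * wpN τ z := by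
  rw [JF_bArr hτ, JF_rArr hτ hz, wpN]; ring

theorem bArr_low : LowAt 0 bArr := fun n r h => by
  have h1 : conv p0Arr aArr (n, r) = 0 := conv_low p0Arr_low aArr_low n r (by simpa using h)
  simp [bArr, rArr_low n r h, h1]

theorem bArr_wj : WJ 0 1 bArr where
  ell := ell_of_JF bArr_sm fun τ z hτ l => by
    refine eq_of_eq_offL hτ (f := fun z => JF bArr τ (z + l * τ)) (g := fun z =>
      ee (-((1 : ℕ) : ℂ) * (l ^ 2 * τ + 2 * l * z)) * JF bArr τ z)
      ((bArr_sm.continuous_right hτ).comp (by fun_prop))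
      ((continuous_ee.comp (by fun_prop)).mul (bArr_sm.continuous_right hτ)) (fun z hz => ?_) z
    have h1 : OffL τ (z + l * τ) := by simpa using (offL_shift l 0).mpr hz
    have h2 := wpN_shift τ z l 0
    have h3 := JF_elliptic aArr_ell τ hτ z l 0
    simp only [Int.cast_zero, add_zero] at h2 h3
    rw [JF_bArr_offL hτ hz, JF_bArr_offL hτ h1, h2, h3]; ring
  even := even_of_JF bArr_sm fun τ z hτ => by
    refine eq_of_eq_offL hτ (f := fun z => JF bArr τ (-z))
      ((bArr_sm.continuous_right hτ).comp (by fun_prop)) (bArr_sm.continuous_right hτ)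
      (fun z hz => ?_) z
    rw [JF_bArr_offL hτ hz, JF_bArr_offL hτ (offL_neg.mpr hz), wpN_neg, JF_even aArr_wj.even]
  low := ⟨0, bArr_low⟩
  sm := bArr_sm
  slaw τ z hτ := by
    have h0 := ne_zero_of_im_pos hτ
    have hτ' := im_neg_one_div_pos hτ
    refine eq_of_eq_offL hτ (f := fun z => JF bArr (-1 / τ) (z / τ))
      (g := fun z => τ ^ (0 : ℤ) * ee (((1 : ℕ) : ℂ) * z ^ 2 / τ) * JF bArr τ z)
      ((bArr_sm.continuous_right hτ').comp (by fun_prop))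
      ((continuous_const.mul (continuous_ee.comp (by fun_prop))).mul (bArr_sm.continuous_right hτ))
      (fun z hz => ?_) z
    rw [JF_bArr_offL hτ hz, JF_bArr_offL hτ' ((offL_S h0).mpr hz), wpN_S hτ hz, aArr_wj.slaw τ z hτ,
      show (-2 : ℤ) = -((2 : ℕ) : ℤ) by norm_num, zpow_neg, zpow_natCast]
    field_simp

theorem JF_bArr_zero (hτ : 0 < τ.im) : JF bArr τ 0 = 1 := by
  obtain ⟨g, hg, hg0, hgz⟩ := wpN_expansion hτ
  have h1 : Tendsto (JF bArr τ) (𝓝[≠] 0) (𝓝 (JF bArr τ 0)) :=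
    (bArr_sm.continuous_right hτ).continuousAt.tendsto.mono_left nhdsWithin_le_nhds
  have hu : Tendsto (fun z : ℂ => 1 + (ϖ * z) ^ 2 * g z) (𝓝[≠] 0) (𝓝 1) := by
    have : ContinuousAt (fun z : ℂ => 1 + (ϖ * z) ^ 2 * g z) 0 := by
      have := hg.continuousAt
      fun_prop
    have := this.tendsto
    simp only [mul_zero, ne_eq, OfNat.ofNat_ne_zero, not_false_eq_true, zero_pow, zero_mul,
      add_zero] at this
    exact this.mono_left nhdsWithin_le_nhds
  have h2 := (aArr_tendsto hτ).mul hu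
  rw [one_mul] at h2
  refine tendsto_nhds_unique h1 (h2.congr' ?_)
  filter_upwards [hgz, eventually_offL_zero hτ, self_mem_nhdsWithin] with z h3 h4 h5
  have hz0 : z ≠ 0 := h5
  have hpi := two_pi_I_ne_zero
  rw [JF_bArr_offL hτ h4, ← h3]
  field_simp
  ring

/-- The integral form of index one and weight `4` with leading coefficient `1`. -/
def cArr : Arr :=
  conv rArr e4Arr + conv aArr ((1 / 12 : ℂ) • (e4Arr - e6Arr) +
    (-2 : ℂ) • conv (qArr (coll ppArr)) e4Arr)

theorem qArr_coll_ppArr_low : LowAt 1 (qArr (coll ppArr)) := by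
  intro n r h
  rcases lt_or_eq_of_le (show n ≤ 0 by omega) with h0 | rfl
  · exact qArr_low _ n r h0
  · by_cases hr : r = 0
    · subst hr
      have := qArr_nat (coll ppArr) 0
      rw [Nat.cast_zero] at this
      rw [this, coll]
      simp [ppArr_low 0 _ (by norm_num : (0 : ℤ) < 1)]
    · simp [qArr, hr]

theorem eis_sub_eq (p : ℤ × ℤ) : ((1 / 12 : ℂ) • (e4Arr - e6Arr)) p =
    qArr (fun n => if n = 0 then 0 else 20 * (ArithmeticFunction.sigma 3 n : ℕ) +
      42 * (ArithmeticFunction.sigma 5 n : ℕ)) p := by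
  simp only [e4Arr, e6Arr, Pi.smul_apply, Pi.sub_apply, qArr, eisCoeff, smul_eq_mul]
  split_ifs <;> ring

theorem cArr_lead : LeadTerm cArr 0 0 := by
  have hlow : LowAt 1 ((1 / 12 : ℂ) • (e4Arr - e6Arr) +
      (-2 : ℂ) • conv (qArr (coll ppArr)) e4Arr) := by
    intro n r h
    have h1 := conv_low qArr_coll_ppArr_low e4Arr_lead.low n r (by simpa using h)
    rw [Pi.add_apply, eis_sub_eq, Pi.smul_apply, h1, smul_zero, add_zero]
    rcases lt_or_eq_of_le (show n ≤ 0 by omega) with h0 | rfl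
    · exact qArr_low _ n r h0
    · simp [qArr]
  have h2 := conv_low aArr_low hlow
  have h3 : ∀ r : ℤ, cArr (0, r) = rArr (0, r) := fun r => by
    rw [cArr, Pi.add_apply, h2 0 r (by norm_num), conv_eq_of_leadTerm_zero rArr_low e4Arr_lead,
      add_zero]
  refine ⟨fun n r h => ?_, fun r hr => ?_, ?_, ?_⟩
  · rw [cArr, Pi.add_apply, h2 n r (by omega),
      conv_low rArr_low e4Arr_lead.low n r (by simpa using h), add_zero]
  · rw [h3, rArr_lead.out r hr]
  · rw [h3, rArr_lead.pos]
  · rw [h3, rArr_lead.neg]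

theorem cArr_int : IntArr cArr := by
  refine (rArr_int.conv e4Arr_int).add (aArr_int.conv (IntArr.add (fun p => ?_) fun p => ?_))
  · rw [eis_sub_eq]
    refine qArr_int (fun n => ?_) p
    by_cases hn : n = 0
    · exact ⟨0, by simp [hn]⟩
    · exact ⟨20 * (ArithmeticFunction.sigma 3 n : ℕ) + 42 * (ArithmeticFunction.sigma 5 n : ℕ),
        by simp [hn]⟩
  · have h : IntArr ppArr := fun p => by
      unfold ppArr
      split_ifs
      · exact ⟨p.2, rfl⟩
      · exact ⟨0, by simp⟩
    obtain ⟨k, hk⟩ := (qArr_int (fun n => exists_int_tsum fun s => h ((n : ℤ), s))).conv e4Arr_int p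
    refine ⟨-2 * k, ?_⟩
    rw [Pi.smul_apply, smul_eq_mul]
    push_cast
    rw [← hk]; rfl

theorem cArr_wj : WJ 4 1 cArr := by
  have h1 : WJ 4 1 (conv e4Arr bArr) := e4Arr_wj.conv bArr_wj
  have h2 : WJ 4 1 ((-1 / 12 : ℂ) • conv e6Arr aArr) := (e6Arr_wj.conv aArr_wj).smul _
  have he4 := e4Arr_wj.sm
  have he6 := e6Arr_wj.sm
  have hp := coll_ppArr_disc.sm
  have hX := ((he4.sub he6).smul (1 / 12)).add ((hp.conv he4).smul (-2))
  convert h1.add h2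
  refine JF_injective ((rArr_sm.conv he4).add (aArr_sm.conv hX)) (h1.add h2).sm fun τ z hτ => ?_
  rw [cArr, JF_add (rArr_sm.conv he4 τ z hτ) (aArr_sm.conv hX τ z hτ), JF_add (h1.sm τ z hτ) (h2.sm τ z hτ),
    JF_conv (rArr_sm τ z hτ) (he4 τ z hτ), JF_conv (aArr_sm τ z hτ) (hX τ z hτ), JF_smul,
    JF_conv (he4 τ z hτ) (bArr_sm τ z hτ), JF_conv (he6 τ z hτ) (aArr_sm τ z hτ), JF_bArr hτ,
    JF_add ((he4.sub he6).smul _ τ z hτ) ((hp.conv he4).smul _ τ z hτ), JF_smul, JF_smul,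
    JF_sub (he4 τ z hτ) (he6 τ z hτ), JF_conv (hp τ z hτ) (he4 τ z hτ), JF_coll_ppArr hτ, wp0]
  ring

/-! ### A standard form of every index -/

/-- `bArr ^ m · wpN`, extended by zero to the lattice. -/
def stdForm (m : ℕ) (τ z : ℂ) : ℂ := if OffL τ z then JF bArr τ z ^ m * wpN τ z else 0

/-- The array of the finite part of `stdForm m`. -/
def stdArr (m : ℕ) : Arr := lpArr m (convPow bArr m) - conv p0Arr (convPow bArr m)

/-- The coefficient function `C(Δ,ℓ)` of an array of index `m`. -/
def coeffOf (m : ℕ) (c : Arr) (Δ l : ℤ) : ℂ :=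
  if 4 * (m : ℤ) ∣ Δ + l ^ 2 then c ((Δ + l ^ 2) / (4 * m), l) else 0

theorem coeffOf_apply (hm : 0 < m) (c : Arr) (p : ℤ × ℤ) :
    coeffOf m c (4 * m * p.1 - p.2 ^ 2) p.2 = c p := by
  have hm' : (4 * m : ℤ) ≠ 0 := by positivity
  rw [coeffOf, sub_add_cancel, if_pos (dvd_mul_right _ _), Int.mul_ediv_cancel_left _ hm']

theorem coeffOf_periodic (hm : 0 < m) (hc : Ell m c) (Δ l : ℤ) :
    coeffOf m c Δ (l + 2 * m) = coeffOf m c Δ l := by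
  have hm' : (4 * m : ℤ) ≠ 0 := by positivity
  have e : Δ + (l + 2 * m) ^ 2 = Δ + l ^ 2 + 4 * m * (l + m) := by ring
  unfold coeffOf
  simp only [e, Int.dvd_add_left (dvd_mul_right (4 * (m : ℤ)) (l + m))]
  split_ifs with h
  · rw [Int.add_mul_ediv_left _ _ hm']
    have := hc ((Δ + l ^ 2) / (4 * m)) l 1
    rw [← this]; congr 2 <;> ring
  · rfl

theorem isFinitePartCoeffs_of_array (hm : 0 < m) (hc : Ell m c) (hs : Sm c)
    (h : ∀ τ z : ℂ, 0 < τ.im → OffL τ z → JF c τ z = φ τ z - A2sum m τ z) :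
    IsFinitePartCoeffs m φ (coeffOf m c) := by
  refine ⟨coeffOf_periodic hm hc, fun Δ l h => if_neg h, fun τ hτ z hz => ?_⟩
  rw [← h τ z hτ hz]
  refine (hs τ z hτ).hasSum.congr_fun fun p => ?_
  rw [coeffOf_apply hm]; rfl

theorem offL_add_one_left : OffL (τ + 1) z ↔ OffL τ z := by
  constructor
  · intro h l k e
    exact h l (k - l) (by rw [e]; push_cast; ring)
  · intro h l k e
    exact h l (k + l) (by rw [e]; push_cast; ring)

/-- An even entire function `f` with `f 0 = 1` is `1 + z² g(z)`. -/
theorem exists_even_quotient {f : ℂ → ℂ} (hf : Differentiable ℂ f) (hev : ∀ z, f (-z) = f z) :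
    ∃ g : ℂ → ℂ, AnalyticAt ℂ g 0 ∧ ∀ z, f z = f 0 + z ^ 2 * g z := by
  have hd : deriv f 0 = 0 := by
    have h1 : HasDerivAt f (deriv f 0) 0 := (hf 0).hasDerivAt
    have h2 : HasDerivAt (fun z => f (-z)) (-deriv f 0) 0 := by
      have h3 : HasDerivAt f (deriv f 0) (-0) := by rwa [neg_zero]
      simpa [Function.comp_def] using h3.scomp (0 : ℂ) (hasDerivAt_neg (0 : ℂ))
    simp only [hev] at h2
    have := h1.unique h2
    linear_combination this / 2
  have h1 : Differentiable ℂ (dslope f 0) := by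
    rw [← differentiableOn_univ, differentiableOn_dslope univ_mem]
    exact hf.differentiableOn
  have h2 : Differentiable ℂ (dslope (dslope f 0) 0) := by
    rw [← differentiableOn_univ, differentiableOn_dslope univ_mem]
    exact h1.differentiableOn
  refine ⟨dslope (dslope f 0) 0, h2.analyticAt 0, fun z => ?_⟩
  have e1 := sub_smul_dslope f 0 z
  have e2 := sub_smul_dslope (dslope f 0) 0 z
  rw [dslope_same, hd] at e2
  simp only [smul_eq_mul, sub_zero] at e1 e2
  linear_combination -e1 - z * e2

theorem stdForm_isStandard (m : ℕ) : IsStandardForm m (stdForm m) := by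
  have hψ := bArr_wj.convPow m
  have hJ : ∀ τ : ℂ, 0 < τ.im → ∀ z, JF (convPow bArr m) τ z = JF bArr τ z ^ m :=
    fun τ hτ z => JF_convPow bArr_sm m hτ z
  simp only [mul_zero, mul_one] at hψ
  refine ⟨modularLaw_of_generators (fun τ z hτ => ?_) fun τ z hτ => ?_, fun τ hτ z l k => ?_,
    fun τ hτ z hz => ?_, fun τ hτ => ?_⟩
  · simp only [stdForm, offL_add_one_left, JF_add_one_left, wpN_add_one_left]
  · have h0 := ne_zero_of_im_pos hτ
    simp only [stdForm, offL_S h0]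
    split_ifs with h
    · have := hψ.slaw τ z hτ
      rw [hJ τ hτ, hJ _ (im_neg_one_div_pos hτ)] at this
      rw [this, wpN_S hτ h]
      simp; ring
    · simp
  · simp only [stdForm, offL_shift]
    split_ifs with h
    · have := JF_elliptic hψ.ell τ hτ z l k
      rw [hJ τ hτ, hJ τ hτ] at this
      rw [this, wpN_shift]; ring
    · simp
  · have hz' : OffL τ z := hz
    have h1 := ((bArr_sm.differentiable hτ z).pow m).mul (wpN_differentiableAt hτ hz')
    refine h1.congr_of_eventuallyEq ?_
    filter_upwards [hz'.eventually hτ] with x hx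
    simp [stdForm, hx]
  · obtain ⟨g, hg, hg0, hgz⟩ := wpN_expansion hτ
    obtain ⟨k, hk, hkz⟩ := exists_even_quotient (hψ.sm.differentiable_right hτ)
      (fun z => JF_even hψ.even τ z)
    have h00 : JF (convPow bArr m) τ 0 = 1 := by rw [hJ τ hτ, JF_bArr_zero hτ, one_pow]
    refine ⟨fun z => JF (convPow bArr m) τ z * g z + k z / (ϖ) ^ 2, ?_, ?_⟩
    · exact (((hψ.sm.differentiable_right hτ).analyticAt 0).mul hg).add (hk.div_const)
    · filter_upwards [hgz, eventually_offL_zero hτ, self_mem_nhdsWithin] with z h3 h4 h5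
      have hz0 : z ≠ 0 := h5
      have hpi := two_pi_I_ne_zero
      have h6 := hkz z
      rw [h00] at h6
      simp only [stdForm, if_pos h4]
      rw [← hJ τ hτ, ← h3]
      rw [show k z / (ϖ) ^ 2 = (JF (convPow bArr m) τ z - 1) /
        (ϖ * z) ^ 2 by rw [h6]; field_simp; ring]
      ring

theorem stdArr_sm (m : ℕ) : Sm (stdArr m) := by
  have hψ := bArr_wj.convPow m
  simp only [mul_one] at hψ
  exact (lpArr_sm hψ.sm hψ.ell hψ.even).sub (p0Arr_sm.conv hψ.sm)

theorem JF_stdArr (m : ℕ) (hτ : 0 < τ.im) (hz : OffL τ z) :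
    JF (stdArr m) τ z = stdForm m τ z - A2sum m τ z := by
  have hψ := bArr_wj.convPow m
  simp only [mul_one] at hψ
  rw [stdArr, JF_sub (lpArr_sm hψ.sm hψ.ell hψ.even τ z hτ) (p0Arr_sm.conv hψ.sm τ z hτ),
    JF_conv (p0Arr_sm τ z hτ) (hψ.sm τ z hτ), JF_lpArr hψ.sm hψ.ell hψ.even hτ hz, JF_p0Arr hτ,
    JF_convPow bArr_sm m hτ, JF_convPow bArr_sm m hτ, JF_bArr_zero hτ, stdForm, if_pos hz, wpN]
  simp; ring

theorem A2sum_shift (m : ℕ) (τ z : ℂ) (l k : ℤ) :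
    A2sum m τ (z + l * τ + k) = ee (-(m : ℂ) * (l ^ 2 * τ + 2 * l * z)) * A2sum m τ z := by
  rw [A2sum_eq, A2sum_eq, ← tsum_mul_left, ← (Equiv.addRight l).tsum_eq (fun s : ℤ =>
    ee (-(m : ℂ) * (l ^ 2 * τ + 2 * l * z)) * (ee (m * (s ^ 2 * τ + 2 * s * z)) * lam (s * τ + z)))]
  refine tsum_congr fun s => ?_
  simp only [Equiv.coe_addRight]
  have e1 : lam ((s : ℂ) * τ + (z + l * τ + k)) = lam (((s + l : ℤ) : ℂ) * τ + z) := by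
    unfold lam
    rw [show (s : ℂ) * τ + (z + l * τ + k) = (((s + l : ℤ) : ℂ) * τ + z) + k by push_cast; ring,
      ee_add_int]
  rw [e1, ← mul_assoc, ← ee_add]
  congr 1
  rw [show (m : ℂ) * ((s : ℂ) ^ 2 * τ + 2 * s * (z + l * τ + k)) =
    (-(m : ℂ) * (l ^ 2 * τ + 2 * l * z) + m * (((s + l : ℤ) : ℂ) ^ 2 * τ + 2 * ((s + l : ℤ) : ℂ) * z))
      + ((2 * m * s * k : ℤ) : ℂ) by push_cast; ring, ee_add_int]

theorem A2sum_neg (m : ℕ) (τ z : ℂ) : A2sum m τ (-z) = A2sum m τ z := by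
  rw [A2sum_eq, A2sum_eq, ← (Equiv.neg ℤ).tsum_eq]
  refine tsum_congr fun s => ?_
  simp only [Equiv.neg_apply, Int.cast_neg]
  rw [show -(s : ℂ) * τ + -z = -(s * τ + z) by ring, lam_neg]
  congr 2; ring

theorem stdArr_ell (m : ℕ) : Ell m (stdArr m) := ell_of_JF (stdArr_sm m) fun τ z hτ l => by
  refine eq_of_eq_offL hτ (f := fun z => JF (stdArr m) τ (z + l * τ)) (g := fun z =>
    ee (-(m : ℂ) * (l ^ 2 * τ + 2 * l * z)) * JF (stdArr m) τ z)
    (((stdArr_sm m).continuous_right hτ).comp (by fun_prop))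
    ((continuous_ee.comp (by fun_prop)).mul ((stdArr_sm m).continuous_right hτ)) (fun z hz => ?_) z
  have h1 : OffL τ (z + l * τ) := by simpa using (offL_shift l 0).mpr hz
  have h2 := A2sum_shift m τ z l 0
  have h3 := (stdForm_isStandard m).2.1 τ hτ z l 0
  simp only [Int.cast_zero, add_zero] at h2 h3
  rw [JF_stdArr m hτ hz, JF_stdArr m hτ h1, h2, h3]; ring

theorem stdArr_even (m : ℕ) : Evn (stdArr m) := even_of_JF (stdArr_sm m) fun τ z hτ => by
  refine eq_of_eq_offL hτ (f := fun z => JF (stdArr m) τ (-z))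
    (((stdArr_sm m).continuous_right hτ).comp (by fun_prop)) ((stdArr_sm m).continuous_right hτ)
    (fun z hz => ?_) z
  rw [JF_stdArr m hτ hz, JF_stdArr m hτ (offL_neg.mpr hz), A2sum_neg, stdForm, stdForm,
    if_pos hz, if_pos (offL_neg.mpr hz), wpN_neg, JF_even bArr_wj.even]

theorem convPow_low (h : LowAt 0 c) (n : ℕ) : LowAt 0 (convPow c n) := by
  induction n with
  | zero => exact LeadTerm.one.low
  | succ n ih =>
    have := conv_low h ih
    rwa [add_zero] at this

theorem stdArr_low (hm : 0 < m) : LowAt (-m) (stdArr m) := fun n r h => by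
  have hψ := bArr_wj.convPow m
  simp only [mul_one] at hψ
  have h1 := lpArr_low hm hψ.ell (convPow_low bArr_low m) n r h
  have h2 := conv_low p0Arr_low (convPow_low bArr_low m) n r (by omega)
  rw [stdArr, Pi.sub_apply, h1, h2, sub_zero]

/-! ### Constant terms of (quasi)modular forms of weight two -/

theorem Sm.of_norm_le {a b : Arr} (hb : Sm b) (h : ∀ p, ‖a p‖ ≤ ‖b p‖) : Sm a :=
  fun τ z hτ => Summable.of_norm_bounded (hb τ z hτ).norm fun p => by
    rw [norm_mul, norm_mul]
    exact mul_le_mul_of_nonneg_right (h p) (norm_nonneg _)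

theorem constant_term_weight_two {e : Arr} (he : Sm e) {κ : ℂ}
    (h : ∀ τ : ℂ, 0 < τ.im → JF e (-1 / τ) 0 = τ ^ 2 * (JF e τ 0 + κ / τ)) :
    ∑' r : ℤ, e (0, r) = κ * (I * π / 6) := by
  have hpi := two_pi_I_ne_zero
  set e' : Arr := fun p => if p.1 = 0 then 0 else e p / (ϖ * p.1) with he'
  have hsm' : Sm e' := he.of_norm_le fun p => by
    simp only [he']
    split_ifs with h0
    · simp
    · rw [norm_div]
      refine div_le_self (norm_nonneg _) ?_
      have h1 : (1 : ℝ) ≤ |(p.1 : ℝ)| := by exact_mod_cast Int.one_le_abs h0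
      have h2 := Real.pi_gt_three
      simp only [norm_mul, norm_ofNat, norm_real, norm_I,
        norm_intCast, Real.norm_eq_abs, abs_of_pos Real.pi_pos]
      nlinarith
  set c0 := ∑' r : ℤ, e (0, r) with hc0
  set e1 : Arr := fun p => if p.1 = 0 then 0 else e p with he1
  have hsm1 : Sm e1 := he.of_norm_le fun p => by
    simp only [he1]
    split_ifs <;> simp
  have hsm0 : Sm (e - e1) := he.sub hsm1
  have hJ : ∀ τ : ℂ, 0 < τ.im → JF e τ 0 = c0 + JF e1 τ 0 := by
    intro τ hτ
    have h1 := JF_sub (he τ 0 hτ) (hsm1 τ 0 hτ)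
    have h2 : JF (e - e1) τ 0 = c0 := by
      have h3 := (hsm0 τ 0 hτ).hasSum
      have hi : Function.Injective (fun r : ℤ => ((0 : ℤ), r)) := fun x y h => by simpa using h
      rw [← hi.hasSum_iff] at h3
      · refine h3.tsum_eq.symm.trans (tsum_congr fun r => ?_)
        simp [he1, chr, ee_zero]
      · rintro ⟨n, r⟩ hn
        have : n ≠ 0 := fun h0 => hn ⟨r, by simp [h0]⟩
        simp [he1, this]
    linear_combination h2 - h1
  have hd : ∀ τ : ℂ, 0 < τ.im → HasDerivAt (fun τ => c0 * τ + JF e' τ 0) (JF e τ 0) τ := by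
    intro τ hτ
    have h1 := ((hasDerivAt_id τ).const_mul c0).add (hsm'.hasDerivAt hτ 0).1
    refine h1.congr_deriv ?_
    rw [hJ τ hτ, mul_one, ← JF_smul]
    congr 2
    ext p
    simp only [he', he1, Pi.smul_apply, smul_eq_mul]
    split_ifs with h0
    · simp
    · have : (p.1 : ℂ) ≠ 0 := by exact_mod_cast h0
      field_simp
  set F : ℂ → ℂ := fun τ => c0 * τ + JF e' τ 0 with hF
  have hper : ∀ τ, F (τ + 1) = F τ + c0 := fun τ => by simp only [hF, JF_add_one_left]; ring
  have hopen : IsOpen {τ : ℂ | 0 < τ.im} := isOpen_lt continuous_const continuous_im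
  have hconn : IsPreconnected {τ : ℂ | 0 < τ.im} := (convex_halfSpace_im_gt 0).isPreconnected
  have hderiv : ∀ τ : ℂ, 0 < τ.im → HasDerivAt (fun τ => F (-1 / τ) - F τ - κ * log τ) 0 τ := by
    intro τ hτ
    have h0 := ne_zero_of_im_pos hτ
    have hslit : τ ∈ slitPlane := Or.inr hτ.ne'
    have h1 : HasDerivAt (fun τ : ℂ => -1 / τ) (1 / τ ^ 2) τ := by
      have := (hasDerivAt_inv h0).const_mul (-1 : ℂ)
      refine (this.congr_deriv (by field_simp)).congr_of_eventuallyEq ?_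
      exact Eventually.of_forall fun x => by simp [div_eq_mul_inv]
    have h2 := (hd (-1 / τ) (im_neg_one_div_pos hτ)).comp τ h1
    have h3 := (h2.sub (hd τ hτ)).sub ((hasDerivAt_log hslit).const_mul κ)
    refine h3.congr_deriv ?_
    rw [h τ hτ]
    field_simp
    ring
  have hconst := fun (x y : ℂ) (hx : 0 < x.im) (hy : 0 < y.im) =>
    hopen.is_const_of_deriv_eq_zero hconn
      (fun τ hτ => (hderiv τ hτ).differentiableAt.differentiableWithinAt)
      (fun τ hτ => (hderiv τ hτ).deriv) hx hy
  set ρ : ℂ := exp (π / 3 * I) with hρ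
  have hρre : ρ = 1 / 2 + (Real.sqrt 3 / 2 : ℝ) * I := by
    rw [hρ, exp_mul_I, show (π / 3 : ℂ) = ((π / 3 : ℝ) : ℂ) by push_cast; ring,
      ← ofReal_cos, ← ofReal_sin, Real.cos_pi_div_three, Real.sin_pi_div_three]
    push_cast; ring
  have hρim : 0 < ρ.im := by rw [hρre]; simp
  have hlogρ : log ρ = π / 3 * I := by rw [hρ, log_exp] <;> simp <;> linarith [Real.pi_pos]
  have hsq : ((Real.sqrt 3 : ℝ) : ℂ) ^ 2 = 3 := by
    rw [← ofReal_pow, Real.sq_sqrt (by norm_num)]; norm_num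
  have hρ2 : -1 / ρ = ρ - 1 := by
    rw [div_eq_iff (ne_zero_of_im_pos hρim), hρre]
    push_cast
    linear_combination (-1 / 4 : ℂ) * (hsq * I ^ 2 + 3 * I_sq)
  have hI : -1 / I = I := by rw [div_eq_iff I_ne_zero, I_mul_I]
  have h1 := hconst I ρ (by simp) hρim
  have h2 := hper (ρ - 1)
  rw [sub_add_cancel] at h2
  simp only [hI, hρ2, hlogρ, log_I] at h1
  linear_combination h1 - h2

theorem constant_term_of_wj (h : WJ 2 0 c) : c (0, 0) = 0 := by
  have h1 := constant_term_weight_two h.sm (κ := 0) fun τ hτ => by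
    have := h.slaw τ 0 hτ
    simp only [zero_div, ne_eq, OfNat.ofNat_ne_zero, not_false_eq_true, zero_pow, mul_zero, ee_zero,
      mul_one] at this
    rw [this]; simp
  rw [zero_mul, tsum_eq_single 0] at h1
  · exact h1
  · intro r hr
    by_contra h0
    have hell : ∀ l : ℤ, c (0 + r * l, r) = c (0, r) := fun l => by
      have := h.ell 0 r l
      simpa using this
    obtain ⟨N, hN⟩ := h.low
    have : c (0 + r * (-(r * (|N| + 1))), r) = 0 := by
      refine hN _ _ ?_
      have := neg_abs_le N
      have := abs_nonneg N
      have : 0 < r ^ 2 := by positivity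
      nlinarith
    rw [hell] at this
    exact h0 this

/-! ### The finite part of a standard form -/

/-- The Fourier array of a coefficient function. -/
def arrOf (m : ℕ) (C : ℤ → ℤ → ℂ) (p : ℤ × ℤ) : ℂ := C (4 * m * p.1 - p.2 ^ 2) p.2

structure FinitePart (m : ℕ) (φ : ℂ → ℂ → ℂ) (c : Arr) : Prop where
  sm : Sm c
  ell : Ell m c
  even : Evn c
  eq : ∀ τ z : ℂ, 0 < τ.im → OffL τ z → JF c τ z = φ τ z - A2sum m τ z

theorem IsStandardForm.even (h : IsStandardForm m φ) (hτ : 0 < τ.im)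
    (z : ℂ) : φ τ (-z) = φ τ z := by
  have := h.1 τ hτ z (-1) 0 0 (-1) (by norm_num)
  simpa [ee_zero, div_neg] using this

theorem arrOf_ell {C : ℤ → ℤ → ℂ} (h : ∀ Δ l : ℤ, C Δ (l + 2 * (m : ℤ)) = C Δ l) :
    Ell m (arrOf m C) := fun n r l => by
  have h1 : Periodic (C (4 * m * n - r ^ 2)) (2 * m) := h _
  have := h1.int_mul l r
  simp only [arrOf]
  rw [← this]
  push_cast
  congr 1 <;> ring

theorem IsFinitePartCoeffs.finitePart {C : ℤ → ℤ → ℂ}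
    (hφ : IsStandardForm m φ) (hC : IsFinitePartCoeffs m φ C) : FinitePart m φ (arrOf m C) := by
  have hsm : Sm (arrOf m C) := fun τ z hτ => by
    by_cases hz : OffL τ z
    · exact (hC.2.2 τ hτ z hz).summable
    · have hz' : OffL τ (z + 1 / 2) := by
        intro a b e
        simp only [OffL, not_forall, not_not] at hz
        obtain ⟨l, k, e'⟩ := hz
        have e2 : (1 / 2 : ℂ) = ((a - l : ℤ) : ℂ) * τ + ((b - k : ℤ) : ℂ) := by
          push_cast; linear_combination e - e'
        have him := congrArg im e2
        have hre := congrArg re e2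
        simp at him hre
        rcases him with h | h
        · rw [show ((a : ℝ) - l) = 0 by exact_mod_cast h] at hre
          have : (1 : ℝ) = 2 * ((b - k : ℤ) : ℝ) := by push_cast; linarith
          have : (1 : ℤ) = 2 * (b - k) := by exact_mod_cast this
          omega
        · exact hτ.ne' h
      have h1 : SmAt (arrOf m C) τ (z + 1 / 2) := (hC.2.2 τ hτ _ hz').summable
      exact h1.congr_im rfl (by simp)
  have heq : ∀ τ z : ℂ, 0 < τ.im → OffL τ z → JF (arrOf m C) τ z = φ τ z - A2sum m τ z :=
    fun τ z hτ hz => (hC.2.2 τ hτ z hz).tsum_eq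
  refine ⟨hsm, arrOf_ell hC.1, even_of_JF hsm fun τ z hτ => ?_, heq⟩
  refine eq_of_eq_offL hτ (f := fun z => JF (arrOf m C) τ (-z))
    ((hsm.continuous_right hτ).comp (by fun_prop)) (hsm.continuous_right hτ) (fun z hz => ?_) z
  rw [heq _ _ hτ hz, heq _ _ hτ (offL_neg.mpr hz), A2sum_neg, hφ.even hτ]

theorem stdForm_finitePart (m : ℕ) : FinitePart m (stdForm m) (stdArr m) :=
  ⟨stdArr_sm m, stdArr_ell m, stdArr_even m, fun _ _ hτ hz => JF_stdArr m hτ hz⟩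

/-! ### The constant Laurent coefficient at `z = 0` -/

/-- The constant Laurent coefficient at `z = 0`. -/
def lc (φ : ℂ → ℂ → ℂ) (τ : ℂ) : ℂ :=
  limUnder (𝓝[≠] (0 : ℂ)) fun z => φ τ z - 1 / (ϖ * z) ^ 2

theorem IsStandardForm.tendsto_lc (h : IsStandardForm m φ)
    (hτ : 0 < τ.im) : Tendsto (fun z => φ τ z - 1 / (ϖ * z) ^ 2)
      (𝓝[≠] (0 : ℂ)) (𝓝 (lc φ τ)) := by
  obtain ⟨g, hg, hz⟩ := h.2.2.2 τ hτ
  have : Tendsto g (𝓝[≠] 0) (𝓝 (g 0)) := hg.continuousAt.tendsto.mono_left nhdsWithin_le_nhds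
  exact tendsto_nhds_limUnder ⟨g 0, this.congr' (hz.mono fun z hz => hz.symm)⟩

theorem tendsto_lc_A2sum (h : IsStandardForm m φ) (hc : FinitePart m φ c) (hτ : 0 < τ.im) :
    Tendsto (fun z => A2sum m τ z - 1 / (ϖ * z) ^ 2)
      (𝓝[≠] (0 : ℂ)) (𝓝 (lc φ τ - JF c τ 0)) := by
  have h1 : Tendsto (JF c τ) (𝓝[≠] 0) (𝓝 (JF c τ 0)) :=
    (hc.sm.continuous_right hτ).continuousAt.tendsto.mono_left nhdsWithin_le_nhds
  refine ((h.tendsto_lc hτ).sub h1).congr' ?_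
  filter_upwards [eventually_offL_zero hτ] with z hz
  rw [hc.eq τ z hτ hz]; ring

theorem lc_A2sum (h : IsStandardForm m φ)
    (hc : FinitePart m φ c) (hτ : 0 < τ.im) : lc (A2sum m) τ = lc φ τ - JF c τ 0 :=
  (tendsto_lc_A2sum h hc hτ).limUnder_eq

theorem tendsto_mul_right_punctured (h0 : τ ≠ 0) :
    Tendsto (fun z : ℂ => z / τ) (𝓝[≠] 0) (𝓝[≠] 0) := by
  apply tendsto_nhdsWithin_of_tendsto_nhds_of_eventually_within
  · have : ContinuousAt (fun z : ℂ => z / τ) 0 := by fun_prop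
    have := this.tendsto
    rw [zero_div] at this
    exact this.mono_left nhdsWithin_le_nhds
  · filter_upwards [self_mem_nhdsWithin] with w hw
    exact div_ne_zero hw h0

theorem IsStandardForm.lc_S (hm : 0 < m) (h : IsStandardForm m φ) (hτ : 0 < τ.im) :
    lc φ (-1 / τ) = τ ^ 2 * (lc φ τ + m / (ϖ) / τ) := by
  have h0 := ne_zero_of_im_pos hτ
  have hpi := two_pi_I_ne_zero
  have hm0 : (m : ℂ) ≠ 0 := by exact_mod_cast hm.ne'
  have h1 := (h.tendsto_lc (im_neg_one_div_pos hτ)).comp (tendsto_mul_right_punctured h0)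
  have hw : Tendsto (fun z : ℂ => (m : ℂ) * z ^ 2 / τ) (𝓝[≠] 0) (𝓝[≠] 0) := by
    apply tendsto_nhdsWithin_of_tendsto_nhds_of_eventually_within
    · have : ContinuousAt (fun z : ℂ => (m : ℂ) * z ^ 2 / τ) 0 := by fun_prop
      have := this.tendsto
      simp only [ne_eq, OfNat.ofNat_ne_zero, not_false_eq_true, zero_pow, mul_zero, zero_div] at this
      exact this.mono_left nhdsWithin_le_nhds
    · filter_upwards [self_mem_nhdsWithin] with w hw
      have : w ≠ 0 := hw
      simp [this, h0, hm0]
  have h2 := ((hasDerivAt_iff_tendsto_slope_zero.mp (hasDerivAt_ee 0)).comp hw).mul_const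
    ((m : ℂ) / τ / (ϖ) ^ 2)
  have h3 : Tendsto (fun z : ℂ => ee ((m : ℂ) * z ^ 2 / τ)) (𝓝[≠] 0) (𝓝 1) := by
    have := (continuous_ee.tendsto 0).comp (hw.mono_right nhdsWithin_le_nhds)
    rwa [ee_zero] at this
  have h4 := ((h3.mul (h.tendsto_lc hτ)).add h2).const_mul (τ ^ 2)
  have h5 : lc φ (-1 / τ) = _ := tendsto_nhds_unique h1 (h4.congr' ?_)
  · rw [h5, ee_zero]
    field_simp
  · filter_upwards [self_mem_nhdsWithin] with z hz
    have hz0 : z ≠ 0 := hz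
    have hS := h.1 τ hτ z 0 (-1) 1 0 (by norm_num)
    simp only [Int.cast_zero, zero_mul, Int.cast_neg, Int.cast_one, zero_add, one_mul, add_zero,
      mul_one] at hS
    simp only [Function.comp, hS, zero_add, ee_zero, smul_eq_mul]
    rw [show (τ ^ (2 : ℤ) : ℂ) = τ ^ 2 by norm_cast]
    field_simp
    ring

/-! ### Torsion translates -/

/-- The specialization of `φ` at the torsion point `(aτ + b)/N`, suitably normalized. -/
def tor (m N : ℕ) (φ : ℂ → ℂ → ℂ) (τ : ℂ) (a b : ℤ) : ℂ :=
  ee (m * ((a / N : ℂ) ^ 2 * τ + a / N * (b / N))) * φ τ (a / N * τ + b / N)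

theorem tor_shift {m N : ℕ} (hN : 0 < N) (hNm : N ∣ m) (h : EllipticLaw m φ)
    (hτ : 0 < τ.im) (a b l k : ℤ) : tor m N φ τ (a + N * l) (b + N * k) = tor m N φ τ a b := by
  have hN0 : (N : ℂ) ≠ 0 := by exact_mod_cast hN.ne'
  obtain ⟨M, rfl⟩ := hNm
  unfold tor
  have e1 : ((a + N * l : ℤ) / N : ℂ) * τ + ((b + N * k : ℤ) / N : ℂ) =
      (a / N * τ + b / N) + l * τ + k := by
    push_cast; field_simp; ring
  rw [e1, h τ hτ, ← mul_assoc, ← ee_add]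
  congr 1
  rw [← ee_add_int _ (-(M * (a * k)) + M * l * b - N * M * l * k)]
  congr 1
  push_cast; field_simp; ring

theorem tor_congr {m N : ℕ} (hN : 0 < N) (hNm : N ∣ m) (h : EllipticLaw m φ)
    (hτ : 0 < τ.im) {a b a' b' : ℤ} (ha : (a : ZMod N) = a') (hb : (b : ZMod N) = b') :
    tor m N φ τ a b = tor m N φ τ a' b' := by
  obtain ⟨l, hl⟩ := (ZMod.intCast_eq_intCast_iff_dvd_sub _ _ _).mp ha.symm
  obtain ⟨k, hk⟩ := (ZMod.intCast_eq_intCast_iff_dvd_sub _ _ _).mp hb.symm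
  rw [← tor_shift hN hNm h hτ a' b' l k]
  congr 1 <;> omega

/-- The sum of the specializations at all nonzero `N`-torsion points. -/
def torSum (m N : ℕ) [NeZero N] (φ : ℂ → ℂ → ℂ) (τ : ℂ) : ℂ :=
  ∑ x ∈ (univ : Finset (ZMod N × ZMod N)).erase 0, tor m N φ τ x.1.val x.2.val

theorem torSum_S {m N : ℕ} [NeZero N] (hNm : N ∣ m) (h : EllipticLaw m φ)
    (h2 : ModularLaw 2 m φ) (hτ : 0 < τ.im) :
    torSum m N φ (-1 / τ) = τ ^ 2 * torSum m N φ τ := by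
  have hN : 0 < N := NeZero.pos N
  have hN0 : (N : ℂ) ≠ 0 := by exact_mod_cast hN.ne'
  have h0 := ne_zero_of_im_pos hτ
  rw [torSum, torSum, mul_sum]
  refine sum_bij' (fun x _ => (x.2, -x.1)) (fun x _ => (-x.2, x.1)) ?_ ?_ ?_ ?_ ?_
  · intro x hx
    simp only [mem_erase, ne_eq, mem_univ, and_true, Prod.mk_eq_zero, neg_eq_zero] at hx ⊢
    exact fun h => hx (Prod.ext h.2 h.1)
  · intro x hx
    simp only [mem_erase, ne_eq, mem_univ, and_true, Prod.mk_eq_zero, neg_eq_zero] at hx ⊢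
    exact fun h => hx (Prod.ext h.2 h.1)
  · intro x _; simp
  · intro x _; simp
  · intro x _
    rw [tor_congr hN hNm h hτ (a := (x.2.val : ℤ)) (a' := (x.2.val : ℤ))
      (b := ((-x.1).val : ℤ)) (b' := -(x.1.val : ℤ)) rfl (by simp)]
    unfold tor
    set a : ℂ := (x.1.val : ℂ)
    set b : ℂ := (x.2.val : ℂ)
    have hS := h2 τ hτ (b / N * τ - a / N) 0 (-1) 1 0 (by norm_num)
    simp only [Int.cast_zero, zero_mul, Int.cast_neg, Int.cast_one, zero_add, one_mul, add_zero,
      mul_one] at hS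
    rw [show (((x.1.val : ℤ) : ℂ) / N) * (-1 / τ) + ((x.2.val : ℤ) : ℂ) / N =
      (b / N * τ - a / N) / τ by push_cast; field_simp; ring, hS]
    rw [show (τ ^ (2 : ℤ) : ℂ) = τ ^ 2 by norm_cast]
    rw [show ((((x.2.val : ℤ)) : ℂ) / N * τ + ((-(x.1.val : ℤ) : ℤ) : ℂ) / N) =
      b / N * τ - a / N by push_cast; ring]
    rw [show ∀ A B C D E : ℂ, A * (B * C * D) = B * (A * C * D) by intros; ring, ← ee_add]
    · congr 3
      push_cast; field_simp; ring
    · exact 0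

theorem torSum_add_one {m N : ℕ} [NeZero N] (hNm : N ∣ m) (h : EllipticLaw m φ)
    (hτ : 0 < τ.im) (hT : ∀ z, φ (τ + 1) z = φ τ z) :
    torSum m N φ (τ + 1) = torSum m N φ τ := by
  rw [torSum, torSum]
  refine sum_bij' (fun x _ => (x.1, x.1 + x.2)) (fun x _ => (x.1, x.2 - x.1)) ?_ ?_ ?_ ?_ ?_
  · intro x hx
    simp only [mem_erase, ne_eq, mem_univ, and_true, Prod.mk_eq_zero] at hx ⊢
    exact fun h => hx (Prod.ext h.1 (by simpa [h.1] using h.2))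
  · intro x hx
    simp only [mem_erase, ne_eq, mem_univ, and_true, Prod.mk_eq_zero] at hx ⊢
    exact fun h => hx (Prod.ext h.1 (by simpa [h.1] using h.2))
  · intro x _; simp
  · intro x _; simp
  · intro x _
    rw [tor_congr (NeZero.pos N) hNm h hτ (a := (x.1.val : ℤ)) (a' := (x.1.val : ℤ))
      (b := ((x.1 + x.2).val : ℤ)) (b' := (x.1.val : ℤ) + (x.2.val : ℤ)) rfl (by simp)]
    unfold tor
    rw [hT]
    congr 2
    · push_cast; ring
    · push_cast; ring

theorem sum_ee_torsion {N : ℕ} [NeZero N] (k : ℤ) :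
    ∑ b : ZMod N, ee (k * b.val / N) = if (N : ℤ) ∣ k then (N : ℂ) else 0 := by
  have hN0 : (N : ℂ) ≠ 0 := NeZero.ne _
  have e1 : ∑ b : ZMod N, ee (k * b.val / N) = ∑ b ∈ range N, ee (k / N) ^ b := by
    obtain ⟨n, rfl⟩ : ∃ n, N = n + 1 := ⟨N - 1, by have := NeZero.pos N; omega⟩
    rw [← Fin.sum_univ_eq_sum_range (fun b => ee (k / ((n + 1 : ℕ) : ℂ)) ^ b) (n + 1)]
    refine sum_congr rfl fun b _ => ?_
    change ee (k * ((Fin.val (n := n + 1) b : ℕ) : ℂ) / _) = ee _ ^ (Fin.val (n := n + 1) b)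
    rw [← ee_nat_mul]
    congr 1
    ring
  have hpow : ee (k / N) ^ N = 1 := by rw [← ee_nat_mul, mul_div_cancel₀ _ hN0, ee_int]
  rw [e1]
  split_ifs with h
  · obtain ⟨j, rfl⟩ := h
    have : ee (((N : ℤ) * j : ℤ) / N : ℂ) = 1 := by
      rw [show (((N : ℤ) * j : ℤ) / N : ℂ) = (j : ℤ) by push_cast; field_simp, ee_int]
    simp only [this, one_pow, sum_const, Finset.card_range, nsmul_eq_mul, mul_one]
  · have hne : ee (k / N) ≠ 1 := by
      rw [Ne, ee_eq_one_iff]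
      rintro ⟨j, hj⟩
      apply h
      rw [div_eq_iff hN0] at hj
      exact ⟨j, by rw [mul_comm]; exact_mod_cast hj⟩
    rw [geom_sum_eq hne, hpow, sub_self, zero_div]

/-! ### Constant terms of the torsion sums -/

/-- Shear of the index set by `n ↦ n + a⌊(Ma + r)/N⌋`. -/
def shearEquiv (N M : ℕ) (a : ℤ) : ℤ × ℤ ≃ ℤ × ℤ where
  toFun p := (p.1 + a * ((M * a + p.2) / N), p.2)
  invFun p := (p.1 - a * ((M * a + p.2) / N), p.2)
  left_inv p := by simp
  right_inv p := by simp

/-- The array of `∑_b tor (JF c) τ a b`, divided by `N`. -/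
def torArr (N M : ℕ) (c : Arr) (a : ℤ) (p : ℤ × ℤ) : ℂ :=
  if (N : ℤ) ∣ M * a + p.2 then c ((shearEquiv N M a).symm p) else 0

theorem torArr_shear {N M : ℕ} [NeZero N] (c : Arr) (a : ℤ) (τ z : ℂ) (p : ℤ × ℤ) :
    torArr N M c a (shearEquiv N M a p) * chr τ z (shearEquiv N M a p) =
      ee ((N * M : ℕ) * (a / N : ℂ) ^ 2 * τ) *
        ((if (N : ℤ) ∣ M * a + p.2 then 1 else 0) * (c p * chr τ (a / N * τ + z) p)) := by
  have hN0 : (N : ℂ) ≠ 0 := NeZero.ne _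
  have e2 : (shearEquiv N M a p).2 = p.2 := rfl
  rw [torArr, e2, Equiv.symm_apply_apply]
  split_ifs with h
  · obtain ⟨j, hj⟩ := h
    have hN1 : (N : ℤ) ≠ 0 := NeZero.ne _
    have e1 : (shearEquiv N M a p).1 = p.1 + a * j := by
      simp only [shearEquiv, Equiv.coe_fn_mk, hj, Int.mul_ediv_cancel_left _ hN1]
    have hjc : (M : ℂ) * a + p.2 = N * j := by exact_mod_cast hj
    rw [chr, e1, e2, chr, one_mul]
    rw [show ∀ A B C : ℂ, A * (B * C) = B * (A * C) by intros; ring, ← ee_add]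
    congr 2
    push_cast
    field_simp
    linear_combination -(a : ℂ) * τ * hjc
  · simp

theorem torArr_sm {N M : ℕ} [NeZero N] (hc : Sm c) (a : ℤ) : Sm (torArr N M c a) := fun τ z hτ => by
  rw [SmAt, ← (shearEquiv N M a).summable_iff]
  refine (Summable.of_norm_bounded (hc τ (a / N * τ + z) hτ).norm fun p => ?_ :
    Summable fun p : ℤ × ℤ => (if (N : ℤ) ∣ M * a + p.2 then 1 else 0) *
      (c p * chr τ (a / N * τ + z) p)).mul_left
      (ee ((N * M : ℕ) * (a / N : ℂ) ^ 2 * τ)) |>.congr fun p => (torArr_shear c a τ z p).symm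
  split_ifs
  · simp
  · simpa using mul_nonneg (norm_nonneg _) (norm_nonneg _)

theorem sum_tor_JF {N M : ℕ} [NeZero N] (hc : Sm c) (a : ℤ) (hτ : 0 < τ.im) :
    ∑ b : ZMod N, tor (N * M) N (JF c) τ a b.val = N * JF (torArr N M c a) τ 0 := by
  have hN0 : (N : ℂ) ≠ 0 := NeZero.ne _
  have h1 : ∀ b : ZMod N, HasSum (fun p : ℤ × ℤ => ee ((N * M : ℕ) * (a / N : ℂ) ^ 2 * τ) *
      (ee ((M * a + p.2 : ℤ) * b.val / N) * (c p * chr τ (a / N * τ + 0) p)))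
      (tor (N * M) N (JF c) τ a b.val) := by
    intro b
    have := (hc τ (a / N * τ + b.val / N) hτ).hasSum.mul_left
      (ee ((N * M : ℕ) * ((a / N : ℂ) ^ 2 * τ + a / N * (b.val / N))))
    refine (this.congr_fun fun p => ?_)
    rw [chr, chr]
    rw [show ∀ A B C D : ℂ, A * (B * (C * D)) = C * (A * B * D) by intros; ring, ← ee_add, ← ee_add,
      show ∀ A C D : ℂ, A * (C * D) = C * (A * D) by intros; ring, ← ee_add]
    congr 2
    push_cast
    field_simp
    ring
  have h2 := hasSum_sum fun b (_ : b ∈ (univ : Finset (ZMod N))) => h1 b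
  have h3 := ((shearEquiv N M a).hasSum_iff.mpr
    (torArr_sm (N := N) (M := M) hc a τ 0 hτ).hasSum).mul_left (N : ℂ)
  refine h2.unique (h3.congr_fun fun p => ?_)
  simp only [Function.comp]
  rw [torArr_shear, ← mul_sum, ← sum_mul, sum_ee_torsion]
  split_ifs <;> ring

theorem Sm.sum {ι : Type*} {s : Finset ι} {f : ι → Arr} (h : ∀ i ∈ s, Sm (f i)) :
    Sm (∑ i ∈ s, f i) ∧ ∀ τ z : ℂ, 0 < τ.im → JF (∑ i ∈ s, f i) τ z = ∑ i ∈ s, JF (f i) τ z := by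
  induction s using Finset.induction_on with
  | empty => exact ⟨Sm.zero, fun τ z _ => JF_zero τ z⟩
  | insert i s hi ih =>
    obtain ⟨h1, h2⟩ := ih fun j hj => h j (mem_insert_of_mem hj)
    have h0 := h i (mem_insert_self i s)
    rw [sum_insert hi]
    exact ⟨h0.add h1, fun τ z hτ => by
      rw [JF_add (h0 τ z hτ) (h1 τ z hτ), h2 τ z hτ, sum_insert hi]⟩

/-- The array of the sum over all torsion points. -/
def torTot (N M : ℕ) [NeZero N] (c : Arr) : Arr := (N : ℂ) • ∑ a : ZMod N, torArr N M c a.val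

theorem torTot_sm {N M : ℕ} [NeZero N] (hc : Sm c) : Sm (torTot N M c) :=
  (Sm.sum fun _ _ => torArr_sm hc _).1.smul _

theorem JF_torTot {N M : ℕ} [NeZero N] (hc : Sm c) (hτ : 0 < τ.im) :
    JF (torTot N M c) τ 0 = torSum (N * M) N (JF c) τ + JF c τ 0 := by
  rw [torTot, JF_smul, (Sm.sum fun a _ => torArr_sm hc _).2 τ 0 hτ, mul_sum]
  simp only [← sum_tor_JF hc _ hτ]
  rw [← Finset.sum_product', torSum, Finset.univ_product_univ,
    ← sum_erase_add _ _ (mem_univ (0 : ZMod N × ZMod N))]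
  simp [tor, ee_zero]

theorem tsum_torTot {N M : ℕ} [NeZero N] (hco : Nat.Coprime N M) {C : ℤ → ℤ → ℂ}
    (hper : ∀ Δ l : ℤ, C Δ (l + 2 * ((N * M : ℕ) : ℤ)) = C Δ l)
    {r₀ : ℤ} (h1 : (2 * N : ℤ) ∣ r₀ + 1) (h2 : (2 * M : ℤ) ∣ r₀ - 1) (hs : Sm (arrOf (N * M) C)) :
    HasSum (fun r : ℤ => C (-r ^ 2) (r₀ * r))
      ((∑' r : ℤ, torTot N M (arrOf (N * M) C) (0, r)) / N) := by
  have hN0 : (N : ℂ) ≠ 0 := NeZero.ne _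
  set c := arrOf (N * M) C
  have hrow : ∀ a : ZMod N, Summable fun r : ℤ => torArr N M c a.val (0, r) := fun a => by
    have := (torArr_sm (N := N) (M := M) hs a.val I 0 (by simp)).prod_factor 0
    refine this.congr fun r => ?_
    simp [chr, ee_zero]
  have hpl : ∀ Δ l k : ℤ, C Δ (l + 2 * (N * M) * k) = C Δ l := fun Δ l k => by
    have h : Periodic (C Δ) (2 * ((N * M : ℕ) : ℤ)) := hper Δ
    have := h.int_mul k l
    rw [← this]; congr 1; push_cast; ring
  have hval : ∀ a : ZMod N, ∀ r : ℤ, torArr N M c a.val (0, r - 2 * M * a.val) =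
      if (M : ZMod N) * a = r then C (-r ^ 2) (r₀ * r) else 0 := by
    intro a r
    have hiff : (N : ℤ) ∣ M * a.val + (r - 2 * M * a.val) ↔ (M : ZMod N) * a = r := by
      rw [← ZMod.intCast_zmod_eq_zero_iff_dvd]
      push_cast
      rw [ZMod.natCast_zmod_val]
      constructor
      · intro h; linear_combination -h
      · intro h; linear_combination -h
    rw [torArr]
    simp only [hiff]
    split_ifs with h
    · obtain ⟨j, hj⟩ := hiff.mpr h
      have hN1 : (N : ℤ) ≠ 0 := NeZero.ne _
      simp only [shearEquiv, Equiv.coe_fn_symm_mk, hj, Int.mul_ediv_cancel_left _ hN1, c, arrOf]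
      obtain ⟨u, hu⟩ := h1
      obtain ⟨v, hv⟩ := h2
      have hgcd : IsCoprime (N : ℤ) (M : ℤ) := Nat.isCoprime_iff_coprime.mpr hco
      have hd : (N * M : ℤ) ∣ (M * v * r + M * a.val) := by
        refine hgcd.mul_dvd ?_ (dvd_add ⟨v * r, by ring⟩ ⟨_, rfl⟩)
        refine ⟨u * r - j, ?_⟩
        have : 2 * (N * u) = 2 * (M * v) + 2 := by linarith
        have : (N : ℤ) * u = M * v + 1 := by linarith
        linear_combination -r * this - hj
      obtain ⟨w, hw⟩ := hd
      rw [← hpl _ (r - 2 * M * a.val) w]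
      congr 1
      · push_cast
        linear_combination (4 * M * (a.val : ℤ)) * hj
      · linear_combination -r * hv - 2 * hw
    · rfl
  have hsh : ∀ a : ZMod N, HasSum (fun r : ℤ => if (M : ZMod N) * a = r then C (-r ^ 2) (r₀ * r) else 0)
      (∑' r : ℤ, torArr N M c a.val (0, r)) := fun a => by
    have := (Equiv.subRight (2 * M * a.val : ℤ)).hasSum_iff.mpr (hrow a).hasSum
    refine this.congr_fun fun r => ?_
    simp only [Function.comp, Equiv.subRight_apply]
    rw [hval]
  have hu : IsUnit (M : ZMod N) := (ZMod.isUnit_iff_coprime M N).mpr hco.symm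
  have htot := hasSum_sum fun a (_ : a ∈ (univ : Finset (ZMod N))) => hsh a
  have e1 : (∑' r : ℤ, torTot N M c (0, r)) / N = ∑ a : ZMod N, ∑' r : ℤ, torArr N M c a.val (0, r) := by
    simp only [torTot, Pi.smul_apply, Finset.sum_apply, smul_eq_mul]
    rw [tsum_mul_left, mul_div_cancel_left₀ _ hN0, Summable.tsum_finsetSum fun a _ => hrow a]
  rw [e1]
  refine htot.congr_fun fun r => ?_
  obtain ⟨v, hv⟩ := hu
  rw [sum_eq_single (((v⁻¹ : (ZMod N)ˣ) : ZMod N) * r)]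
  · rw [if_pos]; rw [← hv]; simp
  · intro b _ hb
    rw [if_neg]
    intro h
    apply hb
    rw [← h, ← hv]; simp
  · simp

/-! ### The Appell–Lerch contribution -/

theorem A2sum_elliptic (m : ℕ) : EllipticLaw m (A2sum m) := fun τ _ z l k => A2sum_shift m τ z l k

theorem A2sum_add_one (m : ℕ) (τ z : ℂ) : A2sum m (τ + 1) z = A2sum m τ z := by
  rw [A2sum_eq, A2sum_eq]
  refine tsum_congr fun s => ?_
  rw [show (m : ℂ) * ((s : ℂ) ^ 2 * (τ + 1) + 2 * s * z) = m * ((s : ℂ) ^ 2 * τ + 2 * s * z) +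
    ((m * s ^ 2 : ℤ) : ℂ) by push_cast; ring, ee_add_int, lam, lam,
    show (s : ℂ) * (τ + 1) + z = (s * τ + z) + s by ring, ee_add_int]

theorem norm_lam_le_of_im {x : ℂ} {Q : ℝ} (hQ : Q < 1) (h : Real.exp (-(2 * π * |x.im|)) ≤ Q) :
    ‖lam x‖ ≤ Q / (1 - Q) ^ 2 := by
  have key : ∀ y : ℂ, 0 ≤ y.im → Real.exp (-(2 * π * |y.im|)) ≤ Q → ‖lam y‖ ≤ Q / (1 - Q) ^ 2 := by
    intro y hy h
    have hW : ‖ee y‖ ≤ Q := by rw [norm_ee]; rwa [abs_of_nonneg hy] at h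
    have h0 := norm_nonneg (ee y)
    refine (norm_lam_le (by linarith)).trans ?_
    have h1 : (1 - Q) ^ 2 ≤ (1 - ‖ee y‖) ^ 2 := by apply pow_le_pow_left₀ <;> linarith
    have h2 : 0 < (1 - Q) ^ 2 := by
      have : 0 < 1 - Q := by linarith
      positivity
    exact div_le_div₀ (h0.trans hW) hW h2 h1
  rcases le_total 0 x.im with hx | hx
  · exact key x hx h
  · rw [← lam_neg]
    exact key (-x) (by simpa using hx) (by simpa using h)

theorem summable_half_pow_natAbs : Summable fun s : ℤ => (1 / 2 : ℝ) ^ s.natAbs := by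
  rw [summable_int_iff_summable_nat_and_neg]
  simp only [Int.natAbs_natCast, Int.natAbs_neg, and_self]
  exact summable_geometric_of_lt_one (by norm_num) (by norm_num)

theorem A2sum_sub_lam_bound (m : ℕ) : ∃ K : ℝ, ∀ τ z : ℂ, 1 ≤ τ.im → |z.im| ≤ τ.im / 2 →
    ‖A2sum m τ z - lam z‖ ≤ K * Real.exp (-(π * τ.im)) := by
  refine ⟨∑' s : ℤ, 8 * (1 / 2 : ℝ) ^ s.natAbs, fun τ z hτ hz => ?_⟩
  set Q := Real.exp (-(π * τ.im)) with hQ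
  have hpi := Real.pi_gt_three
  have hQ0 : 0 < Q := Real.exp_pos _
  have hQ2 : Q ≤ 1 / 2 := by
    have h1 : Q ≤ Real.exp (-1) := Real.exp_le_exp.mpr (by nlinarith)
    have h2 := Real.exp_neg_one_lt_half
    linarith
  set t : ℤ → ℂ := fun s => ee (m * (s ^ 2 * τ + 2 * s * z)) * lam (s * τ + z) with ht
  have hb : ∀ s : ℤ, ‖if s = 0 then 0 else t s‖ ≤ Q * (8 * (1 / 2 : ℝ) ^ s.natAbs) := by
    intro s
    split_ifs with hs
    · rw [norm_zero]; positivity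
    · have hs1 : 1 ≤ s.natAbs := Int.natAbs_pos.mpr hs
      have hab : (s.natAbs : ℝ) = |(s : ℝ)| := by rw [Nat.cast_natAbs, Int.cast_abs]
      have hs1' : (1 : ℝ) ≤ |(s : ℝ)| := by rw [← hab]; exact_mod_cast hs1
      have hsz : |(s : ℝ) * z.im| ≤ |(s : ℝ)| * (τ.im / 2) := by
        rw [abs_mul]; exact mul_le_mul_of_nonneg_left hz (abs_nonneg _)
      have h1 : ‖ee (m * (s ^ 2 * τ + 2 * s * z))‖ ≤ 1 := by
        rw [norm_ee, Real.exp_le_one_iff]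
        have e : ((m : ℂ) * ((s : ℂ) ^ 2 * τ + 2 * s * z)).im =
            m * ((s : ℝ) ^ 2 * τ.im + 2 * ((s : ℝ) * z.im)) := by simp [sq, -mul_eq_mul_left_iff]; ring
        rw [e]
        have := neg_abs_le ((s : ℝ) * z.im)
        have hsq := sq_abs (s : ℝ)
        have h9 : |(s : ℝ)| * τ.im ≤ |(s : ℝ)| ^ 2 * τ.im :=
          mul_le_mul_of_nonneg_right (by nlinarith) (by linarith)
        have : 0 ≤ (s : ℝ) ^ 2 * τ.im + 2 * ((s : ℝ) * z.im) := by rw [← hsq]; linarith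
        have := mul_nonneg (Nat.cast_nonneg (α := ℝ) m) this
        nlinarith
      have h2 : ‖lam (s * τ + z)‖ ≤ Q ^ s.natAbs / (1 - Q ^ s.natAbs) ^ 2 := by
        refine norm_lam_le_of_im (pow_lt_one₀ hQ0.le (by linarith) (by omega)) ?_
        rw [hQ, ← Real.exp_nat_mul, hab]
        refine Real.exp_le_exp.mpr ?_
        have e : ((s : ℂ) * τ + z).im = s * τ.im + z.im := by simp
        have h3 : |(s : ℝ)| * τ.im - |z.im| ≤ |(s : ℝ) * τ.im + z.im| := by
          have := abs_sub_abs_le_abs_sub ((s : ℝ) * τ.im) (-z.im)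
          rw [abs_neg, sub_neg_eq_add, abs_mul, abs_of_pos (by linarith : 0 < τ.im)] at this
          exact this
        have h9 : τ.im ≤ |(s : ℝ)| * τ.im := le_mul_of_one_le_left (by linarith) hs1'
        have h10 : |(s : ℝ)| * τ.im ≤ 2 * |(s : ℝ) * τ.im + z.im| := by linarith
        rw [e]
        have := mul_le_mul_of_nonneg_left h10 Real.pi_pos.le
        linarith
      have h4 : Q ^ s.natAbs ≤ Q * (2 * (1 / 2 : ℝ) ^ s.natAbs) := by
        obtain ⟨k, hk⟩ : ∃ k, s.natAbs = k + 1 := ⟨s.natAbs - 1, by omega⟩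
        rw [hk, pow_succ, pow_succ]
        have := pow_le_pow_left₀ hQ0.le hQ2 k
        nlinarith
      have h5 : Q ^ s.natAbs ≤ 1 / 2 := by
        refine (pow_le_of_le_one hQ0.le (by linarith) (by omega)).trans hQ2
      have h6 : (1 / 4 : ℝ) ≤ (1 - Q ^ s.natAbs) ^ 2 := by nlinarith
      rw [ht, norm_mul]
      calc _ ≤ 1 * (Q ^ s.natAbs / (1 - Q ^ s.natAbs) ^ 2) :=
            mul_le_mul h1 h2 (norm_nonneg _) zero_le_one
        _ ≤ Q * (2 * (1 / 2 : ℝ) ^ s.natAbs) / (1 / 4) := by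
            rw [one_mul]
            exact div_le_div₀ (by positivity) h4 (by norm_num) h6
        _ = _ := by ring
  have hsb := (summable_half_pow_natAbs.mul_left 8)
  have hst : Summable fun s : ℤ => if s = 0 then 0 else t s :=
    Summable.of_norm_bounded (hsb.mul_left Q) hb
  have hone : HasSum (fun s : ℤ => if s = 0 then lam z else 0) (lam z) := hasSum_ite_eq 0 (lam z)
  have hA : A2sum m τ z - lam z = ∑' s : ℤ, if s = 0 then 0 else t s := by
    have := (hst.hasSum.add hone).tsum_eq
    rw [A2sum_eq, sub_eq_iff_eq_add, ← this]
    refine tsum_congr fun s => ?_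
    by_cases hs : s = 0
    · subst hs; simp [ee_zero]
    · simp [hs, ht]
  rw [hA]
  calc _ ≤ ∑' s : ℤ, Q * (8 * (1 / 2 : ℝ) ^ s.natAbs) :=
        tsum_of_norm_bounded (hsb.mul_left Q).hasSum hb
    _ = _ := by rw [tsum_mul_left, mul_comm]

theorem tendsto_lam_zero : Tendsto (fun z => lam z - 1 / (ϖ * z) ^ 2)
    (𝓝[≠] (0 : ℂ)) (𝓝 (-1 / 12)) := by
  obtain ⟨g, hg, hg0, hz⟩ := lam_expansion
  have : Tendsto g (𝓝[≠] 0) (𝓝 (g 0)) := hg.continuousAt.tendsto.mono_left nhdsWithin_le_nhds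
  rw [← hg0]
  exact this.congr' (hz.mono fun z hz => hz.symm)

theorem sum_lam_torsion {N : ℕ} [NeZero N] (hz : 0 < z.im) :
    ∑ b : ZMod N, lam (z + b.val / N) = N ^ 2 * lam (N * z) := by
  have hN := NeZero.pos N
  have hlam : ∀ x : ℂ, 0 < x.im → HasSum (fun k : ℕ => (k : ℂ) * ee x ^ k) (lam x) := fun x hx =>
    hasSum_coe_mul_geometric_of_norm_lt_one (norm_ee_lt_one hx)
  have h1 := hasSum_sum fun b (_ : b ∈ (univ : Finset (ZMod N))) =>
    hlam (z + b.val / N) (by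
      rw [show (b.val / N : ℂ) = ((b.val / N : ℝ) : ℂ) by push_cast; rfl, add_im, ofReal_im, add_zero]
      exact hz)
  have h2 := (hlam (N * z) (by simp; positivity)).mul_left ((N : ℂ) ^ 2)
  refine h1.unique ?_
  have hi : Function.Injective (fun j : ℕ => N * j) := fun a b h => Nat.eq_of_mul_eq_mul_left hN h
  have e : ∀ k : ℕ, ∑ b : ZMod N, (k : ℂ) * ee (z + b.val / N) ^ k =
      k * ee z ^ k * if N ∣ k then (N : ℂ) else 0 := by
    intro k
    have := sum_ee_torsion (N := N) (k : ℤ)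
    simp only [Int.natCast_dvd_natCast] at this
    rw [← this, mul_sum]
    refine sum_congr rfl fun b _ => ?_
    rw [ee_add, mul_pow, ← ee_nat_mul k (_ / _)]
    push_cast
    rw [mul_div_assoc]; ring
  simp only [e]
  rw [← hi.hasSum_iff]
  · refine h2.congr_fun fun j => ?_
    simp only [Function.comp, dvd_mul_right, if_true]
    rw [ee_nat_mul N z, ← pow_mul]
    push_cast; ring
  · intro k hk
    rw [if_neg, mul_zero]
    rintro ⟨j, rfl⟩
    exact hk ⟨j, rfl⟩

theorem ee_torsion_ne_one {N : ℕ} [NeZero N] {b : ZMod N} (hb : b ≠ 0) : ee (b.val / N) ≠ 1 := by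
  have hN0 : (N : ℂ) ≠ 0 := NeZero.ne _
  rw [Ne, ee_eq_one_iff]
  rintro ⟨n, hn⟩
  rw [div_eq_iff hN0] at hn
  have h1 : (b.val : ℤ) = n * N := by exact_mod_cast hn
  have h2 : N ∣ b.val := Int.natCast_dvd_natCast.mp ⟨n, by rw [h1, mul_comm]⟩
  have h3 := Nat.eq_zero_of_dvd_of_lt h2 (ZMod.val_lt b)
  exact hb ((ZMod.val_eq_zero b).mp h3)

theorem sum_lam_roots_of_unity (N : ℕ) [NeZero N] :
    ∑ b ∈ (univ : Finset (ZMod N)).erase 0, lam (b.val / N) = (1 - (N : ℂ) ^ 2) / 12 := by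
  have hN0 : (N : ℂ) ≠ 0 := NeZero.ne _
  have hpi := two_pi_I_ne_zero
  have ht : Tendsto (fun t : ℝ => (t : ℂ) * I) (𝓝[>] 0) (𝓝[≠] 0) := by
    apply tendsto_nhdsWithin_of_tendsto_nhds_of_eventually_within
    · have : ContinuousAt (fun t : ℝ => (t : ℂ) * I) 0 := by fun_prop
      have := this.tendsto
      simp only [ofReal_zero, zero_mul] at this
      exact this.mono_left nhdsWithin_le_nhds
    · filter_upwards [self_mem_nhdsWithin] with t ht
      have : t ≠ 0 := ne_of_gt ht
      simpa using this
  have hN' : Tendsto (fun z : ℂ => z / (1 / N)) (𝓝[≠] 0) (𝓝[≠] 0) :=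
    tendsto_mul_right_punctured (one_div_ne_zero hN0)
  have h1 := (tendsto_lam_zero.comp hN').const_mul ((N : ℂ) ^ 2)
  have h2 := (h1.sub tendsto_lam_zero).comp ht
  have h3 : Tendsto (fun t : ℝ => ∑ b ∈ (univ : Finset (ZMod N)).erase 0,
      lam ((t : ℂ) * I + b.val / N)) (𝓝[>] 0)
      (𝓝 (∑ b ∈ (univ : Finset (ZMod N)).erase 0, lam (b.val / N))) := by
    refine tendsto_finsetSum _ fun b hb => ?_
    have hne := ee_torsion_ne_one (ne_of_mem_erase hb)
    have hc : ContinuousAt lam (b.val / N : ℂ) := by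
      have := continuous_ee.continuousAt (x := (b.val / N : ℂ))
      unfold lam
      exact this.div ((continuousAt_const.sub this).pow 2)
        (pow_ne_zero 2 (sub_ne_zero.mpr hne.symm))
    have h4 : ContinuousAt (fun t : ℝ => (t : ℂ) * I + b.val / N) 0 := by fun_prop
    have h5 := h4.tendsto
    simp only [ofReal_zero, zero_mul, zero_add] at h5
    exact hc.tendsto.comp (h5.mono_left nhdsWithin_le_nhds)
  have h4 := tendsto_nhds_unique h3 (h2.congr' ?_)
  · rw [h4]; ring
  · filter_upwards [self_mem_nhdsWithin] with t ht
    have ht' : 0 < t := ht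
    have ht0 : (t : ℂ) ≠ 0 := by exact_mod_cast ht'.ne'
    have h5 := sum_lam_torsion (N := N) (z := (t : ℂ) * I) (by simpa using ht')
    rw [← sum_erase_add _ _ (mem_univ (0 : ZMod N))] at h5
    simp only [ZMod.val_zero, Nat.cast_zero, zero_div, add_zero] at h5
    simp only [Function.comp]
    rw [show (t : ℂ) * I / (1 / N) = N * (t * I) by field_simp]
    have e : (N : ℂ) ^ 2 * (1 / (ϖ * (N * (t * I))) ^ 2) =
        1 / (ϖ * (t * I)) ^ 2 := by
      field_simp
    linear_combination -h5 - e

theorem tendsto_exp_im_zero {t : ℝ} (ht : 0 < t) :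
    Tendsto (fun τ : ℂ => Real.exp (-(t * τ.im))) (comap im atTop) (𝓝 0) :=
  (Real.tendsto_exp_neg_atTop_nhds_zero.comp (tendsto_id.const_mul_atTop ht)).comp tendsto_comap

theorem eventually_im_ge (A : ℝ) : ∀ᶠ τ : ℂ in comap im atTop, A ≤ τ.im :=
  tendsto_comap.eventually (eventually_ge_atTop A)

theorem exists_qArr_of_periodic {f : ℂ → ℂ} {L : ℂ}
    (hd : ∀ τ : ℂ, 0 < τ.im → DifferentiableAt ℂ f τ) (hp : ∀ τ : ℂ, 0 < τ.im → f (τ + 1) = f τ)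
    (hl : Tendsto f (comap im atTop) (𝓝 L)) :
    ∃ a : ℕ → ℂ, DiscSummable a ∧ a 0 = L ∧ ∀ τ : ℂ, 0 < τ.im → JF (qArr a) τ 0 = f τ := by
  set F : ℂ → ℂ := fun τ => if 0 < τ.im then f τ else 0 with hF
  have hev : ∀ τ : ℂ, 0 < τ.im → F =ᶠ[𝓝 τ] f := fun τ hτ => by
    filter_upwards [continuous_im.continuousAt.eventually (lt_mem_nhds hτ)] with x hx
    simp [hF, hx]
  have hper : Periodic F ((1 : ℝ) : ℂ) := fun τ => by
    simp only [hF, ofReal_one, add_im, one_im, add_zero]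
    split_ifs with h
    · exact hp τ h
    · rfl
  have hFd : ∀ τ : ℂ, 0 < τ.im → DifferentiableAt ℂ F τ := fun τ hτ =>
    (hd τ hτ).congr_of_eventuallyEq (hev τ hτ)
  have hFl : Tendsto F (comap im atTop) (𝓝 L) := hl.congr' (by
    filter_upwards [eventually_im_ge 1] with τ hτ
    have : 0 < τ.im := by linarith
    simp [hF, this])
  have hFe : ∀ᶠ τ in comap im atTop, DifferentiableAt ℂ F τ := by
    filter_upwards [eventually_im_ge 1] with τ hτ
    exact hFd τ (by linarith)
  have hbd : BoundedAtFilter (comap im atTop) F := hFl.isBigO_one ℝ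
  have hq : ∀ τ : ℂ, Function.Periodic.qParam 1 τ = ee τ := fun τ => by
    simp [Function.Periodic.qParam, ee]
  set G := Function.Periodic.cuspFunction 1 F with hG
  have : (comap im (atTop : Filter ℝ)).NeBot :=
    atTop_neBot.comap_of_range_mem (by rw [range_im]; exact univ_mem)
  have hG0 : G 0 = L := tendsto_nhds_unique
    (Function.Periodic.tendsto_at_I_inf one_pos hper hFe hbd) hFl
  have hGd : DifferentiableOn ℂ G (Metric.ball 0 1) := by
    intro w hw
    refine DifferentiableAt.differentiableWithinAt ?_
    by_cases h0 : w = 0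
    · rw [h0]
      exact Function.Periodic.differentiableAt_cuspFunction_zero one_pos hper hFe hbd
    · obtain ⟨τ, hτ, rfl⟩ := exists_ee_eq h0 (by simpa using hw)
      rw [← hq]
      exact Function.Periodic.differentiableAt_cuspFunction one_ne_zero hper (hFd τ hτ)
  obtain ⟨a, ha, haG, ha0⟩ := exists_discSummable hGd
  refine ⟨a, ha, ha0.trans hG0, fun τ hτ => ?_⟩
  rw [ha.JF_qArr hτ, haG _ (norm_ee_lt_one hτ), ← hq, hG,
    Function.Periodic.eq_cuspFunction one_ne_zero hper]
  simp [hF, hτ]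

theorem lc_stdForm (m : ℕ) (hτ : 0 < τ.im) : lc (stdForm m) τ =
      JF (fun p => (p.2 : ℂ) * ((p.2 : ℂ) * convPow bArr m p)) τ 0 / 2 := by
  have hψ := bArr_wj.convPow m
  have hpi := two_pi_I_ne_zero
  obtain ⟨g, hg, hg0, hgz⟩ := wpN_expansion hτ
  obtain ⟨k, hk, hkz⟩ := exists_even_quotient (hψ.sm.differentiable_right hτ)
    (fun z => JF_even hψ.even τ z)
  have h00 : JF (convPow bArr m) τ 0 = 1 := by
    rw [JF_convPow bArr_sm m hτ, JF_bArr_zero hτ, one_pow]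
  set ψ := JF (convPow bArr m) τ
  have hψd := fun z => (hψ.sm.hasDerivAt hτ z).2
  have hkd : ∀ᶠ z in 𝓝 (0 : ℂ), AnalyticAt ℂ k z := hk.eventually_analyticAt
  have hd1 : ∀ᶠ z in 𝓝 (0 : ℂ), ϖ *
      JF (fun p => (p.2 : ℂ) * convPow bArr m p) τ z = 2 * z * k z + z ^ 2 * deriv k z := by
    filter_upwards [hkd] with z hz
    refine (hψd z).unique ?_
    have h1 := (((hasDerivAt_pow 2 z).mul hz.differentiableAt.hasDerivAt)).const_add (ψ 0)
    refine (h1.congr_deriv (by simp)).congr_of_eventuallyEq (Eventually.of_forall fun w => ?_)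
    simpa using hkz w
  have hr := hψ.sm.int_mul.2
  have hz1 : JF (fun p => (p.2 : ℂ) * convPow bArr m p) τ 0 = 0 := by
    have := hd1.self_of_nhds
    simpa [hpi] using this
  have hlim1 := (hasDerivAt_iff_tendsto_slope_zero.mp (hr.hasDerivAt hτ 0).2).const_mul
    (ϖ)
  have hlim2 : Tendsto (fun z => 2 * k z + z * deriv k z) (𝓝[≠] 0) (𝓝 (2 * k 0)) := by
    have h1 : ContinuousAt (fun z => 2 * k z + z * deriv k z) 0 := by
      have := hk.continuousAt
      have := hk.deriv.continuousAt
      fun_prop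
    have := h1.tendsto
    simp only [zero_mul, add_zero] at this
    exact this.mono_left nhdsWithin_le_nhds
  have hk0 := tendsto_nhds_unique hlim2 (hlim1.congr' ?_)
  swap
  · filter_upwards [nhdsWithin_le_nhds hd1, self_mem_nhdsWithin] with z hz h0
    have h0' : z ≠ 0 := h0
    simp only [zero_add, hz1, sub_zero, smul_eq_mul]
    rw [mul_left_comm, hz]
    field_simp
  refine Tendsto.limUnder_eq ?_
  have h1 : Tendsto (fun z => ψ z * g z + k z / (ϖ) ^ 2) (𝓝[≠] 0)
      (𝓝 (k 0 / (ϖ) ^ 2)) := by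
    have h1 : ContinuousAt (fun z => ψ z * g z + k z / (ϖ) ^ 2) 0 := by
      have := hk.continuousAt
      have := hg.continuousAt
      have := (hψ.sm.continuous_right hτ).continuousAt (x := 0)
      fun_prop
    have := h1.tendsto
    simp only [hg0, mul_zero, zero_add] at this
    exact this.mono_left nhdsWithin_le_nhds
  have e : k 0 / (ϖ) ^ 2 =
      JF (fun p => (p.2 : ℂ) * ((p.2 : ℂ) * convPow bArr m p)) τ 0 / 2 := by
    rw [div_eq_div_iff (pow_ne_zero 2 hpi) two_ne_zero]
    linear_combination hk0
  rw [← e]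
  refine h1.congr' ?_
  filter_upwards [hgz, eventually_offL_zero hτ, self_mem_nhdsWithin] with z h3 h4 h5
  have hz0 : z ≠ 0 := h5
  have h6 := hkz z
  rw [h00] at h6
  simp only [stdForm, if_pos h4]
  rw [← JF_convPow bArr_sm m hτ, ← h3]
  rw [show k z / (ϖ) ^ 2 = (ψ z - 1) /
    (ϖ * z) ^ 2 by rw [h6]; field_simp; ring]
  ring

theorem offL_torsion {N : ℕ} [NeZero N] {x : ZMod N × ZMod N} (hx : x ≠ 0) (hτ : 0 < τ.im) :
    OffL τ (((x.1.val : ℤ) : ℂ) / N * τ + ((x.2.val : ℤ) : ℂ) / N) := by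
  intro l k e
  have hN0 : (N : ℂ) ≠ 0 := NeZero.ne _
  have e2 : ((x.1.val - N * l : ℤ) : ℂ) * τ + ((x.2.val - N * k : ℤ) : ℂ) = 0 := by
    push_cast at e ⊢
    field_simp at e
    linear_combination e
  have him := congrArg im e2
  simp only [add_im, mul_im, intCast_re, intCast_im, zero_mul, add_zero, zero_im] at him
  have h1 : (x.1.val - N * l : ℤ) = 0 := by
    rcases mul_eq_zero.mp him with h | h
    · exact_mod_cast h
    · exact absurd h hτ.ne'
  rw [h1, Int.cast_zero, zero_mul, zero_add] at e2
  have h2 : (x.2.val - N * k : ℤ) = 0 := by exact_mod_cast e2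
  have key : ∀ b : ZMod N, ∀ k : ℤ, (b.val - N * k : ℤ) = 0 → b = 0 := fun b k h => by
    have h2 : N ∣ b.val := Int.natCast_dvd_natCast.mp ⟨k, by linarith⟩
    exact (ZMod.val_eq_zero b).mp (Nat.eq_zero_of_dvd_of_lt h2 (ZMod.val_lt b))
  exact hx (Prod.ext (key _ _ h1) (key _ _ h2))

/-- The Appell–Lerch contribution to the torsion sum. -/
def torA (m N : ℕ) [NeZero N] (τ : ℂ) : ℂ := torSum m N (A2sum m) τ + lc (A2sum m) τ

theorem torA_add_one {m N : ℕ} [NeZero N] (hNm : N ∣ m) (hτ : 0 < τ.im) :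
    torA m N (τ + 1) = torA m N τ := by
  rw [torA, torA, torSum_add_one hNm (A2sum_elliptic m) hτ (A2sum_add_one m τ), lc, lc]
  simp only [A2sum_add_one]

theorem torA_differentiableAt {m N : ℕ} [NeZero N] (hτ : 0 < τ.im) :
    DifferentiableAt ℂ (torA m N) τ := by
  have hfp := stdForm_finitePart m
  have hst := stdForm_isStandard m
  have hpos : ∀ᶠ t : ℂ in 𝓝 τ, 0 < t.im := continuous_im.continuousAt.eventually (lt_mem_nhds hτ)
  have hJ : ∀ c : Arr, Sm c → DifferentiableAt ℂ (fun t => JF c t 0) τ := fun c hc =>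
    ((hc.hasDerivAt hτ 0).1).differentiableAt
  refine DifferentiableAt.add ?_ ?_
  · unfold torSum
    refine DifferentiableAt.fun_sum fun x hx => ?_
    have hx0 := ne_of_mem_erase hx
    have hoff := offL_torsion hx0 hτ
    unfold tor
    set a : ℂ := ((x.1.val : ℤ) : ℂ) / N
    set b : ℂ := ((x.2.val : ℤ) : ℂ) / N
    refine DifferentiableAt.mul ?_ ?_
    · exact (differentiable_ee _).comp τ (by fun_prop)
    · have h1 : DifferentiableAt ℂ (fun t => stdForm m t (a * t + b)) τ :=
        DifferentiableAt.comp τ (g := fun y : ℂ × ℂ => stdForm m y.1 y.2)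
          (f := fun t => (t, a * t + b)) (hst.2.2.1 τ hτ _ hoff) (by fun_prop)
      have h2 : DifferentiableAt ℂ (fun t => JF (stdArr m) t (a * t + b)) τ :=
        DifferentiableAt.comp τ (g := fun y : ℂ × ℂ => JF (stdArr m) y.1 y.2)
          (f := fun t => (t, a * t + b)) (hfp.sm.differentiable hτ _) (by fun_prop)
      refine (h1.sub h2).congr_of_eventuallyEq ?_
      filter_upwards [hpos] with t ht
      have := hfp.eq t _ ht (offL_torsion hx0 ht)
      simp only [Pi.sub_apply]
      rw [this]; ring
  · have h1 := (hJ _ hψ2).div_const 2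
    refine (h1.sub (hJ _ hfp.sm)).congr_of_eventuallyEq ?_
    filter_upwards [hpos] with t ht
    rw [lc_A2sum hst hfp ht, lc_stdForm m ht]; rfl
where hψ2 : Sm (fun p => (p.2 : ℂ) * ((p.2 : ℂ) * convPow bArr m p)) :=
  (bArr_sm.convPow m).int_mul.2.int_mul.2

theorem tendsto_torA {m N : ℕ} [NeZero N] (hNm : N ∣ m) :
    Tendsto (torA m N) (comap im atTop) (𝓝 (-(N : ℂ) ^ 2 / 12)) := by
  have hN := NeZero.pos N
  have hNr : (0 : ℝ) < N := by exact_mod_cast hN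
  obtain ⟨K, hK⟩ := A2sum_sub_lam_bound m
  have hK0 : Tendsto (fun τ : ℂ => K * Real.exp (-(π * τ.im))) (comap im atTop)
      (𝓝 0) := by simpa using (tendsto_exp_im_zero Real.pi_pos).const_mul K
  have hlc : Tendsto (lc (A2sum m)) (comap im atTop) (𝓝 (-1 / 12)) := by
    rw [tendsto_iff_norm_sub_tendsto_zero]
    refine squeeze_zero' (Eventually.of_forall fun _ => norm_nonneg _) ?_ hK0
    filter_upwards [eventually_im_ge 1] with τ hτ
    have hτ0 : 0 < τ.im := by linarith
    have h1 := tendsto_lc_A2sum (stdForm_isStandard m) (stdForm_finitePart m) hτ0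
    rw [← lc_A2sum (stdForm_isStandard m) (stdForm_finitePart m) hτ0] at h1
    have h2 := (h1.sub tendsto_lam_zero).norm
    refine le_of_tendsto h2 ?_
    have h3 : ∀ᶠ z in 𝓝[≠] (0 : ℂ), |z.im| < τ.im / 2 := nhdsWithin_le_nhds
      ((continuous_im.abs).continuousAt.eventually (gt_mem_nhds (by simpa using hτ0)))
    filter_upwards [h3] with z hz
    have := hK τ z hτ hz.le
    rwa [sub_sub_sub_cancel_right]
  have hterm : ∀ x : ZMod N × ZMod N, Tendsto (fun τ => tor m N (A2sum m) τ x.1.val x.2.val)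
      (comap im atTop) (𝓝 (if x.1 = 0 then lam (x.2.val / N) else 0)) := by
    intro x
    set a : ℤ := x.1.valMinAbs
    set u : ℝ := (a : ℝ) / N
    have hu : |u| ≤ 1 / 2 := by
      have h1 := ZMod.natAbs_valMinAbs_le x.1
      have h2 : |(a : ℝ)| ≤ N / 2 := by
        have h3 : (a.natAbs : ℝ) ≤ ((N / 2 : ℕ) : ℝ) := by exact_mod_cast h1
        have h4 : ((N / 2 : ℕ) : ℝ) ≤ N / 2 := Nat.cast_div_le
        have h5 : (a.natAbs : ℝ) = |(a : ℝ)| := by rw [Nat.cast_natAbs, Int.cast_abs]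
        linarith
      rw [abs_div, abs_of_pos hNr, div_le_iff₀ hNr]; linarith
    set z : ℂ → ℂ := fun τ => a / N * τ + ((x.2.val : ℤ) : ℂ) / N
    have hzim : ∀ τ, (z τ).im = u * τ.im := fun τ => by
      simp only [z, u]
      rw [show ((a : ℂ) / N * τ + ((x.2.val : ℤ) : ℂ) / N) =
        ((a / N : ℝ) : ℂ) * τ + ((x.2.val / N : ℝ) : ℂ) by push_cast; ring]
      simp
    have hdiff : Tendsto (fun τ => A2sum m τ (z τ) - lam (z τ)) (comap im atTop) (𝓝 0) := by
      rw [tendsto_zero_iff_norm_tendsto_zero]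
      refine squeeze_zero' (Eventually.of_forall fun _ => norm_nonneg _) ?_ hK0
      filter_upwards [eventually_im_ge 1] with τ hτ
      refine hK τ _ hτ ?_
      rw [hzim, abs_mul, abs_of_pos (by linarith : 0 < τ.im)]
      nlinarith
    have htor : ∀ᶠ τ : ℂ in comap im atTop, tor m N (A2sum m) τ x.1.val x.2.val =
        ee (m * ((a / N : ℂ) ^ 2 * τ + a / N * (((x.2.val : ℤ) : ℂ) / N))) * A2sum m τ (z τ) := by
      filter_upwards [eventually_im_ge 1] with τ hτ
      rw [tor_congr hN hNm (A2sum_elliptic m) (by linarith : 0 < τ.im) (a := x.1.val) (a' := a)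
        (b := x.2.val) (b' := x.2.val) (by simp [a]) rfl]
      rfl
    by_cases hx : x.1 = 0
    · have ha : a = 0 := by simp [a, hx]
      rw [if_pos hx]
      have hz : ∀ τ, z τ = x.2.val / N := fun τ => by simp [z, ha]
      have h1 := hdiff.add_const (lam (x.2.val / N))
      rw [zero_add] at h1
      refine h1.congr' ?_
      filter_upwards [htor] with τ h
      rw [h, ha]
      simp [hz, ee_zero]
    · rw [if_neg hx]
      have ha : a ≠ 0 := by simpa [a] using hx
      have hu0 : 0 < |u| := abs_pos.mpr (div_ne_zero (by exact_mod_cast ha) hNr.ne')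
      have hQ := tendsto_exp_im_zero (t := 2 * π * |u|) (by positivity)
      have hlam : Tendsto (fun τ => lam (z τ)) (comap im atTop) (𝓝 0) := by
        rw [tendsto_zero_iff_norm_tendsto_zero]
        have h2 : Tendsto (fun τ : ℂ => Real.exp (-(2 * π * |u| * τ.im)) /
            (1 - Real.exp (-(2 * π * |u| * τ.im))) ^ 2) (comap im atTop) (𝓝 0) := by
          have := hQ.div ((hQ.const_sub 1).pow 2) (by norm_num)
          rw [zero_div] at this
          exact this
        refine squeeze_zero' (Eventually.of_forall fun _ => norm_nonneg _) ?_ h2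
        filter_upwards [eventually_im_ge 1] with τ hτ
        refine norm_lam_le_of_im ?_ ?_
        · rw [Real.exp_lt_one_iff]
          have : 0 < 2 * π * |u| * τ.im := by positivity
          linarith
        · rw [hzim, abs_mul, abs_of_pos (by linarith : 0 < τ.im), mul_assoc (2 * π)]
      have hA := hdiff.add hlam
      simp only [sub_add_cancel, add_zero] at hA
      have hA' := hA.norm
      rw [norm_zero] at hA'
      refine squeeze_zero_norm' ?_ hA'
      filter_upwards [htor, eventually_im_ge 1] with τ h hτ
      rw [h, norm_mul]
      refine mul_le_of_le_one_left (norm_nonneg _) ?_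
      rw [norm_ee, Real.exp_le_one_iff]
      have e : ((m : ℂ) * ((a / N : ℂ) ^ 2 * τ + a / N * (((x.2.val : ℤ) : ℂ) / N))).im =
          m * (u ^ 2 * τ.im) := by
        rw [show (m : ℂ) * ((a / N : ℂ) ^ 2 * τ + a / N * (((x.2.val : ℤ) : ℂ) / N)) =
          ((m * u ^ 2 : ℝ) : ℂ) * τ + ((m * (u * (x.2.val / N)) : ℝ) : ℂ) by
            simp only [u]; push_cast; ring]
        rw [add_im, ofReal_im, add_zero, im_ofReal_mul]; ring
      rw [e]
      have : 0 ≤ 2 * π * (m * (u ^ 2 * τ.im)) := by positivity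
      linarith
  have htot := (tendsto_finsetSum ((univ : Finset (ZMod N × ZMod N)).erase 0)
    fun x _ => hterm x).add hlc
  have h1 := sum_lam_roots_of_unity N
  have h2 : ∑ x ∈ (univ : Finset (ZMod N × ZMod N)).erase 0,
      (if x.1 = 0 then lam (x.2.val / N) else 0) =
      ∑ b ∈ (univ : Finset (ZMod N)).erase 0, lam (b.val / N) := by
    rw [← sum_filter]
    exact sum_bij' (fun x _ => x.2) (fun b _ => (0, b)) (by simp +contextual [Prod.ext_iff])
      (by simp) (by simp +contextual [Prod.ext_iff]) (by simp) (by simp)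
  rw [h2, h1, show (1 - (N : ℂ) ^ 2) / 12 + -1 / 12 = -(N : ℂ) ^ 2 / 12 by ring] at htot
  exact htot

/-- The sum of the coefficients of discriminant `-r²` in the finite part of a standard form. -/
theorem hasSum_square_coefficients {N M : ℕ} [NeZero N] (hM : 0 < M) (hco : Nat.Coprime N M)
    {C : ℤ → ℤ → ℂ} (hφ : IsStandardForm (N * M) φ)
    (hC : IsFinitePartCoeffs (N * M) φ C) {r₀ : ℤ} (h1 : (2 * N : ℤ) ∣ r₀ + 1)
    (h2 : (2 * M : ℤ) ∣ r₀ - 1) :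
    HasSum (fun r : ℤ => C (-r ^ 2) (r₀ * r)) (((N : ℂ) + M) / 12) := by
  have hN := NeZero.pos N
  have hNm : N ∣ N * M := dvd_mul_right N M
  have hN0 : (N : ℂ) ≠ 0 := by exact_mod_cast hN.ne'
  have hfp := hC.finitePart hφ
  obtain ⟨a, ha, ha0, haJ⟩ := exists_qArr_of_periodic
    (fun τ hτ => torA_differentiableAt (m := N * M) (N := N) hτ)
    (fun τ hτ => torA_add_one hNm hτ) (tendsto_torA hNm)
  set c := arrOf (N * M) C
  have hsmT := torTot_sm (N := N) (M := M) hfp.sm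
  have hJ : ∀ τ : ℂ, 0 < τ.im → JF (torTot N M c + qArr a) τ 0 = torSum (N * M) N φ τ + lc φ τ := by
    intro τ hτ
    rw [JF_add (hsmT τ 0 hτ) (ha.sm τ 0 hτ), JF_torTot hfp.sm hτ, haJ τ hτ, torA,
      lc_A2sum hφ hfp hτ]
    have : torSum (N * M) N φ τ = torSum (N * M) N (JF c) τ + torSum (N * M) N (A2sum (N * M)) τ := by
      simp only [torSum]
      rw [← sum_add_distrib]
      refine sum_congr rfl fun x hx => ?_
      simp only [tor]
      rw [hfp.eq τ _ hτ (offL_torsion (ne_of_mem_erase hx) hτ)]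
      ring
    rw [this]; ring
  have hCT := constant_term_weight_two (hsmT.add ha.sm)
    (κ := (N * M : ℕ) / (ϖ)) fun τ hτ => by
      rw [hJ τ hτ, hJ _ (im_neg_one_div_pos hτ), torSum_S hNm hφ.2.1 hφ.1 hτ,
        hφ.lc_S (Nat.mul_pos hN hM) hτ]
      ring
  have hrow : Summable fun r : ℤ => torTot N M c (0, r) := by
    refine ((hsmT I 0 (by simp)).prod_factor 0).congr fun r => ?_
    simp [chr, ee_zero]
  have hq : HasSum (fun r : ℤ => qArr a (0, r)) (a 0) := by
    have := hasSum_ite_eq (0 : ℤ) (a 0)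
    refine this.congr_fun fun r => ?_
    by_cases hr : r = 0
    · subst hr; simpa using qArr_nat a 0
    · simp [qArr, hr]
  have h3 : ∑' r : ℤ, (torTot N M c + qArr a) (0, r) = ∑' r : ℤ, torTot N M c (0, r) + a 0 := by
    rw [← hq.tsum_eq, ← hrow.tsum_add hq.summable]; rfl
  have hpi := two_pi_I_ne_zero
  have hpi' : (π : ℂ) ≠ 0 := by exact_mod_cast Real.pi_ne_zero
  rw [h3, ha0] at hCT
  have h4 : ∑' r : ℤ, torTot N M c (0, r) = ((N : ℂ) * M + N ^ 2) / 12 := by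
    have e : ((N * M : ℕ) : ℂ) / (ϖ) * (I * π / 6) = N * M / 12 := by
      push_cast; field_simp; ring
    rw [e] at hCT
    linear_combination hCT
  have h5 := tsum_torTot hco hC.1 h1 h2 hfp.sm
  rw [h4] at h5
  convert h5 using 1
  field_simp; ring

/-! ### The operators `U_d` and the primitive part -/

/-- The array of `φ(τ, dz)`. -/
def uArr (d : ℕ) (c : Arr) (p : ℤ × ℤ) : ℂ := if (d : ℤ) ∣ p.2 then c (p.1, p.2 / d) else 0

theorem uArr_mul {d : ℕ} (hd : 0 < d) (c : Arr) (n r : ℤ) : uArr d c (n, d * r) = c (n, r) := by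
  have : (d : ℤ) ≠ 0 := by exact_mod_cast hd.ne'
  simp [uArr, Int.mul_ediv_cancel_left _ this]

theorem hasSum_uArr {d : ℕ} (hd : 0 < d) {τ z s : ℂ} :
    HasSum (fun p => uArr d c p * chr τ z p) s ↔ HasSum (fun p => c p * chr τ (d * z) p) s := by
  have hd0 : (d : ℤ) ≠ 0 := by exact_mod_cast hd.ne'
  have hi : Function.Injective (fun p : ℤ × ℤ => (p.1, (d : ℤ) * p.2)) := fun p q h => by
    simp only [Prod.mk.injEq] at h
    exact Prod.ext h.1 (mul_left_cancel₀ hd0 h.2)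
  rw [← hi.hasSum_iff]
  · have e : (fun p => uArr d c p * chr τ z p) ∘ (fun p : ℤ × ℤ => (p.1, (d : ℤ) * p.2)) =
        fun p => c p * chr τ (d * z) p := by
      ext p
      simp only [Function.comp, uArr_mul hd, chr]
      congr 2; push_cast; ring
    rw [e]
  · rintro ⟨n, r⟩ h
    have : ¬ (d : ℤ) ∣ r := by
      rintro ⟨k, rfl⟩
      exact h ⟨(n, k), rfl⟩
    simp [uArr, this]

theorem uArr_sm {d : ℕ} (hd : 0 < d) (hc : Sm c) : Sm (uArr d c) := fun τ z hτ =>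
  ((hasSum_uArr hd).mpr (hc τ (d * z) hτ).hasSum).summable

theorem JF_uArr {d : ℕ} (hd : 0 < d) (hc : Sm c) (hτ : 0 < τ.im) (z : ℂ) :
    JF (uArr d c) τ z = JF c τ (d * z) := ((hasSum_uArr hd).mpr (hc τ (d * z) hτ).hasSum).tsum_eq

theorem uArr_ell {d m : ℕ} (hd : 0 < d) (hc : Ell m c) :
    Ell (m * d ^ 2) (uArr d c) := fun n r l => by
  have hd0 : (d : ℤ) ≠ 0 := by exact_mod_cast hd.ne'
  by_cases h : (d : ℤ) ∣ r
  · obtain ⟨k, rfl⟩ := h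
    have e : (d * k + 2 * ((m * d ^ 2 : ℕ) : ℤ) * l : ℤ) = d * (k + 2 * m * (d * l)) := by
      push_cast; ring
    rw [e, uArr_mul hd, uArr_mul hd, ← hc n k (d * l)]
    congr 2; push_cast; ring
  · have h' : ¬ (d : ℤ) ∣ r + 2 * ((m * d ^ 2 : ℕ) : ℤ) * l := fun h2 => h
      ((Int.dvd_add_left ⟨2 * m * d * l, by push_cast; ring⟩).mp h2)
    rw [uArr, uArr, if_neg h', if_neg h]

theorem uArr_even {d : ℕ} (hc : Evn c) : Evn (uArr d c) := fun n r => by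
  by_cases h : (d : ℤ) ∣ r
  · simp [uArr, h, Int.neg_ediv_of_dvd h, hc n]
  · simp [uArr, h]

theorem uArr_low {d : ℕ} {N : ℤ} (hc : LowAt N c) : LowAt N (uArr d c) :=
  fun n r h => by simp [uArr, hc n _ h]

theorem uArr_slaw {d m : ℕ} (hd : 0 < d) (hc : Sm c)
    (h : ∀ τ z : ℂ, 0 < τ.im → JF c (-1 / τ) (z / τ) = τ ^ k * ee (m * z ^ 2 / τ) * JF c τ z)
    (τ z : ℂ) (hτ : 0 < τ.im) : JF (uArr d c) (-1 / τ) (z / τ) =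
      τ ^ k * ee ((m * d ^ 2 : ℕ) * z ^ 2 / τ) * JF (uArr d c) τ z := by
  rw [JF_uArr hd hc hτ, JF_uArr hd hc (im_neg_one_div_pos hτ), ← mul_div_assoc, h τ _ hτ]
  congr 3; push_cast; ring

/-- The array of the primitive part. -/
def primArr (m : ℕ) (F : ℕ → Arr) : Arr :=
  ∑ d ∈ m.divisors.filter (fun d => d ^ 2 ∣ m), ((moebius d : ℤ) : ℂ) • uArr d (F (m / d ^ 2))

theorem arrOf_primC0 (m : ℕ) (C : ℕ → ℤ → ℤ → ℂ) :
    arrOf m (primC0 m C) = primArr m (fun k => arrOf k (C k)) := by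
  ext ⟨n, r⟩
  simp only [arrOf, primC0, primArr, Finset.sum_apply, Pi.smul_apply, smul_eq_mul]
  rw [sum_filter]
  refine sum_congr rfl fun d hd => ?_
  by_cases h1 : d ^ 2 ∣ m
  · rw [if_pos h1]
    obtain ⟨k, rfl⟩ := h1
    have hd0 : 0 < d := Nat.pos_of_mem_divisors hd
    have hd1 : (d : ℤ) ≠ 0 := by exact_mod_cast hd0.ne'
    have hd2 : (d : ℤ) ^ 2 ≠ 0 := pow_ne_zero 2 hd1
    by_cases h2 : (d : ℤ) ∣ r
    · obtain ⟨s, rfl⟩ := h2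
      have e : 4 * ((d ^ 2 * k : ℕ) : ℤ) * n - (d * s) ^ 2 = d ^ 2 * (4 * k * n - s ^ 2) := by
        push_cast; ring
      rw [uArr_mul hd0, e, if_pos ⟨dvd_mul_right _ _, dvd_mul_right _ _, dvd_mul_right _ _⟩,
        Int.mul_ediv_cancel_left _ hd1, Int.mul_ediv_cancel_left _ hd2,
        Nat.mul_div_cancel_left _ (by positivity)]
      rfl
    · simp [uArr, h2]
  · simp [h1]

theorem primC0_periodic {C : ℕ → ℤ → ℤ → ℂ} (hm : 0 < m)
    (h : ∀ k : ℕ, 0 < k → ∀ Δ l : ℤ, C k Δ (l + 2 * (k : ℤ)) = C k Δ l) (Δ l : ℤ) :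
    primC0 m C Δ (l + 2 * m) = primC0 m C Δ l := by
  unfold primC0
  refine sum_congr rfl fun d hd => ?_
  by_cases h1 : d ^ 2 ∣ m
  · obtain ⟨k, rfl⟩ := h1
    have hd0 : 0 < d := Nat.pos_of_mem_divisors hd
    have hk : 0 < k := Nat.pos_of_mul_pos_left hm
    have hd1 : (d : ℤ) ≠ 0 := by exact_mod_cast hd0.ne'
    have e : (l + 2 * ((d ^ 2 * k : ℕ) : ℤ)) = l + d * (2 * k * d) := by push_cast; ring
    have hp : Periodic (C k (Δ / d ^ 2)) (2 * k) := h k hk _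
    have e2 : C k (Δ / d ^ 2) (l / d + 2 * k * d) = C k (Δ / d ^ 2) (l / d) := by
      have := hp.int_mul d (l / d)
      rw [← this]; congr 1; simp; ring
    simp only [e, Int.dvd_add_left (dvd_mul_right (d : ℤ) (2 * k * d)),
      Int.add_mul_ediv_left _ _ hd1, Nat.mul_div_cancel_left k (show 0 < d ^ 2 by positivity), e2]
  · simp [h1]

theorem primC0_support {C : ℕ → ℤ → ℤ → ℂ} (hm : 0 < m)
    (h : ∀ k : ℕ, 0 < k → ∀ Δ l : ℤ, ¬ (4 * (k : ℤ)) ∣ Δ + l ^ 2 → C k Δ l = 0) (Δ l : ℤ)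
    (hΔ : ¬ (4 * (m : ℤ)) ∣ Δ + l ^ 2) : primC0 m C Δ l = 0 := by
  refine sum_eq_zero fun d hd => ?_
  split_ifs with h1
  · obtain ⟨⟨k, rfl⟩, ⟨s, rfl⟩, ⟨D, rfl⟩⟩ := h1
    have hd0 : 0 < d := Nat.pos_of_mem_divisors hd
    have hk : 0 < k := Nat.pos_of_mul_pos_left hm
    have hd1 : (d : ℤ) ≠ 0 := by exact_mod_cast hd0.ne'
    rw [Int.mul_ediv_cancel_left _ hd1, Int.mul_ediv_cancel_left _ (pow_ne_zero 2 hd1),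
      Nat.mul_div_cancel_left _ (by positivity), h k hk, mul_zero]
    rintro ⟨w, hw⟩
    exact hΔ ⟨w, by push_cast; linear_combination (d : ℤ) ^ 2 * hw⟩
  · rfl

/-! ### The polar coefficients -/

theorem gcd_mul_gcd_of_sq {k : ℕ} {r : ℤ} (h : 4 * (k : ℤ) ∣ r ^ 2 - 1) :
    Int.gcd ((r + 1) / 2) k * Int.gcd ((r - 1) / 2) k = k ∧
      Nat.Coprime (Int.gcd ((r + 1) / 2) k) (Int.gcd ((r - 1) / 2) k) ∧
      2 * (Int.gcd ((r + 1) / 2) k : ℤ) ∣ r + 1 ∧ 2 * (Int.gcd ((r - 1) / 2) k : ℤ) ∣ r - 1 := by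
  obtain ⟨v, rfl⟩ : ∃ v, r = 2 * v + 1 := by
    rcases Int.even_or_odd r with ⟨v, rfl⟩ | ⟨v, rfl⟩
    · obtain ⟨w, hw⟩ := h
      exfalso
      have : (v + v) ^ 2 - 1 = 4 * (k * w) := by rw [hw]; ring
      have : 4 * (v ^ 2 - k * w) = 1 := by linear_combination this
      omega
    · exact ⟨v, rfl⟩
  rw [show (2 * v + 1 + 1) / 2 = v + 1 by omega, show (2 * v + 1 - 1) / 2 = v by omega]
  have hcop : Int.gcd (v + 1) v = 1 := Int.isCoprime_iff_gcd_eq_one.mp ⟨1, -1, by ring⟩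
  have hk : (k : ℤ) ∣ (v + 1) * v := by
    obtain ⟨w, hw⟩ := h
    exact ⟨w, by linarith⟩
  refine ⟨?_, ?_, ?_, ?_⟩
  · have h1 : Nat.Coprime (v + 1).natAbs v.natAbs := hcop
    have h2 := h1.gcd_mul k
    have h3 : k ∣ (v + 1).natAbs * v.natAbs := by rw [← Int.natAbs_mul]; exact Int.natCast_dvd.mp hk
    rw [Nat.gcd_eq_left h3] at h2
    rw [Int.gcd_comm (v + 1), Int.gcd_comm v]
    exact h2.symm
  · have h1 : Nat.Coprime (v + 1).natAbs v.natAbs := hcop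
    exact Nat.Coprime.coprime_dvd_left (Nat.gcd_dvd_left _ _)
      (Nat.Coprime.coprime_dvd_right (Nat.gcd_dvd_left _ _) h1)
  · rw [show 2 * v + 1 + 1 = 2 * (v + 1) by ring]
    exact mul_dvd_mul_left 2 (Int.gcd_dvd_left _ _)
  · rw [show 2 * v + 1 - 1 = 2 * v by ring]
    exact mul_dvd_mul_left 2 (Int.gcd_dvd_left _ _)

theorem polar_coefficient {φfam : ℕ → ℂ → ℂ → ℂ} {Cfam : ℕ → ℤ → ℤ → ℂ}
    (hfam : IsStandardFamily φfam Cfam) (hm : 0 < m) (hg : GoodPrim m Cfam) {r : ℤ}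
    (hr : (4 * (m : ℤ)) ∣ (r ^ 2 - 1)) :
    primC0 m Cfam (-1) r = (1 / 24 : ℂ) * ∑ d ∈ m.divisors, (if d ^ 2 ∣ m then
      ((moebius d : ℤ) : ℂ) * ((Int.gcd ((r - 1) / 2) ((m : ℤ) / (d : ℤ) ^ 2) : ℂ) +
          (Int.gcd ((r + 1) / 2) ((m : ℤ) / (d : ℤ) ^ 2) : ℂ)) else 0) := by
  have h1 : ∀ d ∈ m.divisors, HasSum (fun s : ℤ =>
      if d ^ 2 ∣ m ∧ (d : ℤ) ∣ r * s ∧ ((d : ℤ)) ^ 2 ∣ (-s ^ 2) then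
      ((moebius d : ℤ) : ℂ) * Cfam (m / d ^ 2) (-s ^ 2 / (d : ℤ) ^ 2) (r * s / (d : ℤ)) else 0)
      (if d ^ 2 ∣ m then ((moebius d : ℤ) : ℂ) *
        ((Int.gcd ((r - 1) / 2) ((m : ℤ) / (d : ℤ) ^ 2) : ℂ) +
          (Int.gcd ((r + 1) / 2) ((m : ℤ) / (d : ℤ) ^ 2) : ℂ)) / 12 else 0) := by
    intro d hd
    by_cases h2 : d ^ 2 ∣ m
    · obtain ⟨k, rfl⟩ := h2
      have hd0 : 0 < d := Nat.pos_of_mem_divisors hd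
      have hd1 : (d : ℤ) ≠ 0 := by exact_mod_cast hd0.ne'
      have hd2 : (d : ℤ) ^ 2 ≠ 0 := pow_ne_zero 2 hd1
      have hk : 0 < k := Nat.pos_of_mul_pos_left hm
      have hrk : 4 * (k : ℤ) ∣ r ^ 2 - 1 := dvd_trans ⟨(d : ℤ) ^ 2, by push_cast; ring⟩ hr
      obtain ⟨g1, g2, g3, g4⟩ := gcd_mul_gcd_of_sq hrk
      have e1 : (((d ^ 2 * k : ℕ) : ℤ) / (d : ℤ) ^ 2) = k := by
        push_cast; rw [Int.mul_ediv_cancel_left _ hd2]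
      simp only [dvd_mul_right, true_and, if_true, e1,
        Nat.mul_div_cancel_left k (show 0 < d ^ 2 by positivity)]
      set N := Int.gcd ((r + 1) / 2) k
      set M := Int.gcd ((r - 1) / 2) k
      have hNM : 0 < N * M := by rw [g1]; exact hk
      have : NeZero N := ⟨(Nat.pos_of_mul_pos_right hNM).ne'⟩
      obtain ⟨f1, f2⟩ := hfam k hk
      rw [← g1] at f1 f2
      have h3 := (hasSum_square_coefficients (Nat.pos_of_mul_pos_left hNM) g2 f1 f2 g3 g4).mul_left
        ((moebius d : ℤ) : ℂ)
      have hi : Function.Injective (fun s : ℤ => (d : ℤ) * s) := fun a b h => mul_left_cancel₀ hd1 h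
      rw [← hi.hasSum_iff]
      · have h4 := h3
        rw [g1] at h4
        rw [show ((moebius d : ℤ) : ℂ) * (((N : ℕ) + (M : ℕ) : ℂ) / 12) =
          (moebius d : ℤ) * ((M : ℕ) + (N : ℕ) : ℂ) / 12 by ring] at h4
        refine h4.congr_fun fun s => ?_
        · simp only [Function.comp]
          rw [if_pos ⟨⟨r * s, by ring⟩, ⟨-s ^ 2, by ring⟩⟩,
            show r * (d * s) = d * (r * s) by ring, Int.mul_ediv_cancel_left _ hd1,
            show -((d : ℤ) * s) ^ 2 = d ^ 2 * (-s ^ 2) by ring, Int.mul_ediv_cancel_left _ hd2]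
      · intro s hs
        rw [if_neg]
        rintro ⟨-, h⟩
        rw [Int.dvd_neg, Int.pow_dvd_pow_iff two_ne_zero] at h
        obtain ⟨t, rfl⟩ := h
        exact hs ⟨t, rfl⟩
    · simp [h2]
  have h2 := hasSum_sum h1
  have h3 : HasSum (fun s : ℤ => primC0 m Cfam (-s ^ 2) (r * s))
      (primC0 m Cfam (-1) (r * 1) + primC0 m Cfam (-1) (r * (-1))) := by
    have h4 : ∀ s ∉ ({1, -1} : Finset ℤ), primC0 m Cfam (-s ^ 2) (r * s) = 0 := by
      intro s hs
      simp only [mem_insert, Finset.mem_singleton, not_or] at hs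
      by_cases h0 : s = 0
      · subst h0; simpa using hg.2.2 0
      · refine hg.1 _ _ ?_
        have : 2 ≤ |s| := by rcases abs_cases s with h | h <;> omega
        have := sq_abs s
        nlinarith
    have := hasSum_sum_of_ne_finset_zero (L := SummationFilter.unconditional ℤ) h4
    rw [sum_pair (by norm_num)] at this
    simpa using this
  have h4 := h3.unique h2
  have heven : primC0 m Cfam (-1) (r * (-1)) = primC0 m Cfam (-1) r := by
    have hone : ∀ l : ℤ, primC0 m Cfam (-1) l = Cfam m (-1) l := by
      intro l
      rw [primC0, sum_eq_single 1]
      · simp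
      · intro d hd hd1
        rw [if_neg]
        rintro ⟨-, -, h⟩
        rw [Int.dvd_neg] at h
        have h5 : IsUnit ((d : ℤ) ^ 2) := isUnit_of_dvd_one h
        rw [isUnit_pow_iff two_ne_zero, Int.isUnit_iff] at h5
        omega
      · intro h; exact absurd (Nat.one_mem_divisors.mpr hm.ne') h
    rw [hone, hone]
    obtain ⟨f1, f2⟩ := hfam m hm
    obtain ⟨n, hn⟩ := hr
    have h5 := (f2.finitePart f1).even n r
    simp only [arrOf] at h5
    rw [show 4 * (m : ℤ) * n - (-r) ^ 2 = -1 by linear_combination -hn,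
      show 4 * (m : ℤ) * n - r ^ 2 = -1 by linear_combination -hn] at h5
    rw [mul_neg_one, h5]
  rw [heven, mul_one] at h4
  have h5 : ∀ x y : ℂ, x + x = y → x = (1 / 2) * y := fun x y h => by rw [← h]; ring
  rw [h5 _ _ h4, mul_sum, mul_sum]
  refine sum_congr rfl fun d _ => ?_
  split_ifs <;> ring

/-! ### Uniqueness -/

theorem pos_of_mem_sq_divisors (hm : 0 < m) {d : ℕ} (hd : d ∈ m.divisors.filter fun d => d ^ 2 ∣ m) :
    0 < d ∧ 0 < m / d ^ 2 ∧ m / d ^ 2 * d ^ 2 = m := by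
  rw [mem_filter] at hd
  have hd0 := Nat.pos_of_mem_divisors hd.1
  exact ⟨hd0, Nat.div_pos (Nat.le_of_dvd hm hd.2) (pow_pos hd0 2), Nat.div_mul_cancel hd.2⟩

theorem prim_sub_cusp {φfam : ℕ → ℂ → ℂ → ℂ} {Cfam : ℕ → ℤ → ℤ → ℂ} {φfam' : ℕ → ℂ → ℂ → ℂ}
    {Cfam' : ℕ → ℤ → ℤ → ℂ} (h : IsStandardFamily φfam Cfam) (h' : IsStandardFamily φfam' Cfam')
    (hm : 0 < m) (hg : GoodPrim m Cfam) (hg' : GoodPrim m Cfam') :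
    ∃ ψ : EllFormData m, ModularLaw 2 m ψ.toFun ∧ IsCuspC ψ.coeff ∧
      ∀ Δ l : ℤ, primC0 m Cfam Δ l - primC0 m Cfam' Δ l = ψ.coeff Δ l := by
  set F : ℕ → Arr := fun k => arrOf k (Cfam k) - arrOf k (Cfam' k) with hF
  have hf : ∀ k : ℕ, 0 < k → FinitePart k (φfam k) (arrOf k (Cfam k)) := fun k hk =>
    (h k hk).2.finitePart (h k hk).1
  have hf' : ∀ k : ℕ, 0 < k → FinitePart k (φfam' k) (arrOf k (Cfam' k)) := fun k hk =>
    (h' k hk).2.finitePart (h' k hk).1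
  have hFsm : ∀ k : ℕ, 0 < k → Sm (F k) := fun k hk => (hf k hk).sm.sub (hf' k hk).sm
  have hFeq : ∀ k : ℕ, 0 < k → ∀ τ z : ℂ, 0 < τ.im → OffL τ z →
      JF (F k) τ z = φfam k τ z - φfam' k τ z := fun k hk τ z hτ hz => by
    rw [hF, JF_sub ((hf k hk).sm τ z hτ) ((hf' k hk).sm τ z hτ), (hf k hk).eq τ z hτ hz,
      (hf' k hk).eq τ z hτ hz]; ring
  have hFs : ∀ k : ℕ, 0 < k → ∀ τ z : ℂ, 0 < τ.im →
      JF (F k) (-1 / τ) (z / τ) = τ ^ (2 : ℤ) * ee (k * z ^ 2 / τ) * JF (F k) τ z := by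
    intro k hk τ z hτ
    have hτ' := im_neg_one_div_pos hτ
    refine eq_of_eq_offL hτ (f := fun z => JF (F k) (-1 / τ) (z / τ))
      (g := fun z => τ ^ (2 : ℤ) * ee (k * z ^ 2 / τ) * JF (F k) τ z)
      (((hFsm k hk).continuous_right hτ').comp (by fun_prop))
      ((continuous_const.mul (continuous_ee.comp (by fun_prop))).mul
        ((hFsm k hk).continuous_right hτ)) (fun z hz => ?_) z
    rw [hFeq k hk τ z hτ hz, hFeq k hk _ _ hτ' ((offL_S (ne_zero_of_im_pos hτ)).mpr hz)]
    have e1 := (h k hk).1.1 τ hτ z 0 (-1) 1 0 (by norm_num)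
    have e2 := (h' k hk).1.1 τ hτ z 0 (-1) 1 0 (by norm_num)
    simp only [Int.cast_zero, zero_mul, Int.cast_neg, Int.cast_one, zero_add, one_mul, add_zero,
      mul_one] at e1 e2
    rw [e1, e2]; ring
  set D : ℤ → ℤ → ℂ := fun Δ l => primC0 m Cfam Δ l - primC0 m Cfam' Δ l with hD
  have hDF : arrOf m D = primArr m F := by
    rw [show arrOf m D = arrOf m (primC0 m Cfam) - arrOf m (primC0 m Cfam') from rfl, arrOf_primC0,
      arrOf_primC0, primArr, primArr, primArr, ← sum_sub_distrib]
    refine sum_congr rfl fun d _ => ?_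
    ext p
    simp only [Pi.sub_apply, Pi.smul_apply, smul_eq_mul, uArr, hF]
    split_ifs <;> ring
  have hmem {d : ℕ} := pos_of_mem_sq_divisors hm (d := d)
  obtain ⟨hsm, hJ⟩ := Sm.sum (s := m.divisors.filter (fun d => d ^ 2 ∣ m))
    (f := fun d => ((moebius d : ℤ) : ℂ) • uArr d (F (m / d ^ 2)))
    fun d hd => (uArr_sm (hmem hd).1 (hFsm _ (hmem hd).2.1)).smul _
  have hsmD : Sm (arrOf m D) := by rw [hDF]; exact hsm
  have hper : ∀ Δ l : ℤ, D Δ (l + 2 * (m : ℤ)) = D Δ l := fun Δ l => by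
    simp only [hD]
    rw [primC0_periodic hm fun k hk => (h k hk).2.1, primC0_periodic hm fun k hk => (h' k hk).2.1]
  have hsup : ∀ Δ l : ℤ, ¬ (4 * (m : ℤ)) ∣ (Δ + l ^ 2) → D Δ l = 0 := fun Δ l hl => by
    simp only [hD]
    rw [primC0_support hm (fun k hk => (h k hk).2.2.1) Δ l hl,
      primC0_support hm (fun k hk => (h' k hk).2.2.1) Δ l hl, sub_zero]
  refine ⟨⟨JF (arrOf m D), D, fun τ z hτ => hsmD.differentiable hτ z, JF_elliptic (arrOf_ell hper),
    fun τ z hτ => (hsmD τ z hτ).hasSum, hper, hsup⟩, ?_, ?_, fun _ _ => rfl⟩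
  · refine modularLaw_of_generators (fun τ z _ => JF_add_one_left _ τ z) fun τ z hτ => ?_
    simp only [hDF, primArr]
    rw [hJ τ z hτ, hJ _ _ (im_neg_one_div_pos hτ), mul_sum]
    refine sum_congr rfl fun d hd => ?_
    obtain ⟨a1, a2, a3⟩ := hmem hd
    rw [JF_smul, JF_smul, uArr_slaw a1 (hFsm _ a2) (hFs _ a2) τ z hτ, a3]
    ring
  · intro Δ l hΔ
    change primC0 m Cfam Δ l - primC0 m Cfam' Δ l = 0
    rcases lt_or_ge Δ (-1) with h1 | h1
    · rw [hg.1 Δ l h1, hg'.1 Δ l h1, sub_zero]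
    · rcases eq_or_lt_of_le h1 with h2 | h2
      · subst h2
        by_cases hl : 4 * (m : ℤ) ∣ l ^ 2 - 1
        · rw [polar_coefficient h hm hg hl, polar_coefficient h' hm hg' hl, sub_self]
        · exact hsup _ _ (by rwa [show (-1 : ℤ) + l ^ 2 = l ^ 2 - 1 by ring])
      · have : Δ = 0 := by omega
        rw [this, hg.2.2, hg'.2.2, sub_zero]

/-! ### Averages over torsion translates -/

theorem periodic_val {q : ℕ} [NeZero q] {g : ℤ → ℂ} (hg : Periodic g q) (j : ℤ) :
    g ((j : ZMod q).val : ℤ) = g j := by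
  obtain ⟨k, hk⟩ := (ZMod.intCast_eq_intCast_iff_dvd_sub ((j : ZMod q).val : ℤ) j q).mp (by simp)
  have h := hg.int_mul k ((j : ZMod q).val : ℤ)
  rw [Int.cast_id, show ((j : ZMod q).val : ℤ) + k * q = j by linarith] at h
  exact h.symm

theorem sum_periodic_affine {q : ℕ} [NeZero q] {g : ℤ → ℂ} (hg : Periodic g q) {a : ℤ}
    (ha : IsUnit (a : ZMod q)) (b : ℤ) :
    ∑ x : ZMod q, g (a * (x.val : ℤ) + b) = ∑ x : ZMod q, g (x.val : ℤ) := by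
  obtain ⟨u, hu⟩ := ha
  rw [← ((Units.mulLeft u).trans (Equiv.addRight (b : ZMod q))).sum_comp
    (fun x : ZMod q => g (x.val : ℤ))]
  refine sum_congr rfl fun x _ => ?_
  rw [← periodic_val hg (a * (x.val : ℤ) + b)]
  congr 3
  simp [hu]

theorem sum_zmod_eq_fin {q : ℕ} [NeZero q] (f : ℕ → ℂ) :
    ∑ x : ZMod q, f x.val = ∑ i : Fin q, f i := by
  obtain ⟨n, rfl⟩ : ∃ n, q = n + 1 := ⟨q - 1, by have := NeZero.pos q; omega⟩
  rfl

/-- The translate of `φ(τ, z/q)` by the torsion point `(aτ + b)/q`, normalized for index `m`. -/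
def ator (m q : ℕ) (φ : ℂ → ℂ → ℂ) (τ z : ℂ) (a b : ℤ) : ℂ :=
  ee (m * (a ^ 2 * τ + 2 * a * z)) * φ τ ((z + a * τ + b) / q)

/-- The sum of all translates of `φ(τ, z/q)` by `q`-torsion points. -/
def utor (m q : ℕ) [NeZero q] (φ : ℂ → ℂ → ℂ) (τ z : ℂ) : ℂ :=
  ∑ x : ZMod q × ZMod q, ator m q φ τ z x.1.val x.2.val

theorem ator_shift {m q : ℕ} [NeZero q] (h : EllipticLaw (m * q ^ 2) φ)
    (hτ : 0 < τ.im) (z : ℂ) (a b l k : ℤ) :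
    ator m q φ τ z (a + q * l) (b + q * k) = ator m q φ τ z a b := by
  have hq0 : (q : ℂ) ≠ 0 := NeZero.ne _
  unfold ator
  rw [show (z + (a + q * l : ℤ) * τ + (b + q * k : ℤ)) / q = (z + a * τ + b) / q + l * τ + k by
    push_cast; field_simp; ring, h τ hτ, ← mul_assoc, ← ee_add,
    ← ee_add_int _ (2 * m * q * l * b)]
  congr 2
  push_cast; field_simp; ring

theorem ator_congr {m q : ℕ} [NeZero q] (h : EllipticLaw (m * q ^ 2) φ)
    (hτ : 0 < τ.im) (z : ℂ) {a b a' b' : ℤ} (ha : (a : ZMod q) = a') (hb : (b : ZMod q) = b') :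
    ator m q φ τ z a b = ator m q φ τ z a' b' := by
  obtain ⟨l, hl⟩ := (ZMod.intCast_eq_intCast_iff_dvd_sub _ _ _).mp ha.symm
  obtain ⟨k, hk⟩ := (ZMod.intCast_eq_intCast_iff_dvd_sub _ _ _).mp hb.symm
  rw [← ator_shift h hτ z a' b' l k]
  congr 1 <;> omega

theorem utor_S {m q : ℕ} [NeZero q] (h : EllipticLaw (m * q ^ 2) φ) (hS : ∀ τ z : ℂ, 0 < τ.im →
      φ (-1 / τ) (z / τ) = τ ^ k * ee ((m * q ^ 2 : ℕ) * z ^ 2 / τ) * φ τ z)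
    (hτ : 0 < τ.im) (z : ℂ) :
    utor m q φ (-1 / τ) (z / τ) = τ ^ k * ee (m * z ^ 2 / τ) * utor m q φ τ z := by
  have hq0 : (q : ℂ) ≠ 0 := NeZero.ne _
  have h0 := ne_zero_of_im_pos hτ
  rw [utor, utor, mul_sum]
  refine sum_bij' (fun x _ => (x.2, -x.1)) (fun x _ => (-x.2, x.1)) (by simp) (by simp)
    (by simp) (by simp) ?_
  intro x _
  rw [ator_congr h hτ z (a := (x.2.val : ℤ)) (a' := (x.2.val : ℤ))
    (b := ((-x.1).val : ℤ)) (b' := -(x.1.val : ℤ)) rfl (by simp)]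
  unfold ator
  set a : ℂ := (x.1.val : ℂ)
  set b : ℂ := (x.2.val : ℂ)
  rw [show (z / τ + ((x.1.val : ℤ) : ℂ) * (-1 / τ) + ((x.2.val : ℤ) : ℂ)) / q =
    (z + b * τ - a) / q / τ by push_cast; field_simp; ring, hS _ _ hτ,
    show (z + ((x.2.val : ℤ) : ℂ) * τ + ((-(x.1.val : ℤ) : ℤ) : ℂ)) / q = (z + b * τ - a) / q by
      push_cast; ring]
  set w := φ τ ((z + b * τ - a) / q)
  calc _ = τ ^ k * (ee (m * ((((x.1.val : ℤ) : ℂ)) ^ 2 * (-1 / τ) +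
          2 * ((x.1.val : ℤ) : ℂ) * (z / τ))) *
        ee ((m * q ^ 2 : ℕ) * ((z + b * τ - a) / q) ^ 2 / τ)) * w := by ring
    _ = τ ^ k * (ee (m * z ^ 2 / τ) * ee (m * (((x.2.val : ℤ) : ℂ) ^ 2 * τ +
          2 * ((x.2.val : ℤ) : ℂ) * z))) * w := by
        congr 2
        rw [← ee_add, ← ee_add, ← ee_add_int (m * z ^ 2 / τ + _)
          (-(2 * m * (x.1.val : ℤ) * (x.2.val : ℤ)))]
        congr 1
        push_cast; field_simp; ring
    _ = _ := by ring

/-- The operator on arrays, from index `m q²` to index `m`, given by averaging over torsion. -/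
def uop (q m : ℕ) [NeZero q] (c : Arr) (p : ℤ × ℤ) : ℂ :=
  ∑ x : ZMod q, c (p.1 + p.2 * x.val + m * (x.val : ℤ) ^ 2, q * (p.2 + 2 * m * x.val))

theorem uop_periodic {q m : ℕ} (hc : Ell (m * q ^ 2) c) (n r : ℤ) :
    Periodic (fun a : ℤ => c (n + r * a + m * a ^ 2, q * (r + 2 * m * a))) q := fun a => by
  change c _ = c _
  rw [← hc (n + r * a + m * a ^ 2) (q * (r + 2 * m * a)) 1]
  congr 2 <;> push_cast <;> ring

theorem uop_ell {q m : ℕ} [NeZero q] (hc : Ell (m * q ^ 2) c) : Ell m (uop q m c) := fun n r l => by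
  have := sum_periodic_affine (uop_periodic hc n r) (a := 1) (by simp) l
  unfold uop
  rw [← this]
  refine sum_congr rfl fun x _ => ?_
  congr 2 <;> ring

theorem uop_even {q m : ℕ} [NeZero q] (hc : Ell (m * q ^ 2) c) (he : Evn c) :
    Evn (uop q m c) := fun n r => by
  have := sum_periodic_affine (uop_periodic hc n r) (a := -1) (by simp) 0
  unfold uop
  rw [← this]
  refine sum_congr rfl fun x _ => ?_
  rw [← he]
  congr 2 <;> ring

theorem exists_low_of_disc (hm : 0 < m) {N : ℤ}
    (h : ∀ n r : ℤ, 4 * m * n - r ^ 2 < N → c (n, r) = 0) : ∃ L, LowAt L c :=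
  ⟨-|N|, fun n r hn => h n r (by
    have := neg_abs_le N
    have : (1 : ℤ) ≤ m := by exact_mod_cast hm
    nlinarith [sq_nonneg r, abs_nonneg N])⟩

theorem uop_low {q m : ℕ} [NeZero q] (hm : 0 < m) (hc : Ell (m * q ^ 2) c)
    {N : ℤ} (h : LowAt N c) : ∃ L, LowAt L (uop q m c) := by
  have hq : 0 < q := NeZero.pos q
  refine exists_low_of_disc hm (N := -|4 * (m * q ^ 2) * N - (m * q ^ 2) ^ 2|) fun n r hn =>
    sum_eq_zero fun x _ => ?_
  by_contra h1
  have h2 := ell_low_bound (by positivity) hc h h1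
  have e : 4 * ((m * q ^ 2 : ℕ) : ℤ) * (n + r * x.val + m * (x.val : ℤ) ^ 2) -
      (q * (r + 2 * m * x.val)) ^ 2 = q ^ 2 * (4 * m * n - r ^ 2) := by push_cast; ring
  rw [e] at h2
  push_cast at h2
  have h3 := neg_abs_le (4 * ((m : ℤ) * q ^ 2) * N - (m * q ^ 2) ^ 2)
  have h4 : (1 : ℤ) ≤ q ^ 2 := by exact_mod_cast Nat.one_le_pow _ _ hq
  nlinarith [abs_nonneg (4 * ((m : ℤ) * q ^ 2) * N - (m * q ^ 2) ^ 2)]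

theorem hasSum_torsion_translate {q : ℕ} [NeZero q] (m : ℕ) (hc : Sm c) (a : ℤ)
    (hτ : 0 < τ.im) (z : ℂ) :
    HasSum (fun p : ℤ × ℤ => c (p.1 + p.2 * a + m * a ^ 2, q * (p.2 + 2 * m * a)) * chr τ z p)
      (1 / q * ∑ b : ZMod q, ator m q (JF c) τ z (-a) b.val) := by
  have hq0 : (q : ℂ) ≠ 0 := NeZero.ne _
  have hq1 : (q : ℤ) ≠ 0 := NeZero.ne _
  have h1 : HasSum (fun p : ℤ × ℤ => c p * chr τ ((z - a * τ) / q) p *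
      (if (q : ℤ) ∣ p.2 then (q : ℂ) else 0)) (∑ b : ZMod q, JF c τ ((z - a * τ + b.val) / q)) := by
    refine (hasSum_sum fun b (_ : b ∈ (univ : Finset (ZMod q))) =>
      (hc τ ((z - a * τ + b.val) / q) hτ).hasSum).congr_fun fun p => ?_
    rw [← sum_ee_torsion, mul_sum]
    refine sum_congr rfl fun b _ => ?_
    rw [mul_assoc, chr, chr, ← ee_add]; congr 2; field_simp; ring
  let g : ℤ × ℤ → ℤ × ℤ := fun p => (p.1 + p.2 * a + m * a ^ 2, q * (p.2 + 2 * m * a))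
  have hg : Function.Injective g := by
    rintro ⟨n, r⟩ ⟨n', r'⟩ h
    simp only [g, Prod.mk.injEq] at h
    have := mul_left_cancel₀ hq1 h.2
    have h3 : r = r' := by linarith
    subst h3
    exact Prod.ext (by linarith [h.1]) rfl
  rw [← hg.hasSum_iff] at h1
  · have h2 := h1.mul_left (1 / q * ee (m * (a ^ 2 * τ - 2 * a * z)))
    have e : 1 / (q : ℂ) * ee (m * (a ^ 2 * τ - 2 * a * z)) *
        ∑ b : ZMod q, JF c τ ((z - a * τ + b.val) / q) =
        1 / q * ∑ b : ZMod q, ator m q (JF c) τ z (-a) b.val := by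
      rw [mul_assoc, mul_sum]
      congr 1
      refine sum_congr rfl fun b _ => ?_
      rw [ator]; congr 2
      · push_cast; ring
      · push_cast; ring
    rw [e] at h2
    refine h2.congr_fun fun p => ?_
    simp only [Function.comp, g, dvd_mul_right, if_true]
    have e2 : chr τ z p = ee (m * (a ^ 2 * τ - 2 * a * z)) * chr τ ((z - a * τ) / q) (g p) := by
      rw [chr, chr, ← ee_add]; congr 1; simp only [g]; push_cast; field_simp; ring
    rw [e2]; simp only [g]; field_simp
  · rintro ⟨n, r⟩ h
    rw [if_neg, mul_zero]
    rintro ⟨k, rfl⟩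
    exact h ⟨(n - (k - 2 * m * a) * a - m * a ^ 2, k - 2 * m * a), Prod.ext (by simp [g]; ring) (by simp [g])⟩

theorem uop_sm {q : ℕ} [NeZero q] (m : ℕ) (hc : Sm c) : Sm (uop q m c) :=
  fun τ z hτ => by
    refine (summable_sum fun (x : ZMod q) (_ : x ∈ univ) =>
      (hasSum_torsion_translate (q := q) m hc x.val hτ z).summable).congr fun p => ?_
    rw [uop, sum_mul]

theorem JF_uop {q m : ℕ} [NeZero q] (hc : Sm c) (hE : Ell (m * q ^ 2) c)
    (hτ : 0 < τ.im) (z : ℂ) : JF (uop q m c) τ z = 1 / q * utor m q (JF c) τ z := by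
  have h := hasSum_sum fun (x : ZMod q) (_ : x ∈ univ) =>
    hasSum_torsion_translate (q := q) m hc x.val hτ z
  have e : (fun p : ℤ × ℤ => ∑ x : ZMod q, c (p.1 + p.2 * (x.val : ℤ) + m * (x.val : ℤ) ^ 2,
      q * (p.2 + 2 * m * (x.val : ℤ))) * chr τ z p) = fun p => uop q m c p * chr τ z p := by
    ext p; rw [uop, sum_mul]
  rw [e] at h
  rw [JF, h.tsum_eq, ← mul_sum, utor, Fintype.sum_prod_type]
  congr 1
  rw [← Equiv.sum_comp (Equiv.neg (ZMod q))]
  refine sum_congr rfl fun x _ => sum_congr rfl fun y _ => ?_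
  exact ator_congr (JF_elliptic hE) hτ z (by simp) rfl

theorem WJ.uop {q m : ℕ} [NeZero q] (hm : 0 < m) (h : WJ k (m * q ^ 2) c) : WJ k m (uop q m c) where
  ell := uop_ell h.ell
  even := uop_even h.ell h.even
  low := let ⟨_, hN⟩ := h.low; uop_low hm h.ell hN
  sm := uop_sm m h.sm
  slaw := fun τ z hτ => by
    rw [JF_uop h.sm h.ell hτ, JF_uop h.sm h.ell (im_neg_one_div_pos hτ),
      utor_S (JF_elliptic h.ell) h.slaw hτ]; ring

theorem summable_A2sum (m : ℕ) (hτ : 0 < τ.im) (z : ℂ) :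
    Summable fun s : ℤ => ee (m * (s ^ 2 * τ + 2 * s * z)) * lam (s * τ + z) := by
  refine Summable.of_norm_bounded
    ((summable_wpSum hτ z).norm.mul_left (Real.exp (2 * π * (m * (z.im ^ 2 / τ.im))))) fun s => ?_
  rw [norm_mul, norm_ee]
  refine mul_le_mul_of_nonneg_right (Real.exp_le_exp.mpr ?_) (norm_nonneg _)
  rw [← mul_neg]
  refine mul_le_mul_of_nonneg_left ?_ (by positivity)
  have e : (m * ((s : ℂ) ^ 2 * τ + 2 * s * z)).im = m * (s ^ 2 * τ.im + 2 * s * z.im) := by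
    have e1 : ((s : ℂ) ^ 2) = ((s ^ 2 : ℝ) : ℂ) := by push_cast; rfl
    have e2 : (2 * (s : ℂ)) = ((2 * s : ℝ) : ℂ) := by push_cast; rfl
    rw [← ofReal_natCast, im_ofReal_mul, add_im, e1, e2, im_ofReal_mul, im_ofReal_mul]
  rw [e, ← mul_neg]
  refine mul_le_mul_of_nonneg_left ?_ (by positivity)
  rw [le_div_iff₀ hτ]
  nlinarith [sq_nonneg (s * τ.im + z.im)]

theorem continuousAt_lam {x : ℂ} (h : ee x ≠ 1) : ContinuousAt lam x :=
  ContinuousAt.div continuous_ee.continuousAt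
    ((continuousAt_const.sub continuous_ee.continuousAt).pow 2)
    (pow_ne_zero 2 (sub_ne_zero.mpr h.symm))

theorem sum_lam_torsion_of_ne {N : ℕ} [NeZero N] (hz : ee (N * z) ≠ 1) :
    ∑ b : ZMod N, lam (z + b.val / N) = N ^ 2 * lam (N * z) := by
  have hN0 : (N : ℂ) ≠ 0 := NeZero.ne _
  have hb : ∀ b : ZMod N, ee (z + b.val / N) ≠ 1 := fun b h => hz (by
    rw [← ee_add_int _ (b.val : ℤ), show (N * z + ((b.val : ℤ) : ℂ)) = N * (z + b.val / N) by
      push_cast; field_simp, ee_nat_mul, h, one_pow])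
  rcases lt_or_ge z.im 0 with h | h
  · have h1 := sum_lam_torsion (N := N) (z := -z) (by simpa using h)
    rw [mul_neg, lam_neg] at h1
    rw [← h1, ← Equiv.sum_comp (Equiv.neg (ZMod N))]
    refine sum_congr rfl fun b _ => ?_
    obtain ⟨k, hk⟩ := (ZMod.intCast_eq_intCast_iff_dvd_sub (-(b.val : ℤ)) ((-b).val : ℤ) N).mp
      (by simp)
    have : ((-b).val : ℂ) = -b.val + N * k := by exact_mod_cast (by linarith : ((-b).val : ℤ) = _)
    rw [← lam_neg, Equiv.neg_apply, this, lam, lam,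
      show -(z + (-b.val + N * k) / N) = (-z + b.val / N) + ((-k : ℤ) : ℂ) by
        push_cast; field_simp; ring, ee_add_int]
  · have hc : Tendsto (fun t : ℝ => z + t * I) (𝓝[>] 0) (𝓝 z) :=
      tendsto_nhdsWithin_of_tendsto_nhds (Continuous.tendsto' (by fun_prop) _ _ (by simp))
    have h1 : Tendsto (fun t : ℝ => ∑ b : ZMod N, lam (z + t * I + b.val / N)) (𝓝[>] 0)
        (𝓝 (∑ b : ZMod N, lam (z + b.val / N))) :=
      tendsto_finsetSum _ fun b _ => (continuousAt_lam (hb b)).tendsto.comp (hc.add_const _)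
    have h2 : Tendsto (fun t : ℝ => (N : ℂ) ^ 2 * lam (N * (z + t * I))) (𝓝[>] 0)
        (𝓝 ((N : ℂ) ^ 2 * lam (N * z))) :=
      ((continuousAt_lam hz).tendsto.comp (hc.const_mul _)).const_mul _
    refine tendsto_nhds_unique (h1.congr' ?_) h2
    filter_upwards [self_mem_nhdsWithin] with t ht
    exact sum_lam_torsion (by simp; linarith [Set.mem_Ioi.mp ht])

theorem utor_A2sum {m q : ℕ} [NeZero q] (hτ : 0 < τ.im) (hz : OffL τ z) :
    utor m q (A2sum (m * q ^ 2)) τ z = q ^ 2 * A2sum m τ z := by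
  have hq0 : (q : ℂ) ≠ 0 := NeZero.ne _
  let f : ZMod q → ℤ → ℂ := fun b s =>
    ee (m * (s ^ 2 * τ + 2 * s * z)) * lam ((z + s * τ + b.val) / q)
  have e1 : ∀ (b : ZMod q) (a s : ℤ), f b (s * q + a) = ee (m * (a ^ 2 * τ + 2 * a * z)) *
      (ee ((m * q ^ 2 : ℕ) * (s ^ 2 * τ + 2 * s * ((z + a * τ + (b.val : ℤ)) / q))) *
        lam (s * τ + (z + a * τ + (b.val : ℤ)) / q)) := by
    intro b a s
    simp only [f]
    rw [← mul_assoc, ← ee_add]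
    congr 1
    · rw [← ee_add_int _ (2 * m * q * s * b.val)]
      congr 1; push_cast; field_simp; ring
    · congr 1; push_cast; field_simp; ring
  have hs : ∀ (b : ZMod q) (a : ℤ), HasSum (fun s : ℤ => f b (s * q + a))
      (ator m q (A2sum (m * q ^ 2)) τ z a b.val) := fun b a => by
    simp only [e1]
    rw [ator, A2sum_eq]
    exact (summable_A2sum _ hτ _).hasSum.mul_left _
  have h1 : ∀ b : ZMod q, HasSum (f b)
      (∑ a : ZMod q, ator m q (A2sum (m * q ^ 2)) τ z a.val b.val) := fun b => by
    rw [sum_zmod_eq_fin (fun a : ℕ => ator m q (A2sum (m * q ^ 2)) τ z a b.val),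
      ← ((Int.divModEquiv q).symm.trans (Equiv.refl ℤ)).hasSum_iff,
      ← (Equiv.prodComm (Fin q) ℤ).hasSum_iff]
    have h2 : ∀ i : Fin q, HasSum (fun s : ℤ => (((f b) ∘ ((Int.divModEquiv q).symm.trans
        (Equiv.refl ℤ))) ∘ (Equiv.prodComm (Fin q) ℤ)) (i, s))
        (ator m q (A2sum (m * q ^ 2)) τ z (i : ℕ) b.val) := fun i => by
      simpa [Function.comp] using hs b (i : ℕ)
    have h3 : Summable ((((f b) ∘ ((Int.divModEquiv q).symm.trans
        (Equiv.refl ℤ))) ∘ (Equiv.prodComm (Fin q) ℤ))) := by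
      rw [← summable_norm_iff, summable_prod_of_nonneg (fun _ => norm_nonneg _)]
      exact ⟨fun i => (h2 i).summable.norm, Summable.of_finite⟩
    have h4 := h3.hasSum.prod_fiberwise h2
    rw [← h4.unique (hasSum_fintype _)]
    exact h3.hasSum
  have h2 := hasSum_sum fun (b : ZMod q) (_ : b ∈ univ) => h1 b
  rw [utor, Fintype.sum_prod_type, sum_comm, ← h2.tsum_eq, A2sum_eq, ← tsum_mul_left]
  refine tsum_congr fun s => ?_
  have h3 := sum_lam_torsion_of_ne (N := q) (z := (z + s * τ) / q)
    (by rw [mul_div_cancel₀ _ hq0, add_comm]; exact hz.ee_ne_one s)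
  rw [mul_div_cancel₀ _ hq0] at h3
  simp only [f]
  rw [← mul_sum, add_comm (s * τ) z, mul_left_comm, ← h3]
  simp only [← add_div]

theorem OffL.div (h : OffL τ z) {q : ℕ} [NeZero q] (a b : ℤ) :
    OffL τ ((z + a * τ + b) / q) := fun l k e => by
  have hq0 : (q : ℂ) ≠ 0 := NeZero.ne _
  rw [div_eq_iff hq0] at e
  exact h (q * l - a) (q * k - b) (by push_cast; linear_combination e)

/-- Averaging the finite part of a standard form yields that of lower index, modulo weakly
holomorphic forms. -/
theorem uop_stdArr {m q : ℕ} [NeZero q] (hm : 0 < m) :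
    WJ 2 m (uop q m (stdArr (m * q ^ 2)) - (q : ℂ) • stdArr m) := by
  have hq0 : (q : ℂ) ≠ 0 := NeZero.ne _
  have hmq : 0 < m * q ^ 2 := by have := NeZero.pos q; positivity
  have F := stdForm_finitePart (m * q ^ 2)
  have G := stdForm_finitePart m
  have hsm : Sm (uop q m (stdArr (m * q ^ 2)) - (q : ℂ) • stdArr m) :=
    (uop_sm m F.sm).sub (G.sm.smul _)
  have hoff : ∀ τ z : ℂ, 0 < τ.im → OffL τ z →
      JF (uop q m (stdArr (m * q ^ 2)) - (q : ℂ) • stdArr m) τ z =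
        1 / q * utor m q (stdForm (m * q ^ 2)) τ z - q * stdForm m τ z := by
    intro τ z hτ hz
    rw [JF_sub (uop_sm m F.sm τ z hτ) (G.sm.smul _ τ z hτ), JF_smul, JF_uop F.sm F.ell hτ,
      G.eq τ z hτ hz]
    have : utor m q (JF (stdArr (m * q ^ 2))) τ z = utor m q (stdForm (m * q ^ 2)) τ z -
        utor m q (A2sum (m * q ^ 2)) τ z := by
      rw [utor, utor, utor, ← sum_sub_distrib]
      refine sum_congr rfl fun x _ => ?_
      rw [ator, F.eq τ _ hτ (hz.div _ _), ator, ator]; ring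
    rw [this, utor_A2sum hτ hz]
    field_simp; ring
  have hS : ∀ k : ℕ, 0 < k → ∀ τ z : ℂ, 0 < τ.im →
      stdForm k (-1 / τ) (z / τ) = τ ^ (2 : ℤ) * ee (k * z ^ 2 / τ) * stdForm k τ z :=
    fun k hk τ z hτ => by simpa using (stdForm_isStandard k).1 τ hτ z 0 (-1) 1 0 (by norm_num)
  obtain ⟨L, hL⟩ := uop_low hm F.ell (stdArr_low hmq)
  refine ⟨?_, ?_, ⟨min L (-m), fun n r h => ?_⟩, hsm, fun τ z hτ => ?_⟩
  · exact fun n r l => by simp only [Pi.sub_apply, Pi.smul_apply, uop_ell F.ell n r l, G.ell n r l]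
  · exact fun n r => by
      simp only [Pi.sub_apply, Pi.smul_apply, uop_even F.ell F.even n r, G.even n r]
  · simp [hL n r (lt_of_lt_of_le h (min_le_left _ _)),
      stdArr_low hm n r (lt_of_lt_of_le h (min_le_right _ _))]
  · have hτ' := im_neg_one_div_pos hτ
    refine eq_of_eq_offL hτ (f := fun z => JF _ (-1 / τ) (z / τ))
      (g := fun z => τ ^ (2 : ℤ) * ee (m * z ^ 2 / τ) * JF _ τ z)
      ((hsm.continuous_right hτ').comp (by fun_prop))
      ((continuous_const.mul (continuous_ee.comp (by fun_prop))).mul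
        (hsm.continuous_right hτ)) (fun z hz => ?_) z
    rw [hoff τ z hτ hz, hoff _ _ hτ' ((offL_S (ne_zero_of_im_pos hτ)).mpr hz),
      utor_S (stdForm_isStandard (m * q ^ 2)).2.1 (hS _ hmq) hτ, hS m hm τ z hτ]; ring

def uopL (q m : ℕ) [NeZero q] : Arr →ₗ[ℂ] Arr where
  toFun := uop q m
  map_add' a b := by ext p; simp [uop, sum_add_distrib]
  map_smul' s a := by ext p; simp [uop, mul_sum]

theorem uopL_apply (q m : ℕ) [NeZero q] (c : Arr) : uopL q m c = uop q m c := rfl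

def uArrL (d : ℕ) : Arr →ₗ[ℂ] Arr where
  toFun := uArr d
  map_add' a b := by ext p; simp only [uArr, Pi.add_apply]; split_ifs <;> simp
  map_smul' s a := by
    ext p; simp only [uArr, Pi.smul_apply, smul_eq_mul, RingHom.id_apply]; split_ifs <;> simp

theorem uArrL_apply (d : ℕ) (c : Arr) : uArrL d c = uArr d c := rfl

theorem WJ.uArr {d m : ℕ} (hd : 0 < d) (h : WJ k m c) : WJ k (m * d ^ 2) (uArr d c) where
  ell := uArr_ell hd h.ell
  even := uArr_even h.even
  low := let ⟨N, hN⟩ := h.low; ⟨N, uArr_low hN⟩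
  sm := uArr_sm hd h.sm
  slaw := uArr_slaw hd h.sm h.slaw

theorem uop_uArr_of_dvd {p e k : ℕ} [NeZero p] (he : 0 < e) (hc : Ell k c) :
    uop p (k * e ^ 2) (uArr (p * e) c) = (p : ℂ) • uArr e c := by
  have hp : 0 < p := NeZero.pos p
  have hp0 : (p : ℤ) ≠ 0 := by exact_mod_cast hp.ne'
  ext ⟨n, r⟩
  simp only [uop, Pi.smul_apply, smul_eq_mul]
  by_cases h : (e : ℤ) ∣ r
  · obtain ⟨s, rfl⟩ := h
    rw [uArr_mul he, sum_congr rfl (g := fun _ => c (n, s)), sum_const,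
      card_univ, ZMod.card, nsmul_eq_mul]
    intro x _
    rw [show (p : ℤ) * (e * s + 2 * ((k * e ^ 2 : ℕ) : ℤ) * x.val) =
      ((p * e : ℕ) : ℤ) * (s + 2 * k * (e * x.val)) by push_cast; ring, uArr_mul (by positivity),
      ← hc n s (e * x.val)]
    congr 2; push_cast; ring
  · rw [uArr, if_neg h, mul_zero]
    refine sum_eq_zero fun x _ => ?_
    rw [uArr, if_neg]
    push_cast
    rw [mul_dvd_mul_iff_left hp0]
    exact fun h2 => h ((Int.dvd_add_left ⟨2 * k * e * x.val, by ring⟩).mp h2)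

theorem uop_uArr_of_coprime {p d k : ℕ} [NeZero p] (hd : 0 < d) (hpd : Nat.Coprime d p)
    (hc : Ell (k * p ^ 2) c) :
    uop p (k * d ^ 2) (uArr d c) = uArr d (uop p k c) := by
  ext ⟨n, r⟩
  simp only [uop]
  by_cases h : (d : ℤ) ∣ r
  · obtain ⟨s, rfl⟩ := h
    rw [uArr_mul hd]
    simp only [uop]
    rw [← sum_periodic_affine (uop_periodic hc n s) (a := d)
      (by rw [Int.cast_natCast]; exact (ZMod.isUnit_iff_coprime d p).mpr hpd) 0]
    refine sum_congr rfl fun x _ => ?_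
    rw [show (p : ℤ) * (d * s + 2 * ((k * d ^ 2 : ℕ) : ℤ) * x.val) =
      d * (p * (s + 2 * k * (d * x.val + 0))) by push_cast; ring, uArr_mul hd]
    congr 2; push_cast; ring
  · rw [uArr, if_neg h]
    refine sum_eq_zero fun x _ => ?_
    rw [uArr, if_neg]
    intro h2
    have h3 := (Int.isCoprime_iff_gcd_eq_one.mpr (by simpa using hpd) : IsCoprime (d : ℤ) p)
    exact h ((Int.dvd_add_left ⟨2 * k * d * x.val, by push_cast; ring⟩).mp
      (h3.dvd_of_dvd_mul_left h2))

/-- The torsion average of the primitive part of a family is weakly holomorphic as soon as the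
averages of the members agree with the members of lower index up to weakly holomorphic forms. -/
theorem uop_primArr {p m : ℕ} [NeZero p] (hp : p.Prime) (hm : 0 < m) {F : ℕ → Arr}
    (hE : ∀ k, 0 < k → Ell k (F k))
    (hF : ∀ k, 0 < k → WJ 2 k (uop p k (F (k * p ^ 2)) - (p : ℂ) • F k)) :
    WJ 2 m (uop p m (primArr (m * p ^ 2) F)) := by
  set S := (m * p ^ 2).divisors.filter (fun d => d ^ 2 ∣ m * p ^ 2) with hS
  set S' := m.divisors.filter (fun d => d ^ 2 ∣ m ∧ ¬ p ∣ d) with hS'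
  have hpp := hp.pos
  set f : ℕ → Arr := fun d => ((moebius d : ℤ) : ℂ) •
    uop p m (uArr d (F (m * p ^ 2 / d ^ 2))) with hf
  have e0 : uop p m (primArr (m * p ^ 2) F) = ∑ d ∈ S, f d := by
    rw [← uopL_apply, primArr, map_sum]
    simp only [map_smul, uopL_apply, hf]
    rfl
  have e1 : ∑ d ∈ S with ¬ p ∣ d, f d = ∑ d ∈ S', f d := by
    congr 1
    ext d
    simp only [hS, hS', mem_filter, Nat.mem_divisors]
    constructor
    · rintro ⟨⟨⟨h1, h2⟩, h3⟩, h4⟩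
      have hco : Nat.Coprime (d ^ 2) (p ^ 2) := (((hp.coprime_iff_not_dvd).mpr h4).symm).pow 2 2
      have h5 := hco.dvd_of_dvd_mul_right h3
      exact ⟨⟨(Dvd.intro_left (d ^ 1) (by ring)).trans h5, hm.ne'⟩, h5, h4⟩
    · rintro ⟨⟨h1, -⟩, h3, h4⟩
      exact ⟨⟨⟨h1.mul_right _, by positivity⟩, h3.mul_right _⟩, h4⟩
  have e2 : ∑ d ∈ S with p ∣ d, f d = ∑ e ∈ S', f (p * e) := by
    rw [← sum_image (f := f) (s := S') (g := fun e => p * e)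
      fun a _ b _ h => Nat.eq_of_mul_eq_mul_left hpp h]
    symm
    refine Finset.sum_subset ?_ ?_
    · intro d hd
      simp only [hS', Finset.mem_image, mem_filter, Nat.mem_divisors] at hd
      obtain ⟨e, ⟨⟨h1, h2⟩, h3, h4⟩, rfl⟩ := hd
      simp only [hS, mem_filter, Nat.mem_divisors]
      refine ⟨⟨⟨?_, by positivity⟩, ?_⟩, dvd_mul_right _ _⟩
      · rw [mul_comm p e]; exact mul_dvd_mul h1 (dvd_pow_self p two_ne_zero)
      · rw [mul_pow, mul_comm m]; exact mul_dvd_mul_left _ h3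
    · intro d hd hd'
      simp only [hS, mem_filter, Nat.mem_divisors] at hd
      obtain ⟨⟨-, h3⟩, e, rfl⟩ := hd
      have h5 : e ^ 2 ∣ m := by
        rw [mul_pow, mul_comm m] at h3
        exact Nat.dvd_of_mul_dvd_mul_left (by positivity) h3
      by_cases h4 : p ∣ e
      · obtain ⟨g, rfl⟩ := h4
        have : moebius (p * (p * g)) = 0 :=
          ArithmeticFunction.moebius_eq_zero_of_not_squarefree fun h =>
            hp.not_isUnit (h p ⟨g, by ring⟩)
        simp [hf, this]
      · exact absurd (Finset.mem_image.mpr ⟨e, by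
          simp only [hS', mem_filter, Nat.mem_divisors]
          exact ⟨⟨(Dvd.intro_left (e ^ 1) (by ring)).trans h5, hm.ne'⟩, h5, h4⟩, rfl⟩) hd'
  rw [e0, ← Finset.sum_filter_add_sum_filter_not S (fun d => p ∣ d), e1, e2,
    ← sum_add_distrib, ← mem_WJSub]
  refine Submodule.sum_mem _ fun d hd => ?_
  simp only [hS', mem_filter, Nat.mem_divisors] at hd
  obtain ⟨-, ⟨k, rfl⟩, h4⟩ := hd
  have hd0 : 0 < d := Nat.pos_of_ne_zero fun h => by subst h; simp at hm
  have hk : 0 < k := Nat.pos_of_mul_pos_left hm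
  have hco : Nat.Coprime d p := ((hp.coprime_iff_not_dvd).mpr h4).symm
  have hmu : moebius (p * d) = -moebius d := by
    rw [ArithmeticFunction.isMultiplicative_moebius.map_mul_of_coprime hco.symm,
      ArithmeticFunction.moebius_apply_prime hp, neg_one_mul]
  have e3 : d ^ 2 * k * p ^ 2 / (p * d) ^ 2 = k := by
    rw [show d ^ 2 * k * p ^ 2 = (p * d) ^ 2 * k by ring]
    exact Nat.mul_div_cancel_left _ (by positivity)
  have e4 : d ^ 2 * k * p ^ 2 / d ^ 2 = k * p ^ 2 := by
    rw [mul_assoc]; exact Nat.mul_div_cancel_left _ (by positivity)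
  simp only [hf]
  rw [e3, e4, hmu, mul_comm (d ^ 2) k, uop_uArr_of_dvd hd0 (hE k hk),
    uop_uArr_of_coprime hd0 hco (hE _ (by positivity))]
  have := ((hF k hk).uArr hd0).smul ((moebius d : ℤ) : ℂ)
  rw [← uArrL_apply, map_sub, map_smul, uArrL_apply, uArrL_apply] at this
  rw [mem_WJSub]
  convert this using 1
  push_cast
  module

/-! ### The index raising operator -/

/-- The operator `V_q` in weight `2` on arrays. -/
def vArr (q : ℕ) : Arr →ₗ[ℂ] Arr where
  toFun c p := c (q * p.1, p.2) +
    if (q : ℤ) ∣ p.1 ∧ (q : ℤ) ∣ p.2 then q * c (p.1 / q, p.2 / q) else 0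
  map_add' a b := by ext p; simp only [Pi.add_apply]; split_ifs <;> ring
  map_smul' s a := by
    ext p; simp only [Pi.smul_apply, smul_eq_mul, RingHom.id_apply]; split_ifs <;> ring

theorem vArr_apply (q : ℕ) (c : Arr) (n r : ℤ) : vArr q c (n, r) = c (q * n, r) +
    if (q : ℤ) ∣ n ∧ (q : ℤ) ∣ r then q * c (n / q, r / q) else 0 := rfl

theorem vArr_ell {q m : ℕ} [NeZero q] (hc : Ell m c) : Ell (m * q) (vArr q c) :=
  fun n r l => by
    have hq0 : (q : ℤ) ≠ 0 := NeZero.ne _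
    rw [vArr_apply, vArr_apply, ← hc (q * n) r (q * l)]
    congr 1
    · congr 2 <;> push_cast <;> ring
    · by_cases h2 : (q : ℤ) ∣ r
      · obtain ⟨s, rfl⟩ := h2
        by_cases h1 : (q : ℤ) ∣ n
        · obtain ⟨k, rfl⟩ := h1
          rw [show (q : ℤ) * k + q * s * l + ((m * q : ℕ) : ℤ) * l ^ 2 = q * (k + s * l + m * l ^ 2) by
            push_cast; ring, show (q : ℤ) * s + 2 * ((m * q : ℕ) : ℤ) * l = q * (s + 2 * m * l) by
            push_cast; ring]
          simp only [dvd_mul_right, and_self, if_true, Int.mul_ediv_cancel_left _ hq0, hc k s l]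
        · rw [if_neg, if_neg (fun h => h1 h.1)]
          intro h
          have h3 : (q : ℤ) ∣ q * s * l + ((m * q : ℕ) : ℤ) * l ^ 2 :=
            ⟨s * l + m * l ^ 2, by push_cast; ring⟩
          exact h1 ((Int.dvd_add_left h3).mp (by rw [← add_assoc]; exact h.1))
      · rw [if_neg, if_neg (fun h => h2 h.2)]
        intro h
        exact h2 ((Int.dvd_add_left ⟨2 * m * l, by push_cast; ring⟩).mp h.2)

theorem vArr_even {q : ℕ} (hc : Evn c) : Evn (vArr q c) := fun n r => by
  rw [vArr_apply, vArr_apply, hc]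
  simp only [Int.dvd_neg]
  by_cases h : (q : ℤ) ∣ n ∧ (q : ℤ) ∣ r
  · rw [if_pos h, if_pos h, Int.neg_ediv_of_dvd h.2, hc]
  · rw [if_neg h, if_neg h]

theorem hasSum_vArr {q : ℕ} [NeZero q] (hc : Sm c) (hτ : 0 < τ.im) (z : ℂ) :
    HasSum (fun p => vArr q c p * chr τ z p)
      (1 / q * ∑ b : ZMod q, JF c ((τ + b.val) / q) z + q * JF c (q * τ) (q * z)) := by
  have hq0 : (q : ℂ) ≠ 0 := NeZero.ne _
  have hq1 : (q : ℤ) ≠ 0 := NeZero.ne _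
  have hqp : (0 : ℝ) < q := by exact_mod_cast NeZero.pos q
  have him : ∀ b : ZMod q, 0 < ((τ + b.val) / q : ℂ).im := fun b => by
    rw [show ((τ + b.val) / q : ℂ) = (τ + b.val) / ((q : ℝ) : ℂ) by simp, div_ofReal_im]
    simp only [add_im, natCast_im, add_zero]; positivity
  have h1 : HasSum (fun p : ℤ × ℤ => c (q * p.1, p.2) * chr τ z p)
      (1 / q * ∑ b : ZMod q, JF c ((τ + b.val) / q) z) := by
    have h1 := (hasSum_sum fun b (_ : b ∈ (univ : Finset (ZMod q))) =>
      (hc ((τ + b.val) / q) z (him b)).hasSum).mul_left (1 / (q : ℂ))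
    have hg : Function.Injective (fun p : ℤ × ℤ => ((q : ℤ) * p.1, p.2)) := by
      rintro ⟨n, r⟩ ⟨n', r'⟩ h
      simp only [Prod.mk.injEq] at h
      exact Prod.ext (mul_left_cancel₀ hq1 h.1) h.2
    have e : ∀ p : ℤ × ℤ, 1 / (q : ℂ) * ∑ b : ZMod q, c p * chr ((τ + b.val) / q) z p =
        1 / q * (c p * chr (τ / q) z p * if (q : ℤ) ∣ p.1 then (q : ℂ) else 0) := fun p => by
      rw [← sum_ee_torsion]
      congr 1
      rw [mul_sum]
      refine sum_congr rfl fun b _ => ?_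
      rw [mul_assoc, chr, chr, ← ee_add]; congr 2; field_simp; ring
    simp only [e] at h1
    rw [← hg.hasSum_iff] at h1
    · refine h1.congr_fun fun p => ?_
      simp only [Function.comp, dvd_mul_right, if_true]
      rw [show chr (τ / q) z (q * p.1, p.2) = chr τ z p by
        simp only [chr]; congr 1; push_cast; field_simp]
      field_simp
    · rintro ⟨n, r⟩ h
      rw [if_neg, mul_zero, mul_zero]
      rintro ⟨k, rfl⟩
      exact h ⟨(k, r), rfl⟩
  have h2 : HasSum (fun p : ℤ × ℤ => (if (q : ℤ) ∣ p.1 ∧ (q : ℤ) ∣ p.2 then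
      q * c (p.1 / q, p.2 / q) else 0) * chr τ z p) (q * JF c (q * τ) (q * z)) := by
    have hg : Function.Injective (fun p : ℤ × ℤ => ((q : ℤ) * p.1, (q : ℤ) * p.2)) := by
      rintro ⟨n, r⟩ ⟨n', r'⟩ h
      simp only [Prod.mk.injEq] at h
      exact Prod.ext (mul_left_cancel₀ hq1 h.1) (mul_left_cancel₀ hq1 h.2)
    rw [← hg.hasSum_iff]
    · refine ((hc (q * τ) (q * z) (by simp; positivity)).hasSum.mul_left (q : ℂ)).congr_fun
        fun p => ?_
      simp only [Function.comp, dvd_mul_right, and_self, if_true, Int.mul_ediv_cancel_left _ hq1]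
      rw [mul_assoc]; congr 2
      simp only [chr]; congr 1; push_cast; ring
    · rintro ⟨n, r⟩ h
      rw [if_neg, zero_mul]
      rintro ⟨⟨k, rfl⟩, ⟨l, rfl⟩⟩
      exact h ⟨(k, l), rfl⟩
  refine (h1.add h2).congr_fun fun p => ?_
  rw [← add_mul]; rfl

theorem JF_vArr {q : ℕ} [NeZero q] (hc : Sm c) (hτ : 0 < τ.im) (z : ℂ) : JF (vArr q c) τ z =
      1 / q * ∑ b : ZMod q, JF c ((τ + b.val) / q) z + q * JF c (q * τ) (q * z) :=
  (hasSum_vArr hc hτ z).tsum_eq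

theorem WJ.vArr {q m : ℕ} [hq : Fact q.Prime] (h : WJ 2 m c) : WJ 2 (m * q) (vArr q c) where
  ell := vArr_ell h.ell
  even := vArr_even h.even
  low := by
    obtain ⟨N, hN⟩ := h.low
    have hq1 : (1 : ℤ) ≤ q := by exact_mod_cast hq.out.one_le
    refine ⟨-(q * |N|) , fun n r hn => ?_⟩
    have h1 := neg_abs_le N
    have h2 := abs_nonneg N
    have h4 : |N| ≤ q * |N| := by nlinarith
    have h5 : q * n ≤ n := by nlinarith
    rw [vArr_apply, hN _ _ (by linarith), zero_add]
    split_ifs with h3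
    · obtain ⟨⟨k, rfl⟩, -⟩ := h3
      rw [Int.mul_ediv_cancel_left _ (by omega), hN _ _ (by nlinarith), mul_zero]
    · rfl
  sm := fun τ z hτ => (hasSum_vArr h.sm hτ z).summable
  slaw := fun τ z hτ => by
    have hq0 : (q : ℂ) ≠ 0 := NeZero.ne _
    have hqp : (0 : ℝ) < q := by exact_mod_cast hq.out.pos
    have h0 := ne_zero_of_im_pos hτ
    have him : ∀ b : ℂ, b.im = 0 → 0 < ((τ + b) / q : ℂ).im := fun b hb => by
      rw [show ((τ + b) / q : ℂ) = (τ + b) / ((q : ℝ) : ℂ) by simp, div_ofReal_im]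
      simp only [add_im, hb, add_zero]; positivity
    have him2 : 0 < (q * τ : ℂ).im := by simp; positivity
    rw [JF_vArr h.sm (im_neg_one_div_pos hτ), JF_vArr h.sm hτ]
    have a1 : JF c (q * (-1 / τ)) (q * (z / τ)) =
        (τ / q) ^ (2 : ℤ) * ee ((m * q : ℕ) * z ^ 2 / τ) * JF c (τ / q) z := by
      have := h.slaw (τ / q) z (by simpa using him 0 rfl)
      rw [show -1 / (τ / q) = q * (-1 / τ) by field_simp, show z / (τ / q) = q * (z / τ) by field_simp]
        at this
      rw [this]; congr 3; push_cast; field_simp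
    have a2 : JF c ((-1 / τ) / q) (z / τ) =
        (q * τ) ^ (2 : ℤ) * ee ((m * q : ℕ) * z ^ 2 / τ) * JF c (q * τ) (q * z) := by
      have := h.slaw (q * τ) (q * z) him2
      rw [show -1 / (q * τ) = -1 / τ / q by field_simp, show q * z / (q * τ) = z / τ by field_simp]
        at this
      rw [this]; congr 3; push_cast; field_simp
    have a3 : ∀ b : ZMod q, b ≠ 0 → JF c ((-1 / τ + b.val) / q) (z / τ) =
        τ ^ (2 : ℤ) * ee ((m * q : ℕ) * z ^ 2 / τ) * JF c ((τ + ((-b⁻¹).val : ℂ)) / q) z := by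
      intro b hb
      set b' := -b⁻¹ with hb'
      obtain ⟨k, hk⟩ := (ZMod.intCast_eq_intCast_iff_dvd_sub ((b.val : ℤ) * b'.val) (-1) q).mp
        (by simp [hb', hb])
      have := h.modularLaw ((τ + b'.val) / q) (him _ (natCast_im _)) z b.val k q (-(b'.val))
        (by linear_combination hk)
      have e : (((q : ℕ) : ℤ) : ℂ) * ((τ + b'.val) / q) + ((-(b'.val : ℤ) : ℤ) : ℂ) = τ := by
        push_cast; field_simp; ring
      rw [e] at this
      have hkc : (-1 : ℂ) - b.val * b'.val = q * k := by exact_mod_cast hk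
      rw [show ((((b.val : ℕ) : ℤ) : ℂ) * ((τ + b'.val) / q) + (k : ℂ)) / τ =
        (-1 / τ + b.val) / q by push_cast; field_simp; linear_combination -hkc] at this
      rw [this]; congr 3; push_cast; ring
    rw [← add_sum_erase univ (fun b : ZMod q => JF c ((-1 / τ + b.val) / q) (z / τ))
      (mem_univ 0), ← add_sum_erase univ
      (fun b : ZMod q => JF c ((τ + b.val) / q) z) (mem_univ 0),
      sum_congr rfl (fun b hb => a3 b (ne_of_mem_erase hb)), ← mul_sum,
      sum_bij' (t := univ.erase (0 : ZMod q)) (g := fun b => JF c ((τ + (b.val : ℂ)) / q) z)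
        (fun b _ => -b⁻¹) (fun b _ => -b⁻¹) (by simp) (by simp) (by simp [inv_neg])
        (by simp [inv_neg]) (fun _ _ => rfl)]
    simp only [ZMod.val_zero, Nat.cast_zero, add_zero]
    rw [a1, a2, mul_zpow, div_zpow]
    field_simp
    ring

/-! ### A Hecke operator -/

theorem vArr_vArr_mul {q : ℕ} [NeZero q] (c : Arr) (n r : ℤ) :
    vArr q (vArr q c) (n, q * r) = c (q ^ 2 * n, q * r) + q * c (n, r) +
      (if (q : ℤ) ∣ n then q * c (n, r) else 0) +
      if (q : ℤ) ^ 2 ∣ n ∧ (q : ℤ) ∣ r then q ^ 2 * c (n / q ^ 2, r / q) else 0 := by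
  have hq0 : (q : ℤ) ≠ 0 := NeZero.ne _
  rw [vArr_apply, vArr_apply]
  simp only [dvd_mul_right, and_self, and_true, if_true, Int.mul_ediv_cancel_left _ hq0]
  rw [← mul_assoc, ← sq]
  by_cases h : (q : ℤ) ∣ n
  · obtain ⟨k, rfl⟩ := h
    simp only [dvd_mul_right, if_true, Int.mul_ediv_cancel_left _ hq0, vArr_apply]
    by_cases h2 : (q : ℤ) ∣ k ∧ (q : ℤ) ∣ r
    · have h3 : (q : ℤ) ^ 2 ∣ q * k ∧ (q : ℤ) ∣ r :=
        ⟨by rw [sq]; exact mul_dvd_mul_left _ h2.1, h2.2⟩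
      rw [if_pos h2, if_pos h3, sq (q : ℤ), Int.mul_ediv_mul_of_pos _ _ (by have := NeZero.pos q; omega)]
      ring
    · rw [if_neg h2, if_neg]
      · ring
      · rw [sq, mul_dvd_mul_iff_left hq0]; exact h2
  · have h2 : ¬ ((q : ℤ) ^ 2 ∣ n ∧ (q : ℤ) ∣ r) := fun h2 =>
      h ((dvd_pow_self _ two_ne_zero).trans h2.1)
    simp [h, h2]

/-- The Hecke operator attached to a prime `q`. -/
def tOp (q m : ℕ) [NeZero q] : Arr →ₗ[ℂ] Arr :=
  (1 / q : ℂ) • (uopL q m ∘ₗ vArr q ∘ₗ vArr q) - (q + 1 : ℂ) • LinearMap.id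

theorem tOp_apply {q m : ℕ} [NeZero q] (hc : Ell m c) (n r : ℤ) :
    tOp q m c (n, r) = c (q ^ 2 * n, q * r) +
      ((∑ x : ZMod q, if (q : ℤ) ∣ n + r * x.val + m * (x.val : ℤ) ^ 2 then 1 else 0) - 1) *
        c (n, r) +
      q * ∑ x : ZMod q, if (q : ℤ) ^ 2 ∣ n + r * x.val + m * (x.val : ℤ) ^ 2 ∧
          (q : ℤ) ∣ r + 2 * m * x.val then
        c ((n + r * x.val + m * (x.val : ℤ) ^ 2) / q ^ 2, (r + 2 * m * x.val) / q) else 0 := by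
  have hq0 : (q : ℂ) ≠ 0 := NeZero.ne _
  have e : ∀ x : ZMod q, vArr q (vArr q c) (n + r * x.val + m * (x.val : ℤ) ^ 2,
      q * (r + 2 * m * x.val)) = c (q ^ 2 * n, q * r) + q * c (n, r) +
      (q * c (n, r)) * (if (q : ℤ) ∣ n + r * x.val + m * (x.val : ℤ) ^ 2 then 1 else 0) +
      q ^ 2 * if (q : ℤ) ^ 2 ∣ n + r * x.val + m * (x.val : ℤ) ^ 2 ∧
          (q : ℤ) ∣ r + 2 * m * x.val then
        c ((n + r * x.val + m * (x.val : ℤ) ^ 2) / q ^ 2, (r + 2 * m * x.val) / q) else 0 := by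
    intro x
    rw [vArr_vArr_mul, hc n r x.val]
    have := hc (q ^ 2 * n) (q * r) (q * x.val)
    rw [show (q : ℤ) ^ 2 * (n + r * x.val + m * (x.val : ℤ) ^ 2) =
      q ^ 2 * n + q * r * (q * x.val) + m * (q * x.val) ^ 2 by ring,
      show (q : ℤ) * (r + 2 * m * x.val) = q * r + 2 * m * (q * x.val) by ring, this]
    congr 1
    · congr 1; split_ifs <;> simp
    · split_ifs <;> simp
  simp only [tOp, LinearMap.sub_apply, LinearMap.smul_apply, LinearMap.comp_apply, uopL_apply,
    Pi.sub_apply, Pi.smul_apply, smul_eq_mul, LinearMap.id_apply, uop, e]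
  rw [sum_add_distrib, sum_add_distrib, ← mul_sum, ← mul_sum,
    sum_const, card_univ, ZMod.card, nsmul_eq_mul]
  field_simp
  ring

theorem WJ.tOp {q m : ℕ} [Fact q.Prime] (hm : 0 < m) (h : WJ 2 m c) : WJ 2 m (tOp q m c) := by
  have h1 := h.vArr (q := q) |>.vArr (q := q)
  rw [mul_assoc, ← sq] at h1
  have := ((h1.uop hm).smul (1 / q : ℂ)).add (h.smul (-(q + 1 : ℂ)))
  convert this using 1
  rw [neg_smul, ← sub_eq_add_neg]
  rfl

/-- The indicator of the orbit of arrays entries with discriminant `Δ` and residue `±r₀`. -/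
def eArr (m : ℕ) (Δ r₀ : ℤ) (p : ℤ × ℤ) : ℂ :=
  if 4 * m * p.1 - p.2 ^ 2 = Δ ∧ ((2 * m : ℤ) ∣ p.2 - r₀ ∨ (2 * m : ℤ) ∣ p.2 + r₀) then 1 else 0

theorem eArr_ell (m : ℕ) (Δ r₀ : ℤ) : Ell m (eArr m Δ r₀) := fun n r l => by
  unfold eArr
  have h1 : (2 * m : ℤ) ∣ r + 2 * m * l - r₀ ↔ (2 * m : ℤ) ∣ r - r₀ := by
    rw [show r + 2 * m * l - r₀ = r - r₀ + 2 * m * l by ring]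
    exact Int.dvd_add_left (dvd_mul_right _ _)
  have h2 : (2 * m : ℤ) ∣ r + 2 * m * l + r₀ ↔ (2 * m : ℤ) ∣ r + r₀ := by
    rw [show r + 2 * m * l + r₀ = r + r₀ + 2 * m * l by ring]
    exact Int.dvd_add_left (dvd_mul_right _ _)
  simp only [h1, h2]
  rw [show 4 * (m : ℤ) * (n + r * l + m * l ^ 2) - (r + 2 * m * l) ^ 2 = 4 * m * n - r ^ 2 by ring]

theorem sum_indicator_linear {q : ℕ} [Fact q.Prime] {a : ℤ} (ha : ¬ (q : ℤ) ∣ a) (b : ℤ) :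
    ∑ x : ZMod q, (if (q : ℤ) ∣ b + a * x.val then (1 : ℂ) else 0) = 1 := by
  have hu : IsUnit (a : ZMod q) := by
    rw [isUnit_iff_ne_zero, ne_eq, ZMod.intCast_zmod_eq_zero_iff_dvd]; exact ha
  have := sum_periodic_affine (q := q) (g := fun y : ℤ => if (q : ℤ) ∣ y then (1 : ℂ) else 0)
    (fun y => by simp) hu b
  simp only [add_comm b]
  rw [this, sum_eq_single 0]
  · simp
  · intro x _ hx
    rw [if_neg]
    rw [← ZMod.intCast_zmod_eq_zero_iff_dvd]
    simpa using hx
  · simp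

theorem sum_indicator_quadratic {q : ℕ} [Fact q.Prime] (hq : ¬ (q : ℤ) ∣ 2 * m) (n r : ℤ) :
    ∑ x : ZMod q, (if (q : ℤ) ∣ n + r * x.val + m * (x.val : ℤ) ^ 2 then (1 : ℂ) else 0) =
      legendreSym q (-(4 * m * n - r ^ 2)) + 1 := by
  have hqp : Prime (q : ℤ) := Nat.prime_iff_prime_int.mp Fact.out
  have h2 : q ≠ 2 := fun h => hq (by subst h; exact dvd_mul_right _ _)
  have hu : IsUnit ((2 * m : ℤ) : ZMod q) := by
    rw [isUnit_iff_ne_zero, ne_eq, ZMod.intCast_zmod_eq_zero_iff_dvd]; exact hq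
  have h4 : ¬ (q : ℤ) ∣ 4 * m := fun h => hq (by
    rw [show (4 * m : ℤ) = 2 * (2 * m) by ring] at h
    rcases hqp.dvd_or_dvd h with h | h
    · exact h.mul_right _
    · exact h)
  set Δ := 4 * m * n - r ^ 2 with hΔ
  have e1 := sum_periodic_affine (q := q) (g := fun y : ℤ => if (q : ℤ) ∣ Δ + y ^ 2 then (1 : ℂ) else 0)
    (fun y => by
      have : (q : ℤ) ∣ Δ + (y + q) ^ 2 ↔ (q : ℤ) ∣ Δ + y ^ 2 := by
        rw [show Δ + (y + q) ^ 2 = Δ + y ^ 2 + q * (2 * y + q) by ring]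
        exact Int.dvd_add_left (dvd_mul_right _ _)
      simp only [this]) hu r
  have e2 : ∀ x : ZMod q, (q : ℤ) ∣ n + r * x.val + m * (x.val : ℤ) ^ 2 ↔
      (q : ℤ) ∣ Δ + (2 * m * x.val + r) ^ 2 := fun x => by
    rw [show Δ + (2 * m * x.val + r) ^ 2 = 4 * m * (n + r * x.val + m * (x.val : ℤ) ^ 2) by
      rw [hΔ]; ring]
    exact ⟨fun h => h.mul_left _, fun h => (hqp.dvd_or_dvd h).resolve_left h4⟩
  simp only [e2]
  rw [e1, Finset.sum_boole]
  have := legendreSym.card_sqrts q h2 (-Δ)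
  rw [← Int.cast_one, ← Int.cast_add, ← this]
  rw [Int.cast_natCast]
  congr 2
  ext x
  simp only [mem_filter, mem_univ, true_and, Set.mem_toFinset, Set.mem_ofPred_eq]
  rw [← ZMod.intCast_zmod_eq_zero_iff_dvd]
  push_cast
  rw [ZMod.natCast_zmod_val, eq_neg_iff_add_eq_zero, add_comm]

theorem tOp_eArr {q m : ℕ} [Fact q.Prime] (hq : ¬ (q : ℤ) ∣ 2 * m) (Δ r₀ : ℤ) (p : ℤ × ℤ) :
    tOp q m (eArr m Δ r₀) p = eArr m Δ r₀ (q ^ 2 * p.1, q * p.2) +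
      legendreSym q (-Δ) * eArr m Δ r₀ p + q * eArr m (q ^ 2 * Δ) (q * r₀) p := by
  obtain ⟨n, r⟩ := p
  have hqp : Prime (q : ℤ) := Nat.prime_iff_prime_int.mp Fact.out
  have hq0 := hqp.ne_zero
  have hco : IsCoprime (2 * m : ℤ) q := ((Prime.coprime_iff_not_dvd hqp).mpr hq).symm
  rw [tOp_apply (eArr_ell m Δ r₀), sum_indicator_quadratic hq]
  congr 1
  · congr 1
    rw [add_sub_cancel_right]
    by_cases h : 4 * (m : ℤ) * n - r ^ 2 = Δ
    · rw [h]
    · simp [eArr, h]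
  · congr 1
    have e : ∀ x : ZMod q, (if (q : ℤ) ^ 2 ∣ n + r * x.val + m * (x.val : ℤ) ^ 2 ∧
          (q : ℤ) ∣ r + 2 * m * x.val then
        eArr m Δ r₀ ((n + r * x.val + m * (x.val : ℤ) ^ 2) / q ^ 2, (r + 2 * m * x.val) / q)
        else 0) = eArr m (q ^ 2 * Δ) (q * r₀) (n, r) *
          if (q : ℤ) ∣ r + 2 * m * x.val then 1 else 0 := by
      intro x
      have hd : 4 * (m : ℤ) * (n + r * x.val + m * (x.val : ℤ) ^ 2) - (r + 2 * m * x.val) ^ 2 =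
        4 * m * n - r ^ 2 := by ring
      by_cases h2 : (q : ℤ) ∣ r + 2 * m * x.val
      · rw [if_pos h2, mul_one]
        obtain ⟨s, hs⟩ := h2
        have hrs : ∀ t : ℤ, (2 * m : ℤ) ∣ s - t ↔ (2 * m : ℤ) ∣ r - q * t := fun t => by
          rw [show r - q * t = q * (s - t) + 2 * m * (-x.val) by linear_combination hs,
            Int.dvd_add_left (dvd_mul_right _ _)]
          exact ⟨fun h => h.mul_left _, fun h => hco.dvd_of_dvd_mul_left h⟩
        have hrs' : (2 * m : ℤ) ∣ s + r₀ ↔ (2 * m : ℤ) ∣ r + q * r₀ := by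
          have := hrs (-r₀); rwa [sub_neg_eq_add, mul_neg, sub_neg_eq_add] at this
        rw [hs] at hd ⊢
        rw [Int.mul_ediv_cancel_left _ hq0]
        by_cases h1 : (q : ℤ) ^ 2 ∣ n + r * x.val + m * (x.val : ℤ) ^ 2
        · rw [if_pos ⟨h1, dvd_mul_right _ _⟩]
          obtain ⟨k, hk⟩ := h1
          rw [hk] at hd ⊢
          rw [Int.mul_ediv_cancel_left _ (pow_ne_zero 2 hq0)]
          have hΔ : 4 * (m : ℤ) * k - s ^ 2 = Δ ↔ 4 * (m : ℤ) * n - r ^ 2 = q ^ 2 * Δ := by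
            rw [← hd, show 4 * (m : ℤ) * (q ^ 2 * k) - (q * s) ^ 2 = q ^ 2 * (4 * m * k - s ^ 2) by
              ring]
            exact (mul_right_inj' (pow_ne_zero 2 hq0)).symm
          simp only [eArr, hΔ, hrs r₀, hrs']
        · rw [if_neg (fun h => h1 h.1), eArr, if_neg]
          rintro ⟨h3, -⟩
          apply h1
          have h4 : IsCoprime ((q : ℤ) ^ 2) (2 * (2 * m)) := by
            refine IsCoprime.pow_left (IsCoprime.mul_right ?_ hco.symm)
            exact hco.symm.of_mul_right_left
          refine h4.dvd_of_dvd_mul_left ⟨Δ + s ^ 2, ?_⟩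
          simp only at h3
          linear_combination hd + h3
      · rw [if_neg (fun h => h2 h.2), if_neg h2, mul_zero]
    simp only [e]
    rw [← mul_sum, sum_indicator_linear hq, mul_one]

/-! ### A Nakayama argument -/

theorem chain_eq_zero {W : Type*} [AddCommGroup W] [Module ℂ W] (T : W →ₗ[ℤ] W) {q : ℕ} (hq : 2 ≤ q)
    (z : ℕ → W) (h0 : T (z 0) = (q : ℤ) • z 1)
    (h1 : ∀ k, T (z (k + 1)) = (q : ℤ) • z (k + 2) + z k)
    {Λ : Submodule ℤ W} (hΛ : Λ.FG) (hz : ∀ k, z k ∈ Λ) (k : ℕ) : z k = 0 := by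
  set M : Submodule ℤ W := Submodule.span ℤ (Set.range z) with hM
  have hzM : ∀ k, z k ∈ M := fun k => Submodule.subset_span ⟨k, rfl⟩
  have hMle : M ≤ Λ := Submodule.span_le.mpr (by rintro _ ⟨k, rfl⟩; exact hz k)
  have : IsNoetherian ℤ Λ := isNoetherian_of_fg_of_noetherian Λ hΛ
  have hfg : M.FG := by
    have := IsNoetherian.noetherian (M.comap Λ.subtype)
    have h2 := this.map Λ.subtype
    rwa [Submodule.map_comap_subtype, inf_eq_right.mpr hMle] at h2
  have hTM : ∀ x ∈ M, T x ∈ M := by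
    have : M ≤ M.comap T := Submodule.span_le.mpr (by
      rintro _ ⟨k, rfl⟩
      change T (z k) ∈ M
      cases k with
      | zero => rw [h0]; exact M.smul_mem _ (hzM _)
      | succ k => rw [h1]; exact M.add_mem (M.smul_mem _ (hzM _)) (hzM _))
    exact this
  have : IsNoetherian ℤ M := isNoetherian_of_fg_of_noetherian M hfg
  set N := LinearMap.range (LinearMap.lsmul ℤ M q)
  have hN : N ≤ N.comap (T.restrict hTM) := by
    rintro _ ⟨y, rfl⟩
    exact ⟨T.restrict hTM y, (map_smul _ _ _).symm⟩
  set Q := N.mapQ N (T.restrict hTM) hN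
  have hQ (k : ℕ) : Q (N.mkQ ⟨z (k + 1), hzM _⟩) = N.mkQ ⟨z k, hzM k⟩ :=
    (Submodule.Quotient.eq N).mpr ⟨⟨z (k + 2), hzM _⟩, Subtype.ext (by simp [h1])⟩
  have hQ0 : Q (N.mkQ ⟨z 0, hzM 0⟩) = 0 :=
    (Submodule.Quotient.mk_eq_zero N).mpr ⟨⟨z 1, hzM _⟩, Subtype.ext (by simp [h0])⟩
  have hsurj : Function.Surjective Q := by
    have h3 (x : W) (hx : x ∈ M) : N.mkQ ⟨x, hx⟩ ∈ LinearMap.range Q := by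
      induction hx using Submodule.span_induction with
      | mem x h => obtain ⟨k, rfl⟩ := h; exact ⟨_, hQ k⟩
      | zero => exact zero_mem _
      | add a b _ _ ha hb => exact add_mem ha hb
      | smul s a _ ha => exact Submodule.smul_mem _ s ha
    intro y
    obtain ⟨x, rfl⟩ := N.mkQ_surjective y
    exact h3 x x.2
  have hinj := IsNoetherian.injective_of_surjective_endomorphism Q hsurj
  have hzero (k : ℕ) : N.mkQ ⟨z k, hzM k⟩ = 0 := by
    induction k with
    | zero => exact hinj (hQ0.trans (map_zero Q).symm)
    | succ k ih => exact hinj ((hQ k).trans (ih.trans (map_zero Q).symm))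
  have hle : M ≤ Ideal.span {(q : ℤ)} • M := Submodule.span_le.mpr (by
    rintro _ ⟨k, rfl⟩
    obtain ⟨y, hy⟩ := (Submodule.Quotient.mk_eq_zero N).mp (hzero k)
    rw [show z k = (q : ℤ) • (y : W) from (congrArg Subtype.val hy).symm]
    exact Submodule.smul_mem_smul (Ideal.mem_span_singleton_self _) y.2)
  obtain ⟨r, hr1, hr2⟩ := Submodule.exists_sub_one_mem_and_smul_eq_zero_of_fg_of_le_smul
    (Ideal.span {(q : ℤ)}) M hfg hle
  have hr : r ≠ 0 := by
    rintro rfl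
    rw [Ideal.mem_span_singleton, zero_sub, Int.dvd_neg] at hr1
    have := Int.le_of_dvd one_pos hr1
    omega
  have h3 := hr2 _ (hzM k)
  rw [← Int.cast_smul_eq_zsmul ℂ] at h3
  exact (smul_eq_zero.mp h3).resolve_left (by exact_mod_cast hr)

/-! ### Orbit representatives -/

/-- Arrays whose coefficients of discriminant `≤ 0` vanish. -/
def PosSub (m : ℕ) : Submodule ℂ Arr where
  carrier := {c | ∀ n r : ℤ, 4 * m * n - r ^ 2 ≤ 0 → c (n, r) = 0}
  zero_mem' := fun _ _ _ => rfl
  add_mem' := fun ha hb n r h => by simp [ha n r h, hb n r h]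
  smul_mem' := fun s a ha n r h => by simp [ha n r h]

/-- Arrays whose coefficients of discriminant `≤ 0` vanish, except for discriminant `-1`. -/
def OptSub (m : ℕ) : Submodule ℂ Arr where
  carrier := {c | ∀ n r : ℤ, 4 * m * n - r ^ 2 ≤ 0 → 4 * m * n - r ^ 2 ≠ -1 → c (n, r) = 0}
  zero_mem' := fun _ _ _ _ => rfl
  add_mem' := fun ha hb n r h h' => by simp [ha n r h h', hb n r h h']
  smul_mem' := fun s a ha n r h h' => by simp [ha n r h h']

theorem posSub_le_optSub (m : ℕ) : PosSub m ≤ OptSub m := fun _ hc n r h _ => hc n r h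

theorem exists_rep (hm : 0 < m) (n r : ℤ) : ∃ (s : ℕ) (n₀ : ℤ), s ≤ m ∧
    4 * m * n₀ - (s : ℤ) ^ 2 = 4 * m * n - r ^ 2 ∧
    ∀ d : Arr, Ell m d → Evn d → d (n, r) = d (n₀, s) := by
  have hm' : (0 : ℤ) < 2 * m := by omega
  set t := r % (2 * m) with ht
  set l := -(r / (2 * m)) with hl
  have h0 : 0 ≤ t := Int.emod_nonneg _ hm'.ne'
  have h1 : t < 2 * m := Int.emod_lt_of_pos _ hm'
  have h2 : r + 2 * m * l = t := by rw [hl, ht, Int.emod_def]; ring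
  have h3 : ∀ k : ℤ, 4 * (m : ℤ) * (n + r * k + m * k ^ 2) - (r + 2 * m * k) ^ 2 =
    4 * m * n - r ^ 2 := fun k => by ring
  rcases le_or_gt t m with h | h
  · refine ⟨t.toNat, n + r * l + m * l ^ 2, by omega, ?_, fun d hd _ => ?_⟩
    · rw [Int.toNat_of_nonneg h0, ← h2]; exact h3 l
    · rw [Int.toNat_of_nonneg h0, ← h2, hd]
  · have h4 : r + 2 * m * (l - 1) = -(2 * m - t) := by rw [← h2]; ring
    refine ⟨(2 * m - t).toNat, n + r * (l - 1) + m * (l - 1) ^ 2, by omega, ?_, fun d hd he => ?_⟩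
    · rw [Int.toNat_of_nonneg (by omega), ← neg_sq (2 * (m : ℤ) - t), ← h4]; exact h3 _
    · rw [Int.toNat_of_nonneg (by omega), ← he _ (2 * (m : ℤ) - t), ← h4, hd]

theorem eArr_even (m : ℕ) (Δ r₀ : ℤ) : Evn (eArr m Δ r₀) := fun n r => by
  have h1 : (2 * m : ℤ) ∣ -r - r₀ ↔ (2 * m : ℤ) ∣ r + r₀ := by
    rw [show -r - r₀ = -(r + r₀) by ring, Int.dvd_neg]
  have h2 : (2 * m : ℤ) ∣ -r + r₀ ↔ (2 * m : ℤ) ∣ r - r₀ := by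
    rw [show -r + r₀ = -(r - r₀) by ring, Int.dvd_neg]
  simp only [eArr, neg_sq, h1, h2, or_comm]

theorem eArr_low (hm : 0 < m) (Δ r₀ : ℤ) : ∃ L, LowAt L (eArr m Δ r₀) :=
  exists_low_of_disc hm (N := Δ) fun n r h => by rw [eArr, if_neg (fun h2 => h.ne h2.1)]

theorem eArr_rep (hm : 0 < m) {s s' : ℕ} (hs : s ≤ m) (hs' : s' ≤ m) (n n' : ℤ) :
    eArr m (4 * m * n' - (s' : ℤ) ^ 2) s' (n, s) = if n' = n ∧ s' = s then 1 else 0 := by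
  rw [eArr]
  refine if_congr ⟨?_, ?_⟩ rfl rfl
  · rintro ⟨h1, h2⟩
    have h3 : s' = s := by
      rcases h2 with ⟨k, hk⟩ | ⟨k, hk⟩
      · have : k = 0 := by
          have : -1 < k := by nlinarith
          have : k < 1 := by nlinarith
          omega
        subst this; omega
      · have : -1 < k := by nlinarith
        have : k < 2 := by nlinarith
        obtain rfl | rfl : k = 0 ∨ k = 1 := by omega
        · omega
        · omega
    subst h3
    refine ⟨?_, rfl⟩
    have : (4 * m : ℤ) * n' = 4 * m * n := by linarith
    exact mul_left_cancel₀ (by omega) this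
  · rintro ⟨rfl, rfl⟩; simp

theorem sub_sum_eArr_mem (hm : 0 < m) (hE : Ell m c) (he : Evn c) {L : ℤ}
    (hL : LowAt L c) : c - ∑ s ∈ range (m + 1), ∑ n ∈ Icc L m,
      c (n, s) • eArr m (4 * m * n - (s : ℤ) ^ 2) s ∈ PosSub m := by
  set d := ∑ s ∈ range (m + 1), ∑ n ∈ Icc L m, c (n, s) • eArr m (4 * m * n - (s : ℤ) ^ 2) s with hd
  have hdE : Ell m d := fun n r l => by
    simp only [hd, Finset.sum_apply, Pi.smul_apply, eArr_ell m _ _ n r l]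
  have hde : Evn d := fun n r => by
    simp only [hd, Finset.sum_apply, Pi.smul_apply, eArr_even m _ _ n r]
  intro n r hn
  obtain ⟨s, n₀, hs, h1, h2⟩ := exists_rep hm n r
  rw [Pi.sub_apply, h2 c hE he, h2 d hdE hde, sub_eq_zero, hd]
  simp only [Finset.sum_apply, Pi.smul_apply, smul_eq_mul]
  rw [Finset.sum_eq_single_of_mem s (mem_range.mpr (by omega))]
  · by_cases hn0 : n₀ < L
    · rw [hL _ _ hn0]
      symm
      refine sum_eq_zero fun n' hn' => ?_
      rw [eArr_rep hm hs hs, if_neg, mul_zero]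
      rintro ⟨rfl, -⟩
      have := (mem_Icc.mp hn').1
      omega
    · rw [Finset.sum_eq_single_of_mem n₀]
      · rw [eArr_rep hm hs hs]; simp
      · refine mem_Icc.mpr ⟨by omega, ?_⟩
        have : (s : ℤ) ≤ m := by exact_mod_cast hs
        by_contra h
        nlinarith
      · intro n' _ hn'
        rw [eArr_rep hm hs hs, if_neg (fun h => hn' h.1), mul_zero]
  · intro s' hs' hne
    refine sum_eq_zero fun n' _ => ?_
    rw [eArr_rep hm hs (by rw [mem_range] at hs'; omega), if_neg (fun h => hne h.2), mul_zero]

/-! ### Integral weakly holomorphic forms with given leading term -/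

theorem exists_four_six (h0 : 0 ≤ k) (he : Even k) (h2 : k ≠ 2) :
    ∃ a b : ℕ, 4 * (a : ℤ) + 6 * b = k := by
  obtain ⟨j, rfl⟩ := he
  rcases Int.even_or_odd j with ⟨i, rfl⟩ | ⟨i, rfl⟩
  · exact ⟨i.toNat, 0, by push_cast; omega⟩
  · exact ⟨(i - 1).toNat, 1, by push_cast; omega⟩

theorem exists_leadTerm {m s c : ℕ} (hm : 0 < m) (hs : s ≤ m) (hc : m ≤ c) :
    ∃ f, WJ 2 m f ∧ IntArr f ∧ LeadTerm f (-c) s := by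
  obtain ⟨a, b, hab⟩ := exists_four_six (k := 2 + 2 * s - 4 * (m - s) + 12 * c) (by omega)
    ⟨1 + s - 2 * (m - s) + 6 * c, by ring⟩ (by omega)
  refine ⟨conv (conv (convPow aArr s) (convPow cArr (m - s)))
    (conv (conv (convPow e4Arr a) (convPow e6Arr b)) (convPow dltInv c)), ?_, ?_, ?_⟩
  · have := ((aArr_wj.convPow s).conv (cArr_wj.convPow (m - s))).conv
      (((e4Arr_wj.convPow a).conv (e6Arr_wj.convPow b)).conv (dltInv_wj.convPow c))
    convert this using 1
    · push_cast [hs]; linear_combination -hab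
    · omega
  · exact ((aArr_int.convPow s).conv (cArr_int.convPow _)).conv
      (((e4Arr_int.convPow a).conv (e6Arr_int.convPow b)).conv (dltInv_int.convPow c))
  · have := ((aArr_lead.convPow s).conv (cArr_lead.convPow (m - s))).conv
      (((e4Arr_lead.convPow a).conv (e6Arr_lead.convPow b)).conv (dltInv_lead.convPow c))
    convert this using 1 <;> simp

/-- The span of the weakly holomorphic forms and the arrays without polar part. -/
abbrev PolSub (m : ℕ) := WJSub 2 m ⊔ PosSub m

/-- Arrays modulo `PolSub m`. -/
abbrev PolarQuot (m : ℕ) := Arr ⧸ (PolSub m)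

theorem mkQ_mem_span_of_int (hm : 0 < m) (hE : Ell m c) (he : Evn c)
    {L : ℤ} (hL : LowAt L c) (hi : IntArr c) {N : Submodule ℤ (PolarQuot m)}
    (hN : ∀ s : ℕ, s ≤ m → ∀ n : ℤ, L ≤ n → n ≤ m → c (n, s) ≠ 0 →
      (PolSub m).mkQ (eArr m (4 * m * n - (s : ℤ) ^ 2) s) ∈ N) :
    (PolSub m).mkQ c ∈ N := by
  have h := (Submodule.Quotient.mk_eq_zero _).mpr
    (Submodule.mem_sup_right (S := WJSub 2 m) (sub_sum_eArr_mem hm hE he hL))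
  rw [← Submodule.mkQ_apply, map_sub, sub_eq_zero] at h
  rw [h, map_sum]
  refine N.sum_mem fun s hs => ?_
  rw [map_sum]
  refine N.sum_mem fun n hn => ?_
  rw [map_smul]
  by_cases h0 : c (n, s) = 0
  · rw [h0, zero_smul]; exact N.zero_mem
  · obtain ⟨k, hk⟩ := hi (n, s)
    rw [hk, Int.cast_smul_eq_zsmul]
    rw [mem_Icc] at hn
    exact N.smul_mem _ (hN s (by rw [mem_range] at hs; omega) n hn.1 hn.2 h0)

theorem exists_fg_lattice (hm : 0 < m) : ∃ N : Submodule ℤ (PolarQuot m), N.FG ∧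
    ∀ Δ r : ℤ, (PolSub m).mkQ (eArr m Δ r) ∈ N := by
  set g : ℕ × ℤ → PolarQuot m := fun x =>
    (PolSub m).mkQ (eArr m (4 * m * x.2 - (x.1 : ℤ) ^ 2) x.1) with hg
  set N : Submodule ℤ (PolarQuot m) := Submodule.span ℤ
    (((range (m + 1) ×ˢ Icc (-m : ℤ) m).image g : Finset _) : Set (PolarQuot m)) with hN
  have key : ∀ k s : ℕ, ∀ n : ℤ, s ≤ m → n ≤ m → ((-n).toNat * (m + 1) + s = k) → g (s, n) ∈ N := by
    intro k
    induction k using Nat.strong_induction_on with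
    | _ k ih =>
    intro s n hs hn hk
    by_cases hnm : -(m : ℤ) ≤ n
    · exact Submodule.subset_span (Finset.mem_coe.mpr (Finset.mem_image_of_mem _
        (Finset.mem_product.mpr ⟨mem_range.mpr (by omega), mem_Icc.mpr ⟨hnm, hn⟩⟩)))
    · obtain ⟨c, rfl⟩ : ∃ c : ℕ, n = -c := ⟨(-n).toNat, by omega⟩
      obtain ⟨f, h1, h2, h3⟩ := exists_leadTerm hm hs (c := c) (by omega)
      set e := eArr m (4 * m * (-c : ℤ) - (s : ℤ) ^ 2) s with he
      have hfe : (PolSub m).mkQ (f - e) ∈ N := by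
        refine mkQ_mem_span_of_int hm (c := f - e) (L := -c) ?_ ?_ ?_ ?_ ?_
        · exact fun n r l => by simp only [Pi.sub_apply, h1.ell n r l, he, eArr_ell m _ _ n r l]
        · exact fun n r => by simp only [Pi.sub_apply, h1.even n r, he, eArr_even m _ _ n r]
        · intro n r hn
          rw [Pi.sub_apply, h3.low n r hn, zero_sub, neg_eq_zero]
          rw [he, eArr, if_neg]
          rintro ⟨h7, h8⟩
          have hmz : (0 : ℤ) < m := by exact_mod_cast hm
          obtain ⟨h5, h6⟩ := abs_lt_of_sq_lt_sq' (a := r) (b := s) (by simp only at h7; nlinarith)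
            (by positivity)
          rcases h8 with ⟨k, hk⟩ | ⟨k, hk⟩
          · have : -1 < k := by nlinarith
            have : k < 0 := by nlinarith
            omega
          · have : 0 < k := by nlinarith
            have : k < 1 := by nlinarith
            omega
        · exact fun p => by
            obtain ⟨k, hk⟩ := h2 p
            by_cases h : e p = 0
            · exact ⟨k, by simp [hk, h]⟩
            · refine ⟨k - 1, ?_⟩
              rw [Pi.sub_apply, hk, he, eArr, if_pos]
              · push_cast; rfl
              · by_contra h'; exact h (by rw [he, eArr, if_neg h'])
        · intro s' hs' n' h4 h5 h6
          refine ih _ ?_ s' n' hs' h5 rfl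
          rw [Pi.sub_apply, he, eArr_rep hm hs' hs] at h6
          rcases h4.eq_or_lt with h7 | h7
          · subst h7
            have h8 : s' < s := by
              by_contra h8
              rcases (not_lt.mp h8).eq_or_lt with h9 | h9
              · subst h9; simp [h3.pos] at h6
              · rw [h3.out s' (by rw [Nat.abs_cast]; exact_mod_cast h9), if_neg (by omega)] at h6
                simp at h6
            omega
          · have : (-n').toNat + 1 ≤ c := by omega
            have h9 : (-(-(c : ℤ))).toNat = c := by omega
            rw [h9] at hk
            nlinarith
      have hf : (PolSub m).mkQ f = 0 :=
        (Submodule.Quotient.mk_eq_zero _).mpr (Submodule.mem_sup_left (mem_WJSub.mpr h1))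
      rw [map_sub, hf, zero_sub] at hfe
      exact neg_mem_iff.mp hfe
  refine ⟨N, ⟨_, rfl⟩, fun Δ r => ?_⟩
  obtain ⟨L, hL⟩ := eArr_low hm Δ r
  refine mkQ_mem_span_of_int hm (eArr_ell m Δ r) (eArr_even m Δ r) hL (fun p => ?_)
    fun s hs n _ hn _ => key _ s n hs hn rfl
  unfold eArr
  split_ifs
  · exact ⟨1, by simp⟩
  · exact ⟨0, by simp⟩

/-! ### Reduction to discriminant minus one -/

theorem eArr_scale {m q : ℕ} [Fact q.Prime] (hq : ¬ (q : ℤ) ∣ 2 * m) (Δ r₀ n r : ℤ) :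
    eArr m (q ^ 2 * Δ) (q * r₀) (q ^ 2 * n, q * r) = eArr m Δ r₀ (n, r) := by
  have hqp : Prime (q : ℤ) := Nat.prime_iff_prime_int.mp Fact.out
  have hco : IsCoprime (2 * m : ℤ) q := ((Prime.coprime_iff_not_dvd hqp).mpr hq).symm
  have h1 : ∀ t : ℤ, (2 * m : ℤ) ∣ q * t ↔ (2 * m : ℤ) ∣ t := fun t =>
    ⟨fun h => hco.dvd_of_dvd_mul_left h, fun h => h.mul_left _⟩
  have h2 : 4 * (m : ℤ) * (q ^ 2 * n) - (q * r) ^ 2 = q ^ 2 * Δ ↔ 4 * m * n - r ^ 2 = Δ := by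
    rw [show 4 * (m : ℤ) * (q ^ 2 * n) - (q * r) ^ 2 = q ^ 2 * (4 * m * n - r ^ 2) by ring]
    exact mul_right_inj' (pow_ne_zero 2 hqp.ne_zero)
  simp only [eArr, ← mul_sub, ← mul_add, h1, h2]

theorem eArr_congr {Δ r r' : ℤ} (h : (2 * m : ℤ) ∣ r - r') : eArr m Δ r = eArr m Δ r' := by
  ext ⟨n, t⟩
  have h1 : (2 * m : ℤ) ∣ t - r ↔ (2 * m : ℤ) ∣ t - r' := by
    rw [show t - r' = (t - r) + (r - r') by ring]; exact (Int.dvd_add_left h).symm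
  have h2 : (2 * m : ℤ) ∣ t + r ↔ (2 * m : ℤ) ∣ t + r' := by
    rw [show t + r = (t + r') + (r - r') by ring]; exact Int.dvd_add_left h
  simp only [eArr, h1, h2]

theorem tOp_mem {m q : ℕ} [Fact q.Prime] (hm : 0 < m) :
    PolSub m ≤ (PolSub m).comap (tOp q m) := by
  have hqp : (0 : ℤ) < q := by exact_mod_cast (Fact.out : q.Prime).pos
  refine sup_le (fun c hc => Submodule.mem_sup_left (mem_WJSub.mpr ((mem_WJSub.mp hc).tOp hm)))
    fun c hc => Submodule.mem_sup_right fun n r h => ?_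
  have hx : ∀ x : ℤ, 4 * (m : ℤ) * (n + r * x + m * x ^ 2) - (r + 2 * m * x) ^ 2 ≤ 0 := fun x => by
    rw [show 4 * (m : ℤ) * (n + r * x + m * x ^ 2) - (r + 2 * m * x) ^ 2 = 4 * m * n - r ^ 2 by ring]
    exact h
  simp only [tOp, LinearMap.sub_apply, LinearMap.smul_apply, LinearMap.comp_apply, uopL_apply,
    Pi.sub_apply, Pi.smul_apply, smul_eq_mul, LinearMap.id_apply, uop, hc n r h]
  rw [sum_eq_zero, mul_zero, mul_zero, sub_zero]
  intro x _
  have hx := hx x.val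
  set n' := n + r * (x.val : ℤ) + m * (x.val : ℤ) ^ 2
  set r' := r + 2 * m * (x.val : ℤ)
  rw [vArr_vArr_mul, hc n' r' hx, hc (q ^ 2 * n') (q * r') (by nlinarith [sq_nonneg (q : ℤ)])]
  split_ifs with h1 h2 h2 <;> simp only [mul_zero, add_zero]
  all_goals
    obtain ⟨⟨k, hk⟩, ⟨l, hl⟩⟩ := h2
    rw [hk, hl] at hx
    have h3 : (0 : ℤ) < q ^ 2 := by positivity
    have h4 : 4 * (m : ℤ) * k - l ^ 2 ≤ 0 := by
      by_contra h4
      nlinarith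
    rw [hk, hl, Int.mul_ediv_cancel_left _ (by positivity), Int.mul_ediv_cancel_left _ hqp.ne',
      hc k l h4, mul_zero, add_zero]

theorem chain_character {W : Type*} [AddCommGroup W] [Module ℂ W] (T : W →ₗ[ℤ] W) {q : ℕ}
    (hq : 2 ≤ q) {χ : ℤ} (hχ : χ = 0 ∨ χ * χ = 1) (y : ℕ → W)
    (hT0 : T (y 0) = (q : ℤ) • y 1 + χ • y 0)
    (hT1 : ∀ k, T (y (k + 1)) = (q : ℤ) • y (k + 2) + y k)
    {Λ : Submodule ℤ W} (hΛ : Λ.FG) (hy : ∀ k, y k ∈ Λ) (k : ℕ) :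
    (χ = 0 → y k = 0) ∧ (χ ≠ 0 → y k = (χ : ℂ) ^ k • y 0) := by
  refine ⟨fun h0 => chain_eq_zero T hq y (by rw [hT0, h0, zero_smul, add_zero]) hT1 hΛ hy k,
    fun h0 => ?_⟩
  have hχ2 := hχ.resolve_left h0
  have hz := chain_eq_zero T hq (fun k => y (k + 1) - χ • y k) (by
      simp only [zero_add]
      rw [map_sub, map_zsmul, hT1, hT0, smul_add, smul_smul χ χ, hχ2, one_smul, smul_sub,
        smul_comm χ]
      abel)
    (fun k => by
      rw [map_sub, map_zsmul, hT1, hT1, smul_add, smul_sub, smul_comm χ]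
      abel) hΛ
    (fun k => Λ.sub_mem (hy _) (Λ.smul_mem _ (hy _)))
  induction k with
  | zero => simp
  | succ k ih => rw [sub_eq_zero.mp (hz k), ih, ← Int.cast_smul_eq_zsmul ℂ, smul_smul, pow_succ']

theorem tOp_eArr_zero {m q : ℕ} [Fact q.Prime] (hq : ¬ (q : ℤ) ∣ 2 * m) {Δ : ℤ}
    (hΔ : ¬ (q : ℤ) ^ 2 ∣ Δ) (r : ℤ) : tOp q m (eArr m (q ^ (2 * 0) * Δ) (q ^ 0 * r)) =
      (q : ℂ) • eArr m (q ^ (2 * 1) * Δ) (q ^ 1 * r) +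
        (legendreSym q (-Δ) : ℂ) • eArr m (q ^ (2 * 0) * Δ) (q ^ 0 * r) := by
  ext p
  simp only [mul_zero, pow_zero, one_mul, mul_one, pow_one]
  rw [tOp_eArr hq, eArr, if_neg]
  · simp only [Pi.add_apply, Pi.smul_apply, smul_eq_mul]; ring
  · rintro ⟨h, -⟩
    exact hΔ ⟨4 * m * p.1 - p.2 ^ 2, by rw [← h]; ring⟩

theorem tOp_eArr_succ {m q : ℕ} [Fact q.Prime] (hq : ¬ (q : ℤ) ∣ 2 * m) (Δ r : ℤ) (k : ℕ) :
    tOp q m (eArr m (q ^ (2 * (k + 1)) * Δ) (q ^ (k + 1) * r)) =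
      (q : ℂ) • eArr m (q ^ (2 * (k + 2)) * Δ) (q ^ (k + 2) * r) +
        eArr m (q ^ (2 * k) * Δ) (q ^ k * r) := by
  ext p
  have h0 : legendreSym q (-(q ^ (2 * (k + 1)) * Δ)) = 0 := by
    rw [legendreSym.eq_zero_iff]; push_cast; simp
  rw [tOp_eArr hq, h0, show (q : ℤ) ^ (2 * (k + 1)) * Δ = q ^ 2 * (q ^ (2 * k) * Δ) by ring,
    show (q : ℤ) ^ (k + 1) * r = q * (q ^ k * r) by ring, eArr_scale hq,
    show (q : ℤ) ^ (2 * (k + 2)) * Δ = q ^ 2 * (q ^ 2 * (q ^ (2 * k) * Δ)) by ring,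
    show (q : ℤ) ^ (k + 2) * r = q * (q * (q ^ k * r)) by ring]
  simp only [Pi.add_apply, Pi.smul_apply, smul_eq_mul]
  push_cast; ring

/-- In the polar quotient, scaling an orbit by a prime multiplies it by a quadratic character. -/
theorem mkQ_eArr_scale {m q : ℕ} [hqf : Fact q.Prime] (hm : 0 < m) (hq : ¬ (q : ℤ) ∣ 2 * m) {Δ : ℤ}
    (hΔ : ¬ (q : ℤ) ^ 2 ∣ Δ) (r : ℤ) (k : ℕ) :
    (legendreSym q (-Δ) = 0 →
      (PolSub m).mkQ (eArr m (q ^ (2 * k) * Δ) (q ^ k * r)) = 0) ∧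
    (legendreSym q (-Δ) ≠ 0 → (PolSub m).mkQ (eArr m (q ^ (2 * k) * Δ) (q ^ k * r)) =
        (legendreSym q (-Δ) : ℂ) ^ k • (PolSub m).mkQ (eArr m Δ r)) := by
  obtain ⟨N, hfg, hN⟩ := exists_fg_lattice hm
  have hT : ∀ c, (PolSub m).mapQ _ (tOp q m) (tOp_mem hm)
      ((PolSub m).mkQ c) = (PolSub m).mkQ (tOp q m c) :=
    fun c => Submodule.mapQ_apply _ _ _ _
  have h := chain_character (((PolSub m).mapQ _ (tOp q m)
    (tOp_mem hm)).restrictScalars ℤ) hqf.out.two_le (χ := legendreSym q (-Δ)) (by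
      by_cases h0 : ((-Δ : ℤ) : ZMod q) = 0
      · exact Or.inl ((legendreSym.eq_zero_iff q _).mpr h0)
      · exact Or.inr (by rw [← sq]; exact legendreSym.sq_one q h0))
    (fun k => (PolSub m).mkQ (eArr m (q ^ (2 * k) * Δ) (q ^ k * r)))
    (by
      rw [LinearMap.restrictScalars_apply, hT, tOp_eArr_zero hq hΔ, map_add, map_smul, map_smul,
        ← Int.cast_smul_eq_zsmul ℂ, ← Int.cast_smul_eq_zsmul ℂ, Int.cast_natCast])
    (fun k => by
      rw [LinearMap.restrictScalars_apply, hT, tOp_eArr_succ hq, map_add, map_smul,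
        ← Int.cast_smul_eq_zsmul ℂ, Int.cast_natCast]) hfg (fun k => hN _ _) k
  simpa only [mul_zero, pow_zero, one_mul] using h

theorem exists_minimal {m q : ℕ} [hqf : Fact q.Prime] (hq : ¬ (q : ℤ) ∣ 2 * m) (D : ℕ) :
    ∀ n r : ℤ, 0 < D → r ^ 2 - 4 * m * n = D → ∃ (k : ℕ) (n' r' : ℤ),
      4 * m * n - r ^ 2 = q ^ (2 * k) * (4 * m * n' - r' ^ 2) ∧ (2 * m : ℤ) ∣ r - q ^ k * r' ∧
      ¬ (q : ℤ) ^ 2 ∣ 4 * m * n' - r' ^ 2 := by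
  have hqp : Prime (q : ℤ) := Nat.prime_iff_prime_int.mp Fact.out
  have hq2 : (2 : ℤ) ≤ q := by exact_mod_cast hqf.out.two_le
  induction D using Nat.strong_induction_on with
  | _ D ih =>
  intro n r hD h
  by_cases h2 : (q : ℤ) ^ 2 ∣ 4 * m * n - r ^ 2
  · have hu : IsCoprime (2 * m : ℤ) q := ((Prime.coprime_iff_not_dvd hqp).mpr hq).symm
    obtain ⟨u, v, huv⟩ := hu
    have e1 : r + 2 * m * (-(r * u)) = q * (r * v) := by linear_combination r * (-huv)
    obtain ⟨D', hD'⟩ := h2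
    have h4 : IsCoprime ((q : ℤ) ^ 2) (2 * (2 * m)) := by
      have hco : IsCoprime (q : ℤ) (2 * m) := (Prime.coprime_iff_not_dvd hqp).mpr hq
      exact IsCoprime.pow_left (IsCoprime.mul_right hco.of_mul_right_left hco)
    obtain ⟨n₁, hn₁⟩ : (q : ℤ) ^ 2 ∣ n + r * (-(r * u)) + m * (-(r * u)) ^ 2 := by
      refine h4.dvd_of_dvd_mul_left ⟨D' + (r * v) ^ 2, ?_⟩
      have : (r + 2 * m * (-(r * u))) ^ 2 = (q * (r * v)) ^ 2 := by rw [e1]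
      linear_combination hD' + this
    have e2 : 4 * m * n - r ^ 2 = q ^ 2 * (4 * m * n₁ - (r * v) ^ 2) := by
      have : (r + 2 * m * (-(r * u))) ^ 2 = (q * (r * v)) ^ 2 := by rw [e1]
      linear_combination 4 * m * hn₁ - this
    have hpos : 0 < (r * v) ^ 2 - 4 * m * n₁ := by
      have : (q : ℤ) ^ 2 * ((r * v) ^ 2 - 4 * m * n₁) = D := by linear_combination h + e2
      have h5 : (0 : ℤ) < D := by exact_mod_cast hD
      rw [← this] at h5
      exact (mul_pos_iff_of_pos_left (by positivity)).mp h5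
    obtain ⟨k, n', r', g1, g2, g3⟩ := ih ((r * v) ^ 2 - 4 * m * n₁).toNat (by
        have : (q : ℤ) ^ 2 * ((r * v) ^ 2 - 4 * m * n₁) = D := by linear_combination h + e2
        zify
        rw [Int.toNat_of_nonneg hpos.le, ← this]
        have : (4 : ℤ) ≤ q ^ 2 := by nlinarith
        nlinarith) n₁ (r * v) (by omega) (by rw [Int.toNat_of_nonneg hpos.le])
    refine ⟨k + 1, n', r', by rw [e2, g1]; ring, ?_, g3⟩
    rw [show r - q ^ (k + 1) * r' = q * (r * v - q ^ k * r') + 2 * m * (r * u) by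
      linear_combination e1]
    exact dvd_add (g2.mul_left _) (dvd_mul_right _ _)
  · exact ⟨0, n, r, by simp, by simp, h2⟩

/-- The orbits of residues coprime to `2m` are combinations of weakly holomorphic forms and
arrays of optimal growth. -/
theorem eArr_mem_of_coprime (hm : 0 < m) (D : ℕ) : ∀ n r : ℤ, r ^ 2 - 4 * m * n = D →
    IsCoprime r (2 * m : ℤ) → eArr m (4 * m * n - r ^ 2) r ∈ WJSub 2 m ⊔ OptSub m := by
  induction D using Nat.strong_induction_on with
  | _ D ih =>
  intro n r hD hr
  have hle : PolSub m ≤ WJSub 2 m ⊔ OptSub m := sup_le_sup_left (posSub_le_optSub m) _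
  have hcoD : IsCoprime (D : ℤ) (2 * m) := by
    rw [← hD, show r ^ 2 - 4 * m * n = r ^ 2 + (2 * m) * (-2 * n) by ring]
    exact (IsCoprime.pow_left hr).add_mul_left_left _
  by_cases hD1 : D = 1
  · subst hD1
    refine Submodule.mem_sup_right fun n' r' _ h2 => ?_
    rw [eArr, if_neg]
    rintro ⟨h3, -⟩
    exact h2 (by rw [h3]; push_cast at hD; linarith)
  · have hD0 : D ≠ 0 := by
      rintro rfl
      have := Int.isUnit_iff.mp (isCoprime_zero_left.mp (by rwa [Nat.cast_zero] at hcoD))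
      omega
    obtain ⟨q, hqp, hqD⟩ := Nat.exists_prime_and_dvd hD1
    have : Fact q.Prime := ⟨hqp⟩
    have hqZ : Prime (q : ℤ) := Nat.prime_iff_prime_int.mp hqp
    have hq : ¬ (q : ℤ) ∣ 2 * m := fun h =>
      hqZ.not_isUnit (hcoD.isUnit_of_dvd' (Int.natCast_dvd_natCast.mpr hqD) h)
    obtain ⟨k, n', r', g1, g2, g3⟩ := exists_minimal hq D n r (Nat.pos_of_ne_zero hD0) hD
    obtain ⟨k1, k2⟩ := mkQ_eArr_scale hm hq g3 r' k
    rw [eArr_congr g2, g1]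
    by_cases h0 : legendreSym q (-(4 * m * n' - r' ^ 2)) = 0
    · exact hle ((Submodule.Quotient.mk_eq_zero _).mp (k1 h0))
    · have h1 := k2 h0
      rw [← map_smul, ← sub_eq_zero, ← map_sub] at h1
      have h2 := hle ((Submodule.Quotient.mk_eq_zero _).mp h1)
      rw [← sub_add_cancel (eArr m (q ^ (2 * k) * (4 * m * n' - r' ^ 2)) (q ^ k * r'))]
      refine Submodule.add_mem _ h2 (Submodule.smul_mem _ _ ?_)
      have hk : k ≠ 0 := by
        rintro rfl
        rw [mul_zero, pow_zero, one_mul] at g1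
        apply h0
        rw [legendreSym.eq_zero_iff, ← g1, ZMod.intCast_zmod_eq_zero_iff_dvd]
        rw [show -(4 * m * n - r ^ 2) = (D : ℤ) by linarith]
        exact Int.natCast_dvd_natCast.mpr hqD
      have hq2 : (2 : ℤ) ≤ q := by exact_mod_cast hqp.two_le
      have hDD : (q : ℤ) ^ (2 * k) * (r' ^ 2 - 4 * m * n') = D := by linear_combination hD + g1
      have hDp : (0 : ℤ) < D := by exact_mod_cast Nat.pos_of_ne_zero hD0
      have hpos : 0 < r' ^ 2 - 4 * m * n' := by
        rw [← hDD] at hDp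
        exact (mul_pos_iff_of_pos_left (by positivity)).mp hDp
      have hlt : (1 : ℤ) < q ^ (2 * k) := one_lt_pow₀ (by omega) (by omega)
      refine ih (r' ^ 2 - 4 * m * n').toNat (by zify; rw [Int.toNat_of_nonneg hpos.le]; nlinarith)
        n' r' (by rw [Int.toNat_of_nonneg hpos.le]) ?_
      obtain ⟨j, hj⟩ := g2
      have : IsCoprime ((q : ℤ) ^ k * r') (2 * m) := by
        rw [show (q : ℤ) ^ k * r' = r + 2 * m * (-j) by linear_combination -hj]
        exact hr.add_mul_left_left _
      exact this.of_mul_left_right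

/-! ### Convergent Laurent series -/

/-- The Laurent series with given coefficients, if these are bounded below. -/
def lser (g : ℤ → ℂ) : LaurentSeries ℂ :=
  if h : BddBelow (Function.support g) then HahnSeries.ofSuppBddBelow g h else 0

theorem lser_coeff {g : ℤ → ℂ} {N : ℤ} (h : ∀ n, n < N → g n = 0) : (lser g).coeff = g := by
  have : BddBelow (Function.support g) := ⟨N, fun n hn => not_lt.mp fun h' => hn (h n h')⟩
  rw [lser, dif_pos this]; rfl

theorem coeff_mul_eq_conv (f g : LaurentSeries ℂ) (n : ℤ) :
    (f * g).coeff n = conv f.coeff g.coeff n := by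
  rw [HahnSeries.coeff_mul, conv,
    tsum_eq_sum (s := (Finset.antidiagonal f.isPWO_support g.isPWO_support n).image Prod.fst)]
  · rw [sum_image]
    · refine sum_congr rfl fun x hx => ?_
      rw [Finset.mem_antidiagonal] at hx
      rw [← hx.2.2, add_sub_cancel_left]
    · intro x hx y hy h
      rw [Finset.mem_coe, Finset.mem_antidiagonal] at hx hy
      exact Prod.ext h (by have := hx.2.2; have := hy.2.2; omega)
  · intro x hx
    by_contra h
    refine hx (Finset.mem_image.mpr ⟨(x, n - x), ?_, rfl⟩)
    rw [Finset.mem_antidiagonal]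
    exact ⟨left_ne_zero_of_mul h, right_ne_zero_of_mul h, by ring⟩

/-- The ring of Laurent series converging on the punctured unit disc. -/
def CvRing : Subring (LaurentSeries ℂ) where
  carrier := {f | ∀ τ : ℂ, 0 < τ.im → Summable fun n : ℤ => f.coeff n * ee (n * τ)}
  zero_mem' := fun τ _ => by simp [summable_zero]
  one_mem' := fun τ _ => summable_of_ne_finset_zero (s := {0}) fun n hn => by
    rw [HahnSeries.coeff_one, if_neg (by simpa using hn), zero_mul]
  add_mem' := fun hf hg τ hτ => ((hf τ hτ).add (hg τ hτ)).congr fun n => by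
    rw [HahnSeries.coeff_add, add_mul]
  neg_mem' := fun hf τ hτ => (hf τ hτ).neg.congr fun n => by rw [HahnSeries.coeff_neg, neg_mul]
  mul_mem' := fun {f g} hf hg τ hτ => by
    simp only [coeff_mul_eq_conv]
    exact (hasSum_conv (χ := fun n : ℤ => ee (n * τ))
      (fun x y => by rw [← ee_add]; push_cast; rw [add_mul]) (hf τ hτ) (hg τ hτ)).summable

/-- Evaluation of convergent Laurent series. -/
def evL {τ : ℂ} (hτ : 0 < τ.im) : CvRing →+* ℂ where
  toFun f := ∑' n : ℤ, f.1.coeff n * ee (n * τ)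
  map_zero' := by simp
  map_one' := by
    rw [tsum_eq_single 0 fun n hn => by simp [HahnSeries.coeff_one, hn]]
    simp [ee_zero]
  map_add' f g := by
    rw [← (f.2 τ hτ).tsum_add (g.2 τ hτ)]
    exact tsum_congr fun n => by simp [add_mul]
  map_mul' f g := by
    rw [← (hasSum_conv (χ := fun n : ℤ => ee (n * τ))
      (fun x y => by rw [← ee_add]; push_cast; rw [add_mul]) (f.2 τ hτ) (g.2 τ hτ)).tsum_eq]
    exact tsum_congr fun n => by rw [← coeff_mul_eq_conv]; rfl

/-- The `s`-th row of an array as a Laurent series. -/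
def rowL (c : Arr) (s : ℤ) : LaurentSeries ℂ := lser fun n => c (n, s)

theorem rowL_coeff {N : ℤ} (h : LowAt N c) (s n : ℤ) :
    (rowL c s).coeff n = c (n, s) := by rw [rowL, lser_coeff fun n hn => h n s hn]

theorem rowL_mem {N : ℤ} (h : LowAt N c) (hc : Sm c) (s : ℤ) : rowL c s ∈ CvRing :=
  fun τ hτ => by simpa only [rowL_coeff h] using (hc τ 0 hτ).row_summable s

theorem evL_rowL {N : ℤ} (h : LowAt N c) (hc : Sm c) (s : ℤ)
    (hτ : 0 < τ.im) : evL hτ ⟨rowL c s, rowL_mem h hc s⟩ = row c s τ := by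
  change ∑' n : ℤ, (rowL c s).coeff n * ee (n * τ) = _
  simp only [rowL_coeff h, row]

theorem cvRing_eq_zero {f : CvRing} (h : ∀ (τ : ℂ) (hτ : 0 < τ.im), evL hτ f = 0) : f = 0 := by
  refine Subtype.ext (HahnSeries.ext (funext fun n => ?_))
  have h1 := fourier_coeff_eq_zero (a := fun n : ℤ => f.1.coeff n * ee (n * I)) (f.2 I (by simp))
    (fun x => by
      rw [← h (I + x) (by simp)]
      refine tsum_congr fun n => ?_
      rw [mul_assoc, ← ee_add, ← mul_add]) n
  simpa using (mul_eq_zero.mp h1).resolve_right (ee_ne_zero _)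

theorem WJ.eq_zero_of_index_zero (h : WJ k 0 c) (n : ℤ) {r : ℤ} (hr : r ≠ 0) : c (n, r) = 0 := by
  obtain ⟨N, hN⟩ := h.low
  have h1 := h.ell n r (-(r * (|n| + |N| + 1)))
  rw [← h1]
  refine hN _ _ ?_
  have := le_abs_self n
  have := neg_abs_le N
  have := abs_nonneg n
  have := abs_nonneg N
  have : 1 ≤ r ^ 2 := by have := sq_pos_of_ne_zero hr; omega
  push_cast
  nlinarith

theorem rowL_conv {c d : Arr} (hc : WJ k 0 c) {N : ℤ} (hd : LowAt N d) (s : ℤ) :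
    rowL (conv c d) s = rowL c 0 * rowL d s := by
  obtain ⟨M, hM⟩ := hc.low
  ext n
  rw [rowL_coeff (conv_low hM hd), coeff_mul_eq_conv, conv, conv]
  have hi : Function.Injective (fun k : ℤ => (k, (0 : ℤ))) := fun a b h => (Prod.mk.inj h).1
  rw [← hi.tsum_eq]
  · refine tsum_congr fun k => ?_
    rw [rowL_coeff hM, rowL_coeff hd]; simp
  · rintro ⟨a, b⟩ h
    by_cases hb : b = 0
    · exact ⟨a, by rw [hb]⟩
    · exact absurd (by simp [hc.eq_zero_of_index_zero a hb]) h

theorem WJ.row_law {f : Arr} (h : WJ k 0 f) (hτ : 0 < τ.im) {a b c d : ℤ}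
    (hdet : a * d - b * c = 1) :
    row f 0 ((a * τ + b) / (c * τ + d)) = (c * τ + d) ^ k * row f 0 τ := by
  have e : ∀ τ : ℂ, 0 < τ.im → JF f τ 0 = row f 0 τ := fun τ hτ => by
    rw [← (h.sm τ 0 hτ).hasSum_row.tsum_eq, tsum_eq_single 0]
    · simp [ee_zero]
    · intro r hr
      have : row f r τ = 0 := by simp [row, h.eq_zero_of_index_zero _ hr]
      rw [this, zero_mul]
  have h1 := h.modularLaw τ hτ 0 a b c d hdet
  rw [zero_div, e _ (im_moebius_pos hτ hdet).2, e τ hτ] at h1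
  simpa [ee_zero] using h1

/-! ### Duality -/

theorem exists_mono {k o : ℤ} (h0 : 0 ≤ k - 12 * o) (he : Even k) (h2 : k - 12 * o ≠ 2) :
    ∃ c, WJ k 0 c ∧ LeadTerm c o 0 := by
  obtain ⟨a, b, hab⟩ := exists_four_six h0 (he.sub ⟨6 * o, by ring⟩) h2
  have h1 := (e4Arr_wj.convPow a).conv (e6Arr_wj.convPow b)
  have h3 := (e4Arr_lead.convPow a).conv (e6Arr_lead.convPow b)
  rcases le_or_gt 0 o with h | h
  · obtain ⟨j, rfl⟩ := Int.eq_ofNat_of_zero_le h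
    refine ⟨conv (conv (convPow e4Arr a) (convPow e6Arr b)) (convPow dltArr j), ?_, ?_⟩
    · convert h1.conv (dltArr_wj.convPow j) using 1
      · linear_combination -hab
      · simp
    · convert h3.conv (dltArr_lead.convPow j) using 1 <;> simp
  · obtain ⟨j, rfl⟩ : ∃ j : ℕ, o = -j := ⟨(-o).toNat, by omega⟩
    refine ⟨conv (conv (convPow e4Arr a) (convPow e6Arr b)) (convPow dltInv j), ?_, ?_⟩
    · convert h1.conv (dltInv_wj.convPow j) using 1
      · linear_combination -hab
      · simp
    · convert h3.conv (dltInv_lead.convPow j) using 1 <;> simp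

theorem coeff_zero_mul_of_lead {o : ℤ} (hc : LeadTerm c (-o) 0)
    {w : LaurentSeries ℂ} (hw : ∀ k < o, w.coeff k = 0) : (rowL c 0 * w).coeff 0 = w.coeff o := by
  rw [coeff_mul_eq_conv, conv, tsum_eq_single (-o)]
  · rw [rowL_coeff hc.low]
    have := hc.pos
    rw [Nat.cast_zero] at this
    simp [this]
  · intro k hk
    rw [rowL_coeff hc.low]
    rcases lt_or_ge k (-o) with h | h
    · rw [hc.low k 0 h, zero_mul]
    · rw [hw _ (by omega), mul_zero]

/-- A Laurent series orthogonal to all weakly holomorphic forms of weight `2 - k` is itself a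
weakly holomorphic form of weight `k`. -/
theorem exists_form_of_orthogonal (hk : Even k) {w : LaurentSeries ℂ}
    (hw : ∀ c, WJ (2 - k) 0 c → (rowL c 0 * w).coeff 0 = 0) : ∃ c, WJ k 0 c ∧ w = rowL c 0 := by
  have hev : Even (2 - k) := even_two.sub hk
  have test : ∀ (o : ℤ) (w : LaurentSeries ℂ),
      (∀ c, WJ (2 - k) 0 c → (rowL c 0 * w).coeff 0 = 0) → (∀ j < o, w.coeff j = 0) →
      (k - 12 * o < 0 ∨ k - 12 * o = 2) → w.coeff o = 0 := by
    intro o w hw h0 h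
    obtain ⟨j, hj⟩ := hk
    obtain ⟨c, h1, h2⟩ := exists_mono (k := 2 - k) (o := -o) (by omega) hev (by omega)
    rw [← coeff_zero_mul_of_lead h2 h0]
    exact hw c h1
  have main : ∀ (n : ℕ) (w : LaurentSeries ℂ), (∀ c, WJ (2 - k) 0 c → (rowL c 0 * w).coeff 0 = 0) →
      (∀ j < |k| + 1 - n, w.coeff j = 0) → ∃ c, WJ k 0 c ∧ w = rowL c 0 := by
    intro n
    induction n with
    | zero =>
      intro w hw h0
      have hz : ∀ j : ℕ, ∀ i < |k| + 1 + j, w.coeff i = 0 := by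
        intro j
        induction j with
        | zero => simpa using h0
        | succ j ih =>
          intro i hi
          rcases (show i ≤ |k| + 1 + j by push_cast at hi; omega).lt_or_eq with h | h
          · exact ih i h
          · have := le_abs_self k
            have := abs_nonneg k
            exact h ▸ test _ w hw ih (Or.inl (by omega))
      refine ⟨0, WJ.zero k 0, ?_⟩
      ext i
      rw [rowL_coeff (N := 0) fun _ _ _ => rfl]
      exact hz (i.toNat) i (by have := abs_nonneg k; omega)
    | succ n ih =>
      intro w hw h0
      set o : ℤ := |k| + 1 - (n + 1 : ℕ) with ho
      have hlt : ∀ w' : LaurentSeries ℂ, (∀ j < o, w'.coeff j = 0) → w'.coeff o = 0 →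
          ∀ j < |k| + 1 - n, w'.coeff j = 0 := fun w' h1 h2 j hj => by
        rcases (show j ≤ o by rw [ho]; push_cast; omega).lt_or_eq with h | h
        · exact h1 j h
        · exact h ▸ h2
      by_cases hx : k - 12 * o < 0 ∨ k - 12 * o = 2
      · exact ih w hw (hlt w h0 (test o w hw h0 hx))
      · push Not at hx
        obtain ⟨g, hg, hl⟩ := exists_mono hx.1 hk hx.2
        have hlow : LowAt o (w.coeff o • g) := fun i r hi => by simp [hl.low i r hi]
        obtain ⟨c, hc, hce⟩ := ih (w - rowL (w.coeff o • g) 0) (fun c hc => by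
            obtain ⟨N, hN⟩ := hc.low
            rw [mul_sub, HahnSeries.coeff_sub, hw c hc, ← rowL_conv hc hlow, zero_sub, neg_eq_zero,
              rowL_coeff (conv_low hN hlow)]
            refine constant_term_of_wj ?_
            have := hc.conv (hg.smul (w.coeff o))
            rwa [sub_add_cancel] at this)
          (hlt _ (fun j hj => by
              rw [HahnSeries.coeff_sub, h0 j hj, rowL_coeff hlow, hlow j 0 hj, sub_zero])
            (by
              have := hl.pos
              rw [Nat.cast_zero] at this
              simp [HahnSeries.coeff_sub, rowL_coeff hlow, this]))
        refine ⟨c + w.coeff o • g, hc.add (hg.smul _), ?_⟩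
        obtain ⟨N, hN⟩ := hc.low
        refine (sub_eq_iff_eq_add.mp hce).trans ?_
        ext j
        rw [rowL_coeff (N := min N o), HahnSeries.coeff_add, rowL_coeff hN, rowL_coeff hlow]
        · rfl
        · intro i r hi
          rw [Pi.add_apply, hN i r (lt_of_lt_of_le hi (min_le_left _ _)),
            hlow i r (lt_of_lt_of_le hi (min_le_right _ _)), add_zero]
  have hbd : ∃ L : ℤ, ∀ j < L, w.coeff j = 0 :=
    ⟨w.order, fun j hj => HahnSeries.coeff_eq_zero_of_lt_order hj⟩
  obtain ⟨L, hL⟩ := hbd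
  exact main (|k| + 1 - L).toNat w hw fun j hj => hL j (by omega)

/-! ### Even periodic functions and rows of arrays -/

/-- Even functions on `ℤ` with period `2m`. -/
def EP (m : ℕ) : Submodule ℂ (ℤ → ℂ) where
  carrier := {y | (∀ r l : ℤ, y (r + 2 * m * l) = y r) ∧ ∀ r, y (-r) = y r}
  zero_mem' := ⟨fun _ _ => rfl, fun _ => rfl⟩
  add_mem' := fun ha hb => ⟨fun r l => by simp [ha.1 r l, hb.1 r l], fun r => by simp [ha.2, hb.2]⟩
  smul_mem' := fun s a ha => ⟨fun r l => by simp [ha.1 r l], fun r => by simp [ha.2]⟩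

theorem EP.ext (hm : 0 < m) {y y' : ℤ → ℂ} (hy : y ∈ EP m) (hy' : y' ∈ EP m)
    (h : ∀ s : Fin (m + 1), y s = y' s) : y = y' := by
  funext r
  obtain ⟨s, n, hs, -, hd⟩ := exists_rep hm 0 r
  have h1 := hd (fun p => y p.2) (fun n r l => hy.1 r l) fun n r => hy.2 r
  have h2 := hd (fun p => y' p.2) (fun n r l => hy'.1 r l) fun n r => hy'.2 r
  exact h1.trans ((h ⟨s, by omega⟩).trans h2.symm)

/-- The rows of an array, normalised to depend only on the residue modulo `2m`. -/
def nrow (m : ℕ) (c : Arr) (τ : ℂ) (r : ℤ) : ℂ := row c r τ * ee (-(r ^ 2 * τ / (4 * m)))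

theorem row_eq_nrow (m : ℕ) (c : Arr) (τ : ℂ) (r : ℤ) :
    row c r τ = nrow m c τ r * ee (r ^ 2 * τ / (4 * m)) := by
  rw [nrow, mul_assoc, ← ee_add, neg_add_cancel, ee_zero, mul_one]

theorem nrow_mem (hm : 0 < m) (hE : Ell m c) (he : Evn c) (τ : ℂ) : nrow m c τ ∈ EP m := by
  have hm' : (m : ℂ) ≠ 0 := by exact_mod_cast hm.ne'
  refine ⟨fun r l => ?_, fun r => ?_⟩
  · rw [nrow, nrow, row, row, ← (Equiv.addRight (r * l + m * l ^ 2)).tsum_eq, ← tsum_mul_right,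
      ← tsum_mul_right]
    refine tsum_congr fun n => ?_
    dsimp only [Equiv.coe_addRight]
    rw [← add_assoc, hE, mul_assoc (c _), mul_assoc (c _), ← ee_add, ← ee_add]
    congr 2
    push_cast
    field_simp
    ring
  · rw [nrow, nrow, row, row]
    simp only [he _ r]
    push_cast
    rw [neg_sq]

theorem row_sum_smul {ι : Type*} [Fintype ι] {f : ι → Arr} (h : ∀ i, Sm (f i)) (a : ι → ℂ)
    (r : ℤ) (hτ : 0 < τ.im) : row (∑ i, a i • f i) r τ = ∑ i, a i * row (f i) r τ := by
  simp only [row, ← tsum_mul_left]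
  rw [← Summable.tsum_finsetSum fun i _ => ((h i τ 0 hτ).row_summable r).mul_left (a i)]
  refine tsum_congr fun n => ?_
  simp [Finset.sum_apply, sum_mul, mul_assoc]

/-! ### The monomials in the generators -/

/-- The weak Jacobi form `φ_{-2,1}^i φ_{0,1}^{m-i}`, suitably normalised. -/
def hArr (m i : ℕ) : Arr := conv (convPow aArr i) (convPow bArr (m - i))

theorem hArr_wj {m i : ℕ} (hi : i ≤ m) : WJ (-(2 * i)) m (hArr m i) := by
  convert (aArr_wj.convPow i).conv (bArr_wj.convPow (m - i)) using 1
  · ring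
  · omega
  · rfl

theorem hArr_wj_fin (i : Fin (m + 1)) : WJ (-(2 * (i : ℕ))) m (hArr m i) :=
  hArr_wj (Nat.lt_succ_iff.mp i.2)

theorem JF_hArr (m i : ℕ) (hτ : 0 < τ.im) (z : ℂ) :
    JF (hArr m i) τ z = JF aArr τ z ^ i * JF bArr τ z ^ (m - i) := by
  rw [hArr, JF_conv (aArr_sm.convPow i τ z hτ) (bArr_sm.convPow _ τ z hτ),
    JF_convPow aArr_sm i hτ, JF_convPow bArr_sm _ hτ]

theorem sum_smul_hArr (a : Fin (m + 1) → ℂ) : Ell m (∑ i, a i • hArr m i) ∧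
    Evn (∑ i, a i • hArr m i) ∧ Sm (∑ i, a i • hArr m i) ∧ ∀ τ z : ℂ, 0 < τ.im →
      JF (∑ i, a i • hArr m i) τ z = ∑ i, a i * JF (hArr m i) τ z := by
  have h := Sm.sum (s := univ) (f := fun i : Fin (m + 1) => a i • hArr m i)
    fun i _ => (hArr_wj_fin i).sm.smul _
  refine ⟨fun n r l => ?_, fun n r => ?_, h.1, fun τ z hτ => ?_⟩
  · simp only [Finset.sum_apply, Pi.smul_apply, (hArr_wj_fin _).ell n r l]
  · simp only [Finset.sum_apply, Pi.smul_apply, (hArr_wj_fin _).even n r]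
  · rw [h.2 τ z hτ]
    simp only [JF_smul]

def hMat (m : ℕ) (τ : ℂ) : Matrix (Fin (m + 1)) (Fin (m + 1)) ℂ :=
  Matrix.of fun i s => row (hArr m i) (s : ℕ) τ

theorem hMat_det_ne_zero (hm : 0 < m) (hτ : 0 < τ.im) : (hMat m τ).det ≠ 0 := by
  rw [Ne, ← Matrix.exists_vecMul_eq_zero_iff]
  rintro ⟨a, ha, h0⟩
  obtain ⟨hE, he, hs, hJ⟩ := sum_smul_hArr a
  set f := ∑ i, a i • hArr m i with hf
  have h1 : nrow m f τ = 0 := EP.ext hm (nrow_mem hm hE he τ) (zero_mem _) fun s => by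
    rw [nrow, hf, row_sum_smul (fun i => (hArr_wj_fin i).sm) a _ hτ]
    have := congrFun h0 s
    rw [Matrix.vecMul, dotProduct] at this
    exact mul_eq_zero_of_left this _
  have h2 : ∀ z, JF f τ z = 0 := fun z => by
    refine (hs τ z hτ).hasSum_row.unique ?_
    simp [row_eq_nrow m, h1, hasSum_zero]
  set P : Polynomial ℂ := ∑ i : Fin (m + 1), Polynomial.C (a i) * Polynomial.X ^ (i : ℕ) with hP
  have hP0 : P ≠ 0 := fun h => ha <| funext fun i => by
    have := congrArg (fun p => Polynomial.coeff p i) h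
    simpa [hP, Polynomial.finsetSum_coeff, Polynomial.coeff_C_mul, Polynomial.coeff_X_pow,
      Fin.val_inj] using this
  have hcont : ContinuousAt (fun z => JF aArr τ z / JF bArr τ z) 0 :=
    (aArr_sm.continuous_right hτ).continuousAt.div (bArr_sm.continuous_right hτ).continuousAt
      (by rw [JF_bArr_zero hτ]; exact one_ne_zero)
  have hfin := (Polynomial.finite_setOfPred_isRoot hP0).subset (Set.sdiff_subset (t := {(0 : ℂ)}))
  have e1 : ∀ᶠ z in 𝓝[≠] (0 : ℂ), JF aArr τ z / JF bArr τ z ∉ {x | P.IsRoot x} \ {(0 : ℂ)} :=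
    (hcont.eventually (hfin.isClosed.isOpen_compl.mem_nhds (by
      simp [JF_aArr_zero hτ]))).filter_mono nhdsWithin_le_nhds
  have e2 : ∀ᶠ z in 𝓝[≠] (0 : ℂ), JF bArr τ z ≠ 0 :=
    ((bArr_sm.continuous_right hτ).continuousAt.eventually_ne (by
      rw [JF_bArr_zero hτ]; exact one_ne_zero)).filter_mono nhdsWithin_le_nhds
  obtain ⟨z, hz1, hz2, hz3⟩ :=
    (e1.and (e2.and ((aArr_tendsto hτ).eventually_ne one_ne_zero))).exists
  have hA : JF aArr τ z ≠ 0 := fun h => hz3 (by rw [h, zero_div])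
  refine hz1 ⟨?_, div_ne_zero hA hz2⟩
  have h3 := h2 z
  rw [hJ τ z hτ] at h3
  have h4 : JF bArr τ z ^ m * P.eval (JF aArr τ z / JF bArr τ z) = 0 := by
    rw [hP, Polynomial.eval_finsetSum, mul_sum, ← h3]
    refine sum_congr rfl fun i _ => ?_
    rw [JF_hArr m i hτ, Polynomial.eval_mul, Polynomial.eval_C, Polynomial.eval_pow,
      Polynomial.eval_X, div_pow]
    nth_rewrite 1 [← Nat.sub_add_cancel (Nat.lt_succ_iff.mp i.2)]
    rw [pow_add]
    field_simp
  exact (mul_eq_zero.mp h4).resolve_left (pow_ne_zero _ hz2)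

theorem exists_combination (hm : 0 < m) (hτ : 0 < τ.im) {y : ℤ → ℂ}
    (hy : y ∈ EP m) : ∃ a : Fin (m + 1) → ℂ, ∀ r : ℤ,
      row (∑ i, a i • hArr m i) r τ = y r * ee (r ^ 2 * τ / (4 * m)) := by
  set g : Fin (m + 1) → ℂ := fun s => y (s : ℕ) * ee (((s : ℕ) : ℤ) ^ 2 * τ / (4 * m)) with hg
  refine ⟨Matrix.vecMul g (hMat m τ)⁻¹, fun r => ?_⟩
  obtain ⟨hE, he, hs, -⟩ := sum_smul_hArr (Matrix.vecMul g (hMat m τ)⁻¹)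
  rw [row_eq_nrow m, EP.ext hm (nrow_mem hm hE he τ) hy]
  intro s
  have h1 : Matrix.vecMul (Matrix.vecMul g (hMat m τ)⁻¹) (hMat m τ) = g := by
    rw [Matrix.vecMul_vecMul, Matrix.nonsing_inv_mul _ (hMat_det_ne_zero hm hτ).isUnit,
      Matrix.vecMul_one]
  have h2 : row (∑ i, Matrix.vecMul g (hMat m τ)⁻¹ i • hArr m i) (s : ℕ) τ = g s := by
    rw [row_sum_smul (fun i => (hArr_wj_fin i).sm) _ _ hτ, ← congrFun h1 s]
    rfl
  rw [nrow, h2, hg]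
  dsimp only
  rw [mul_assoc, ← ee_add, add_neg_cancel, ee_zero, mul_one]

/-! ### Functionals killing weak Jacobi forms and arrays of optimal growth -/

/-- A vector-valued function on the upper half plane pairing modularly with the monomials. -/
structure DualVec (m : ℕ) (u : ℂ → Fin (m + 1) → ℂ) : Prop where
  law : ∀ τ : ℂ, 0 < τ.im → ∀ a b c d : ℤ, a * d - b * c = 1 → ∀ i : Fin (m + 1),
    ∑ s : Fin (m + 1), row (hArr m i) (s : ℕ) τ * u τ s = (c * τ + d) ^ (2 * (i : ℕ)) *
      ∑ s : Fin (m + 1), row (hArr m i) (s : ℕ) ((a * τ + b) / (c * τ + d)) *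
        u ((a * τ + b) / (c * τ + d)) s
  coprime : ∀ τ : ℂ, 0 < τ.im → ∀ s : Fin (m + 1), IsCoprime ((s : ℕ) : ℤ) (2 * m) → u τ s = 0

theorem exists_dualVec (hm : 0 < m) {b : Arr →ₗ[ℂ] ℂ}
    (hb : ∀ c ∈ WJSub 2 m ⊔ OptSub m, b c = 0) : ∃ u, DualVec m u ∧
      ∀ t, Ell m t → Evn t → Sm t → ∀ N, LowAt N t →
        (∀ τ : ℂ, 0 < τ.im → ∑ s : Fin (m + 1), row t (s : ℕ) τ * u τ s = 0) → b t = 0 := by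
  have hpos : ∀ c ∈ PosSub m, b c = 0 := fun c hc =>
    hb c (Submodule.mem_sup_right (posSub_le_optSub m hc))
  set v : Fin (m + 1) → LaurentSeries ℂ := fun s =>
    lser fun k => b (eArr m (4 * m * (-k) - ((s : ℕ) : ℤ) ^ 2) (s : ℕ)) with hv
  have hlow : ∀ (s : Fin (m + 1)) (k : ℤ), k < -m →
      b (eArr m (4 * m * (-k) - ((s : ℕ) : ℤ) ^ 2) (s : ℕ)) = 0 := fun s k hk => hpos _ <| by
    intro n r h
    rw [eArr, if_neg]
    rintro ⟨h', -⟩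
    have h1 : ((s : ℕ) : ℤ) ≤ m := by have := s.2; omega
    have h2 : (0 : ℤ) ≤ (s : ℕ) := by positivity
    dsimp only at h'
    nlinarith
  have hvc : ∀ s k, (v s).coeff k = b (eArr m (4 * m * (-k) - ((s : ℕ) : ℤ) ^ 2) (s : ℕ)) :=
    fun s k => by rw [hv, lser_coeff (hlow s)]
  have hform : ∀ c, Ell m c → Evn c → ∀ N, LowAt N c →
      b c = (∑ s : Fin (m + 1), rowL c (s : ℕ) * v s).coeff 0 := fun c hE he N hN => by
    have h1 := hpos _ (sub_sum_eArr_mem hm hE he hN)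
    rw [map_sub, sub_eq_zero] at h1
    rw [h1, map_sum, sum_range, HahnSeries.coeff_sum]
    refine sum_congr rfl fun s _ => ?_
    rw [map_sum, coeff_mul_eq_conv, conv, tsum_eq_sum (s := Icc N m)]
    · refine sum_congr rfl fun n _ => ?_
      rw [map_smul, rowL_coeff hN, hvc, zero_sub, neg_neg, smul_eq_mul]
    · intro n hn
      rw [rowL_coeff hN, hvc]
      rcases lt_or_ge n N with h | h
      · rw [hN n _ h, zero_mul]
      · rw [hlow s _ (by rw [mem_Icc] at hn; omega), mul_zero]
  have hex : ∀ i : Fin (m + 1), ∃ c, WJ (-(2 * (i : ℕ))) 0 c ∧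
      ∑ s : Fin (m + 1), rowL (hArr m i) (s : ℕ) * v s = rowL c 0 := fun i => by
    refine exists_form_of_orthogonal ((even_two_mul _).neg) fun c hc => ?_
    obtain ⟨N, hN⟩ := (hArr_wj_fin i).low
    have h1 := hc.conv (hArr_wj_fin i)
    rw [sub_add_cancel, zero_add] at h1
    obtain ⟨N', hN'⟩ := h1.low
    rw [← hb _ (Submodule.mem_sup_left (mem_WJSub.mpr h1)), hform _ h1.ell h1.even N' hN', mul_sum]
    simp only [rowL_conv hc hN, mul_assoc]
  choose w hw hwe using hex
  choose Nh hNh using fun i : Fin (m + 1) => (hArr_wj_fin i).low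
  choose Nw hNw using fun i : Fin (m + 1) => (hw i).low
  set H : Matrix (Fin (m + 1)) (Fin (m + 1)) CvRing := Matrix.of fun i s =>
    ⟨rowL (hArr m i) (s : ℕ), rowL_mem (hNh i) (hArr_wj_fin i).sm _⟩ with hH
  set W : Fin (m + 1) → CvRing := fun i => ⟨rowL (w i) 0, rowL_mem (hNw i) (hw i).sm 0⟩ with hW
  set n := H.adjugate.mulVec W with hn
  have hev : ∀ {τ : ℂ} (hτ : 0 < τ.im), (evL hτ).mapMatrix H = hMat m τ := fun hτ => by
    ext i s
    exact evL_rowL (hNh i) (hArr_wj_fin i).sm _ hτ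
  have hdet : ∀ {τ : ℂ} (hτ : 0 < τ.im), evL hτ H.det ≠ 0 := fun hτ => by
    rw [RingHom.map_det, hev]
    exact hMat_det_ne_zero hm hτ
  have hnv : ∀ s, ((n s : CvRing) : LaurentSeries ℂ) = (H.det : LaurentSeries ℂ) * v s := by
    intro s
    have h1 : CvRing.subtype ∘ W = (CvRing.subtype.mapMatrix H).mulVec v :=
      funext fun i => (hwe i).symm
    have h2 : CvRing.subtype (n s) = _ := RingHom.map_mulVec CvRing.subtype H.adjugate W s
    rw [h1] at h2
    change _ = ((CvRing.subtype.mapMatrix H.adjugate).mulVec _) s at h2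
    rw [RingHom.map_adjugate, Matrix.mulVec_mulVec, Matrix.adjugate_mul, ← RingHom.map_det,
      Matrix.smul_mulVec, Matrix.one_mulVec] at h2
    exact h2
  set u : ℂ → Fin (m + 1) → ℂ := fun τ s =>
    if hτ : 0 < τ.im then evL hτ (n s) / evL hτ H.det else 0 with hu
  have hu' : ∀ {τ : ℂ} (hτ : 0 < τ.im) s, evL hτ (n s) = evL hτ H.det * u τ s := fun hτ s => by
    rw [hu]
    dsimp only
    rw [dif_pos hτ, mul_div_cancel₀ _ (hdet hτ)]
  have hrow : ∀ {τ : ℂ}, 0 < τ.im → ∀ i : Fin (m + 1), ∑ s : Fin (m + 1), row (hArr m i) (s : ℕ) τ * u τ s =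
      row (w i) 0 τ := fun {τ} hτ i => by
    have h1 : H.mulVec n = H.det • W := by
      rw [hn, Matrix.mulVec_mulVec, Matrix.mul_adjugate, Matrix.smul_mulVec, Matrix.one_mulVec]
    have h2 := congrArg (evL hτ) (congrFun h1 i)
    rw [Matrix.mulVec, dotProduct, map_sum, Pi.smul_apply, smul_eq_mul, map_mul,
      evL_rowL (hNw i) (hw i).sm 0 hτ] at h2
    refine mul_left_cancel₀ (hdet hτ) (Eq.trans ?_ h2)
    rw [mul_sum]
    refine sum_congr rfl fun s _ => ?_
    rw [map_mul, hu', hH, Matrix.of_apply, evL_rowL (hNh i) (hArr_wj_fin i).sm _ hτ]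
    ring
  refine ⟨u, ⟨fun τ hτ a b c d h i => ?_, fun τ hτ s hs => ?_⟩, fun t hE he ht N hN h => ?_⟩
  · have hj := im_moebius_pos hτ h
    rw [hrow hτ, hrow hj.2, (hw i).row_law hτ h, ← mul_assoc, zpow_neg]
    norm_cast
    rw [mul_inv_cancel₀, one_mul]
    exact_mod_cast pow_ne_zero _ hj.1
  · have h1 : v s = 0 := by
      ext k
      rw [hvc, HahnSeries.coeff_zero]
      rcases lt_or_ge 0 (4 * m * (-k) - ((s : ℕ) : ℤ) ^ 2) with h | h
      · refine hpos _ fun n r h' => ?_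
        rw [eArr, if_neg]
        rintro ⟨h'', -⟩
        dsimp only at h''
        omega
      · exact hb _ (eArr_mem_of_coprime hm ((((s : ℕ) : ℤ) ^ 2 - 4 * m * (-k)).toNat) (-k) _
          (by rw [Int.toNat_of_nonneg (by linarith)]) hs)
    have h2 := hu' hτ s
    rw [show n s = 0 from Subtype.ext (by rw [hnv, h1, mul_zero]; rfl), map_zero] at h2
    exact (mul_eq_zero.mp h2.symm).resolve_left (hdet hτ)
  · set f : CvRing := ∑ s : Fin (m + 1), ⟨rowL t (s : ℕ), rowL_mem hN ht _⟩ * n s with hf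
    have h0 : f = 0 := cvRing_eq_zero fun τ hτ => by
      rw [hf, map_sum, ← mul_zero (evL hτ H.det), ← h τ hτ, mul_sum]
      refine sum_congr rfl fun s _ => ?_
      rw [map_mul, hu', evL_rowL hN ht _ hτ]
      ring
    have h1 : (H.det : LaurentSeries ℂ) * ∑ s : Fin (m + 1), rowL t (s : ℕ) * v s = 0 := by
      have h2 := congrArg CvRing.subtype h0
      rw [hf, map_sum, map_zero] at h2
      rw [← h2, mul_sum]
      refine sum_congr rfl fun s _ => ?_
      rw [map_mul, Subring.coe_subtype, hnv]
      ring
    rw [hform t hE he N hN, (mul_eq_zero.mp h1).resolve_left, HahnSeries.coeff_zero]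
    intro h2
    refine hdet (τ := I) (by simp) ?_
    rw [show H.det = 0 from Subtype.ext h2, map_zero]

theorem row_eq_zero_of_torsion (hc : Sm c) (hτ : 0 < τ.im) {p : ℕ}
    [NeZero p] (h : ∀ z : ℂ, ∑ k : ZMod p, JF c τ (z + k.val / p) = 0) {s : ℤ} (hs : (p : ℤ) ∣ s) :
    row c s τ = 0 := by
  have h1 : ∀ z : ℂ, HasSum (fun r : ℤ =>
      row c r τ * (∑ k : ZMod p, ee (r * k.val / p)) * ee (r * z)) 0 := fun z => by
    rw [← h z]
    refine (hasSum_sum fun k _ => (hc τ (z + (k : ZMod p).val / p) hτ).hasSum_row).congr_fun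
      fun r => ?_
    rw [mul_sum, sum_mul]
    refine sum_congr rfl fun k _ => ?_
    rw [mul_assoc, ← ee_add]
    ring_nf
  have h2 := fourier_coeff_eq_zero (by simpa [ee_zero] using (h1 0).summable)
    (fun x => (h1 x).tsum_eq) s
  rw [sum_ee_torsion, if_pos hs] at h2
  exact (mul_eq_zero.mp h2).resolve_right (NeZero.ne _)

theorem DualVec.vanish (hm : 0 < m) {u : ℂ → Fin (m + 1) → ℂ} (hu : DualVec m u)
    (hτ : 0 < τ.im) {y : ℤ → ℂ} (hy : y ∈ EP m) {a b c d : ℤ} (hdet : a * d - b * c = 1)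
    (H : ∀ (p : ℕ) [Fact p.Prime], p ∣ 2 * m → ∀ r : ℤ, ∑ k : ZMod p,
      y (r + (2 * m / p : ℕ) * (-c * k.val)) *
        ee (r * d * k.val / p - m * c * d * k.val ^ 2 / p ^ 2) = 0) :
    ∑ s : Fin (m + 1), y (s : ℕ) * ee (((s : ℕ) : ℤ) ^ 2 * τ / (4 * m)) * u τ s = 0 := by
  have hm' : (m : ℂ) ≠ 0 := by exact_mod_cast hm.ne'
  obtain ⟨α, hα⟩ := exists_combination hm hτ hy
  obtain ⟨hj, hγ⟩ := im_moebius_pos hτ hdet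
  set γ := (a * τ + b) / (c * τ + d) with hγe
  set j := c * τ + d with hje
  set β : Fin (m + 1) → ℂ := fun i => α i * j ^ (2 * (i : ℕ)) with hβ
  obtain ⟨-, -, hs, hJ⟩ := sum_smul_hArr α
  obtain ⟨-, -, hs', hJ'⟩ := sum_smul_hArr β
  set f := ∑ i, α i • hArr m i
  set f' := ∑ i, β i • hArr m i
  have hlaw : ∀ z, JF f' γ (z / j) = ee (m * c * z ^ 2 / j) * JF f τ z := fun z => by
    rw [hJ' γ _ hγ, hJ τ z hτ, mul_sum]
    refine sum_congr rfl fun i _ => ?_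
    rw [(hArr_wj_fin i).modularLaw τ hτ z a b c d hdet, ← hje, zpow_neg, hβ]
    norm_cast
    field_simp
  have hrow : ∀ (p : ℕ) [Fact p.Prime], p ∣ 2 * m → ∀ s : ℤ, (p : ℤ) ∣ s → row f' s γ = 0 := by
    intro p hp hpm s hps
    have hp0 : (p : ℂ) ≠ 0 := NeZero.ne _
    have hg : ((2 * m / p : ℕ) : ℂ) = 2 * m / p := by
      rw [Nat.cast_div hpm hp0]
      push_cast
      rfl
    refine row_eq_zero_of_torsion hs' hγ (p := p) (fun x => ?_) hps
    have h1 : ∀ k : ZMod p, HasSum (fun r : ℤ => ee (m * c * (j * x) ^ 2 / j) *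
        ee (r ^ 2 * τ / (4 * m) + r * (j * x)) * (y (r + (2 * m / p : ℕ) * (-c * k.val)) *
          ee (r * d * k.val / p - m * c * d * k.val ^ 2 / p ^ 2))) (JF f' γ (x + k.val / p)) := by
      intro k
      have h2 := hlaw (j * x + j * k.val / p)
      rw [show (j * x + j * k.val / p) / j = x + k.val / p by field_simp] at h2
      rw [h2]
      have h3 := ((hs τ (j * x + j * k.val / p) hτ).hasSum_row).mul_left
        (ee (m * c * (j * x + j * k.val / p) ^ 2 / j))
      rw [← (Equiv.addRight ((2 * m / p : ℕ) * (-c * k.val) : ℤ)).hasSum_iff] at h3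
      refine h3.congr_fun fun r => ?_
      dsimp only [Function.comp, Equiv.coe_addRight]
      rw [hα, mul_left_comm, mul_assoc (y _), mul_left_comm (ee _) (y _), ← ee_add, ← ee_add,
        ← ee_add, ← ee_add]
      congr 2
      simp only [Int.cast_add, Int.cast_mul, Int.cast_neg, Int.cast_natCast, hg]
      field_simp
      rw [hje]
      ring
    refine (hasSum_sum fun k _ => h1 k).unique ?_
    simp only [← mul_sum, H p hpm, mul_zero, hasSum_zero]
  have e1 : ∑ s : Fin (m + 1), y (s : ℕ) * ee (((s : ℕ) : ℤ) ^ 2 * τ / (4 * m)) * u τ s =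
      ∑ s : Fin (m + 1), row f' (s : ℕ) γ * u γ s := by
    have hex : ∀ (α' : Fin (m + 1) → ℂ) {σ : ℂ}, 0 < σ.im →
        ∑ s : Fin (m + 1), row (∑ i, α' i • hArr m i) (s : ℕ) σ * u σ s =
          ∑ i, α' i * ∑ s : Fin (m + 1), row (hArr m i) (s : ℕ) σ * u σ s := fun α' σ hσ => by
      simp only [row_sum_smul (fun i => (hArr_wj_fin i).sm) α' _ hσ, sum_mul, mul_sum, mul_assoc]
      rw [sum_comm]
    simp only [← hα]
    rw [hex α hτ, hex β hγ]
    refine sum_congr rfl fun i _ => ?_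
    rw [hu.law τ hτ a b c d hdet i, ← mul_assoc]
  rw [e1]
  refine sum_eq_zero fun s _ => ?_
  by_cases hco : IsCoprime ((s : ℕ) : ℤ) (2 * m)
  · rw [hu.coprime γ hγ s hco, mul_zero]
  · have : ¬ Nat.Coprime (s : ℕ) (2 * m) := fun h => hco (by exact_mod_cast h.isCoprime)
    obtain ⟨p, hp, h1, h2⟩ := Nat.Prime.not_coprime_iff_dvd.mp this
    have := Fact.mk hp
    rw [hrow p h2 _ (by exact_mod_cast h1), zero_mul]

/-! ### Decomposing even periodic functions prime by prime -/

theorem cast_div_mul_cancel {p : ℕ} (hp : p ∣ 2 * m) : ((2 * m / p : ℕ) : ℤ) * p = 2 * m := by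
  exact_mod_cast Nat.div_mul_cancel hp

/-- Operators on functions on `ℤ`. -/
abbrev FEnd := Module.End ℂ (ℤ → ℂ)

/-- Twisted sums of translates by multiples of `2m/p`. -/
def kOp (m p : ℕ) [NeZero p] (f : ℤ → ℤ → ℂ) : FEnd where
  toFun y r := ∑ x : ZMod p, f x.val r * y (r + (2 * m / p : ℕ) * (x.val : ℤ))
  map_add' y y' := by ext r; simp [mul_add, sum_add_distrib]
  map_smul' s y := by ext r; simp [mul_sum, mul_left_comm]

/-- Weights for which `kOp` preserves even periodic functions. -/
structure SymWt (p : ℕ) (f : ℤ → ℤ → ℂ) : Prop where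
  per : ∀ k r i j : ℤ, f (k + p * i) (r + p * j) = f k r
  neg : ∀ k r : ℤ, f (-k) (-r) = f k r

/-- The algebra generated by the operators attached to a prime. -/
def KAlg (m p : ℕ) [NeZero p] : Subalgebra ℂ (FEnd) :=
  Algebra.adjoin ℂ {O | ∃ f, SymWt p f ∧ O = kOp m p f}

theorem kOp_mem (m : ℕ) {p : ℕ} [NeZero p] {f : ℤ → ℤ → ℂ} (hf : SymWt p f) :
    kOp m p f ∈ KAlg m p := Algebra.subset_adjoin ⟨f, hf, rfl⟩

theorem KAlg.commute {m p q : ℕ} [NeZero p] [NeZero q] (hp : (p : ℤ) ∣ (2 * m / q : ℕ))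
    (hq : (q : ℤ) ∣ (2 * m / p : ℕ)) {O X : FEnd} (hO : O ∈ KAlg m p)
    (hX : X ∈ KAlg m q) : Commute O X := by
  refine Algebra.commute_of_mem_adjoin_of_forall_mem_commute hX fun X ⟨f', hf', hX⟩ =>
    (Algebra.commute_of_mem_adjoin_of_forall_mem_commute hO fun O ⟨f, hf, hO⟩ => ?_).symm
  obtain ⟨i, hi⟩ := hp
  obtain ⟨j, hj⟩ := hq
  rw [hX, hO]
  refine LinearMap.ext fun y => funext fun r => ?_
  change ∑ x' : ZMod q, f' x'.val r * ∑ x : ZMod p, f x.val _ * y _ =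
    ∑ x : ZMod p, f x.val r * ∑ x' : ZMod q, f' x'.val _ * y _
  simp only [mul_sum]
  rw [sum_comm]
  refine sum_congr rfl fun x _ => sum_congr rfl fun x' _ => ?_
  have h1 := hf.per x.val r 0 (i * x'.val)
  have h2 := hf'.per x'.val r 0 (j * x.val)
  rw [mul_zero, add_zero, ← mul_assoc] at h1 h2
  rw [hi, hj, h1, h2, add_right_comm]
  ring

theorem KAlg.ep {m p : ℕ} [NeZero p] (hp : p ∣ 2 * m) {O : FEnd}
    (hO : O ∈ KAlg m p) {y : ℤ → ℂ} (hy : y ∈ EP m) : O y ∈ EP m := by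
  have hg := cast_div_mul_cancel hp
  induction hO using Algebra.adjoin_induction generalizing y with
  | mem O h =>
    obtain ⟨f, hf, rfl⟩ := h
    refine ⟨fun r l => sum_congr rfl fun x _ => ?_, fun r => ?_⟩
    · have h1 := hf.per x.val r 0 ((2 * m / p : ℕ) * l)
      rw [mul_zero, add_zero, ← mul_assoc, mul_comm (p : ℤ), hg] at h1
      rw [h1, add_right_comm, hy.1]
    · have h1 : Function.Periodic
          (fun k : ℤ => f k (-r) * y (-r + (2 * m / p : ℕ) * k)) (p : ℤ) := fun k => by
        have h1 := hf.per k (-r) 1 0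
        rw [mul_zero, add_zero, mul_one] at h1
        dsimp only
        rw [h1, mul_add, hg, ← add_assoc, ← hy.1 (-r + (2 * m / p : ℕ) * k) 1, mul_one]
      have h2 := sum_periodic_affine h1 (a := -1) (by simp) 0
      refine h2.symm.trans (sum_congr rfl fun x _ => ?_)
      rw [add_zero, neg_one_mul, hf.neg, mul_neg, ← neg_add, hy.2]
  | algebraMap s => exact (EP m).smul_mem s hy
  | add A B _ _ hA hB => exact (EP m).add_mem (hA hy) (hB hy)
  | mul A B _ _ hA hB => exact hA (hB hy)

def kRes (m p : ℕ) [NeZero p] : FEnd :=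
  kOp m p fun k r => if (p : ℤ) ∣ k ∧ (p : ℤ) ∣ r then 1 else 0

/-- The sum of the translates by multiples of `2m/p`. -/
def kSum (m p : ℕ) [NeZero p] : FEnd := kOp m p fun _ _ => 1

/-- The twisted difference of translates, for `p = 2`. -/
def kAlt (m p : ℕ) [NeZero p] : FEnd :=
  kOp m p fun k r => if Even k then 1 else if Even r then -1 else 1

theorem kRes_mem (m p : ℕ) [NeZero p] : kRes m p ∈ KAlg m p :=
  kOp_mem m ⟨fun k r i j => by simp, fun k r => by simp⟩

theorem kSum_mem (m p : ℕ) [NeZero p] : kSum m p ∈ KAlg m p :=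
  kOp_mem m ⟨fun _ _ _ _ => rfl, fun _ _ => rfl⟩

theorem kAlt_mem (m : ℕ) : kAlt m 2 ∈ KAlg m 2 :=
  kOp_mem m ⟨fun k r i j => by simp [Int.even_add], fun k r => by simp⟩

theorem kRes_apply (m p : ℕ) [NeZero p] (y : ℤ → ℂ) (r : ℤ) :
    kRes m p y r = if (p : ℤ) ∣ r then y r else 0 := by
  change ∑ x : ZMod p, _ = _
  rw [sum_eq_single 0]
  · simp
  · intro x _ hx
    refine mul_eq_zero_of_left (if_neg ?_) _
    rintro ⟨h, -⟩
    rw [Int.natCast_dvd_natCast] at h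
    exact hx ((ZMod.val_eq_zero x).mp (Nat.eq_zero_of_dvd_of_lt h x.val_lt))
  · simp

theorem kSum_apply (m p : ℕ) [NeZero p] (y : ℤ → ℂ) (r : ℤ) :
    kSum m p y r = ∑ x : ZMod p, y (r + (2 * m / p : ℕ) * (x.val : ℤ)) := by
  simp [kSum, kOp]

theorem sum_zmod_two (F : ℤ → ℂ) : ∑ x : ZMod 2, F x.val = F 0 + F 1 :=
  (sum_zmod_eq_fin (q := 2) fun k => F k).trans (by simp [Fin.sum_univ_two])

theorem kAlt_apply (m : ℕ) (y : ℤ → ℂ) (r : ℤ) :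
    kAlt m 2 y r = y r + (if Even r then -1 else 1) * y (r + m) := by
  refine (sum_zmod_two fun k => (if Even k then 1 else if Even r then -1 else 1) *
    y (r + (2 * m / 2 : ℕ) * k)).trans ?_
  rw [Nat.mul_div_cancel_left m two_pos]
  simp

theorem EP.sum_shift {m p : ℕ} [NeZero p] (hp : p ∣ 2 * m) {y : ℤ → ℂ} (hy : y ∈ EP m) {a : ℤ}
    (ha : IsUnit (a : ZMod p)) (r b : ℤ) :
    ∑ x : ZMod p, y (r + (2 * m / p : ℕ) * (a * x.val + b)) = kSum m p y r := by
  rw [kSum_apply]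
  have hg := cast_div_mul_cancel hp
  refine sum_periodic_affine (g := fun k : ℤ => y (r + (2 * m / p : ℕ) * k)) (fun k => ?_) ha b
  dsimp only
  rw [mul_add, hg, ← add_assoc, ← hy.1 (r + (2 * m / p : ℕ) * k) 1, mul_one]

theorem EP.kSum_kSum {m p : ℕ} [NeZero p] (hp : p ∣ 2 * m) {y : ℤ → ℂ} (hy : y ∈ EP m) :
    kSum m p (kSum m p y) = (p : ℂ) • kSum m p y := by
  funext r
  rw [kSum_apply]
  have h : ∀ x : ZMod p, kSum m p y (r + (2 * m / p : ℕ) * (x.val : ℤ)) = kSum m p y r := by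
    intro x
    rw [← EP.sum_shift hp hy (a := 1) (by simp) r x.val, kSum_apply]
    refine sum_congr rfl fun x' _ => ?_
    ring_nf
  rw [sum_congr rfl fun x _ => h x, sum_const, card_univ, ZMod.card,
    nsmul_eq_mul, Pi.smul_apply, smul_eq_mul]

/-- One of the operators attached to `p` kills `y`. -/
def Kill (m p : ℕ) [NeZero p] (y : ℤ → ℂ) : Prop :=
  kRes m p y = 0 ∨ kSum m p y = 0 ∨ p = 2 ∧ m % 4 = 2 ∧ kAlt m p y = 0

theorem Kill.of_mem {m p q : ℕ} [NeZero p] [NeZero q] (hp : (p : ℤ) ∣ (2 * m / q : ℕ))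
    (hq : (q : ℤ) ∣ (2 * m / p : ℕ)) {O : FEnd} (hO : O ∈ KAlg m p)
    {y : ℤ → ℂ} (h : Kill m q y) : Kill m q (O y) := by
  have key : ∀ X ∈ KAlg m q, X y = 0 → X (O y) = 0 := fun X hX h0 => by
    rw [← Module.End.mul_apply, ← (KAlg.commute hp hq hO hX).eq, Module.End.mul_apply, h0, map_zero]
  rcases h with h | h | ⟨rfl, h4, h⟩
  · exact Or.inl (key _ (kRes_mem m q) h)
  · exact Or.inr (Or.inl (key _ (kSum_mem m q) h))
  · exact Or.inr (Or.inr ⟨rfl, h4, key _ (kAlt_mem m) h⟩)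

theorem eq_zero_of_split {m p : ℕ} [hpf : Fact p.Prime] (hp : p ∣ 2 * m) {y : ℤ → ℂ}
    (hy : y ∈ EP m) (h2 : p ^ 2 ∣ m → kSum m p (kRes m p y) = 0) (L : (ℤ → ℂ) →ₗ[ℂ] ℂ)
    (h : ∀ O ∈ KAlg m p, Kill m p (O y) → L (O y) = 0) : L y = 0 := by
  have hR := kRes_mem m p
  have hS := kSum_mem m p
  have hg := cast_div_mul_cancel hp
  have hp0 : (p : ℂ) ≠ 0 := NeZero.ne _
  have hRR : kRes m p (kRes m p y) = kRes m p y := funext fun r => by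
    simp only [kRes_apply]; split_ifs <;> rfl
  have hRy := KAlg.ep hp hR hy
  have h1 : L y = L (kRes m p y) + L ((1 - kRes m p) y) := by rw [← map_add]; congr 1; simp
  by_cases hpg : (p : ℤ) ∣ (2 * m / p : ℕ)
  · rw [h1, h _ (sub_mem (one_mem _) hR) (Or.inl (by simp [hRR])), add_zero]
    by_cases hpm : p ^ 2 ∣ m
    · exact h _ hR (Or.inr (Or.inl (h2 hpm)))
    obtain ⟨rfl, hm4⟩ : p = 2 ∧ m % 4 = 2 := by
      have h3 : p ^ 2 ∣ 2 * m := by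
        obtain ⟨j, hj⟩ := hpg
        rw [hj] at hg
        have h5 : (p : ℤ) ^ 2 ∣ 2 * m := ⟨j, by rw [← hg]; ring⟩
        exact_mod_cast h5
      have h4 : p = 2 := by
        by_contra h4
        exact hpm (Nat.Coprime.dvd_of_dvd_mul_left
          (((Nat.coprime_primes hpf.out Nat.prime_two).mpr h4).pow_left 2) h3)
      subst h4
      exact ⟨rfl, by omega⟩
    have hm2 : Even (m : ℤ) := by rw [Int.even_iff]; omega
    have hdd : ∀ r, kRes m 2 y (r + m + m) = kRes m 2 y r := fun r => by rw [← hRy.1 r 1]; ring_nf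
    have hodd : ∀ r : ℤ, ¬ Even r → kRes m 2 y r = 0 := fun r hr => by
      rw [kRes_apply, if_neg (by rwa [Nat.cast_two, ← even_iff_two_dvd])]
    have hev : ∀ r : ℤ, Even (r + m) ↔ Even r := fun r => by simp [Int.even_add, hm2]
    have hsum : ∀ (w : ℤ → ℂ) (r : ℤ), kSum m 2 w r = w r + w (r + m) := fun w r => by
      rw [kSum_apply]
      refine (sum_zmod_two fun k => w (r + (2 * m / 2 : ℕ) * k)).trans ?_
      rw [Nat.mul_div_cancel_left m two_pos]
      simp
    have e1 := h _ (mul_mem hS hR) (Or.inr (Or.inr ⟨rfl, hm4, funext fun r => by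
      simp only [Module.End.mul_apply, kAlt_apply, hsum, hdd, Pi.zero_apply]
      split_ifs with hr
      · ring
      · simp [hodd r hr, hodd _ (mt (hev r).mp hr)]⟩))
    have e2 := h _ (mul_mem (kAlt_mem m) hR) (Or.inr (Or.inl (funext fun r => by
      simp only [Module.End.mul_apply, kAlt_apply, hsum, hdd, hev, Pi.zero_apply]
      split_ifs with hr
      · ring
      · simp [hodd r hr, hodd _ (mt (hev r).mp hr)])))
    have e3 : (2 : ℂ) • kRes m 2 y = (kSum m 2 * kRes m 2) y + (kAlt m 2 * kRes m 2) y :=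
      funext fun r => by
        simp only [Module.End.mul_apply, kAlt_apply, hsum, Pi.add_apply, Pi.smul_apply, smul_eq_mul]
        split_ifs with hr
        · ring
        · simp [hodd r hr, hodd _ (mt (hev r).mp hr)]
    have e4 := congrArg L e3
    rw [map_add, e1, e2, add_zero, map_smul, smul_eq_mul] at e4
    exact (mul_eq_zero.mp e4).resolve_left two_ne_zero
  · have hRSR : kRes m p (kSum m p (kRes m p y)) = kRes m p y := funext fun r => by
      rw [kRes_apply, kRes_apply]
      split_ifs with hr
      · rw [kSum_apply, sum_eq_single 0]
        · simp [kRes_apply, hr]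
        · intro x _ hx
          rw [kRes_apply, if_neg]
          intro h
          rw [Int.dvd_add_right hr] at h
          have h3 := ((Nat.prime_iff_prime_int.mp hpf.out).dvd_or_dvd h).resolve_left hpg
          rw [Int.natCast_dvd_natCast] at h3
          exact hx ((ZMod.val_eq_zero x).mp (Nat.eq_zero_of_dvd_of_lt h3 x.val_lt))
        · simp
      · rfl
    set O := kRes m p - (p : ℂ)⁻¹ • (kSum m p * kRes m p) with hO
    have hOm : O ∈ KAlg m p := sub_mem hR (Subalgebra.smul_mem _ (mul_mem hS hR) _)
    have hs : (1 - (p : ℂ)⁻¹) ≠ 0 := by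
      rw [sub_ne_zero]
      exact fun h => hpf.out.one_lt.ne' (by exact_mod_cast (inv_eq_one.mp h.symm))
    have e1 := h O hOm (Or.inr (Or.inl (by
      simp [hO, EP.kSum_kSum hp hRy, smul_smul, inv_mul_cancel₀ hp0])))
    have e2 := h (1 - (1 - (p : ℂ)⁻¹)⁻¹ • O) (sub_mem (one_mem _) (Subalgebra.smul_mem _ hOm _))
      (Or.inl (by
        have : kRes m p (O y) = (1 - (p : ℂ)⁻¹) • kRes m p y := by simp [hO, hRR, hRSR, sub_smul]
        simp [this, smul_smul, inv_mul_cancel₀ hs]))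
    simpa [e1] using e2

theorem eq_zero_of_kill (L : (ℤ → ℂ) →ₗ[ℂ] ℂ)
    (h : ∀ y ∈ EP m, (∀ (p : ℕ) [Fact p.Prime], p ∣ 2 * m → Kill m p y) → L y = 0)
    (S : Finset ℕ) : ∀ y ∈ EP m, (∀ (p : ℕ) [Fact p.Prime], p ∣ 2 * m → p ∉ S → Kill m p y) →
      (∀ (p : ℕ) [Fact p.Prime], p ∈ S → p ^ 2 ∣ m → kSum m p (kRes m p y) = 0) → L y = 0 := by
  induction S using Finset.induction_on with
  | empty => exact fun y hy h1 _ => h y hy fun p _ hp => h1 p hp (Finset.notMem_empty p)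
  | insert p S hpS ih =>
    intro y hy h1 h2
    by_cases hp : p.Prime ∧ p ∣ 2 * m
    · have := Fact.mk hp.1
      have hdv : ∀ q : ℕ, q.Prime → q ∣ 2 * m → q ≠ p →
          (p : ℤ) ∣ (2 * m / q : ℕ) ∧ (q : ℤ) ∣ (2 * m / p : ℕ) := fun q hq hqm hqp => by
        have hc := (Nat.coprime_primes hp.1 hq).mpr hqp.symm
        constructor <;> rw [Int.natCast_dvd_natCast]
        · exact hc.dvd_of_dvd_mul_right (by rw [Nat.div_mul_cancel hqm]; exact hp.2)
        · exact hc.symm.dvd_of_dvd_mul_right (by rw [Nat.div_mul_cancel hp.2]; exact hqm)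
      refine eq_zero_of_split hp.2 hy (h2 p (mem_insert_self _ _)) L fun O hO hk =>
        ih (O y) (KAlg.ep hp.2 hO hy) (fun q hq hqm hqS => ?_) fun q hq hqS hqm => ?_
      · by_cases hqp : q = p
        · subst hqp
          exact hk
        · obtain ⟨d1, d2⟩ := hdv q hq.out hqm hqp
          exact (h1 q hqm (by simp [hqp, hqS])).of_mem d1 d2 hO
      · obtain ⟨d1, d2⟩ := hdv q hq.out
          (((dvd_pow_self q two_ne_zero).trans hqm).mul_left 2) fun h => hpS (h ▸ hqS)
        have h3 := h2 q (mem_insert_of_mem hqS) hqm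
        rw [← Module.End.mul_apply] at h3 ⊢
        rw [← Module.End.mul_apply,
          ← (KAlg.commute d1 d2 hO (mul_mem (kSum_mem m q) (kRes_mem m q))).eq,
          Module.End.mul_apply, h3, map_zero]
    · refine ih y hy (fun q hq hqm hqS => h1 q hqm ?_) fun q hq hqS => h2 q (mem_insert_of_mem hqS)
      rw [mem_insert, not_or]
      exact ⟨fun h => hp (h ▸ ⟨hq.out, hqm⟩), hqS⟩

theorem ee_int_div_two (n : ℤ) : ee (n / 2) = if Even n then 1 else -1 := by
  rcases Int.even_or_odd' n with ⟨k, rfl | rfl⟩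
  · rw [if_pos (even_two_mul k)]
    push_cast
    rw [mul_div_cancel_left₀ _ two_ne_zero, ee_int]
  · rw [if_neg (by simp), ← ee_half, ← ee_add_int (1 / 2) k]
    push_cast
    ring_nf

theorem DualVec.vanish_of_kill (hm : 0 < m) {u : ℂ → Fin (m + 1) → ℂ} (hu : DualVec m u)
    (hτ : 0 < τ.im) {y : ℤ → ℂ} (hy : y ∈ EP m)
    (h : ∀ (p : ℕ) [Fact p.Prime], p ∣ 2 * m → Kill m p y) :
    ∑ s : Fin (m + 1), y (s : ℕ) * ee (((s : ℕ) : ℤ) ^ 2 * τ / (4 * m)) * u τ s = 0 := by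
  set P₀ : ℕ → Prop := fun p => ∀ r : ℤ, (p : ℤ) ∣ r → y r = 0
  set P₁ : ℕ → Prop := fun p => ∀ _ : Fact p.Prime, kSum m p y = 0
  set S₀ := (2 * m).primeFactors.filter P₀ with hS₀
  set S₁ := (2 * m).primeFactors.filter fun p => ¬ P₀ p ∧ P₁ p with hS₁
  have hpr : ∀ {S : Finset ℕ}, S ⊆ (2 * m).primeFactors → ∀ {p : ℕ}, p.Prime → p ∉ S →
      ¬ (p : ℤ) ∣ ((∏ q ∈ S, q ^ 2 : ℕ) : ℤ) := fun hS p hp hpS hd => by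
    rw [Int.natCast_dvd_natCast, hp.prime.dvd_finsetProd_iff] at hd
    obtain ⟨q, hq, hd⟩ := hd
    exact hpS (((Nat.prime_dvd_prime_iff_eq hp (Nat.prime_of_mem_primeFactors (hS hq))).mp
      (hp.dvd_of_dvd_pow hd)) ▸ hq)
  have hs0 : S₀ ⊆ (2 * m).primeFactors := filter_subset _ _
  have hs1 : S₁ ⊆ (2 * m).primeFactors := filter_subset _ _
  have hco : Nat.Coprime (∏ q ∈ S₀, q ^ 2) (∏ q ∈ S₁, q ^ 2) :=
    Nat.Coprime.prod_left fun q hq => Nat.Coprime.prod_right fun q' hq' => by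
      refine Nat.Coprime.pow _ _ ((Nat.coprime_primes (Nat.prime_of_mem_primeFactors (hs0 hq))
        (Nat.prime_of_mem_primeFactors (hs1 hq'))).mpr ?_)
      rintro rfl
      exact (mem_filter.mp hq').2.1 (mem_filter.mp hq).2
  obtain ⟨b, a, hab⟩ := hco.isCoprime
  set c : ℤ := ((∏ q ∈ S₀, q ^ 2 : ℕ) : ℤ) with hc
  set d : ℤ := ((∏ q ∈ S₁, q ^ 2 : ℕ) : ℤ) with hd
  refine hu.vanish hm hτ hy (a := a) (b := -b) (c := c) (d := d) (by linear_combination hab)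
    fun p hp hpm r => ?_
  have hp0 : (p : ℂ) ≠ 0 := NeZero.ne _
  have hmem : p ∈ (2 * m).primeFactors := Nat.mem_primeFactors.mpr ⟨hp.out, hpm, by omega⟩
  have hg := cast_div_mul_cancel hpm
  have hsq : ∀ {S : Finset ℕ}, p ∈ S → ∃ c' : ℤ, ((∏ q ∈ S, q ^ 2 : ℕ) : ℤ) = p ^ 2 * c' :=
    fun hS => by
      obtain ⟨c', h⟩ := Finset.dvd_prod_of_mem (fun q => q ^ 2) hS
      exact ⟨c', by rw [h]; push_cast; rfl⟩
  have hpi := Nat.prime_iff_prime_int.mp hp.out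
  by_cases h0 : P₀ p
  · obtain ⟨c', hc'⟩ := hsq (mem_filter.mpr ⟨hmem, h0⟩ : p ∈ S₀)
    rw [← hc] at hc'
    have hpd : ¬ (p : ℤ) ∣ d := hpr hs1 hp.out fun h => (mem_filter.mp h).2.1 h0
    have e1 : ∀ x : ZMod p, y (r + (2 * m / p : ℕ) * (-c * x.val)) *
        ee (r * d * x.val / p - m * c * d * x.val ^ 2 / p ^ 2) =
        y r * ee ((r * d : ℤ) * x.val / p) := fun x => by
      congr 1
      · rw [← hy.1 r (-(p * c' * x.val)), ← hg, hc']
        congr 1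
        ring
      · rw [← ee_add_int _ (m * c' * d * x.val ^ 2), hc']
        congr 1
        push_cast
        field_simp
        ring
    rw [sum_congr rfl fun x _ => e1 x, ← mul_sum, sum_ee_torsion]
    split_ifs with hr
    · rw [h0 r ((hpi.dvd_or_dvd hr).resolve_right hpd), zero_mul]
    · rw [mul_zero]
  have hpc : ¬ (p : ℤ) ∣ c := hpr hs0 hp.out fun h => h0 (mem_filter.mp h).2
  by_cases h1 : P₁ p
  · obtain ⟨d', hd'⟩ := hsq (mem_filter.mpr ⟨hmem, h0, h1⟩ : p ∈ S₁)
    rw [← hd] at hd'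
    have hu : IsUnit ((-c : ℤ) : ZMod p) := by
      rw [isUnit_iff_ne_zero, Ne, ZMod.intCast_zmod_eq_zero_iff_dvd, dvd_neg]
      exact hpc
    refine Eq.trans ?_ (congrFun (h1 hp) r)
    rw [← EP.sum_shift hpm hy hu r 0]
    refine sum_congr rfl fun x _ => ?_
    rw [add_zero]
    refine (congrArg _ ?_).trans (mul_one _)
    rw [← ee_int (r * d' * p * x.val - m * c * d' * x.val ^ 2), hd']
    congr 1
    push_cast
    field_simp
  have hpd : ¬ (p : ℤ) ∣ d := hpr hs1 hp.out fun h => h1 (mem_filter.mp h).2.2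
  rcases h p hpm with h2 | h2 | ⟨rfl, hm4, h2⟩
  · refine absurd (fun s hs => ?_) h0
    have := congrFun h2 s
    rwa [kRes_apply, if_pos hs] at this
  · exact absurd (fun _ => h2) h1
  · refine (sum_zmod_two fun k => y (r + (2 * m / 2 : ℕ) * (-c * k)) *
      ee (r * d * k / 2 - m * c * d * k ^ 2 / 2 ^ 2)).trans ?_
    refine Eq.trans ?_ (congrFun h2 r)
    rw [kAlt_apply, Nat.mul_div_cancel_left m two_pos]
    obtain ⟨k, rfl⟩ : ∃ k : ℕ, m = 4 * k + 2 := ⟨m / 4, by omega⟩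
    have hco' : Odd c := by rwa [← Int.not_even_iff_odd, even_iff_two_dvd]
    have hdo : Odd d := by rwa [← Int.not_even_iff_odd, even_iff_two_dvd]
    congr 1
    · simp [ee_zero]
    rw [mul_comm]
    congr 1
    · rw [show (r * d * ((1 : ℤ) : ℂ) / 2 - ((4 * k + 2 : ℕ) : ℂ) * c * d * ((1 : ℤ) : ℂ) ^ 2 / 2 ^ 2) =
        (((r - (2 * k + 1) * c) * d : ℤ) : ℂ) / 2 by push_cast; ring, ee_int_div_two]
      have : Even ((r - (2 * k + 1) * c) * d) ↔ ¬ Even r := by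
        have h5 : ¬ Even c := Int.not_even_iff_odd.mpr hco'
        have h6 : ¬ Even d := Int.not_even_iff_odd.mpr hdo
        simp [Int.even_mul, Int.even_sub, h5, h6, show ¬ Odd (2 * (k : ℤ)) by simp]
      by_cases hr : Even r <;> simp [this, hr]
    · obtain ⟨j, hj⟩ := hco'
      rw [← hy.1 _ (j + 1), hj]
      congr 1
      push_cast
      ring

theorem kSum_kRes_nrow {p k : ℕ} [NeZero p] (hk : 0 < k) {t : Arr} (ht : Sm t)
    (h : uop p k t = 0) (hτ : 0 < τ.im) :
    kSum (k * p ^ 2) p (kRes (k * p ^ 2) p (nrow (k * p ^ 2) t τ)) = 0 := by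
  have hp0 : (p : ℂ) ≠ 0 := NeZero.ne _
  have hk0 : (k : ℂ) ≠ 0 := by exact_mod_cast hk.ne'
  funext r
  rw [kSum_apply, show 2 * (k * p ^ 2) / p = 2 * k * p from
    Nat.div_eq_of_eq_mul_left (NeZero.pos p) (by ring), Pi.zero_apply]
  simp only [kRes_apply]
  by_cases hr : (p : ℤ) ∣ r
  · obtain ⟨s, rfl⟩ := hr
    have h1 : ∀ x : ZMod p, HasSum (fun n : ℤ => t (n + s * x.val + k * (x.val : ℤ) ^ 2,
        p * (s + 2 * k * x.val)) * ee (n * τ)) (ee (s ^ 2 * τ / (4 * k)) *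
          nrow (k * p ^ 2) t τ (p * (s + 2 * k * x.val))) := fun x => by
      have h2 := ((ht τ 0 hτ).row_summable (p * (s + 2 * k * x.val))).hasSum.mul_left
        (ee (-((s * x.val + k * x.val ^ 2) * τ)))
      rw [← (Equiv.addRight (s * x.val + k * (x.val : ℤ) ^ 2)).hasSum_iff] at h2
      refine HasSum.congr_fun (Eq.subst (motive := HasSum _) ?_ h2) fun n => ?_
      · change _ * row t _ τ = _
        rw [nrow, mul_left_comm, ← ee_add, mul_comm]
        congr 2
        push_cast
        field_simp
        ring
      · dsimp only [Function.comp, Equiv.coe_addRight]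
        rw [mul_left_comm, ← ee_add, ← add_assoc]
        congr 2
        push_cast
        ring
    have h2 : ∑ x : ZMod p, ee (s ^ 2 * τ / (4 * k)) *
        nrow (k * p ^ 2) t τ (p * (s + 2 * k * x.val)) = 0 := by
      refine (hasSum_sum fun x _ => h1 x).unique ?_
      have h3 : ∀ n : ℤ, ∑ x : ZMod p, t (n + s * x.val + k * (x.val : ℤ) ^ 2,
        p * (s + 2 * k * x.val)) = 0 := fun n => congrFun h (n, s)
      simp only [← sum_mul, h3, zero_mul, hasSum_zero]
    rw [← mul_sum] at h2
    refine Eq.trans (sum_congr rfl fun x _ => ?_) ((mul_eq_zero.mp h2).resolve_left (ee_ne_zero _))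
    have e : (p : ℤ) * s + (2 * k * p : ℕ) * x.val = p * (s + 2 * k * x.val) := by push_cast; ring
    rw [e, if_pos (Dvd.intro _ rfl)]
  · refine sum_eq_zero fun x _ => if_neg fun h' => hr ?_
    rwa [Int.dvd_add_left (Dvd.intro_left (2 * k * x.val : ℤ) (by push_cast; ring))] at h'

theorem mem_sup_of_uop_eq_zero (hm : 0 < m) {t : Arr} (hE : Ell m t) (he : Evn t)
    (hs : Sm t) {N : ℤ} (hN : LowAt N t)
    (h : ∀ (p : ℕ) [Fact p.Prime] (k : ℕ), m = k * p ^ 2 → uop p k t = 0) :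
    t ∈ WJSub 2 m ⊔ OptSub m := by
  by_contra hne
  obtain ⟨b, hbt, hb⟩ := Submodule.exists_le_ker_of_notMem hne
  obtain ⟨u, hu, hlast⟩ := exists_dualVec hm fun c hc => LinearMap.mem_ker.mp (hb hc)
  refine hbt (hlast t hE he hs N hN fun τ hτ => ?_)
  have h1 := eq_zero_of_kill (m := m) (∑ s : Fin (m + 1),
    (ee (((s : ℕ) : ℤ) ^ 2 * τ / (4 * m)) * u τ s) • LinearMap.proj (R := ℂ) ((s : ℕ) : ℤ))
    (fun y hy hk => by
      refine Eq.trans ?_ (hu.vanish_of_kill hm hτ hy hk)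
      simp only [LinearMap.sum_apply, LinearMap.smul_apply, LinearMap.proj_apply, smul_eq_mul]
      exact sum_congr rfl fun s _ => by ring)
    (2 * m).primeFactors (nrow m t τ) (nrow_mem hm hE he τ)
    (fun p hp hpm hn => absurd (Nat.mem_primeFactors.mpr ⟨hp.out, hpm, by omega⟩) hn)
    fun p hp _ hpm => by
      obtain ⟨k, hk⟩ := hpm
      rw [mul_comm] at hk
      have h2 := h p k hk
      subst hk
      exact kSum_kRes_nrow (Nat.pos_of_mul_pos_right hm) hs h2 hτ
  rw [← h1]
  simp only [LinearMap.sum_apply, LinearMap.smul_apply, LinearMap.proj_apply, smul_eq_mul]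
  refine sum_congr rfl fun s _ => ?_
  rw [row_eq_nrow m]
  ring

/-! ### Primitive representatives -/

/-- Even arrays of holomorphic elliptic forms of index `m`, bounded below in `n`. -/
def RegSub (m : ℕ) : Submodule ℂ Arr where
  carrier := {c | Ell m c ∧ Evn c ∧ Sm c ∧ ∃ N, LowAt N c}
  zero_mem' := ⟨fun _ _ _ => rfl, fun _ _ => rfl, Sm.zero, 0, fun _ _ _ => rfl⟩
  add_mem' := fun {a b} ⟨h1, h2, h3, N, h4⟩ ⟨k1, k2, k3, M, k4⟩ =>
    ⟨fun n r l => by simp [h1 n r l, k1 n r l], fun n r => by simp [h2 n r, k2 n r], h3.add k3,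
      min N M, fun n r h => by simp [h4 n r (lt_min_iff.mp h).1, k4 n r (lt_min_iff.mp h).2]⟩
  smul_mem' := fun s _ ⟨h1, h2, h3, N, h4⟩ => ⟨fun n r l => by simp [h1 n r l],
    fun n r => by simp [h2 n r], h3.smul s, N, fun n r h => by simp [h4 n r h]⟩

theorem WJ.mem_regSub (h : WJ k m c) : c ∈ RegSub m := ⟨h.ell, h.even, h.sm, h.low⟩

theorem uArr_mem_regSub {d m : ℕ} (hd : 0 < d) (h : c ∈ RegSub m) : uArr d c ∈ RegSub (m * d ^ 2) :=
  ⟨uArr_ell hd h.1, uArr_even h.2.1, uArr_sm hd h.2.2.1, let ⟨N, hN⟩ := h.2.2.2; ⟨N, uArr_low hN⟩⟩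

theorem uArr_one (c : Arr) : uArr 1 c = c := by
  ext p
  simp [uArr]

theorem uop_comm {p q j : ℕ} [NeZero p] [NeZero q] (hpq : Nat.Coprime p q)
    (hc : Ell (j * (p * q) ^ 2) c) : uop q j (uop p (j * q ^ 2) c) = uop p j (uop q (j * p ^ 2) c) := by
  have key : ∀ (p q : ℕ) [NeZero p] [NeZero q], Nat.Coprime p q → Ell (j * (p * q) ^ 2) c →
      ∀ n r : ℤ, uop q j (uop p (j * q ^ 2) c) (n, r) = ∑ y : ZMod q, ∑ x : ZMod p,
        c (n + r * (p * y.val + q * x.val) + j * (p * y.val + q * x.val) ^ 2,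
          (p * q : ℕ) * (r + 2 * j * (p * y.val + q * x.val))) := by
    intro p q _ _ hpq hc n r
    set T : ℤ → ℂ := fun w => c (n + r * w + j * w ^ 2, (p * q : ℕ) * (r + 2 * j * w)) with hT
    have hTp : Periodic T (p * q : ℕ) := uop_periodic hc n r
    have hS : Periodic (fun y : ℤ => ∑ x : ZMod p, T (y + q * x.val)) q := fun y => by
      have h1 : Periodic (fun x : ℤ => T (y + q * x)) p := fun x => by
        dsimp only
        rw [← hTp (y + q * x)]
        push_cast
        ring_nf
      have h2 := sum_periodic_affine h1 (a := 1) (by simp) 1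
      refine Eq.trans (sum_congr rfl fun x _ => ?_) h2
      ring_nf
    have h1 := sum_periodic_affine hS (a := p)
      (by rw [Int.cast_natCast]; exact (ZMod.isUnit_iff_coprime p q).mpr hpq) 0
    simp only [add_zero] at h1
    refine Eq.trans ?_ h1.symm
    refine sum_congr rfl fun y _ => sum_congr rfl fun x _ => ?_
    rw [hT]
    dsimp only
    congr 2 <;> · push_cast; ring
  ext ⟨n, r⟩
  rw [key p q hpq hc, key q p hpq.symm (by rwa [mul_comm q p]), sum_comm]
  refine sum_congr rfl fun x _ => sum_congr rfl fun y _ => ?_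
  rw [mul_comm q p, add_comm ((p : ℤ) * _)]

/-- The projection to the forms with trivial image under `uop p`. -/
def purify (p k : ℕ) [NeZero p] (c : Arr) : Arr := c - (p : ℂ)⁻¹ • uArr p (uop p k c)

theorem uop_purify {p k : ℕ} [NeZero p] (h : Ell (k * p ^ 2) c) : uop p k (purify p k c) = 0 := by
  have h1 := uop_uArr_of_dvd (p := p) one_pos (uop_ell h)
  rw [one_pow, mul_one, mul_one, uArr_one] at h1
  rw [purify, ← uopL_apply, map_sub, map_smul, uopL_apply, uopL_apply, h1, smul_smul,
    inv_mul_cancel₀ (NeZero.ne _), one_smul, sub_self]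

theorem uop_purify_of_ne {p q k l : ℕ} [hp : Fact p.Prime] [hq : Fact q.Prime] (hpq : p ≠ q)
    (hkl : k * p ^ 2 = l * q ^ 2) (hc : Ell (k * p ^ 2) c) (h : uop q l c = 0) :
    uop q l (purify p k c) = 0 := by
  have hco := (Nat.coprime_primes hp.out hq.out).mpr hpq
  obtain ⟨j, rfl⟩ : p ^ 2 ∣ l := (hco.pow 2 2).dvd_of_dvd_mul_right (hkl ▸ dvd_mul_left _ _)
  obtain rfl : k = j * q ^ 2 :=
    Nat.eq_of_mul_eq_mul_right (pow_pos hp.out.pos 2) (by rw [hkl]; ring)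
  rw [mul_comm] at h ⊢
  have h1 : uop p j (uop q (j * p ^ 2) c) = 0 := by rw [h, ← uopL_apply, map_zero]
  rw [purify, ← uopL_apply, map_sub, map_smul, uopL_apply, uopL_apply, h,
    uop_uArr_of_coprime hp.out.pos hco (uop_ell (by convert hc using 1)),
    uop_comm hco (by convert hc using 1; ring), h1, ← uArrL_apply, map_zero, smul_zero, sub_zero]

theorem purify_mem_optSub {p k : ℕ} [NeZero p] (h : c ∈ OptSub (k * p ^ 2)) :
    purify p k c ∈ OptSub (k * p ^ 2) := by
  refine sub_mem h (Submodule.smul_mem _ _ fun n r h1 h2 => ?_)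
  rw [uArr]
  split_ifs with hr
  · obtain ⟨s, rfl⟩ := hr
    rw [Int.mul_ediv_cancel_left _ (NeZero.ne _)]
    refine sum_eq_zero fun x _ => ?_
    have e : 4 * ((k * p ^ 2 : ℕ) : ℤ) * (n + s * x.val + k * (x.val : ℤ) ^ 2) -
        (p * (s + 2 * k * x.val)) ^ 2 = 4 * ((k * p ^ 2 : ℕ) : ℤ) * n - (p * s) ^ 2 := by
      push_cast; ring
    exact h _ _ (e ▸ h1) (e ▸ h2)
  · rfl

theorem exists_pure (hm : 0 < m) (hc : c ∈ RegSub m)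
    (hu : ∀ (p : ℕ) [Fact p.Prime] (k : ℕ), m = k * p ^ 2 → WJ 2 k (uop p k c)) :
    ∃ c', c' ∈ RegSub m ∧ c' - c ∈ WJSub 2 m ∧ (c ∈ OptSub m → c' ∈ OptSub m) ∧
      ∀ (p : ℕ) [Fact p.Prime] (k : ℕ), m = k * p ^ 2 → uop p k c' = 0 := by
  have key : ∀ S : Finset ℕ, ∃ c', c' ∈ RegSub m ∧ c' - c ∈ WJSub 2 m ∧
      (c ∈ OptSub m → c' ∈ OptSub m) ∧
      ∀ (p : ℕ) [Fact p.Prime] (k : ℕ), p ∈ S → m = k * p ^ 2 → uop p k c' = 0 := by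
    intro S
    induction S using Finset.induction_on with
    | empty => exact ⟨c, hc, by simp, id, by simp⟩
    | insert p S _ ih =>
      obtain ⟨c', h1, h2, h3, h4⟩ := ih
      by_cases hp : p.Prime ∧ p ^ 2 ∣ m
      · obtain ⟨hp, k, hk⟩ := hp
        have := Fact.mk hp
        rw [mul_comm] at hk
        subst hk
        have hk : 0 < k := Nat.pos_of_mul_pos_right hm
        have hw : WJ 2 (k * p ^ 2) (uArr p (uop p k c')) := by
          refine WJ.uArr hp.pos ?_
          have := (WJ.uop hk (mem_WJSub.mp h2)).add (hu p k rfl)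
          rwa [← uopL_apply, ← uopL_apply, ← map_add, sub_add_cancel] at this
        refine ⟨purify p k c', sub_mem h1 (Submodule.smul_mem _ _ hw.mem_regSub), ?_,
          fun h => purify_mem_optSub (h3 h), fun q hq l hqS hl => ?_⟩
        · rw [purify, sub_right_comm]
          exact sub_mem h2 (Submodule.smul_mem _ _ (mem_WJSub.mpr hw))
        · by_cases hqp : p = q
          · subst hqp
            obtain rfl := Nat.eq_of_mul_eq_mul_right (pow_pos hp.pos 2) hl
            exact uop_purify h1.1
          · exact uop_purify_of_ne hqp hl h1.1
              (h4 q l ((mem_insert.mp hqS).resolve_left (Ne.symm hqp)) hl)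
      · refine ⟨c', h1, h2, h3, fun q hq k hqS hk => h4 q k
          ((mem_insert.mp hqS).resolve_left ?_) hk⟩
        rintro rfl
        exact hp ⟨hq.out, hk ▸ dvd_mul_left _ _⟩
  obtain ⟨c', h1, h2, h3, h4⟩ := key m.primeFactors
  refine ⟨c', h1, h2, h3, fun p hp k hk => h4 p k (Nat.mem_primeFactors.mpr ⟨hp.out, ?_, hm.ne'⟩) hk⟩
  exact hk ▸ (dvd_pow_self p two_ne_zero).mul_left k

theorem exists_optimal (hm : 0 < m) : ∃ D, WJ 2 m (D - primArr m stdArr) ∧ D ∈ OptSub m ∧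
    ∀ (p : ℕ) [Fact p.Prime] (k : ℕ), m = k * p ^ 2 → uop p k D = 0 := by
  have hreg : primArr m stdArr ∈ RegSub m := Submodule.sum_mem _ fun d hd => by
    obtain ⟨h1, h2, h3⟩ := pos_of_mem_sq_divisors hm hd
    have h4 := uArr_mem_regSub h1 (c := stdArr (m / d ^ 2))
      ⟨stdArr_ell _, stdArr_even _, stdArr_sm _, _, stdArr_low h2⟩
    rw [h3] at h4
    exact Submodule.smul_mem _ _ h4
  obtain ⟨t, t1, t2, -, t4⟩ := exists_pure hm hreg fun p hp k hk => by
    subst hk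
    exact uop_primArr hp.out (Nat.pos_of_mul_pos_right hm) (fun k _ => stdArr_ell k)
      fun k hk => uop_stdArr hk
  obtain ⟨N, hN⟩ := t1.2.2.2
  obtain ⟨h, hh, d, hd, hhd⟩ :=
    Submodule.mem_sup.mp (mem_sup_of_uop_eq_zero hm t1.1 t1.2.1 t1.2.2.1 hN t4)
  have hh' := mem_WJSub.mp hh
  obtain rfl : d = t - h := by rw [← hhd, add_sub_cancel_left]
  obtain ⟨D, -, d2, d3, d4⟩ := exists_pure hm (sub_mem t1 hh'.mem_regSub) fun p hp k hk => by
    rw [← uopL_apply, map_sub, uopL_apply, uopL_apply, t4 p k hk, zero_sub]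
    subst hk
    have := (WJ.uop (q := p) (Nat.pos_of_mul_pos_right hm) hh').smul (-1)
    rwa [neg_one_smul] at this
  refine ⟨D, mem_WJSub.mp ?_, d3 hd, d4⟩
  have := sub_mem (add_mem d2 t2) hh
  rwa [show D - (t - h) + (t - primArr m stdArr) - h = D - primArr m stdArr by abel] at this

/-- The solution `g` of `primArr m g = κ m`. -/
def corrArr (κ : ℕ → Arr) (m : ℕ) : Arr :=
  κ m - ∑ d ∈ (m.divisors.filter fun d => d ^ 2 ∣ m ∧ d ≠ 1).attach,
    ((moebius d.1 : ℤ) : ℂ) • uArr d.1 (corrArr κ (m / d.1 ^ 2))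
termination_by m
decreasing_by
  have h := mem_filter.mp d.2
  have h1 := Nat.pos_of_mem_divisors h.1
  exact Nat.div_lt_self (Nat.pos_of_ne_zero (Nat.mem_divisors.mp h.1).2)
    (Nat.one_lt_pow two_ne_zero (by omega))

theorem corrArr_eq (κ : ℕ → Arr) (m : ℕ) : corrArr κ m =
    κ m - ∑ d ∈ m.divisors.filter fun d => d ^ 2 ∣ m ∧ d ≠ 1,
      ((moebius d : ℤ) : ℂ) • uArr d (corrArr κ (m / d ^ 2)) := by
  rw [corrArr, Finset.sum_attach (m.divisors.filter fun d => d ^ 2 ∣ m ∧ d ≠ 1) fun d =>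
    ((moebius d : ℤ) : ℂ) • uArr d (corrArr κ (m / d ^ 2))]

theorem corrArr_wj {κ : ℕ → Arr} (hκ : ∀ m, 0 < m → WJ 2 m (κ m)) (m : ℕ) (hm : 0 < m) :
    WJ 2 m (corrArr κ m) := by
  induction m using Nat.strong_induction_on with
  | _ m ih =>
    rw [corrArr_eq, ← mem_WJSub]
    refine sub_mem (mem_WJSub.mpr (hκ m hm)) (Submodule.sum_mem _ fun d hd => ?_)
    obtain ⟨h1, h2, h3⟩ := mem_filter.mp hd
    have hd0 := Nat.pos_of_mem_divisors h1
    have h4 := (ih (m / d ^ 2) (Nat.div_lt_self hm (Nat.one_lt_pow two_ne_zero (by omega)))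
      (Nat.div_pos (Nat.le_of_dvd hm h2) (pow_pos hd0 2))).uArr hd0
    rw [Nat.div_mul_cancel h2] at h4
    exact Submodule.smul_mem _ _ (mem_WJSub.mpr h4)

theorem primArr_corrArr (κ : ℕ → Arr) (hm : 0 < m) : primArr m (corrArr κ) = κ m := by
  rw [primArr, ← add_sum_erase _ _ (a := 1) (by simp [hm.ne'])]
  rw [show (m.divisors.filter fun d => d ^ 2 ∣ m).erase 1 =
    m.divisors.filter fun d => d ^ 2 ∣ m ∧ d ≠ 1 by ext d; simp; tauto, one_pow, Nat.div_one,
    uArr_one, ArithmeticFunction.moebius_apply_one, Int.cast_one, one_smul]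
  nth_rewrite 1 [corrArr_eq]
  rw [sub_add_cancel]

theorem IsStandardForm.add_wj (h : IsStandardForm m φ) {g : Arr}
    (hg : WJ 2 m g) : IsStandardForm m fun τ z => φ τ z + JF g τ z := by
  refine ⟨fun τ hτ z a b c d hdet => ?_, fun τ hτ z l k => ?_, fun τ hτ z hz => ?_, fun τ hτ => ?_⟩
  · dsimp only
    rw [h.1 τ hτ z a b c d hdet, hg.modularLaw τ hτ z a b c d hdet, mul_add]
  · dsimp only
    rw [h.2.1 τ hτ z l k, JF_elliptic hg.ell τ hτ z l k, ← mul_add]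
  · exact (h.2.2.1 τ hτ z hz).add (hg.sm.differentiable hτ z)
  · obtain ⟨f, hf, he⟩ := h.2.2.2 τ hτ
    refine ⟨fun z => f z + JF g τ z, hf.add ((hg.sm.differentiable_right hτ).analyticAt 0), ?_⟩
    filter_upwards [he] with z hz
    rw [← hz]
    ring

theorem exists_good_family : ∃ (φfam : ℕ → ℂ → ℂ → ℂ) (Cfam : ℕ → ℤ → ℤ → ℂ),
    IsStandardFamily φfam Cfam ∧ ∀ m : ℕ, 0 < m → GoodPrim m Cfam := by
  choose! D hD hO hU using fun (m : ℕ) (hm : 0 < m) => exists_optimal hm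
  set κ : ℕ → Arr := fun m => D m - primArr m stdArr
  have hg := corrArr_wj (κ := κ) hD
  have hfam : IsStandardFamily (fun m τ z => stdForm m τ z + JF (corrArr κ m) τ z)
      fun m => coeffOf m (stdArr m + corrArr κ m) := fun m hm => by
    refine ⟨(stdForm_isStandard m).add_wj (hg m hm), isFinitePartCoeffs_of_array hm
      (fun n r l => by simp [stdArr_ell m n r l, (hg m hm).ell n r l])
      ((stdArr_sm m).add (hg m hm).sm) fun τ z hτ hz => ?_⟩
    rw [JF_add (stdArr_sm m τ z hτ) ((hg m hm).sm τ z hτ), JF_stdArr m hτ hz]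
    ring
  refine ⟨_, _, hfam, fun m hm => ?_⟩
  set C : ℕ → ℤ → ℤ → ℂ := fun m => coeffOf m (stdArr m + corrArr κ m) with hC
  have harr : ∀ n r : ℤ, primC0 m C (4 * m * n - r ^ 2) r = D m (n, r) := fun n r => by
    have h1 : arrOf m (primC0 m C) = D m := by
      have h2 : primArr m stdArr + primArr m (corrArr κ) = D m := by
        rw [primArr_corrArr κ hm, add_sub_cancel]
      rw [arrOf_primC0, ← h2, primArr, primArr, primArr, ← sum_add_distrib]
      refine sum_congr rfl fun d hd => ?_
      rw [← smul_add, ← uArrL_apply, ← uArrL_apply, ← uArrL_apply, ← map_add]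
      congr 2
      exact funext fun p => coeffOf_apply (pos_of_mem_sq_divisors hm hd).2.1 _ p
    exact congrFun h1 (n, r)
  have hsupp := primC0_support hm (C := C) fun k hk => (hfam k hk).2.2.1
  have hopt : ∀ Δ l : ℤ, Δ ≤ 0 → Δ ≠ -1 → primC0 m C Δ l = 0 := fun Δ l h1 h2 => by
    by_cases hd : 4 * (m : ℤ) ∣ Δ + l ^ 2
    · obtain ⟨n, hn⟩ := hd
      obtain rfl : Δ = 4 * m * n - l ^ 2 := by linarith
      rw [harr, hO m hm n l h1 h2]
    · exact hsupp Δ l hd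
  refine ⟨fun Δ l h => hopt Δ l (by omega) (by omega), fun q hq hqm Δ l => ?_,
    fun l => hopt 0 l le_rfl (by norm_num)⟩
  have := Fact.mk hq
  have hq0 : (q : ℤ) ^ 2 ≠ 0 := pow_ne_zero 2 (NeZero.ne _)
  obtain ⟨k, hk⟩ := hqm
  rw [mul_comm] at hk
  have hk' : (m : ℤ) = k * q ^ 2 := by exact_mod_cast hk
  rw [show 2 * (m : ℤ) / q ^ 2 = 2 * k by rw [hk', ← mul_assoc, Int.mul_ediv_cancel _ hq0]]
  by_cases hd : 4 * (k : ℤ) ∣ Δ + l ^ 2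
  · obtain ⟨n, hn⟩ := hd
    obtain rfl : Δ = 4 * k * n - l ^ 2 := by linarith
    refine Eq.trans ?_ (congrFun (hU m hm q k hk) (n, l))
    rw [sum_range, uop]
    refine Eq.trans (sum_congr rfl fun j _ => ?_) (sum_zmod_eq_fin fun x : ℕ =>
      D m (n + l * x + k * (x : ℤ) ^ 2, q * (l + 2 * k * x))).symm
    rw [← harr, hk']
    congr 1 <;> ring
  · refine sum_eq_zero fun j _ => hsupp _ _ fun h => hd ?_
    rw [hk', show (4 * (k * q ^ 2) : ℤ) = 4 * k * q ^ 2 by ring,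
      show Δ * (q : ℤ) ^ 2 + ((l + 2 * k * j) * q) ^ 2 =
        (Δ + l ^ 2 + 4 * k * (l * j + k * j ^ 2)) * q ^ 2 by ring,
      mul_dvd_mul_iff_right hq0, Int.dvd_add_left (dvd_mul_right _ _)] at h
    exact h

/-- Theorem: the standard forms can be chosen so that every `Φ⁰_{2,m}` has optimal growth,
is primitive and has vanishing `Δ = 0` coefficients; for any such choice the polar
coefficients are `C(-1,r) = (1/24)·∑_{d²∣m} μ(d)·(gcd((r-1)/2, m/d²) + gcd((r+1)/2, m/d²))`
for `r² ≡ 1 (mod 4m)`; and for each `m` such a `Φ⁰_{2,m}` is unique up to the addition of a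
Jacobi cusp form of weight 2 and index `m`. -/
theorem primitive_choice_with_vanishing_zero_coefficients :
    (∃ (φfam : ℕ → ℂ → ℂ → ℂ) (Cfam : ℕ → ℤ → ℤ → ℂ),
      IsStandardFamily φfam Cfam ∧ ∀ m : ℕ, 0 < m → GoodPrim m Cfam) ∧
    (∀ (φfam : ℕ → ℂ → ℂ → ℂ) (Cfam : ℕ → ℤ → ℤ → ℂ), IsStandardFamily φfam Cfam →
      ∀ m : ℕ, 0 < m → GoodPrim m Cfam →
      ∀ r : ℤ, (4 * (m : ℤ)) ∣ (r ^ 2 - 1) →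
        primC0 m Cfam (-1) r =
          (1 / 24 : ℂ) * ∑ d ∈ m.divisors,
            (if d ^ 2 ∣ m then
              ((ArithmeticFunction.moebius d : ℤ) : ℂ) *
                ((Int.gcd ((r - 1) / 2) ((m : ℤ) / (d : ℤ) ^ 2) : ℂ) +
                  (Int.gcd ((r + 1) / 2) ((m : ℤ) / (d : ℤ) ^ 2) : ℂ))
            else 0)) ∧
    (∀ (φfam : ℕ → ℂ → ℂ → ℂ) (Cfam : ℕ → ℤ → ℤ → ℂ)
        (φfam' : ℕ → ℂ → ℂ → ℂ) (Cfam' : ℕ → ℤ → ℤ → ℂ),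
      IsStandardFamily φfam Cfam → IsStandardFamily φfam' Cfam' →
      ∀ m : ℕ, 0 < m → GoodPrim m Cfam → GoodPrim m Cfam' →
      ∃ ψ : EllFormData m, ModularLaw 2 m ψ.toFun ∧ IsCuspC ψ.coeff ∧
        ∀ Δ l : ℤ, primC0 m Cfam Δ l - primC0 m Cfam' Δ l = ψ.coeff Δ l) :=
  ⟨exists_good_family, fun _ _ h _ hm hg _ hr => polar_coefficient h hm hg hr,
    fun _ _ _ _ h h' _ hm hg hg' => prim_sub_cusp h h' hm hg hg'⟩
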